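/- For every R ≥ 1 there exist an exponent α > 0 depending only on (d,λ,Λ) and a constant C < ∞ depending only on (R,d,λ,Λ) such that for every ξ in the closed ball B_R = {ζ ∈ ℝ^d : |ζ| ≤ R} and every integer L ≥ 2: max_{e ∈ E(Q_{⌈L/2⌉})} | ⟨∇φ(e)⟩_{μ_{L,ξ}} | ≤ C L^{−α}. -/

import Mathlib

/- Estimate (3.35): for `R ≥ 1` there are `α = α(d,λ,Λ) > 0` and
`C = C(R,d,λ,Λ)` such that for `ξ ∈ B_R` and `L ≥ 2`:
`max_{e ∈ E(Q_{⌈L/2⌉})} |⟨∇φ(e)⟩_{μ_{L,ξ}}| ≤ C L^{−α}`. -/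

open MeasureTheory Real Filter

noncomputable section

abbrev Zd (d : ℕ) := Fin d → ℤ

/-- nearest-neighbour adjacency on ℤ^d -/
def adj {d : ℕ} (x y : Zd d) : Prop := (∑ i, |x i - y i|) = 1

/-- the cube Q_L = [-L,L]^d ∩ ℤ^d -/
def cube (d : ℕ) (L : ℤ) : Finset (Zd d) :=
  Fintype.piFinset fun _ => Finset.Icc (-L) L

open Classical in
/-- interior of a finite set U ⊆ ℤ^d -/
def intr {d : ℕ} (U : Finset (Zd d)) : Finset (Zd d) :=
  U.filter fun x => ∀ y : Zd d, adj x y → y ∈ U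

/-- boundary of U -/
def bdry {d : ℕ} (U : Finset (Zd d)) : Finset (Zd d) := U \ intr U

/-- the neighbour x ± e_i of x (s = true : +) -/
def step {d : ℕ} (x : Zd d) (i : Fin d) (s : Bool) : Zd d :=
  Function.update x i (x i + (if s then 1 else -1))

/-- configurations Ω₀(Q_L) ≅ ℝ^{Q_L°} -/
abbrev Conf (d : ℕ) (L : ℤ) := (↥(intr (cube d L))) → ℝ

/-- extension of a configuration by zero to all of ℤ^d -/
def extD {d : ℕ} {L : ℤ} (φ : Conf d L) : Zd d → ℝ :=
  fun x => if h : x ∈ intr (cube d L) then φ ⟨x, h⟩ else 0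

/-- ξ·(y-x) -/
def xiDot {d : ℕ} (ξ : EuclideanSpace ℝ (Fin d)) (x y : Zd d) : ℝ :=
  ∑ i, ξ i * ((y i - x i : ℤ) : ℝ)

/-- the Hamiltonian Σ_{x∈Q_L°} Σ_{y∼x} V(ψ(y)-ψ(x)-ξ·(y-x)) -/
def hamil {d : ℕ} (V : ℝ → ℝ) (L : ℤ) (ξ : EuclideanSpace ℝ (Fin d)) (ψ : Zd d → ℝ) : ℝ :=
  ∑ x ∈ intr (cube d L), ∑ i : Fin d, ∑ s : Bool,
    V (ψ (step x i s) - ψ x - xiDot ξ x (step x i s))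

/-- the partition function Z_{L,ξ} -/
def Zpart (d : ℕ) (V : ℝ → ℝ) (L : ℤ) (ξ : EuclideanSpace ℝ (Fin d)) : ℝ :=
  ∫ φ : Conf d L, Real.exp (-(hamil V L ξ (extD φ)))

/-- the finite-volume Gibbs measure μ_{L,ξ} -/
def gibbs (d : ℕ) (V : ℝ → ℝ) (L : ℤ) (ξ : EuclideanSpace ℝ (Fin d)) : Measure (Conf d L) :=
  volume.withDensity fun φ =>
    ENNReal.ofReal (Real.exp (-(hamil V L ξ (extD φ))) / Zpart d V L ξ)

/-- the vertical derivative ∂_y F -/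
def pd {d : ℕ} {L : ℤ} (y : ↥(intr (cube d L))) (F : Conf d L → ℝ) (φ : Conf d L) : ℝ :=
  deriv (fun t => F (Function.update φ y t)) (φ y)

open Classical in
/-- the set of (interior-touching) directed nearest-neighbour edges of U -/
def edges {d : ℕ} (U : Finset (Zd d)) : Finset (Zd d × Zd d) :=
  (U ×ˢ U).filter fun e =>
    adj e.1 e.2 ∧ (∀ i, e.1 i ≤ e.2 i) ∧ ¬(e.1 ∈ bdry U ∧ e.2 ∈ bdry U)

noncomputable section

/-- directions of the lattice: a coordinate and a sign -/
abbrev Dir (d : ℕ) := Fin d × Bool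

/-- the neighbour of `x` in direction `k` -/
def nbr {d : ℕ} (x : Zd d) (k : Dir d) : Zd d := step x k.1 k.2

/-- the opposite direction -/
def rev {d : ℕ} (k : Dir d) : Dir d := (k.1, !k.2)

variable {d : ℕ}

lemma nbr_eq_add (x : Zd d) (k : Dir d) :
    nbr x k = x + Pi.single k.1 (if k.2 then 1 else -1) := by
  funext j
  unfold nbr step
  by_cases h : j = k.1
  · subst h; simp
  · simp [h]

lemma nbr_add (x z : Zd d) (k : Dir d) : nbr (x + z) k = x + nbr z k := by
  simp [nbr_eq_add, add_assoc]

lemma nbr_nbr_rev (x : Zd d) (k : Dir d) : nbr (nbr x k) (rev k) = x := by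
  rcases k with ⟨i, b⟩
  rw [nbr_eq_add, nbr_eq_add, add_assoc]
  simp only [rev]
  rw [← Pi.single_add]
  cases b <;> simp

lemma rev_rev (k : Dir d) : rev (rev k) = k := by simp [rev]

lemma abs_nbr_sub_le (x : Zd d) (k : Dir d) (i : Fin d) : |nbr x k i - x i| ≤ 1 := by
  rw [nbr_eq_add]
  by_cases h : i = k.1
  · subst h; cases k.2 <;> simp
  · simp [h]

/-- the cube of radius `r` about `c` -/
def box (c : Zd d) (r : ℕ) : Finset (Zd d) :=
  Fintype.piFinset fun i => Finset.Icc (c i - r) (c i + r)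

lemma mem_box {c : Zd d} {r : ℕ} {x : Zd d} : x ∈ box c r ↔ ∀ i, |x i - c i| ≤ r := by
  simp only [box, Fintype.mem_piFinset, Finset.mem_Icc, abs_le]
  exact forall_congr' fun i => by constructor <;> intro h <;> constructor <;> linarith [h.1, h.2]

lemma card_box (c : Zd d) (r : ℕ) : (box c r).card = (2 * r + 1) ^ d := by
  simp only [box, Fintype.card_piFinset, Int.card_Icc]
  rw [Finset.prod_congr rfl (g := fun _ => 2 * r + 1) (fun i _ => by omega)]
  simp

lemma box_mono {c : Zd d} {r s : ℕ} (h : r ≤ s) : box c r ⊆ box c s := fun x hx =>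
  mem_box.2 fun i => (mem_box.1 hx i).trans (by exact_mod_cast h)

lemma box_subset_box {c c' : Zd d} {r s t : ℕ} (hc : c' ∈ box c t) (h : t + r ≤ s) :
    box c' r ⊆ box c s := fun x hx => mem_box.2 fun i => by
  have h1 := mem_box.1 hx i
  have h2 := mem_box.1 hc i
  have h3 : ((t : ℤ) + r) ≤ s := by exact_mod_cast h
  rw [abs_le] at *
  constructor <;> linarith [h1.1, h1.2, h2.1, h2.2]

lemma nbr_mem_box {c x : Zd d} {r s : ℕ} (hx : x ∈ box c r) (h : r + 1 ≤ s) (k : Dir d) :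
    nbr x k ∈ box c s := mem_box.2 fun i => by
  have h1 := mem_box.1 hx i
  have h2 := abs_nbr_sub_le x k i
  have h3 : ((r : ℤ) + 1) ≤ s := by exact_mod_cast h
  rw [abs_le] at *
  constructor <;> linarith [h1.1, h1.2, h2.1, h2.2]

lemma self_mem_box (c : Zd d) (r : ℕ) : c ∈ box c r := mem_box.2 fun i => by simp

/-- `v` vanishes off the sites of `B` all of whose neighbours lie in `B` -/
def SuppIn (B : Finset (Zd d)) (v : Zd d → ℝ) : Prop :=
  ∀ x, v x ≠ 0 → x ∈ B ∧ ∀ k, nbr x k ∈ B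

lemma SuppIn.mem_of_nbr {B : Finset (Zd d)} {v : Zd d → ℝ} (h : SuppIn B v) {x : Zd d} {k : Dir d}
    (hx : v (nbr x k) ≠ 0) : x ∈ B := by
  have := (h _ hx).2 (rev k)
  rwa [nbr_nbr_rev] at this

lemma SuppIn.mono {B : Finset (Zd d)} {v w : Zd d → ℝ} (h : SuppIn B v)
    (hw : ∀ x, v x = 0 → w x = 0) : SuppIn B w := fun x hx => h x fun h0 => hx (hw x h0)

lemma exists_suppIn (U : Finset (Zd d)) : ∃ B : Finset (Zd d), ∀ x ∈ U, x ∈ B ∧ ∀ k, nbr x k ∈ B := by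
  classical
  refine ⟨U ∪ U.biUnion fun x => Finset.univ.image (nbr x), fun x hx => ⟨?_, fun k => ?_⟩⟩
  · exact Finset.mem_union_left _ hx
  · refine Finset.mem_union_right _ (Finset.mem_biUnion.2 ⟨x, hx, ?_⟩)
    exact Finset.mem_image_of_mem _ (Finset.mem_univ _)

lemma sum_nbr_swap (B : Finset (Zd d)) (F : Zd d → Zd d → ℝ)
    (hF : ∀ x k, F x (nbr x k) ≠ 0 → x ∈ B ∧ nbr x k ∈ B) :
    ∑ x ∈ B, ∑ k, F x (nbr x k) = ∑ x ∈ B, ∑ k, F (nbr x k) x := by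
  classical
  rw [← Finset.sum_product', ← Finset.sum_product']
  refine Finset.sum_bij_ne_zero (fun p _ _ => (nbr p.1 p.2, rev p.2)) ?_ ?_ ?_ ?_
  · intro p _ hp
    simp [(hF _ _ hp).2]
  · intro p _ _ q _ _ h
    simp only [Prod.mk.injEq] at h
    have h2 : p.2 = q.2 := by rw [← rev_rev p.2, h.2, rev_rev]
    have h1 : p.1 = q.1 := by rw [← nbr_nbr_rev p.1 p.2, ← nbr_nbr_rev q.1 q.2, h.1, h.2]
    exact Prod.ext h1 h2
  · intro q hq hq0
    have e : nbr (nbr q.1 q.2) (rev q.2) = q.1 := nbr_nbr_rev _ _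
    have hq0' : F (nbr q.1 q.2) (nbr (nbr q.1 q.2) (rev q.2)) ≠ 0 := by rw [e]; exact hq0
    refine ⟨(nbr q.1 q.2, rev q.2), ?_, hq0', ?_⟩
    · simp [(hF _ _ hq0').1]
    · simp [e, rev_rev]
  · intro p _ _
    simp [nbr_nbr_rev]

/-- symmetric, uniformly elliptic conductances -/
structure Ell (lam Lam : ℝ) (a : Zd d → Zd d → ℝ) : Prop where
  symm : ∀ x y, a x y = a y x
  lower : ∀ x y, lam ≤ a x y
  upper : ∀ x y, a x y ≤ Lam

/-- the divergence-form operator with conductances `a` -/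
def Lap (a : Zd d → Zd d → ℝ) (v : Zd d → ℝ) (x : Zd d) : ℝ :=
  ∑ k, a x (nbr x k) * (v (nbr x k) - v x)

/-- Dirichlet energy -/
def En (B : Finset (Zd d)) (v : Zd d → ℝ) : ℝ := ∑ x ∈ B, ∑ k, (v (nbr x k) - v x) ^ 2

/-- Dirichlet energy with conductances -/
def Ena (a : Zd d → Zd d → ℝ) (B : Finset (Zd d)) (v : Zd d → ℝ) : ℝ :=
  ∑ x ∈ B, ∑ k, a x (nbr x k) * (v (nbr x k) - v x) ^ 2

lemma En_nonneg (B : Finset (Zd d)) (v : Zd d → ℝ) : 0 ≤ En B v :=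
  Finset.sum_nonneg fun _ _ => Finset.sum_nonneg fun _ _ => sq_nonneg _

lemma Ell.lam_En_le {lam Lam : ℝ} {a : Zd d → Zd d → ℝ} (ha : Ell lam Lam a) (B : Finset (Zd d))
    (v : Zd d → ℝ) : lam * En B v ≤ Ena a B v := by
  unfold En Ena
  rw [Finset.mul_sum]
  refine Finset.sum_le_sum fun x _ => ?_
  rw [Finset.mul_sum]
  exact Finset.sum_le_sum fun k _ => mul_le_mul_of_nonneg_right (ha.lower _ _) (sq_nonneg _)

lemma Ell.Ena_le {lam Lam : ℝ} {a : Zd d → Zd d → ℝ} (ha : Ell lam Lam a) (B : Finset (Zd d))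
    (v : Zd d → ℝ) : Ena a B v ≤ Lam * En B v := by
  unfold En Ena
  rw [Finset.mul_sum]
  refine Finset.sum_le_sum fun x _ => ?_
  rw [Finset.mul_sum]
  exact Finset.sum_le_sum fun k _ => mul_le_mul_of_nonneg_right (ha.upper _ _) (sq_nonneg _)

lemma sum_mul_Lap {a : Zd d → Zd d → ℝ} (hs : ∀ x y, a x y = a y x) {B : Finset (Zd d)}
    {w : Zd d → ℝ} (hw : SuppIn B w) (v : Zd d → ℝ) :
    ∑ x ∈ B, w x * Lap a v x
      = -(1 / 2) * ∑ x ∈ B, ∑ k, a x (nbr x k) * (w (nbr x k) - w x) * (v (nbr x k) - v x) := by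
  have h1 : ∑ x ∈ B, w x * Lap a v x
      = ∑ x ∈ B, ∑ k, (fun x y => a x y * w x * (v y - v x)) x (nbr x k) := by
    refine Finset.sum_congr rfl fun x _ => ?_
    unfold Lap
    rw [Finset.mul_sum]
    exact Finset.sum_congr rfl fun k _ => by ring
  have h2 := sum_nbr_swap B (fun x y => a x y * w x * (v y - v x)) (fun x k h => by
    have : w x ≠ 0 := fun h0 => h (by simp [h0])
    exact ⟨(hw x this).1, (hw x this).2 k⟩)
  have h3 : ∑ x ∈ B, ∑ k, a x (nbr x k) * (w (nbr x k) - w x) * (v (nbr x k) - v x)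
      = -(∑ x ∈ B, ∑ k, (fun x y => a x y * w x * (v y - v x)) x (nbr x k))
        - ∑ x ∈ B, ∑ k, (fun x y => a x y * w x * (v y - v x)) (nbr x k) x := by
    rw [← Finset.sum_neg_distrib, ← Finset.sum_sub_distrib]
    refine Finset.sum_congr rfl fun x _ => ?_
    rw [← Finset.sum_neg_distrib, ← Finset.sum_sub_distrib]
    refine Finset.sum_congr rfl fun k _ => ?_
    simp only
    rw [hs (nbr x k) x]
    ring
  rw [h3, ← h2, h1]; ring

lemma card_Dir : (Fintype.card (Dir d) : ℝ) = 2 * d := by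
  simp [Fintype.card_prod]; ring

lemma Lap_sq_le {lam Lam : ℝ} {a : Zd d → Zd d → ℝ} (hl : 0 < lam) (ha : Ell lam Lam a)
    (v : Zd d → ℝ) (x : Zd d) :
    Lap a v x ^ 2 ≤ 2 * d * Lam * ∑ k, a x (nbr x k) * (v (nbr x k) - v x) ^ 2 := by
  have h := sq_sum_le_card_mul_sum_sq (s := (Finset.univ : Finset (Dir d)))
    (f := fun k => a x (nbr x k) * (v (nbr x k) - v x))
  rw [Finset.card_univ, card_Dir] at h
  refine h.trans ?_
  rw [mul_assoc (2 * (d : ℝ))]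
  refine mul_le_mul_of_nonneg_left ?_ (by positivity)
  rw [Finset.mul_sum]
  refine Finset.sum_le_sum fun k _ => ?_
  have h1 := ha.lower x (nbr x k)
  have h2 := ha.upper x (nbr x k)
  rw [mul_pow, sq (a _ _), mul_assoc, ← mul_assoc Lam]
  rw [← mul_assoc]
  exact mul_le_mul_of_nonneg_right (mul_le_mul_of_nonneg_right h2 (by linarith)) (sq_nonneg _)

/-- one time step of the energy inequality -/
lemma sum_sq_step_le {lam Lam h : ℝ} {a : Zd d → Zd d → ℝ} (hl : 0 < lam) (ha : Ell lam Lam a)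
    (hh : 0 ≤ h) (hh' : 2 * d * Lam * h ≤ 1 / 2) {B : Finset (Zd d)} {v v' : Zd d → ℝ}
    (hv : SuppIn B v) (hv0 : ∀ x ∈ B, 0 ≤ v' x)
    (hle : ∀ x ∈ B, v' x ≠ 0 → v' x ≤ v x + h * Lap a v x) :
    ∑ x ∈ B, v' x ^ 2 ≤ ∑ x ∈ B, v x ^ 2 - h * lam / 2 * En B v := by
  have h1 : ∑ x ∈ B, v' x ^ 2 ≤ ∑ x ∈ B, (v x + h * Lap a v x) ^ 2 := by
    refine Finset.sum_le_sum fun x hx => ?_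
    by_cases h0 : v' x = 0
    · rw [h0]; simp only [ne_eq, OfNat.ofNat_ne_zero, not_false_eq_true, zero_pow]; positivity
    · exact pow_le_pow_left₀ (hv0 x hx) (hle x hx h0) 2
  have h2 : ∑ x ∈ B, (v x + h * Lap a v x) ^ 2
      = ∑ x ∈ B, v x ^ 2 + 2 * h * ∑ x ∈ B, v x * Lap a v x + h ^ 2 * ∑ x ∈ B, Lap a v x ^ 2 := by
    rw [Finset.mul_sum, Finset.mul_sum, ← Finset.sum_add_distrib, ← Finset.sum_add_distrib]
    exact Finset.sum_congr rfl fun x _ => by ring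
  have h3 : ∑ x ∈ B, v x * Lap a v x = -(1 / 2) * Ena a B v := by
    rw [sum_mul_Lap ha.symm hv]
    unfold Ena
    congr 1
    exact Finset.sum_congr rfl fun x _ => Finset.sum_congr rfl fun k _ => by ring
  have h4 : ∑ x ∈ B, Lap a v x ^ 2 ≤ 2 * d * Lam * Ena a B v := by
    unfold Ena
    rw [Finset.mul_sum]
    exact Finset.sum_le_sum fun x _ => Lap_sq_le hl ha v x
  have h5 := ha.lam_En_le B v
  have h6 : 0 ≤ Ena a B v := le_trans (mul_nonneg hl.le (En_nonneg B v)) h5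
  have h7 : h ^ 2 * ∑ x ∈ B, Lap a v x ^ 2 ≤ h / 2 * Ena a B v := by
    calc h ^ 2 * ∑ x ∈ B, Lap a v x ^ 2 ≤ h ^ 2 * (2 * d * Lam * Ena a B v) :=
          mul_le_mul_of_nonneg_left h4 (sq_nonneg h)
      _ = h * (2 * d * Lam * h) * Ena a B v := by ring
      _ ≤ h * (1 / 2) * Ena a B v := by gcongr
      _ = h / 2 * Ena a B v := by ring
  have h8 : h / 2 * (lam * En B v) ≤ h / 2 * Ena a B v :=
    mul_le_mul_of_nonneg_left h5 (by linarith)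
  rw [h2, h3] at h1
  nlinarith [h1, h7, h8]

/-- a coordinatewise monotone lattice path from `0` to `z` -/
lemma exists_path (z : Zd d) : ∃ n : ℕ, n ≤ ∑ i, (z i).natAbs ∧ ∃ s : ℕ → Zd d, s 0 = 0 ∧ s n = z ∧
    (∀ t < n, ∃ k, s (t + 1) = nbr (s t) k) ∧
    ∀ t ≤ n, ∀ i, (0 ≤ s t i ∧ s t i ≤ z i) ∨ (z i ≤ s t i ∧ s t i ≤ 0) := by
  suffices H : ∀ m : ℕ, ∀ z : Zd d, ∑ i, (z i).natAbs = m → ∃ s : ℕ → Zd d, s 0 = 0 ∧ s m = z ∧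
    (∀ t < m, ∃ k, s (t + 1) = nbr (s t) k) ∧
    ∀ t ≤ m, ∀ i, (0 ≤ s t i ∧ s t i ≤ z i) ∨ (z i ≤ s t i ∧ s t i ≤ 0) from
    ⟨_, le_rfl, H _ z rfl⟩
  intro m
  induction m with
  | zero =>
    intro z hz
    have h0 : z = 0 := by
      funext i
      have := (Finset.sum_eq_zero_iff.1 hz) i (Finset.mem_univ i)
      simpa using this
    subst h0
    exact ⟨fun _ => 0, rfl, rfl, fun t ht => absurd ht (Nat.not_lt_zero t), fun t _ i => by simp⟩
  | succ m ih =>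
    intro z hz
    obtain ⟨i, hi⟩ : ∃ i, z i ≠ 0 := by
      by_contra! h
      simp [h] at hz
    set k : Dir d := (i, decide (z i < 0)) with hk
    have hki : nbr z k i = z i + (if z i < 0 then 1 else -1) := by
      simp [nbr, step, hk]
    have hkj : ∀ j, j ≠ i → nbr z k j = z j := fun j hj => by simp [nbr, step, hk, hj]
    have hsum : ∑ j, (nbr z k j).natAbs = m := by
      rw [← Finset.add_sum_erase _ _ (Finset.mem_univ i)] at hz ⊢
      rw [Finset.sum_congr rfl (g := fun j => (z j).natAbs) (fun j hj => by
        rw [hkj j (Finset.ne_of_mem_erase hj)]), hki]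
      split_ifs <;> omega
    obtain ⟨s, s0, sm, sstep, sb⟩ := ih _ hsum
    refine ⟨fun t => if t ≤ m then s t else z, by simp [s0], by simp, fun t ht => ?_, fun t ht j => ?_⟩
    · rcases Nat.lt_or_ge t m with h | h
      · obtain ⟨k', hk'⟩ := sstep t h
        exact ⟨k', by simp [h.le, Nat.succ_le_of_lt h, hk']⟩
      · have : t = m := by omega
        subst this
        exact ⟨rev k, by simp [sm, nbr_nbr_rev]⟩
    · by_cases h : t ≤ m
      · simp only [h, if_true]
        have := sb t h j
        by_cases hj : j = i
        · subst hj
          rw [hki] at this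
          split_ifs at this <;> omega
        · rw [hkj j hj] at this
          exact this
      · simp only [h, if_false]
        omega

/-- translation differences are controlled by the (weighted) Dirichlet energy -/
lemma sum_translation_le (A B : Finset (Zd d)) (ω g : Zd d → ℝ) (hω0 : ∀ x, 0 ≤ ω x)
    (hω : ∀ x y p : Zd d, (∀ i, (x i ≤ p i ∧ p i ≤ y i) ∨ (y i ≤ p i ∧ p i ≤ x i)) →
      ω x * ω y ≤ ω p)
    (hB : ∀ x k, x ∉ B → min (ω x) (ω (nbr x k)) * (g (nbr x k) - g x) ^ 2 = 0)
    (r : ℕ) (z : Zd d) (hz : ∀ i, |z i| ≤ r) :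
    ∑ x ∈ A, ω x * ω (x + z) * (g (x + z) - g x) ^ 2
      ≤ (d * r) ^ 2 * ∑ x ∈ B, ∑ k, min (ω x) (ω (nbr x k)) * (g (nbr x k) - g x) ^ 2 := by
  classical
  obtain ⟨n, hn, s, s0, sn, sstep, sb⟩ := exists_path z
  set E := ∑ x ∈ B, ∑ k, min (ω x) (ω (nbr x k)) * (g (nbr x k) - g x) ^ 2 with hE
  have hnn : ∀ x k, 0 ≤ min (ω x) (ω (nbr x k)) * (g (nbr x k) - g x) ^ 2 := fun x k =>
    mul_nonneg (le_min (hω0 _) (hω0 _)) (sq_nonneg _)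
  have hE0 : 0 ≤ E := Finset.sum_nonneg fun _ _ => Finset.sum_nonneg fun _ _ => hnn _ _
  have hnr : (n : ℝ) ≤ d * r := by
    have : ∑ i, (z i).natAbs ≤ ∑ _i : Fin d, r := Finset.sum_le_sum fun i _ => by
      have := hz i
      rw [Int.abs_eq_natAbs] at this
      exact_mod_cast this
    simp at this
    exact_mod_cast hn.trans this
  rcases Nat.eq_zero_or_pos n with hn0 | hn0
  · subst hn0
    have hz0 : z = 0 := by rw [← sn, s0]
    simp only [hz0, add_zero, sub_self]
    simp only [ne_eq, OfNat.ofNat_ne_zero, not_false_eq_true, zero_pow, mul_zero,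
      Finset.sum_const_zero]
    positivity
  have : Nonempty (Dir d) := ⟨(sstep 0 hn0).choose⟩
  choose! k hk using sstep
  have hpt : ∀ x, ω x * ω (x + z) * (g (x + z) - g x) ^ 2
      ≤ n * ∑ t ∈ Finset.range n, min (ω (x + s t)) (ω (nbr (x + s t) (k t))) *
        (g (nbr (x + s t) (k t)) - g (x + s t)) ^ 2 := by
    intro x
    have htel : g (x + z) - g x
        = ∑ t ∈ Finset.range n, (g (nbr (x + s t) (k t)) - g (x + s t)) := by
      have h := Finset.sum_range_sub (fun t => g (x + s t)) n
      rw [s0, sn, add_zero] at h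
      rw [← h]
      exact Finset.sum_congr rfl fun t ht => by rw [nbr_add, ← hk t (Finset.mem_range.1 ht)]
    have hcs := sq_sum_le_card_mul_sum_sq (s := Finset.range n)
      (f := fun t => g (nbr (x + s t) (k t)) - g (x + s t))
    rw [Finset.card_range] at hcs
    rw [htel]
    have hww : 0 ≤ ω x * ω (x + z) := mul_nonneg (hω0 _) (hω0 _)
    refine (mul_le_mul_of_nonneg_left hcs hww).trans ?_
    rw [mul_left_comm]
    refine mul_le_mul_of_nonneg_left ?_ (Nat.cast_nonneg n)
    rw [Finset.mul_sum]
    refine Finset.sum_le_sum fun t ht => ?_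
    have ht' := Finset.mem_range.1 ht
    refine mul_le_mul_of_nonneg_right (le_min ?_ ?_) (sq_nonneg _)
    · refine hω _ _ _ fun i => ?_
      have := sb t ht'.le i
      simp only [Pi.add_apply]
      omega
    · rw [nbr_add, ← hk t ht']
      refine hω _ _ _ fun i => ?_
      have := sb (t + 1) ht' i
      simp only [Pi.add_apply]
      omega
  have hshift : ∀ (w : Zd d) (k : Dir d), ∑ x ∈ A, min (ω (x + w)) (ω (nbr (x + w) k)) *
        (g (nbr (x + w) k) - g (x + w)) ^ 2 ≤ E := by
    intro w k
    have hinj : Set.InjOn (fun x : Zd d => x + w) A := fun x _ y _ h => add_right_cancel h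
    rw [← Finset.sum_image (f := fun y => min (ω y) (ω (nbr y k)) * (g (nbr y k) - g y) ^ 2) hinj]
    have h1 : ∑ y ∈ A.image (fun x => x + w), min (ω y) (ω (nbr y k)) * (g (nbr y k) - g y) ^ 2
        ≤ ∑ y ∈ B, min (ω y) (ω (nbr y k)) * (g (nbr y k) - g y) ^ 2 := by
      refine (Finset.sum_le_sum_of_subset_of_nonneg (Finset.subset_union_left (s₂ := B))
        fun y _ _ => hnn y k).trans (le_of_eq ?_)
      exact (Finset.sum_subset Finset.subset_union_right fun y _ hy => hB y k hy).symm
    refine h1.trans (Finset.sum_le_sum fun x _ => ?_)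
    exact Finset.single_le_sum (f := fun k => min (ω x) (ω (nbr x k)) * (g (nbr x k) - g x) ^ 2)
      (fun k _ => hnn x k) (Finset.mem_univ k)
  calc ∑ x ∈ A, ω x * ω (x + z) * (g (x + z) - g x) ^ 2
      ≤ ∑ x ∈ A, n * ∑ t ∈ Finset.range n, min (ω (x + s t)) (ω (nbr (x + s t) (k t))) *
        (g (nbr (x + s t) (k t)) - g (x + s t)) ^ 2 := Finset.sum_le_sum fun x _ => hpt x
    _ = n * ∑ t ∈ Finset.range n, ∑ x ∈ A, min (ω (x + s t)) (ω (nbr (x + s t) (k t))) *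
        (g (nbr (x + s t) (k t)) - g (x + s t)) ^ 2 := by
        rw [← Finset.mul_sum, Finset.sum_comm]
    _ ≤ n * ∑ t ∈ Finset.range n, E := by
        refine mul_le_mul_of_nonneg_left ?_ (Nat.cast_nonneg n)
        exact Finset.sum_le_sum fun t _ => hshift _ _
    _ = n ^ 2 * E := by simp; ring
    _ ≤ (d * r) ^ 2 * E := by gcongr

/-- Faber–Krahn: functions with small support have large energy -/
lemma faber_krahn (B S : Finset (Zd d)) (v : Zd d → ℝ) (hv : SuppIn B v)
    (hS : ∀ x, v x ≠ 0 → x ∈ S) (r : ℕ) (hr : 2 * S.card ≤ r ^ d) :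
    ∑ x ∈ S, v x ^ 2 ≤ 2 * (d * r) ^ 2 * En B v := by
  classical
  set Z : Finset (Zd d) := Fintype.piFinset fun _ => Finset.Ico (0 : ℤ) r with hZ
  have hZc : Z.card = r ^ d := by simp [hZ]
  have h1 : ∀ z ∈ Z, ∑ x ∈ S, (v (x + z) - v x) ^ 2 ≤ (d * r) ^ 2 * En B v := by
    intro z hz
    have := sum_translation_le S B (fun _ => 1) v (fun _ => zero_le_one) (fun _ _ _ _ => by simp)
      (fun x k hx => by
        have h1 : v x = 0 := by by_contra h; exact hx (hv x h).1
        have h2 : v (nbr x k) = 0 := by by_contra h; exact hx (hv.mem_of_nbr h)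
        simp [h1, h2]) r z (fun i => by
          have := (Fintype.mem_piFinset.1 hz) i
          rw [Finset.mem_Ico] at this
          rw [abs_of_nonneg this.1]; exact this.2.le)
    simpa [En] using this
  have h2 : ∀ x ∈ S, ((r : ℝ) ^ d - S.card) * v x ^ 2 ≤ ∑ z ∈ Z, (v (x + z) - v x) ^ 2 := by
    intro x _
    have hc : (r : ℝ) ^ d - S.card ≤ ((Z.filter fun z => x + z ∉ S).card : ℝ) := by
      have h3 : (Z.filter fun z => x + z ∈ S).card ≤ S.card := by
        refine Finset.card_le_card_of_injOn (fun z => x + z) (fun z hz => ?_) (fun a _ b _ h => add_left_cancel h)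
        exact (Finset.mem_filter.1 hz).2
      have h4 := Finset.card_filter_add_card_filter_not (s := Z) (fun z => x + z ∈ S)
      rw [hZc] at h4
      have h5 : ((Z.filter fun z => x + z ∈ S).card : ℝ) + ((Z.filter fun z => x + z ∉ S).card : ℝ)
          = (r : ℝ) ^ d := by exact_mod_cast h4
      have h6 : ((Z.filter fun z => x + z ∈ S).card : ℝ) ≤ S.card := by exact_mod_cast h3
      linarith
    calc ((r : ℝ) ^ d - S.card) * v x ^ 2 ≤ ((Z.filter fun z => x + z ∉ S).card : ℝ) * v x ^ 2 := by
          gcongr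
      _ = ∑ z ∈ Z.filter fun z => x + z ∉ S, v x ^ 2 := by simp
      _ = ∑ z ∈ Z.filter fun z => x + z ∉ S, (v (x + z) - v x) ^ 2 := by
          refine Finset.sum_congr rfl fun z hz => ?_
          have : v (x + z) = 0 := by
            by_contra h; exact (Finset.mem_filter.1 hz).2 (hS _ h)
          rw [this]; ring
      _ ≤ ∑ z ∈ Z, (v (x + z) - v x) ^ 2 :=
          Finset.sum_le_sum_of_subset_of_nonneg (Finset.filter_subset _ _) fun _ _ _ => sq_nonneg _
  have h3 : ((r : ℝ) ^ d - S.card) * ∑ x ∈ S, v x ^ 2 ≤ (r : ℝ) ^ d * ((d * r) ^ 2 * En B v) := by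
    rw [Finset.mul_sum]
    refine (Finset.sum_le_sum h2).trans ?_
    rw [Finset.sum_comm]
    refine (Finset.sum_le_sum h1).trans ?_
    rw [Finset.sum_const, hZc, nsmul_eq_mul]
    push_cast
    exact le_rfl
  have hr' : 2 * (S.card : ℝ) ≤ (r : ℝ) ^ d := by exact_mod_cast hr
  have hpos : 0 ≤ ∑ x ∈ S, v x ^ 2 := Finset.sum_nonneg fun _ _ => sq_nonneg _
  rcases S.eq_empty_or_nonempty with h | h
  · subst h
    simp only [Finset.sum_empty]
    exact mul_nonneg (by positivity) (En_nonneg _ _)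
  · have hc : (0 : ℝ) < S.card := by exact_mod_cast h.card_pos
    have hrd : (0 : ℝ) < (r : ℝ) ^ d := by linarith
    have h4 : (r : ℝ) ^ d * (∑ x ∈ S, v x ^ 2) ≤ (r : ℝ) ^ d * (2 * (d * r) ^ 2 * En B v) := by
      nlinarith
    exact le_of_mul_le_mul_left h4 hrd

end

noncomputable section
variable {d : ℕ}

/-- the number of sites of `B` where `v` does not vanish -/
def nz (B : Finset (Zd d)) (v : Zd d → ℝ) : ℝ := by
  classical exact ((B.filter fun x => v x ≠ 0).card : ℝ)

lemma nz_nonneg (B : Finset (Zd d)) (v : Zd d → ℝ) : 0 ≤ nz B v := by unfold nz; positivity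

open Classical in
lemma nz_eq_sum (B : Finset (Zd d)) (v : Zd d → ℝ) :
    nz B v = ∑ x ∈ B, if v x ≠ 0 then (1 : ℝ) else 0 := by
  unfold nz
  rw [Finset.card_filter]
  push_cast
  rfl

/-- constant in the energy inequality for truncations at variable levels -/
def Kone (d : ℕ) (Lam : ℝ) : ℝ := 4 * d * Lam + 2 + 3 * ((2 * d * Lam) ^ 2 + 1)

lemma sum_Lap_level_sq {lam Lam ε : ℝ} {a : Zd d → Zd d → ℝ} (hl : 0 < lam) (ha : Ell lam Lam a)
    {k : Zd d → ℝ} (hk : ∀ x e, |k (nbr x e) - k x| ≤ ε) (x : Zd d) :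
    Lap a k x ^ 2 ≤ (2 * d * Lam) ^ 2 * ε ^ 2 := by
  refine (Lap_sq_le hl ha k x).trans ?_
  have hL : 0 ≤ Lam := by linarith [ha.lower x x, ha.upper x x]
  have h1 : ∑ e, a x (nbr x e) * (k (nbr x e) - k x) ^ 2 ≤ ∑ _e : Dir d, Lam * ε ^ 2 := by
    refine Finset.sum_le_sum fun e _ => mul_le_mul (ha.upper _ _) ?_ (sq_nonneg _) hL
    rw [← sq_abs]
    exact pow_le_pow_left₀ (abs_nonneg _) (hk x e) 2
  rw [Finset.sum_const, Finset.card_univ, nsmul_eq_mul, card_Dir] at h1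
  calc _ ≤ 2 * d * Lam * (2 * d * (Lam * ε ^ 2)) := by gcongr
    _ = _ := by ring

set_option maxHeartbeats 800000 in
/-- energy inequality for a truncation at a variable level, one time step -/
lemma level_step {lam Lam h ε : ℝ} {a : Zd d → Zd d → ℝ} (hl : 0 < lam) (ha : Ell lam Lam a)
    (hh : 0 < h) (hh1 : h ≤ 1) (hh2 : 48 * d * Lam * h ≤ 1) (hε : 0 ≤ ε) (hε1 : ε ≤ 1)
    (B : Finset (Zd d)) (z z' k k' v v' : Zd d → ℝ) (hvdef : ∀ x, v x = max (z x - k x) 0)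
    (hvdef' : ∀ x, v' x = max (z' x - k' x) 0) (hv : SuppIn B v) (hv1 : ∀ x, v x ≤ 1)
    (hk : ∀ x e, |k (nbr x e) - k x| ≤ ε) (hk' : ∀ x, k x - k' x ≤ h * ε ^ 2)
    (hsub : ∀ x, v' x ≠ 0 → z' x ≤ z x + h * Lap a z x) :
    ∑ x ∈ B, v' x ^ 2 ≤ ∑ x ∈ B, v x ^ 2 - h * lam / 2 * En B v
      + h * ε ^ 2 * Kone d Lam * (nz B v + nz B v') := by
  classical
  have hL : lam ≤ Lam := (ha.lower 0 0).trans (ha.upper 0 0)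
  have hL0 : 0 ≤ Lam := by linarith
  set q : Zd d → ℝ := fun x => Lap a v x + Lap a k x + ε ^ 2 with hq
  have hv0 : ∀ x, 0 ≤ v x := fun x => by rw [hvdef]; exact le_max_right _ _
  have hv0' : ∀ x, 0 ≤ v' x := fun x => by rw [hvdef']; exact le_max_right _ _
  -- pointwise one-step bound
  have hle : ∀ x, v' x ≠ 0 → v' x ≤ v x + h * q x := by
    intro x hx
    have h1 := hsub x hx
    have hpos : v' x = z' x - k' x := by
      rw [hvdef'] at hx ⊢
      rcases max_cases (z' x - k' x) 0 with h | h
      · exact h.1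
      · exact absurd h.1 hx
    have hm : 0 ≤ v x - (z x - k x) := by rw [hvdef]; linarith [le_max_left (z x - k x) 0]
    have hLz : Lap a z x ≤ Lap a v x + Lap a k x + 2 * d * Lam * (v x - (z x - k x)) := by
      unfold Lap
      have : (2 * d * Lam * (v x - (z x - k x)))
          = ∑ _e : Dir d, Lam * (v x - (z x - k x)) := by
        rw [Finset.sum_const, Finset.card_univ, nsmul_eq_mul, card_Dir]; ring
      rw [this, ← Finset.sum_add_distrib, ← Finset.sum_add_distrib]
      refine Finset.sum_le_sum fun e _ => ?_
      have h2 : z (nbr x e) - k (nbr x e) ≤ v (nbr x e) := by rw [hvdef]; exact le_max_left _ _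
      have h3 := mul_le_mul_of_nonneg_right (ha.upper x (nbr x e)) hm
      have h4 := mul_le_mul_of_nonneg_left h2 (hl.le.trans (ha.lower x (nbr x e)))
      nlinarith
    have h5 := mul_le_mul_of_nonneg_left hLz hh.le
    have h6 : h * (2 * d * Lam * (v x - (z x - k x))) ≤ v x - (z x - k x) := by
      have : 2 * d * Lam * h ≤ 1 := by
        have : 0 ≤ d * Lam * h := by positivity
        nlinarith
      nlinarith
    have h7 := hk' x
    rw [hpos]
    simp only [hq]
    nlinarith
  have hpt : ∀ x, v' x ^ 2 ≤ v x ^ 2 + 2 * h * (v x * q x)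
      + h ^ 2 * (q x ^ 2 * ((if v x ≠ 0 then 1 else 0) + (if v' x ≠ 0 then 1 else 0))) := by
    intro x
    by_cases h0' : v' x = 0
    · by_cases h0 : v x = 0
      · simp [h0, h0']
      · simp only [h0, h0', ne_eq, not_false_eq_true, if_true, not_true_eq_false, if_false]
        nlinarith [sq_nonneg (v x + h * q x)]
    · have h1 := pow_le_pow_left₀ (hv0' x) (hle x h0') 2
      have h2 : q x ^ 2 ≤ q x ^ 2 * ((if v x ≠ 0 then 1 else 0) + (if v' x ≠ 0 then 1 else 0)) := by
        refine le_mul_of_one_le_right (sq_nonneg _) ?_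
        rw [if_pos h0']
        split_ifs <;> norm_num
      have h3 := mul_le_mul_of_nonneg_left h2 (sq_nonneg h)
      nlinarith
  -- the three contributions
  have e1 : ∑ x ∈ B, v x * Lap a v x = -(1 / 2) * Ena a B v := by
    rw [sum_mul_Lap ha.symm hv]
    unfold Ena
    congr 1
    exact Finset.sum_congr rfl fun x _ => Finset.sum_congr rfl fun k _ => by ring
  have hcount : ∑ x ∈ B, ∑ e, ((if v x ≠ 0 then (1 : ℝ) else 0) + if v (nbr x e) ≠ 0 then 1 else 0)
      = 4 * d * nz B v := by
    have hs := sum_nbr_swap B (fun _ y => if v y ≠ 0 then (1 : ℝ) else 0) (fun x e hx => by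
      have : v (nbr x e) ≠ 0 := by
        by_contra h0; simp [h0] at hx
      exact ⟨hv.mem_of_nbr this, (hv _ this).1⟩)
    have h1 : ∑ x ∈ B, ∑ _e : Dir d, (if v x ≠ 0 then (1 : ℝ) else 0) = 2 * d * nz B v := by
      rw [nz_eq_sum, Finset.mul_sum]
      refine Finset.sum_congr rfl fun x _ => ?_
      rw [Finset.sum_const, Finset.card_univ, nsmul_eq_mul, card_Dir]
    have h2 : ∑ x ∈ B, ∑ e, ((if v x ≠ 0 then (1 : ℝ) else 0) + if v (nbr x e) ≠ 0 then 1 else 0)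
        = ∑ x ∈ B, ∑ _e : Dir d, (if v x ≠ 0 then (1 : ℝ) else 0)
          + ∑ x ∈ B, ∑ e, (if v (nbr x e) ≠ 0 then (1 : ℝ) else 0) := by
      rw [← Finset.sum_add_distrib]
      exact Finset.sum_congr rfl fun x _ => Finset.sum_add_distrib
    rw [h2, hs, h1]; ring
  have e2 : ∑ x ∈ B, v x * Lap a k x ≤ 1 / 8 * Ena a B v + 2 * d * Lam * ε ^ 2 * nz B v := by
    rw [sum_mul_Lap ha.symm hv]
    have : -(∑ x ∈ B, ∑ e, a x (nbr x e) * (v (nbr x e) - v x) * (k (nbr x e) - k x))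
        ≤ 1 / 4 * Ena a B v + Lam * ε ^ 2 * (4 * d * nz B v) := by
      rw [← hcount, Ena, Finset.mul_sum, Finset.mul_sum, ← Finset.sum_add_distrib,
        ← Finset.sum_neg_distrib]
      refine Finset.sum_le_sum fun x _ => ?_
      rw [Finset.mul_sum, Finset.mul_sum, ← Finset.sum_add_distrib, ← Finset.sum_neg_distrib]
      refine Finset.sum_le_sum fun e _ => ?_
      have ha0 : 0 ≤ a x (nbr x e) := hl.le.trans (ha.lower _ _)
      by_cases h0 : v x = 0 ∧ v (nbr x e) = 0
      · simp [h0.1, h0.2]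
      · have hone : (1 : ℝ) ≤ (if v x ≠ 0 then (1 : ℝ) else 0) + if v (nbr x e) ≠ 0 then 1 else 0 := by
          by_cases h1 : v x = 0
          · have h2 : v (nbr x e) ≠ 0 := fun h2 => h0 ⟨h1, h2⟩
            simp [h1, h2]
          · simp only [ne_eq, h1, not_false_eq_true, if_true]
            split_ifs <;> norm_num
        have hA : Lam * ε ^ 2 ≤ Lam * ε ^ 2 *
            ((if v x ≠ 0 then (1 : ℝ) else 0) + if v (nbr x e) ≠ 0 then 1 else 0) :=
          le_mul_of_one_le_right (by positivity) hone
        have hB : (k (nbr x e) - k x) ^ 2 ≤ ε ^ 2 := by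
          rw [← sq_abs]; exact pow_le_pow_left₀ (abs_nonneg _) (hk x e) 2
        have hC : a x (nbr x e) * (k (nbr x e) - k x) ^ 2 ≤ Lam * ε ^ 2 :=
          mul_le_mul (ha.upper _ _) hB (sq_nonneg _) hL0
        nlinarith [mul_nonneg ha0 (sq_nonneg ((v (nbr x e) - v x) / 2 + (k (nbr x e) - k x)))]
    linarith
  have e3 : ∑ x ∈ B, v x ≤ nz B v := by
    rw [nz_eq_sum]
    refine Finset.sum_le_sum fun x _ => ?_
    by_cases h0 : v x = 0
    · simp [h0]
    · simp [h0, hv1 x]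
  have e4 : ∑ x ∈ B, v x * q x ≤ -(3 / 8) * Ena a B v
      + (2 * d * Lam + 1) * ε ^ 2 * nz B v := by
    have : ∑ x ∈ B, v x * q x = ∑ x ∈ B, v x * Lap a v x + ∑ x ∈ B, v x * Lap a k x
        + ε ^ 2 * ∑ x ∈ B, v x := by
      rw [Finset.mul_sum, ← Finset.sum_add_distrib, ← Finset.sum_add_distrib]
      exact Finset.sum_congr rfl fun x _ => by simp only [hq]; ring
    rw [this, e1]
    have := mul_le_mul_of_nonneg_left e3 (sq_nonneg ε)
    linarith
  have e5 : ∑ x ∈ B, q x ^ 2 * ((if v x ≠ 0 then (1 : ℝ) else 0) + (if v' x ≠ 0 then 1 else 0))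
      ≤ 6 * (2 * d * Lam * Ena a B v)
        + 3 * ((2 * d * Lam) ^ 2 + 1) * ε ^ 2 * (nz B v + nz B v') := by
    have hA : ∀ x ∈ B, q x ^ 2 * ((if v x ≠ 0 then (1 : ℝ) else 0) + (if v' x ≠ 0 then 1 else 0))
        ≤ 6 * (2 * d * Lam * ∑ e, a x (nbr x e) * (v (nbr x e) - v x) ^ 2)
          + 3 * ((2 * d * Lam) ^ 2 + 1) * ε ^ 2 *
            ((if v x ≠ 0 then (1 : ℝ) else 0) + (if v' x ≠ 0 then 1 else 0)) := by
      intro x _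
      have h1 := Lap_sq_le hl ha v x
      have h2 := sum_Lap_level_sq hl ha hk x
      have h3 : (ε ^ 2) ^ 2 ≤ ε ^ 2 := by
        have : ε ^ 2 ≤ 1 := pow_le_one₀ hε hε1
        nlinarith [sq_nonneg ε]
      have h4 : q x ^ 2 ≤ 3 * (2 * d * Lam * ∑ e, a x (nbr x e) * (v (nbr x e) - v x) ^ 2)
          + 3 * ((2 * d * Lam) ^ 2 + 1) * ε ^ 2 := by
        simp only [hq]
        nlinarith [sq_nonneg (Lap a v x - Lap a k x), sq_nonneg (Lap a v x - ε ^ 2),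
          sq_nonneg (Lap a k x - ε ^ 2)]
      have h5 : 0 ≤ 2 * d * Lam * ∑ e, a x (nbr x e) * (v (nbr x e) - v x) ^ 2 :=
        (sq_nonneg _).trans h1
      split_ifs <;> nlinarith
    refine (Finset.sum_le_sum hA).trans ?_
    rw [Finset.sum_add_distrib, ← Finset.mul_sum, ← Finset.mul_sum, ← Finset.mul_sum,
      Finset.sum_add_distrib, nz_eq_sum, nz_eq_sum]
    exact le_rfl
  have e6 : ∑ x ∈ B, v' x ^ 2 ≤ ∑ x ∈ B, v x ^ 2 + 2 * h * ∑ x ∈ B, v x * q x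
      + h ^ 2 * ∑ x ∈ B, q x ^ 2 *
        ((if v x ≠ 0 then (1 : ℝ) else 0) + (if v' x ≠ 0 then 1 else 0)) := by
    rw [Finset.mul_sum, Finset.mul_sum, ← Finset.sum_add_distrib, ← Finset.sum_add_distrib]
    exact Finset.sum_le_sum fun x _ => hpt x
  have h5 := ha.lam_En_le B v
  have h6 : 0 ≤ Ena a B v := le_trans (mul_nonneg hl.le (En_nonneg B v)) h5
  have s0 := nz_nonneg B v
  have s0' := nz_nonneg B v'
  have f1 := mul_le_mul_of_nonneg_left e4 (by linarith : 0 ≤ 2 * h)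
  have f2 := mul_le_mul_of_nonneg_left e5 (sq_nonneg h)
  have f3 : h ^ 2 * (6 * (2 * d * Lam * Ena a B v)) ≤ h / 4 * Ena a B v := by
    have : h * (48 * d * Lam * h) * Ena a B v ≤ h * 1 * Ena a B v := by gcongr
    linarith
  set P : ℝ := 3 * ((2 * d * Lam) ^ 2 + 1) * ε ^ 2 * (nz B v + nz B v') with hP
  have hP0 : 0 ≤ P := by positivity
  have f4 : h ^ 2 * P ≤ h * P := by
    have : h ^ 2 ≤ h := by nlinarith
    exact mul_le_mul_of_nonneg_right this hP0
  have f5 : h * lam / 2 * En B v ≤ h / 2 * Ena a B v := by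
    have := mul_le_mul_of_nonneg_left h5 (by linarith : 0 ≤ h / 2)
    linarith
  have f6 : (2 * h) * ((2 * d * Lam + 1) * ε ^ 2 * nz B v) + h * P
      ≤ h * ε ^ 2 * Kone d Lam * (nz B v + nz B v') := by
    have : 0 ≤ (2 * h) * ((2 * d * Lam + 1) * ε ^ 2 * nz B v') := by positivity
    have e7 : h * ε ^ 2 * Kone d Lam * (nz B v + nz B v')
        = (2 * h) * ((2 * d * Lam + 1) * ε ^ 2 * nz B v) + h * P
          + (2 * h) * ((2 * d * Lam + 1) * ε ^ 2 * nz B v') := by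
      simp only [hP, Kone]; ring
    linarith
  rw [mul_add] at f1 f2
  linarith
end

noncomputable section
variable {d : ℕ}

lemma norm_nbr_sub_le (x c : Zd d) (k : Dir d) : |‖nbr x k - c‖ - ‖x - c‖| ≤ 1 := by
  refine (abs_norm_sub_norm_le _ _).trans ?_
  rw [sub_sub_sub_cancel_right]
  refine (pi_norm_le_iff_of_nonneg zero_le_one).2 fun i => ?_
  rw [Pi.sub_apply, Int.norm_eq_abs]
  exact_mod_cast abs_nbr_sub_le x k i

lemma mem_box_iff_norm {c x : Zd d} {r : ℕ} : x ∈ box c r ↔ ‖x - c‖ ≤ r := by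
  rw [mem_box, pi_norm_le_iff_of_nonneg (Nat.cast_nonneg r)]
  refine forall_congr' fun i => ?_
  rw [Pi.sub_apply, Int.norm_eq_abs]
  exact ⟨fun h => by exact_mod_cast h, fun h => by exact_mod_cast h⟩

/-- cone-shaped levels -/
def lev (x0 : Zd d) (ρ N : ℕ) (κ : ℝ) (n : ℕ) (x : Zd d) : ℝ :=
  κ + ‖x - x0‖ / ρ + max (1 - (n : ℝ) / N) 0

/-- truncation above the cone-shaped level -/
def trunc (z : ℕ → Zd d → ℝ) (x0 : Zd d) (ρ N : ℕ) (κ : ℝ) (n : ℕ) (x : Zd d) : ℝ :=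
  max (z n x - lev x0 ρ N κ n x) 0

/-- space-time size of the support of the truncation -/
def Xsz (z : ℕ → Zd d → ℝ) (x0 : Zd d) (ρ N T : ℕ) (h κ : ℝ) : ℝ :=
  h * ∑ n ∈ Finset.range (T + 1), nz (box x0 (ρ + 1)) (trunc z x0 ρ N κ n)

lemma trunc_ne_zero {z : ℕ → Zd d → ℝ} {x0 : Zd d} {ρ N : ℕ} {κ : ℝ} {n : ℕ} {x : Zd d}
    (h : trunc z x0 ρ N κ n x ≠ 0) : lev x0 ρ N κ n x < z n x := by
  by_contra! h1
  exact h (max_eq_right (by linarith))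

lemma trunc_ne_zero_iff {z : ℕ → Zd d → ℝ} {x0 : Zd d} {ρ N : ℕ} {κ : ℝ} {n : ℕ} {x : Zd d} :
    trunc z x0 ρ N κ n x ≠ 0 ↔ lev x0 ρ N κ n x < z n x := by
  refine ⟨trunc_ne_zero, fun h => ?_⟩
  have : 0 < trunc z x0 ρ N κ n x := lt_max_of_lt_left (by linarith)
  exact this.ne'

section
variable {z : ℕ → Zd d → ℝ} {x0 : Zd d} {ρ N T : ℕ}

lemma mem_box_of_trunc (hρ : 1 ≤ ρ) (hz : ∀ n x, z n x ≤ 1) {κ : ℝ} (hκ : 0 ≤ κ) {n : ℕ} {x : Zd d}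
    (h : trunc z x0 ρ N κ n x ≠ 0) : x ∈ box x0 ρ := by
  have h1 := trunc_ne_zero h
  have h2 := hz n x
  have h3 : 0 ≤ max (1 - (n : ℝ) / N) 0 := le_max_right _ _
  have hρ' : (0 : ℝ) < ρ := by exact_mod_cast hρ
  have h4 : ‖x - x0‖ / ρ ≤ 1 := by unfold lev at h1; linarith
  rw [div_le_one hρ'] at h4
  exact mem_box_iff_norm.2 h4

lemma suppIn_trunc (hρ : 1 ≤ ρ) (hz : ∀ n x, z n x ≤ 1) {κ : ℝ} (hκ : 0 ≤ κ) (n : ℕ) :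
    SuppIn (box x0 (ρ + 1)) (trunc z x0 ρ N κ n) := fun x hx => by
  have := mem_box_of_trunc hρ hz hκ hx
  exact ⟨box_mono (Nat.le_succ _) this, nbr_mem_box this le_rfl⟩

lemma Xsz_nonneg {h : ℝ} (hh : 0 ≤ h) (κ : ℝ) : 0 ≤ Xsz z x0 ρ N T h κ :=
  mul_nonneg hh (Finset.sum_nonneg fun _ _ => nz_nonneg _ _)

lemma nz_mono {B : Finset (Zd d)} {v w : Zd d → ℝ} (h : ∀ x, v x ≠ 0 → w x ≠ 0) : nz B v ≤ nz B w := by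
  classical
  unfold nz
  exact_mod_cast Finset.card_le_card (Finset.monotone_filter_right _ fun x _ hx => h x hx)

lemma Xsz_anti {h : ℝ} (hh : 0 ≤ h) {κ κ' : ℝ} (hκ : κ ≤ κ') :
    Xsz z x0 ρ N T h κ' ≤ Xsz z x0 ρ N T h κ := by
  refine mul_le_mul_of_nonneg_left (Finset.sum_le_sum fun n _ => nz_mono fun x hx => ?_) hh
  rw [trunc_ne_zero_iff] at *
  unfold lev at *
  linarith

variable {lam Lam h : ℝ} {a : ℕ → Zd d → Zd d → ℝ}

lemma trunc_energy (hl : 0 < lam) (ha : ∀ n, Ell lam Lam (a n)) (hh : 0 < h) (hh1 : h ≤ 1)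
    (hh2 : 48 * d * Lam * h ≤ 1) (hρ : 1 ≤ ρ) (hN : (ρ : ℝ) ^ 2 ≤ N * h) (hz : ∀ n x, z n x ≤ 1)
    (hsub : ∀ n < T, ∀ x ∈ box x0 ρ, z (n + 1) x ≤ z n x + h * Lap (a n) (z n) x)
    {κ : ℝ} (hκ : 0 ≤ κ) {n : ℕ} (hn : n ≤ T) :
    ∑ x ∈ box x0 (ρ + 1), trunc z x0 ρ N κ n x ^ 2
      + h * lam / 2 * ∑ m ∈ Finset.range n, En (box x0 (ρ + 1)) (trunc z x0 ρ N κ m)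
      ≤ 2 * Kone d Lam / ρ ^ 2 * Xsz z x0 ρ N T h κ := by
  set B := box x0 (ρ + 1)
  set v := trunc z x0 ρ N κ with hv
  have hρ' : (1 : ℝ) ≤ ρ := by exact_mod_cast hρ
  have hN0 : (0 : ℝ) < N := by
    rcases Nat.eq_zero_or_pos N with h0 | h0
    · rw [h0] at hN; norm_num at hN; nlinarith
    · exact_mod_cast h0
  have hLam : 0 ≤ Lam := by linarith [(ha 0).lower 0 0, (ha 0).upper 0 0]
  have hK : 0 ≤ Kone d Lam := by unfold Kone; positivity
  have key : ∀ n ≤ T, ∑ x ∈ B, v n x ^ 2 + h * lam / 2 * ∑ m ∈ Finset.range n, En B (v m)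
      ≤ h * (1 / (ρ : ℝ)) ^ 2 * Kone d Lam * ∑ m ∈ Finset.range n, (nz B (v m) + nz B (v (m + 1))) := by
    intro n
    induction n with
    | zero =>
      intro _
      have : ∀ x ∈ B, v 0 x ^ 2 = 0 := by
        intro x _
        by_contra h0
        have h1 := trunc_ne_zero (pow_ne_zero_iff (two_ne_zero) |>.1 h0)
        have h2 : 0 ≤ ‖x - x0‖ / ρ := by positivity
        have h3 := hz 0 x
        have h4 : (1 : ℝ) ≤ max (1 - ((0 : ℕ) : ℝ) / N) 0 := le_max_of_le_left (by simp)
        unfold lev at h1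
        linarith
      rw [Finset.sum_eq_zero this]; simp
    | succ n ih =>
      intro hn
      have ih := ih (by omega)
      have hst := level_step (lam := lam) (Lam := Lam) (h := h) (ε := 1 / (ρ : ℝ)) hl (ha n) hh hh1 hh2
        (by positivity) (by rw [div_le_one (by linarith)]; exact hρ') B (z n) (z (n + 1))
        (lev x0 ρ N κ n) (lev x0 ρ N κ (n + 1)) (v n) (v (n + 1)) (fun _ => rfl) (fun _ => rfl)
        (suppIn_trunc hρ hz hκ n) (fun x => by
          refine max_le ?_ zero_le_one
          have h1 : 0 ≤ lev x0 ρ N κ n x := by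
            unfold lev
            have := le_max_right (1 - (n : ℝ) / N) 0
            positivity
          linarith [hz n x])
        (fun x e => by
          unfold lev
          rw [show κ + ‖nbr x e - x0‖ / ρ + max (1 - (n : ℝ) / N) 0
            - (κ + ‖x - x0‖ / ρ + max (1 - (n : ℝ) / N) 0) = (‖nbr x e - x0‖ - ‖x - x0‖) / ρ by ring,
            abs_div, abs_of_pos (by linarith : (0 : ℝ) < ρ)]
          gcongr
          exact norm_nbr_sub_le x x0 e)
        (fun x => by
          unfold lev
          have h1 : max (1 - (n : ℝ) / N) 0 ≤ max (1 - ((n + 1 : ℕ) : ℝ) / N) 0 + 1 / N := by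
            refine max_le ?_ (by positivity)
            have := le_max_left (1 - ((n + 1 : ℕ) : ℝ) / N) 0
            push_cast at this ⊢
            rw [add_div] at *
            linarith
          have h2 : 1 / (N : ℝ) ≤ h * (1 / ρ) ^ 2 := by
            rw [div_le_iff₀ hN0, div_pow, one_pow, mul_assoc, mul_comm _ (N : ℝ), ← mul_assoc,
              mul_one_div, le_div_iff₀ (by positivity)]
            linarith
          linarith)
        (fun x hx => hsub n (by omega) x (mem_box_of_trunc hρ hz hκ hx))
      rw [Finset.sum_range_succ, Finset.sum_range_succ, mul_add, mul_add]
      linarith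
  refine (key n hn).trans ?_
  have h1 : ∑ m ∈ Finset.range n, (nz B (v m) + nz B (v (m + 1)))
      ≤ 2 * ∑ m ∈ Finset.range (T + 1), nz B (v m) := by
    rw [Finset.sum_add_distrib]
    have h2 : ∑ m ∈ Finset.range n, nz B (v m) ≤ ∑ m ∈ Finset.range (T + 1), nz B (v m) :=
      Finset.sum_le_sum_of_subset_of_nonneg (Finset.range_mono (by omega))
        fun _ _ _ => nz_nonneg _ _
    have h3 : ∑ m ∈ Finset.range n, nz B (v (m + 1)) ≤ ∑ m ∈ Finset.range (T + 1), nz B (v m) := by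
      have h4 := Finset.sum_range_succ' (fun m => nz B (v m)) n
      have h5 : ∑ m ∈ Finset.range (n + 1), nz B (v m) ≤ ∑ m ∈ Finset.range (T + 1), nz B (v m) :=
        Finset.sum_le_sum_of_subset_of_nonneg (Finset.range_mono (by omega))
          fun _ _ _ => nz_nonneg _ _
      have := nz_nonneg B (v 0)
      linarith
    linarith
  calc _ ≤ h * (1 / (ρ : ℝ)) ^ 2 * Kone d Lam * (2 * ∑ m ∈ Finset.range (T + 1), nz B (v m)) := by
        gcongr
    _ = _ := by unfold Xsz; simp only [B, v]; ring

lemma trunc_chebyshev {κ κ' δ : ℝ} (hδ : 0 ≤ δ) (hκ : κ + δ ≤ κ') (B : Finset (Zd d)) (n : ℕ) :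
    δ ^ 2 * nz B (trunc z x0 ρ N κ' n) ≤ ∑ x ∈ B, trunc z x0 ρ N κ n x ^ 2 := by
  classical
  rw [nz_eq_sum, Finset.mul_sum]
  refine Finset.sum_le_sum fun x _ => ?_
  split_ifs with h
  · rw [mul_one]
    refine pow_le_pow_left₀ hδ ?_ 2
    have := trunc_ne_zero h
    refine le_max_of_le_left ?_
    unfold lev at *
    linarith
  · rw [mul_zero]; positivity

/-- the levels of the De Giorgi iteration -/
def kap (j : ℕ) : ℝ := 1 / 2 - (1 / 4) * (1 / 2) ^ j

lemma kap_nonneg (j : ℕ) : 0 ≤ kap j := by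
  have : (1 / 2 : ℝ) ^ j ≤ 1 := pow_le_one₀ (by norm_num) (by norm_num)
  unfold kap; linarith

lemma kap_succ (j : ℕ) : kap j + (1 / 8) * (1 / 2) ^ j = kap (j + 1) := by
  unfold kap; rw [pow_succ]; ring

lemma kap_lt (j : ℕ) : kap j < 1 / 2 := by
  have : (0 : ℝ) < (1 / 2 : ℝ) ^ j := by positivity
  unfold kap; linarith

/-- the De Giorgi recursion -/
lemma Xsz_recursion (hd : 1 ≤ d) (hl : 0 < lam) (ha : ∀ n, Ell lam Lam (a n)) (hh : 0 < h) (hh1 : h ≤ 1)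
    (hh2 : 48 * d * Lam * h ≤ 1) (hρ : 1 ≤ ρ) (hN : (ρ : ℝ) ^ 2 ≤ N * h) (hz : ∀ n x, z n x ≤ 1)
    (hsub : ∀ n < T, ∀ x ∈ box x0 ρ, z (n + 1) x ≤ z n x + h * Lap (a n) (z n) x)
    {σ q b : ℝ} (hσ : 0 < σ) (hb : b = 4 * 2 ^ d)
    (hσ1 : 4 ^ 5 * (2 * Kone d Lam * (4 * d ^ 2 / lam + 1)) * σ ^ 2 ≤ 1 / b)
    (hq : q = σ ^ d / (256 * Kone d Lam)) (j : ℕ)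
    (hX : Xsz z x0 ρ N T h (kap j) ≤ q * ρ ^ (d + 2) * (1 / b) ^ j) :
    Xsz z x0 ρ N T h (kap (j + 2)) ≤ 1 / b * Xsz z x0 ρ N T h (kap (j + 1)) := by
  classical
  set B := box x0 (ρ + 1) with hB
  have hρ' : (1 : ℝ) ≤ ρ := by exact_mod_cast hρ
  have hLam : 0 ≤ Lam := by linarith [(ha 0).lower 0 0, (ha 0).upper 0 0]
  have hK : 0 < Kone d Lam := by unfold Kone; positivity
  set K := Kone d Lam with hKdef
  have hX1 := Xsz_nonneg (z := z) (x0 := x0) (ρ := ρ) (N := N) (T := T) hh.le (kap (j + 1))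
  have hs : ∀ n ∈ Finset.range (T + 1), 2 * nz B (trunc z x0 ρ N (kap (j + 1)) n)
      ≤ (σ * (1 / 2) ^ j * ρ) ^ d := by
    intro n hn
    have h1 := trunc_chebyshev (z := z) (x0 := x0) (ρ := ρ) (N := N)
      (by positivity : (0 : ℝ) ≤ (1 / 8) * (1 / 2) ^ j) (kap_succ j).le B n
    have h2 := trunc_energy hl ha hh hh1 hh2 hρ hN hz hsub (kap_nonneg j)
      (Nat.lt_succ_iff.1 (Finset.mem_range.1 hn))
    have h3 : 0 ≤ h * lam / 2 * ∑ m ∈ Finset.range n, En B (trunc z x0 ρ N (kap j) m) :=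
      mul_nonneg (by positivity) (Finset.sum_nonneg fun _ _ => En_nonneg _ _)
    have h4 : 2 * K / ρ ^ 2 * Xsz z x0 ρ N T h (kap j)
        ≤ 2 * K / ρ ^ 2 * (q * ρ ^ (d + 2) * (1 / b) ^ j) := by gcongr
    have h5 : 2 * K / ρ ^ 2 * (q * ρ ^ (d + 2) * (1 / b) ^ j)
        = ((1 / 8) * (1 / 2) ^ j) ^ 2 * (1 / 2 * (σ * (1 / 2) ^ j * ρ) ^ d) := by
      have hb1 : (1 / b) ^ j = ((1 / 2 : ℝ) ^ j) ^ 2 * ((1 / 2 : ℝ) ^ j) ^ d := by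
        rw [hb, ← pow_mul, ← pow_mul, mul_comm j 2, mul_comm j d, pow_mul, pow_mul, ← mul_pow]
        congr 1
        rw [one_div_pow, one_div_pow]
        norm_num
        ring
      rw [hb1, hq, mul_pow (1 / 8 : ℝ), mul_pow (σ * (1 / 2) ^ j), mul_pow σ, pow_add]
      generalize (1 / 2 : ℝ) ^ j = t
      field_simp
      ring
    have hpos : (0 : ℝ) < ((1 / 8) * (1 / 2) ^ j) ^ 2 := by positivity
    have h6 : ((1 / 8 : ℝ) * (1 / 2) ^ j) ^ 2 * nz B (trunc z x0 ρ N (kap (j + 1)) n)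
        ≤ ((1 / 8) * (1 / 2) ^ j) ^ 2 * (1 / 2 * (σ * (1 / 2) ^ j * ρ) ^ d) := by linarith
    have h7 := le_of_mul_le_mul_left h6 hpos
    linarith
  rcases lt_or_ge (σ * (1 / 2) ^ j * ρ) 1 with hlt | hge
  · have h0 : ∀ n ∈ Finset.range (T + 1), nz B (trunc z x0 ρ N (kap (j + 1)) n) = 0 := by
      intro n hn
      have h1 := hs n hn
      have h2 : (σ * (1 / 2) ^ j * ρ) ^ d < 1 := pow_lt_one₀ (by positivity) hlt (by omega)
      have h3 : nz B (trunc z x0 ρ N (kap (j + 1)) n) < 1 := by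
        linarith [nz_nonneg B (trunc z x0 ρ N (kap (j + 1)) n)]
      unfold nz at h3 ⊢
      exact_mod_cast Nat.lt_one_iff.1 (by exact_mod_cast h3)
    have hX1' : Xsz z x0 ρ N T h (kap (j + 1)) = 0 := by
      unfold Xsz; rw [Finset.sum_eq_zero h0, mul_zero]
    have h4 := Xsz_anti (z := z) (x0 := x0) (ρ := ρ) (N := N) (T := T) hh.le
      (by rw [← kap_succ (j + 1)]; linarith [show (0 : ℝ) ≤ 1 / 8 * (1 / 2) ^ (j + 1) by positivity]
        : kap (j + 1) ≤ kap (j + 1 + 1))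
    rw [hX1'] at h4 ⊢
    simpa using h4
  · set r := ⌈σ * (1 / 2) ^ j * ρ⌉₊ with hr
    have hr1 : σ * (1 / 2) ^ j * ρ ≤ r := Nat.le_ceil _
    have hr2 : (r : ℝ) ≤ 2 * (σ * (1 / 2) ^ j * ρ) := by
      have := (Nat.ceil_lt_add_one (by positivity : 0 ≤ σ * (1 / 2) ^ j * ρ)).le
      linarith
    have hr3 : (1 : ℝ) ≤ r := hge.trans hr1
    set v := trunc z x0 ρ N (kap (j + 1)) with hv
    have hFK : ∀ n ∈ Finset.range (T + 1), ∑ x ∈ B, v n x ^ 2 ≤ 2 * (d * r) ^ 2 * En B (v n) := by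
      intro n hn
      have h1 := faber_krahn B (B.filter fun x => v n x ≠ 0) (v n) (suppIn_trunc hρ hz (kap_nonneg _) n)
        (fun x hx => Finset.mem_filter.2 ⟨(suppIn_trunc hρ hz (kap_nonneg _) n x hx).1, hx⟩) r (by
          have h2 := (hs n hn).trans (pow_le_pow_left₀ (by positivity) hr1 d)
          unfold nz at h2
          exact_mod_cast h2)
      rw [Finset.sum_filter_of_ne] at h1
      · exact h1
      · intro x _ hx h0
        exact hx (by rw [h0]; simp)
    have hE := trunc_energy hl ha hh hh1 hh2 hρ hN hz hsub (kap_nonneg (j + 1)) (le_refl T)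
    change ∑ x ∈ B, v T x ^ 2 + h * lam / 2 * ∑ m ∈ Finset.range T, En B (v m) ≤ _ at hE
    set S := 2 * K / ρ ^ 2 * Xsz z x0 ρ N T h (kap (j + 1)) with hS
    have hS0 : 0 ≤ S := by positivity
    have hEn0 : 0 ≤ ∑ m ∈ Finset.range T, En B (v m) := Finset.sum_nonneg fun _ _ => En_nonneg _ _
    have hvT0 : 0 ≤ ∑ x ∈ B, v T x ^ 2 := Finset.sum_nonneg fun _ _ => sq_nonneg _
    have hsum : h * ∑ n ∈ Finset.range (T + 1), ∑ x ∈ B, v n x ^ 2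
        ≤ (4 * d ^ 2 / lam + 1) * r ^ 2 * S := by
      rw [Finset.sum_range_succ, mul_add]
      have h1 : ∑ n ∈ Finset.range T, ∑ x ∈ B, v n x ^ 2
          ≤ 2 * (d * r) ^ 2 * ∑ m ∈ Finset.range T, En B (v m) := by
        rw [Finset.mul_sum]
        exact Finset.sum_le_sum fun n hn => hFK n (Finset.range_mono (Nat.le_succ T) hn)
      have h2 : h * ∑ n ∈ Finset.range T, ∑ x ∈ B, v n x ^ 2 ≤ 4 * d ^ 2 / lam * r ^ 2 * S := by
        calc h * ∑ n ∈ Finset.range T, ∑ x ∈ B, v n x ^ 2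
            ≤ h * (2 * (d * r) ^ 2 * ∑ m ∈ Finset.range T, En B (v m)) := by gcongr
          _ = 4 * d ^ 2 / lam * r ^ 2 * (h * lam / 2 * ∑ m ∈ Finset.range T, En B (v m)) := by
              field_simp; ring
          _ ≤ 4 * d ^ 2 / lam * r ^ 2 * S := by
              refine mul_le_mul_of_nonneg_left ?_ (by positivity)
              linarith
      have h3 : h * ∑ x ∈ B, v T x ^ 2 ≤ 1 * r ^ 2 * S := by
        have h4 : ∑ x ∈ B, v T x ^ 2 ≤ S := by
          have : 0 ≤ h * lam / 2 * ∑ m ∈ Finset.range T, En B (v m) := by positivity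
          linarith
        have h5 : S ≤ 1 * r ^ 2 * S := by
          have : (1 : ℝ) ≤ (r : ℝ) ^ 2 := one_le_pow₀ hr3
          nlinarith
        nlinarith
      nlinarith
    have hch : ((1 / 8 : ℝ) * (1 / 2) ^ (j + 1)) ^ 2 * Xsz z x0 ρ N T h (kap (j + 2))
        ≤ h * ∑ n ∈ Finset.range (T + 1), ∑ x ∈ B, v n x ^ 2 := by
      unfold Xsz
      rw [mul_left_comm, Finset.mul_sum]
      refine mul_le_mul_of_nonneg_left (Finset.sum_le_sum fun n _ => ?_) hh.le
      exact trunc_chebyshev (by positivity) (kap_succ (j + 1)).le B n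
    have hr4 : (r : ℝ) ^ 2 ≤ (2 * (σ * (1 / 2) ^ j * ρ)) ^ 2 := by gcongr
    have hfin : (4 * d ^ 2 / lam + 1) * r ^ 2 * S
        ≤ ((1 / 8 : ℝ) * (1 / 2) ^ (j + 1)) ^ 2 * (1 / b * Xsz z x0 ρ N T h (kap (j + 1))) := by
      calc (4 * d ^ 2 / lam + 1) * r ^ 2 * S
          ≤ (4 * d ^ 2 / lam + 1) * (2 * (σ * (1 / 2) ^ j * ρ)) ^ 2 * S := by gcongr
        _ = ((1 / 8 : ℝ) * (1 / 2) ^ (j + 1)) ^ 2 *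
            ((4 ^ 5 * (2 * K * (4 * d ^ 2 / lam + 1)) * σ ^ 2) * Xsz z x0 ρ N T h (kap (j + 1))) := by
            rw [hS, pow_succ (1 / 2 : ℝ) j]
            generalize (1 / 2 : ℝ) ^ j = t
            field_simp
            ring
        _ ≤ _ := by gcongr
    exact le_of_mul_le_mul_left ((hch.trans hsum).trans hfin) (by positivity)

end

/-- local boundedness: a subsolution that is rarely above `1/4` is at most `5/8` further inside -/
lemma degiorgi_sup (d : ℕ) (hd : 1 ≤ d) (lam Lam : ℝ) (hl : 0 < lam) (hL : lam ≤ Lam) :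
    ∃ θ : ℝ, 0 < θ ∧ ∀ h : ℝ, 0 < h → h ≤ 1 → 48 * d * Lam * h ≤ 1 →
      ∀ a : ℕ → Zd d → Zd d → ℝ, (∀ n, Ell lam Lam (a n)) →
      ∀ (x0 : Zd d) (ρ N T : ℕ), 1 ≤ ρ → (ρ : ℝ) ^ 2 ≤ N * h →
      ∀ z : ℕ → Zd d → ℝ, (∀ n x, z n x ≤ 1) →
      (∀ n < T, ∀ x ∈ box x0 ρ, z (n + 1) x ≤ z n x + h * Lap (a n) (z n) x) →
      h * ∑ n ∈ Finset.range (T + 1), (((box x0 ρ).filter fun x => 1 / 4 < z n x).card : ℝ)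
        ≤ θ * ρ ^ (d + 2) →
      ∀ n, N ≤ n → n ≤ T → ∀ x, 8 * ‖x - x0‖ ≤ ρ → z n x ≤ 5 / 8 := by
  have hLam : 0 ≤ Lam := hl.le.trans hL
  have hK : 0 < Kone d Lam := by unfold Kone; positivity
  set b : ℝ := 4 * 2 ^ d with hb
  have hb0 : 0 < b := by positivity
  have hb1 : 1 / b < 1 := by
    rw [div_lt_one hb0]
    have : (1 : ℝ) ≤ 2 ^ d := one_le_pow₀ (by norm_num)
    linarith
  set M : ℝ := 4 ^ 5 * (2 * Kone d Lam * (4 * d ^ 2 / lam + 1)) with hM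
  have hM0 : 0 < M := by positivity
  set σ : ℝ := min 1 (1 / (M * b)) with hσ
  have hσ0 : 0 < σ := lt_min one_pos (by positivity)
  have hσ1 : M * σ ^ 2 ≤ 1 / b := by
    have h1 : σ ^ 2 ≤ σ := by
      have : σ ≤ 1 := min_le_left _ _
      nlinarith
    have h2 : σ ≤ 1 / (M * b) := min_le_right _ _
    calc M * σ ^ 2 ≤ M * (1 / (M * b)) := by gcongr; exact h1.trans h2
      _ = 1 / b := by field_simp
  set q : ℝ := σ ^ d / (256 * Kone d Lam) with hq
  have hq0 : 0 < q := by positivity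
  refine ⟨q / b, by positivity, ?_⟩
  intro h hh hh1 hh2 a ha x0 ρ N T hρ hN z hz hsub hsmall
  have hρ' : (1 : ℝ) ≤ ρ := by exact_mod_cast hρ
  have h0 : Xsz z x0 ρ N T h (kap 0) ≤ q * ρ ^ (d + 2) * (1 / b) := by
    refine le_trans ?_ (hsmall.trans (le_of_eq (by ring)))
    unfold Xsz
    refine mul_le_mul_of_nonneg_left (Finset.sum_le_sum fun n _ => ?_) hh.le
    unfold nz
    refine Nat.cast_le.2 (Finset.card_le_card fun x hx => ?_)
    have hx2 := (Finset.mem_filter.1 hx).2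
    refine Finset.mem_filter.2 ⟨mem_box_of_trunc hρ hz (kap_nonneg 0) hx2, ?_⟩
    have h3 := trunc_ne_zero hx2
    have h4 := le_max_right (1 - (n : ℝ) / N) 0
    have h5 : 0 ≤ ‖x - x0‖ / ρ := by positivity
    have h6 : kap 0 = 1 / 4 := by unfold kap; norm_num
    unfold lev at h3
    linarith
  have hX : ∀ j, Xsz z x0 ρ N T h (kap j) ≤ q * ρ ^ (d + 2) * (1 / b) ^ j ∧
      Xsz z x0 ρ N T h (kap (j + 1)) ≤ q * ρ ^ (d + 2) * (1 / b) ^ (j + 1) := by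
    intro j
    induction j with
    | zero =>
      constructor
      · refine h0.trans ?_
        rw [pow_zero]
        gcongr
      · rw [zero_add, pow_one]
        refine (Xsz_anti hh.le ?_).trans h0
        rw [← kap_succ 0]; norm_num
    | succ j ih =>
      refine ⟨ih.2, ?_⟩
      have := Xsz_recursion hd hl ha hh hh1 hh2 hρ hN hz hsub hσ0 hb hσ1 hq j ih.1
      refine this.trans ?_
      calc 1 / b * Xsz z x0 ρ N T h (kap (j + 1))
          ≤ 1 / b * (q * ρ ^ (d + 2) * (1 / b) ^ (j + 1)) := by gcongr; exact ih.2
        _ = _ := by ring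
  intro n hNn hnT x hx
  by_contra! hcon
  have hlow : ∀ j, h ≤ Xsz z x0 ρ N T h (kap j) := by
    intro j
    have hne : trunc z x0 ρ N (kap j) n x ≠ 0 := by
      rw [trunc_ne_zero_iff]
      have h1 : max (1 - (n : ℝ) / N) 0 = 0 := by
        refine max_eq_right ?_
        have hN0 : (0 : ℝ) < N := by
          rcases Nat.eq_zero_or_pos N with h0 | h0
          · rw [h0] at hN; norm_num at hN; nlinarith
          · exact_mod_cast h0
        have : (1 : ℝ) ≤ n / N := by
          rw [le_div_iff₀ hN0, one_mul]; exact_mod_cast hNn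
        linarith
      have h2 : ‖x - x0‖ / ρ ≤ 1 / 8 := by
        rw [div_le_iff₀ (by linarith)]; linarith
      have h3 := kap_lt j
      unfold lev
      rw [h1]
      linarith
    have h1 : (1 : ℝ) ≤ nz (box x0 (ρ + 1)) (trunc z x0 ρ N (kap j) n) := by
      classical
      unfold nz
      have : 0 < ((box x0 (ρ + 1)).filter fun x => trunc z x0 ρ N (kap j) n x ≠ 0).card :=
        Finset.card_pos.2 ⟨x, Finset.mem_filter.2 ⟨(suppIn_trunc hρ hz (kap_nonneg j) n x hne).1, hne⟩⟩
      exact_mod_cast this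
    have h2 : nz (box x0 (ρ + 1)) (trunc z x0 ρ N (kap j) n)
        ≤ ∑ m ∈ Finset.range (T + 1), nz (box x0 (ρ + 1)) (trunc z x0 ρ N (kap j) m) :=
      Finset.single_le_sum (f := fun m => nz (box x0 (ρ + 1)) (trunc z x0 ρ N (kap j) m))
        (fun _ _ => nz_nonneg _ _) (Finset.mem_range.2 (by omega))
    unfold Xsz
    nlinarith
  have hlim : Tendsto (fun j : ℕ => q * (ρ : ℝ) ^ (d + 2) * (1 / b) ^ j) atTop (nhds 0) := by
    have := (tendsto_pow_atTop_nhds_zero_of_lt_one (by positivity : 0 ≤ 1 / b) hb1).const_mul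
      (q * (ρ : ℝ) ^ (d + 2))
    simpa using this
  have := ge_of_tendsto' hlim fun j => (hlow j).trans (hX j).1
  linarith
end

noncomputable section
variable {d : ℕ}

lemma log_sub_log_sq_le {p r : ℝ} (hp : 0 < p) (hr : 0 < r) :
    (Real.log r - Real.log p) ^ 2 ≤ (r - p) ^ 2 / (p * r) := by
  set t := (Real.log r - Real.log p) / 2 with ht
  have h1 : t ^ 2 ≤ Real.sinh t ^ 2 := by
    rcases le_total 0 t with h | h
    · exact pow_le_pow_left₀ h (Real.self_le_sinh_iff.2 h) 2
    · have := Real.sinh_le_self_iff.2 h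
      nlinarith
  have h2 : (r - p) ^ 2 / (p * r) = 4 * Real.sinh t ^ 2 := by
    have e1 : Real.exp t ^ 2 = r / p := by
      rw [← Real.exp_nat_mul, ht]
      push_cast
      rw [mul_div_cancel₀ _ (two_ne_zero), Real.exp_sub, Real.exp_log hr, Real.exp_log hp]
    have e2 : Real.exp (-t) ^ 2 = p / r := by
      rw [Real.exp_neg, inv_pow, e1, inv_div]
    have e3 : Real.exp t * Real.exp (-t) = 1 := by rw [← Real.exp_add]; simp
    rw [Real.sinh_eq]
    have : 4 * ((Real.exp t - Real.exp (-t)) / 2) ^ 2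
        = Real.exp t ^ 2 + Real.exp (-t) ^ 2 - 2 * (Real.exp t * Real.exp (-t)) := by ring
    rw [this, e1, e2, e3]
    field_simp
    ring
  rw [h2]
  have : (Real.log r - Real.log p) ^ 2 = 4 * t ^ 2 := by rw [ht]; ring
  linarith

lemma sub_two_mul_sq_le_log {s : ℝ} (hs : -(1 / 2) ≤ s) : s - 2 * s ^ 2 ≤ Real.log (1 + s) := by
  have h1 : 0 < 1 + s := by linarith
  have h2 := Real.one_sub_inv_le_log_of_pos h1
  have h3 : s - 2 * s ^ 2 ≤ 1 - (1 + s)⁻¹ := by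
    have : 1 - (1 + s)⁻¹ = s / (1 + s) := by field_simp; ring
    rw [this, le_div_iff₀ h1]
    nlinarith [sq_nonneg s, mul_nonneg (sq_nonneg s) (by linarith : 0 ≤ 1 + 2 * s)]
  linarith

/-- the quadratic form that appears when testing the equation with `η ^ 2 / w` -/
def qf (A B p r : ℝ) : ℝ := (A * r - B * p) ^ 2 / (p * r)

lemma qf_identity {A B p r : ℝ} (hp : 0 < p) (hr : 0 < r) :
    (r - p) * (A ^ 2 / p - B ^ 2 / r) = qf A B p r - (B - A) ^ 2 := by
  unfold qf; field_simp; ring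

lemma qf_nonneg {A B p r : ℝ} (hp : 0 < p) (hr : 0 < r) : 0 ≤ qf A B p r := by
  unfold qf; positivity

lemma qf_upper {A B p r M : ℝ} (hp : 0 < p) (hr : 0 < r) (hM : r ≤ M * p) :
    A ^ 2 * (r - p) ^ 2 / p ^ 2 ≤ 2 * M * qf A B p r + 2 * (B - A) ^ 2 := by
  have h0 := qf_nonneg (A := A) (B := B) hp hr
  have h1 : A ^ 2 * (r - p) ^ 2 / p ^ 2 ≤ 2 * (qf A B p r * (r / p)) + 2 * (B - A) ^ 2 := by
    have e : qf A B p r * (r / p) = (A * r - B * p) ^ 2 / p ^ 2 := by unfold qf; field_simp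
    rw [e, ← mul_div_assoc, div_add' _ _ _ (by positivity), div_le_div_iff_of_pos_right (by positivity)]
    nlinarith [sq_nonneg ((A * r - B * p) - (B - A) * p)]
  have h2 : r / p ≤ M := by rw [div_le_iff₀ hp]; exact hM
  have h3 := mul_le_mul_of_nonneg_left h2 h0
  linarith

lemma qf_lower {A B p r : ℝ} (hp : 0 < p) (hr : 0 < r) :
    1 / 2 * (min (A ^ 2) (B ^ 2) * (Real.log r - Real.log p) ^ 2) - (B - A) ^ 2 ≤ qf A B p r := by
  have hl := log_sub_log_sq_le hp hr
  have hpr : 0 < p * r := by positivity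
  have key : min (A ^ 2) (B ^ 2) * ((r - p) ^ 2 / (p * r)) ≤ 2 * qf A B p r + 2 * (B - A) ^ 2 := by
    have hD : 0 ≤ (r - p) ^ 2 / (p * r) := by positivity
    rcases le_total p r with h | h
    · have h1 := mul_le_mul_of_nonneg_right (min_le_left (A ^ 2) (B ^ 2)) hD
      refine h1.trans ?_
      unfold qf
      rw [← mul_div_assoc, ← mul_div_assoc, div_add' _ _ _ hpr.ne', div_le_div_iff_of_pos_right hpr]
      nlinarith [sq_nonneg ((A * r - B * p) - (B - A) * p),
        mul_nonneg (sq_nonneg (B - A)) (mul_nonneg hp.le (sub_nonneg.2 h))]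
    · have h1 := mul_le_mul_of_nonneg_right (min_le_right (A ^ 2) (B ^ 2)) hD
      refine h1.trans ?_
      unfold qf
      rw [← mul_div_assoc, ← mul_div_assoc, div_add' _ _ _ hpr.ne', div_le_div_iff_of_pos_right hpr]
      nlinarith [sq_nonneg ((A * r - B * p) - (B - A) * r),
        mul_nonneg (sq_nonneg (B - A)) (mul_nonneg hr.le (sub_nonneg.2 h))]
  have hm : 0 ≤ min (A ^ 2) (B ^ 2) := le_min (sq_nonneg _) (sq_nonneg _)
  have := mul_le_mul_of_nonneg_left hl hm
  linarith

/-- one time step of the logarithmic energy estimate for a positive supersolution -/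
lemma log_step {lam Lam h δ : ℝ} {a : Zd d → Zd d → ℝ} (hl : 0 < lam) (ha : Ell lam Lam a)
    (hh : 0 < h) (hδ : 0 < δ) (hh1 : 32 * d * Lam * h * (1 + δ) ≤ δ)
    (B : Finset (Zd d)) (w w' η : Zd d → ℝ) (hw : ∀ x, δ ≤ w x) (hw1 : ∀ x, w x ≤ 1 + δ)
    (hη : SuppIn B η) (hstep : ∀ x, η x ≠ 0 → w x + h * Lap a w x ≤ w' x) :
    ∑ x ∈ B, η x ^ 2 * -Real.log (w' x) ≤ ∑ x ∈ B, η x ^ 2 * -Real.log (w x)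
      - h * lam / 8 * ∑ x ∈ B, ∑ k, min (η x ^ 2) (η (nbr x k) ^ 2) *
        (Real.log (w (nbr x k)) - Real.log (w x)) ^ 2
      + h * Lam * ∑ x ∈ B, ∑ k, (η (nbr x k) - η x) ^ 2 := by
  have hL : lam ≤ Lam := (ha.lower 0 0).trans (ha.upper 0 0)
  have hL0 : 0 ≤ Lam := by linarith
  have hwp : ∀ x, 0 < w x := fun x => hδ.trans_le (hw x)
  set M : ℝ := (1 + δ) / δ with hM
  have hM1 : 1 ≤ M := by rw [hM, one_le_div hδ]; linarith
  have hhM : 32 * d * Lam * h * M ≤ 1 := by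
    rw [hM, ← mul_div_assoc, div_le_one hδ]; exact hh1
  have hdh : 32 * d * Lam * h ≤ 1 := by
    have : 0 ≤ 32 * d * Lam * h := by positivity
    nlinarith
  set Q : Zd d → Dir d → ℝ := fun x k => qf (η x) (η (nbr x k)) (w x) (w (nbr x k)) with hQ
  have hQ0 : ∀ x k, 0 ≤ Q x k := fun x k => qf_nonneg (hwp _) (hwp _)
  set S1 := ∑ x ∈ B, ∑ k, a x (nbr x k) * Q x k with hS1
  set S2 := ∑ x ∈ B, ∑ k, a x (nbr x k) * (η (nbr x k) - η x) ^ 2 with hS2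
  have ha0 : ∀ x y, 0 ≤ a x y := fun x y => hl.le.trans (ha.lower _ _)
  have hS10 : 0 ≤ S1 := Finset.sum_nonneg fun _ _ => Finset.sum_nonneg fun _ _ =>
    mul_nonneg (ha0 _ _) (hQ0 _ _)
  have hS20 : 0 ≤ S2 := Finset.sum_nonneg fun _ _ => Finset.sum_nonneg fun _ _ =>
    mul_nonneg (ha0 _ _) (sq_nonneg _)
  -- pointwise estimate
  have hpt : ∀ x ∈ B, η x ^ 2 * -Real.log (w' x) ≤ η x ^ 2 * -Real.log (w x)
      - h * (η x ^ 2 / w x * Lap a w x)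
      + h * (4 * d * Lam * h) * ∑ k, a x (nbr x k) * (2 * M * Q x k + 2 * (η (nbr x k) - η x) ^ 2) := by
    intro x _
    by_cases h0 : η x = 0
    · simp only [h0, ne_eq, OfNat.ofNat_ne_zero, not_false_eq_true, zero_pow, zero_mul, zero_div,
        mul_zero, sub_zero, zero_add]
      refine mul_nonneg (by positivity) (Finset.sum_nonneg fun k _ => mul_nonneg (ha0 _ _) ?_)
      have := hQ0 x k
      positivity
    · set s := h * Lap a w x / w x with hs
      have hLap : -(2 * d * Lam * w x) ≤ Lap a w x := by
        have : -(2 * d * Lam * w x) = ∑ _k : Dir d, -(Lam * w x) := by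
          rw [Finset.sum_const, Finset.card_univ, nsmul_eq_mul, card_Dir]; ring
        rw [this]
        unfold Lap
        refine Finset.sum_le_sum fun k _ => ?_
        have h1 := mul_nonneg (ha0 x (nbr x k)) (hwp (nbr x k)).le
        have h2 := mul_le_mul_of_nonneg_right (ha.upper x (nbr x k)) (hwp x).le
        nlinarith
      have hs1 : -(1 / 2) ≤ s := by
        rw [hs, le_div_iff₀ (hwp x)]
        have h1 := mul_le_mul_of_nonneg_left hLap hh.le
        have h2 : 2 * d * Lam * h * w x ≤ 1 / 2 * w x := by
          refine mul_le_mul_of_nonneg_right ?_ (hwp x).le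
          have : 0 ≤ d * Lam * h := by positivity
          linarith
        nlinarith
      have hlog : Real.log (w x) + (s - 2 * s ^ 2) ≤ Real.log (w' x) := by
        have h1 : w x + h * Lap a w x = w x * (1 + s) := by
          rw [hs]; field_simp [(hwp x).ne']
        have h2 : 0 < 1 + s := by linarith
        have h3 : Real.log (w x * (1 + s)) ≤ Real.log (w' x) := by
          refine Real.log_le_log (mul_pos (hwp x) h2) ?_
          rw [← h1]; exact hstep x h0
        rw [Real.log_mul (hwp x).ne' h2.ne'] at h3
        linarith [sub_two_mul_sq_le_log hs1]
      have hsq : η x ^ 2 * s ^ 2 ≤ h ^ 2 * (2 * d * Lam) *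
          ∑ k, a x (nbr x k) * (2 * M * Q x k + 2 * (η (nbr x k) - η x) ^ 2) := by
        have h1 := Lap_sq_le hl ha w x
        have h2 : η x ^ 2 * s ^ 2 = h ^ 2 * (η x ^ 2 / w x ^ 2 * Lap a w x ^ 2) := by
          rw [hs]; field_simp
        rw [h2, mul_assoc (h ^ 2)]
        refine mul_le_mul_of_nonneg_left ?_ (sq_nonneg h)
        calc η x ^ 2 / w x ^ 2 * Lap a w x ^ 2
            ≤ η x ^ 2 / w x ^ 2 * (2 * d * Lam * ∑ k, a x (nbr x k) * (w (nbr x k) - w x) ^ 2) := by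
              gcongr
          _ = 2 * d * Lam * ∑ k, a x (nbr x k) * (η x ^ 2 * (w (nbr x k) - w x) ^ 2 / w x ^ 2) := by
              rw [mul_left_comm, Finset.mul_sum]
              congr 1
              exact Finset.sum_congr rfl fun k _ => by ring
          _ ≤ _ := by
              refine mul_le_mul_of_nonneg_left (Finset.sum_le_sum fun k _ => ?_) (by positivity)
              refine mul_le_mul_of_nonneg_left (qf_upper (hwp _) (hwp _) ?_) (ha0 _ _)
              calc w (nbr x k) ≤ 1 + δ := hw1 _
                _ = M * δ := by rw [hM]; field_simp
                _ ≤ M * w x := by gcongr; exact hw x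
      have h1 := mul_le_mul_of_nonneg_left hlog (sq_nonneg (η x))
      have h2 : η x ^ 2 * s = h * (η x ^ 2 / w x * Lap a w x) := by rw [hs]; field_simp
      nlinarith
  have hsum := Finset.sum_le_sum hpt
  rw [Finset.sum_add_distrib, Finset.sum_sub_distrib, ← Finset.mul_sum, ← Finset.mul_sum] at hsum
  have hibp : ∑ x ∈ B, η x ^ 2 / w x * Lap a w x = 1 / 2 * (S1 - S2) := by
    have h1 := sum_mul_Lap ha.symm (B := B) (w := fun x => η x ^ 2 / w x)
      (hη.mono fun x hx => by simp [hx]) w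
    rw [h1, hS1, hS2, ← Finset.sum_sub_distrib, neg_mul, ← mul_neg, ← Finset.sum_neg_distrib]
    congr 1
    refine Finset.sum_congr rfl fun x _ => ?_
    rw [← Finset.sum_sub_distrib, ← Finset.sum_neg_distrib]
    refine Finset.sum_congr rfl fun k _ => ?_
    have h2 := qf_identity (A := η x) (B := η (nbr x k)) (hwp x) (hwp (nbr x k))
    simp only [hQ]
    linear_combination (a x (nbr x k)) * h2
  have hsecond : ∑ x ∈ B, ∑ k, a x (nbr x k) * (2 * M * Q x k + 2 * (η (nbr x k) - η x) ^ 2)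
      = 2 * M * S1 + 2 * S2 := by
    rw [hS1, hS2, Finset.mul_sum, Finset.mul_sum, ← Finset.sum_add_distrib]
    refine Finset.sum_congr rfl fun x _ => ?_
    rw [Finset.mul_sum, Finset.mul_sum, ← Finset.sum_add_distrib]
    exact Finset.sum_congr rfl fun k _ => by ring
  rw [hibp, hsecond] at hsum
  have hlow : lam * ∑ x ∈ B, ∑ k, min (η x ^ 2) (η (nbr x k) ^ 2) *
        (Real.log (w (nbr x k)) - Real.log (w x)) ^ 2 ≤ 2 * S1 + 2 * S2 := by
    rw [hS1, hS2, Finset.mul_sum, Finset.mul_sum, Finset.mul_sum, ← Finset.sum_add_distrib]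
    refine Finset.sum_le_sum fun x _ => ?_
    rw [Finset.mul_sum, Finset.mul_sum, Finset.mul_sum, ← Finset.sum_add_distrib]
    refine Finset.sum_le_sum fun k _ => ?_
    have h1 := qf_lower (A := η x) (B := η (nbr x k)) (hwp x) (hwp (nbr x k))
    have h2 : 0 ≤ min (η x ^ 2) (η (nbr x k) ^ 2) *
        (Real.log (w (nbr x k)) - Real.log (w x)) ^ 2 :=
      mul_nonneg (le_min (sq_nonneg _) (sq_nonneg _)) (sq_nonneg _)
    have h3 := mul_le_mul_of_nonneg_right (ha.lower x (nbr x k)) h2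
    have h4 := mul_le_mul_of_nonneg_left h1 (ha0 x (nbr x k))
    simp only [hQ]
    linarith
  have hS2le : S2 ≤ Lam * ∑ x ∈ B, ∑ k, (η (nbr x k) - η x) ^ 2 := ha.Ena_le B η
  have f1 : h * (4 * d * Lam * h) * (2 * M * S1 + 2 * S2) ≤ h * (1 / 4 * S1 + 1 / 4 * S2) := by
    rw [mul_assoc]
    refine mul_le_mul_of_nonneg_left ?_ hh.le
    have g1 := mul_le_mul_of_nonneg_right hhM hS10
    have g2 := mul_le_mul_of_nonneg_right hdh hS20
    linarith
  have f2 := mul_le_mul_of_nonneg_left hlow (by linarith : 0 ≤ h / 8)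
  have f3 := mul_le_mul_of_nonneg_left hS2le hh.le
  linarith
end

noncomputable section
variable {d : ℕ}

/-- one-dimensional tent function -/
def tent (ρ : ℕ) (t : ℤ) : ℝ := max (1 - |(t : ℝ)| / (2 * ρ)) 0

lemma tent_nonneg (ρ : ℕ) (t : ℤ) : 0 ≤ tent ρ t := le_max_right _ _

lemma tent_le_one (ρ : ℕ) (t : ℤ) : tent ρ t ≤ 1 :=
  max_le (by have : 0 ≤ |(t : ℝ)| / (2 * ρ) := by positivity
             linarith) zero_le_one

lemma tent_mul_le {ρ : ℕ} {s t p : ℤ} (h : (s ≤ p ∧ p ≤ t) ∨ (t ≤ p ∧ p ≤ s)) :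
    tent ρ s * tent ρ t ≤ tent ρ p := by
  have hm : ∀ {a b : ℤ}, |a| ≤ |b| → tent ρ b ≤ tent ρ a := by
    intro a b hab
    unfold tent
    have : |(a : ℝ)| ≤ |(b : ℝ)| := by exact_mod_cast hab
    gcongr
  have h1 := tent_nonneg ρ s
  have h2 := tent_nonneg ρ t
  have h3 := tent_le_one ρ s
  have h4 := tent_le_one ρ t
  have : |p| ≤ |s| ∨ |p| ≤ |t| := by
    by_contra! hc
    rcases abs_cases p with hp | hp <;> rcases abs_cases s with hs | hs <;>
      rcases abs_cases t with ht | ht <;> omega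
  rcases this with hle | hle
  · exact (mul_le_of_le_one_right h1 h4).trans (hm hle)
  · exact (mul_le_of_le_one_left h2 h3).trans (hm hle)

/-- the product cutoff -/
def cut (x0 : Zd d) (ρ : ℕ) (x : Zd d) : ℝ := ∏ i, tent ρ (x i - x0 i)

lemma cut_nonneg (x0 : Zd d) (ρ : ℕ) (x : Zd d) : 0 ≤ cut x0 ρ x :=
  Finset.prod_nonneg fun _ _ => tent_nonneg _ _

lemma cut_le_one (x0 : Zd d) (ρ : ℕ) (x : Zd d) : cut x0 ρ x ≤ 1 :=
  Finset.prod_le_one (fun _ _ => tent_nonneg _ _) fun _ _ => tent_le_one _ _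

lemma cut_mul_le (x0 : Zd d) (ρ : ℕ) (x y p : Zd d)
    (h : ∀ i, (x i ≤ p i ∧ p i ≤ y i) ∨ (y i ≤ p i ∧ p i ≤ x i)) :
    cut x0 ρ x * cut x0 ρ y ≤ cut x0 ρ p := by
  unfold cut
  rw [← Finset.prod_mul_distrib]
  refine Finset.prod_le_prod (fun i _ => mul_nonneg (tent_nonneg _ _) (tent_nonneg _ _)) fun i _ => ?_
  refine tent_mul_le ?_
  rcases h i with h | h
  · left; omega
  · right; omega

lemma cut_sq_mul_le (x0 : Zd d) (ρ : ℕ) (x y p : Zd d)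
    (h : ∀ i, (x i ≤ p i ∧ p i ≤ y i) ∨ (y i ≤ p i ∧ p i ≤ x i)) :
    cut x0 ρ x ^ 2 * cut x0 ρ y ^ 2 ≤ cut x0 ρ p ^ 2 := by
  rw [← mul_pow]
  have := cut_mul_le x0 ρ x y p h
  have h2 := mul_nonneg (cut_nonneg x0 ρ x) (cut_nonneg x0 ρ y)
  gcongr

lemma mem_box_of_cut {x0 : Zd d} {ρ : ℕ} (hρ : 1 ≤ ρ) {x : Zd d} (h : cut x0 ρ x ≠ 0) :
    x ∈ box x0 (2 * ρ - 1) := by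
  rw [mem_box]
  intro i
  by_contra hc
  apply h
  refine Finset.prod_eq_zero (Finset.mem_univ i) ?_
  unfold tent
  refine max_eq_right ?_
  have h1 : (2 * ρ : ℤ) ≤ |x i - x0 i| := by
    push_cast [show 1 ≤ 2 * ρ by omega] at hc
    omega
  have h2 : (2 * ρ : ℝ) ≤ |((x i - x0 i : ℤ) : ℝ)| := by exact_mod_cast h1
  have : (0 : ℝ) < 2 * ρ := by positivity
  have := (one_le_div this).2 h2
  linarith

lemma suppIn_cut {x0 : Zd d} {ρ : ℕ} (hρ : 1 ≤ ρ) : SuppIn (box x0 (2 * ρ)) (cut x0 ρ) := by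
  intro x hx
  have := mem_box_of_cut hρ hx
  exact ⟨box_mono (by omega) this, fun k => nbr_mem_box this (by omega) k⟩

lemma cut_ge {x0 : Zd d} {ρ : ℕ} (hρ : 1 ≤ ρ) {x : Zd d} (hx : x ∈ box x0 ρ) :
    (1 / 2 : ℝ) ^ d ≤ cut x0 ρ x := by
  unfold cut
  have : (1 / 2 : ℝ) ^ d = ∏ _i : Fin d, (1 / 2 : ℝ) := by simp
  rw [this]
  refine Finset.prod_le_prod (fun _ _ => by norm_num) fun i _ => ?_
  refine le_trans ?_ (le_max_left _ _)
  have h1 : |((x i - x0 i : ℤ) : ℝ)| ≤ ρ := by exact_mod_cast mem_box.1 hx i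
  have h0 : (0 : ℝ) < 2 * ρ := by positivity
  have : |((x i - x0 i : ℤ) : ℝ)| / (2 * ρ) ≤ 1 / 2 := by
    rw [div_le_iff₀ h0]; linarith
  linarith

lemma abs_cut_nbr_sub_le {x0 : Zd d} {ρ : ℕ} (hρ : 1 ≤ ρ) (x : Zd d) (k : Dir d) :
    |cut x0 ρ (nbr x k) - cut x0 ρ x| ≤ 1 / (2 * ρ) := by
  classical
  have key : ∀ y : Zd d, cut x0 ρ y = tent ρ (y k.1 - x0 k.1) *
      ∏ i ∈ Finset.univ.erase k.1, tent ρ (y i - x0 i) := fun y =>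
    (Finset.mul_prod_erase _ _ (Finset.mem_univ _)).symm
  have h1 : ∏ i ∈ Finset.univ.erase k.1, tent ρ (nbr x k i - x0 i)
      = ∏ i ∈ Finset.univ.erase k.1, tent ρ (x i - x0 i) := by
    refine Finset.prod_congr rfl fun i hi => ?_
    rw [nbr_eq_add]
    simp [Finset.ne_of_mem_erase hi]
  rw [key, key, h1, ← sub_mul, abs_mul]
  have h2 : |∏ i ∈ Finset.univ.erase k.1, tent ρ (x i - x0 i)| ≤ 1 := by
    rw [abs_of_nonneg (Finset.prod_nonneg fun _ _ => tent_nonneg _ _)]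
    exact Finset.prod_le_one (fun _ _ => tent_nonneg _ _) fun _ _ => tent_le_one _ _
  refine (mul_le_of_le_one_right (abs_nonneg _) h2).trans ?_
  unfold tent
  refine (abs_max_sub_max_le_abs _ _ _).trans ?_
  have h0 : (0 : ℝ) < 2 * ρ := by positivity
  have h3 : |((nbr x k k.1 - x k.1 : ℤ) : ℝ)| ≤ 1 := by exact_mod_cast abs_nbr_sub_le x k k.1
  have h4 := abs_abs_sub_abs_le ((x k.1 - x0 k.1 : ℤ) : ℝ) ((nbr x k k.1 - x0 k.1 : ℤ) : ℝ)
  have h5 : ((x k.1 - x0 k.1 : ℤ) : ℝ) - ((nbr x k k.1 - x0 k.1 : ℤ) : ℝ)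
      = -((nbr x k k.1 - x k.1 : ℤ) : ℝ) := by push_cast; ring
  rw [h5, abs_neg] at h4
  have h6 : (1 - |((nbr x k k.1 - x0 k.1 : ℤ) : ℝ)| / (2 * ρ) - (1 - |((x k.1 - x0 k.1 : ℤ) : ℝ)| / (2 * ρ)))
    = (|((x k.1 - x0 k.1 : ℤ) : ℝ)| - |((nbr x k k.1 - x0 k.1 : ℤ) : ℝ)|) / (2 * ρ) := by ring
  rw [h6, abs_div, abs_of_pos h0]
  gcongr
  linarith

lemma card_box_le {x0 : Zd d} {ρ : ℕ} (hρ : 1 ≤ ρ) :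
    ((box x0 (2 * ρ)).card : ℝ) ≤ 5 ^ d * (ρ : ℝ) ^ d := by
  rw [card_box, ← mul_pow]
  push_cast
  have : (1 : ℝ) ≤ ρ := by exact_mod_cast hρ
  gcongr
  linarith

lemma sum_cut_grad_le {x0 : Zd d} {ρ : ℕ} (hρ : 1 ≤ ρ) :
    (ρ : ℝ) ^ 2 * ∑ x ∈ box x0 (2 * ρ), ∑ k, (cut x0 ρ (nbr x k) - cut x0 ρ x) ^ 2
      ≤ d * 5 ^ d * (ρ : ℝ) ^ d := by
  have h0 : (0 : ℝ) < ρ := by positivity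
  have h1 : ∀ x ∈ box x0 (2 * ρ), ∑ k, (cut x0 ρ (nbr x k) - cut x0 ρ x) ^ 2
      ≤ 2 * d * (1 / (2 * ρ)) ^ 2 := by
    intro x _
    rw [← card_Dir, ← Finset.card_univ, ← nsmul_eq_mul]
    refine Finset.sum_le_card_nsmul _ _ _ fun k _ => ?_
    rw [← sq_abs]
    have := abs_cut_nbr_sub_le (x0 := x0) hρ x k
    gcongr
  have h2 := Finset.sum_le_card_nsmul _ _ _ h1
  rw [nsmul_eq_mul] at h2
  have h3 : ((box x0 (2 * ρ)).card : ℝ) * (2 * d * (1 / (2 * ρ)) ^ 2)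
      ≤ (5 ^ d * (ρ : ℝ) ^ d) * (2 * d * (1 / (2 * ρ)) ^ 2) :=
    mul_le_mul_of_nonneg_right (card_box_le hρ) (by positivity)
  calc _ ≤ (ρ : ℝ) ^ 2 * ((5 ^ d * (ρ : ℝ) ^ d) * (2 * d * (1 / (2 * ρ)) ^ 2)) :=
        mul_le_mul_of_nonneg_left (h2.trans h3) (by positivity)
    _ = d * 5 ^ d * (ρ : ℝ) ^ d / 2 := by field_simp
    _ ≤ _ := by linarith [show (0 : ℝ) ≤ d * 5 ^ d * (ρ : ℝ) ^ d by positivity]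

end

noncomputable section
variable {d : ℕ}

/-- the energy weighted by the squared cutoff -/
def cutEn (x0 : Zd d) (ρ : ℕ) (g : Zd d → ℝ) : ℝ :=
  ∑ x ∈ box x0 (2 * ρ), ∑ k, min (cut x0 ρ x ^ 2) (cut x0 ρ (nbr x k) ^ 2) * (g (nbr x k) - g x) ^ 2

lemma cutEn_nonneg (x0 : Zd d) (ρ : ℕ) (g : Zd d → ℝ) : 0 ≤ cutEn x0 ρ g :=
  Finset.sum_nonneg fun _ _ => Finset.sum_nonneg fun _ _ =>
    mul_nonneg (le_min (sq_nonneg _) (sq_nonneg _)) (sq_nonneg _)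

lemma cut_poincare {x0 : Zd d} {ρ : ℕ} (hρ : 1 ≤ ρ) (g : Zd d → ℝ) (S : Finset (Zd d))
    (hS : S ⊆ box x0 ρ) (hS0 : ∀ x ∈ S, g x = 0) (hc : ((box x0 ρ).card : ℝ) / 4 ≤ S.card) :
    (∑ x ∈ box x0 (2 * ρ), cut x0 ρ x ^ 2 * g x) ^ 2
      ≤ 36 * d ^ 2 * 70 ^ d * (ρ : ℝ) ^ d * ρ ^ 2 * cutEn x0 ρ g := by
  classical
  have h0 : (1 : ℝ) ≤ ρ := by exact_mod_cast hρ
  set B := box x0 (2 * ρ) with hB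
  set ω : Zd d → ℝ := fun x => cut x0 ρ x ^ 2 with hω
  set W := ∑ x ∈ B, ω x * g x ^ 2 with hW
  have hω0 : ∀ x, 0 ≤ ω x := fun x => sq_nonneg _
  have hω1 : ∀ x, ω x ≤ 1 := fun x => pow_le_one₀ (cut_nonneg _ _ _) (cut_le_one _ _ _)
  have hW0 : 0 ≤ W := Finset.sum_nonneg fun x _ => mul_nonneg (hω0 x) (sq_nonneg _)
  have h1 : (∑ x ∈ B, ω x * g x) ^ 2 ≤ (5 ^ d * (ρ : ℝ) ^ d) * W := by
    have e1 : ∀ x ∈ B, (ω x * g x) ^ 2 ≤ ω x * (ω x * g x ^ 2) := fun x _ => by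
      apply le_of_eq; ring
    have := Finset.sum_sq_le_sum_mul_sum_of_sq_le_mul B (r := fun x => ω x * g x) (f := ω)
      (g := fun x => ω x * g x ^ 2) (fun x _ => hω0 x)
      (fun x _ => mul_nonneg (hω0 x) (sq_nonneg _)) e1
    refine this.trans (mul_le_mul_of_nonneg_right ?_ hW0)
    refine le_trans ?_ (card_box_le (x0 := x0) hρ)
    have := Finset.sum_le_card_nsmul B ω 1 (fun x _ => hω1 x)
    simpa using this
  have h2 : (1 / 4 : ℝ) ^ d * S.card * W ≤ ∑ x ∈ B, ∑ y ∈ S, ω x * ω y * (g y - g x) ^ 2 := by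
    rw [hW, Finset.mul_sum]
    refine Finset.sum_le_sum fun x _ => ?_
    have e1 : ∀ y ∈ S, (1 / 4 : ℝ) ^ d * (ω x * g x ^ 2) ≤ ω x * ω y * (g y - g x) ^ 2 := by
      intro y hy
      rw [hS0 y hy]
      have e2 : (1 / 4 : ℝ) ^ d ≤ ω y := by
        have := cut_ge hρ (hS hy)
        calc (1 / 4 : ℝ) ^ d = ((1 / 2 : ℝ) ^ d) ^ 2 := by rw [← pow_mul, mul_comm, pow_mul]; norm_num
          _ ≤ _ := pow_le_pow_left₀ (by positivity) this 2
      have e3 : 0 ≤ ω x * g x ^ 2 := mul_nonneg (hω0 x) (sq_nonneg _)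
      have := mul_le_mul_of_nonneg_right e2 e3
      linarith
    have := Finset.card_nsmul_le_sum S _ _ e1
    rw [nsmul_eq_mul] at this
    linarith
  have h3 : ∑ x ∈ B, ∑ y ∈ S, ω x * ω y * (g y - g x) ^ 2
      ≤ ∑ z ∈ box (0 : Zd d) (3 * ρ), ∑ x ∈ B, ω x * ω (x + z) * (g (x + z) - g x) ^ 2 := by
    rw [Finset.sum_comm (s := box (0 : Zd d) (3 * ρ))]
    refine Finset.sum_le_sum fun x hx => ?_
    have e1 : ∑ y ∈ S, ω x * ω y * (g y - g x) ^ 2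
        = ∑ z ∈ S.image (fun y => y - x), ω x * ω (x + z) * (g (x + z) - g x) ^ 2 := by
      rw [Finset.sum_image (fun _ _ _ _ h => sub_left_injective h)]
      simp
    rw [e1]
    refine Finset.sum_le_sum_of_subset_of_nonneg ?_ fun z _ _ =>
      mul_nonneg (mul_nonneg (hω0 _) (hω0 _)) (sq_nonneg _)
    intro z hz
    obtain ⟨y, hy, rfl⟩ := Finset.mem_image.1 hz
    rw [mem_box]
    intro i
    have a1 := mem_box.1 (hS hy) i
    have a2 := mem_box.1 hx i
    rw [abs_le] at *
    simp only [Pi.sub_apply, Pi.zero_apply]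
    push_cast at *
    constructor <;> linarith
  have h4 : ∑ z ∈ box (0 : Zd d) (3 * ρ), ∑ x ∈ B, ω x * ω (x + z) * (g (x + z) - g x) ^ 2
      ≤ (7 ^ d * (ρ : ℝ) ^ d) * ((d * (3 * ρ : ℕ)) ^ 2 * cutEn x0 ρ g) := by
    have e1 := Finset.sum_le_card_nsmul (box (0 : Zd d) (3 * ρ)) _ _ (fun z hz =>
      sum_translation_le B B ω g hω0 (fun x y p h => cut_sq_mul_le x0 ρ x y p h) (by
        intro x k hx
        have : ω x = 0 := by
          by_contra hc
          exact hx ((suppIn_cut hρ x (fun h => hc (by simp [hω, h]))).1)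
        rw [this, min_eq_left (hω0 _), zero_mul]) (3 * ρ) z (fun i => by
          simpa using mem_box.1 hz i))
    rw [nsmul_eq_mul] at e1
    refine e1.trans (mul_le_mul_of_nonneg_right ?_ (mul_nonneg (sq_nonneg _) (cutEn_nonneg _ _ _)))
    rw [card_box, ← mul_pow]
    push_cast
    gcongr
    linarith
  have h5 : (2 : ℝ) ^ d * ρ ^ d / 4 ≤ S.card := by
    refine le_trans ?_ hc
    rw [card_box, ← mul_pow]
    push_cast
    gcongr
    linarith
  set P : ℝ := (ρ : ℝ) ^ d with hP
  have hP0 : 0 < P := by positivity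
  have h6 : (1 / 4 : ℝ) ^ d * (2 ^ d * P / 4) * W
      ≤ (7 ^ d * P) * ((d * (3 * ρ : ℕ)) ^ 2 * cutEn x0 ρ g) := by
    refine le_trans ?_ (h2.trans (h3.trans h4))
    gcongr
  have h7 : W ≤ 36 * d ^ 2 * 14 ^ d * ρ ^ 2 * cutEn x0 ρ g := by
    have e1 : (1 / 4 : ℝ) ^ d * 2 ^ d = (1 / 2) ^ d := by rw [← mul_pow]; norm_num
    have e2 : (14 : ℝ) ^ d * (1 / 2) ^ d = 7 ^ d := by rw [← mul_pow]; norm_num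
    have e3 : (0 : ℝ) < (1 / 2) ^ d * P / 4 := by positivity
    refine le_of_mul_le_mul_left ?_ e3
    calc (1 / 2 : ℝ) ^ d * P / 4 * W = (1 / 4 : ℝ) ^ d * (2 ^ d * P / 4) * W := by rw [← e1]; ring
      _ ≤ _ := h6
      _ = _ := by rw [← e2]; push_cast; ring
  calc _ ≤ (5 ^ d * P) * W := h1
    _ ≤ (5 ^ d * P) * (36 * d ^ 2 * 14 ^ d * ρ ^ 2 * cutEn x0 ρ g) := by gcongr
    _ = _ := by
        have : (70 : ℝ) ^ d = 5 ^ d * 14 ^ d := by rw [← mul_pow]; norm_num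
        rw [this]; ring

lemma quarter_le_card_good (N : ℕ) (b : ℝ) (hb : 0 < b) (c : ℕ → ℝ) (hc : ∀ n, c n ≤ b)
    (hs : N * b / 2 ≤ ∑ n ∈ Finset.range N, c n) :
    (N : ℝ) / 4 ≤ ((Finset.range N).filter fun n => b / 4 ≤ c n).card := by
  set G := (Finset.range N).filter fun n => b / 4 ≤ c n with hG
  have h1 : ∑ n ∈ Finset.range N, c n ≤ ∑ n ∈ Finset.range N, (b / 4 + if b / 4 ≤ c n then b else 0) := by
    refine Finset.sum_le_sum fun n _ => ?_
    split_ifs with h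
    · linarith [hc n]
    · linarith [not_le.1 h]
  rw [Finset.sum_add_distrib, ← Finset.sum_filter, Finset.sum_const, Finset.sum_const, nsmul_eq_mul,
    nsmul_eq_mul, Finset.card_range] at h1
  have h2 : (N : ℝ) / 4 * b ≤ G.card * b := by linarith
  exact le_of_mul_le_mul_right h2 hb

lemma exists_good_le {N : ℕ} {c h D A : ℝ} (hh : 0 < h) (hc : 0 < c) (hD : 0 ≤ D) (Y E : ℕ → ℝ)
    (hN : 0 < N) (hY : ∀ n, 0 ≤ Y n) (hE : ∀ n, 0 ≤ E n) (hY0 : Y 0 ≤ A)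
    (hs : ∀ n < N, Y (n + 1) ≤ Y n - h * c * E n + h * D) (G : Finset ℕ) (hG : G ⊆ Finset.range N)
    (hGc : (N : ℝ) / 4 ≤ G.card) :
    ∃ n ∈ G, N * h * c / 4 * E n ≤ A + N * h * D := by
  have h1 : ∀ m ≤ N, Y m + h * c * ∑ n ∈ Finset.range m, E n ≤ A + m * h * D := by
    intro m
    induction m with
    | zero => intro _; simpa using hY0
    | succ m ih =>
      intro hm
      have := ih (by omega)
      have h2 := hs m (by omega)
      rw [Finset.sum_range_succ]
      push_cast
      nlinarith
  have h2 := h1 N le_rfl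
  have h3 : ∑ n ∈ G, E n ≤ ∑ n ∈ Finset.range N, E n :=
    Finset.sum_le_sum_of_subset_of_nonneg hG fun n _ _ => hE n
  have hN' : (0 : ℝ) < N := by exact_mod_cast hN
  by_contra! hcon
  have h4 : G.card * ((A + N * h * D) * 4 / (N * h * c)) < ∑ n ∈ G, E n := by
    rw [← nsmul_eq_mul, ← Finset.sum_const]
    refine Finset.sum_lt_sum_of_nonempty ?_ fun n hn => ?_
    · rw [← Finset.card_pos]
      have : (0 : ℝ) < G.card := lt_of_lt_of_le (by positivity) hGc
      exact_mod_cast this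
    · rw [div_lt_iff₀ (by positivity)]
      linarith [hcon n hn]
  have hA : 0 ≤ A := (hY 0).trans hY0
  have h5 : (N : ℝ) / 4 * ((A + N * h * D) * 4 / (N * h * c)) ≤ G.card * ((A + N * h * D) * 4 / (N * h * c)) := by
    gcongr
  have h6 : (N : ℝ) / 4 * ((A + N * h * D) * 4 / (N * h * c)) = (A + N * h * D) / (h * c) := by
    field_simp
  rw [h6] at h5
  have h7 : (A + N * h * D) / (h * c) < ∑ n ∈ Finset.range N, E n := by linarith
  rw [div_lt_iff₀ (by positivity)] at h7
  linarith [hY N]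

lemma le_add_of_step {h c D : ℝ} (hh : 0 < h) (hc : 0 < c) (Y E : ℕ → ℝ) {T : ℕ}
    (hE : ∀ n, 0 ≤ E n) (hs : ∀ n < T, Y (n + 1) ≤ Y n - h * c * E n + h * D) (n : ℕ) :
    ∀ m, n + m ≤ T → Y (n + m) ≤ Y n + m * h * D := by
  intro m
  induction m with
  | zero => intro _; simp
  | succ m ih =>
    intro hm
    have h1 := ih (by omega)
    have h2 := hs (n + m) (by omega)
    have h3 : 0 ≤ h * c * E (n + m) := mul_nonneg (by positivity) (hE _)
    rw [← add_assoc]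
    push_cast
    linarith

end

noncomputable section
variable {d : ℕ}

lemma phase_bound {N T : ℕ} {c h D P Q G K r2 : ℝ} (hh : 0 < h) (hc : 0 < c) (hD : 0 ≤ D)
    (Y E : ℕ → ℝ) (hN : 0 < N) (hY : ∀ n, 0 ≤ Y n) (hE : ∀ n, 0 ≤ E n) (hP : 0 < P) (hQ : 0 ≤ Q)
    (hG1 : 0 ≤ G) (hK : 0 ≤ K) (hr : 0 < r2)
    (hY0 : Y 0 ≤ G * Q * P)
    (hs : ∀ n < T, Y (n + 1) ≤ Y n - h * c * E n + h * D) (hNT : N ≤ T)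
    (hDr : r2 * D ≤ K * P) (hN1 : r2 ≤ N * h) (hN2 : N * h ≤ 2 * r2) (hT : T * h ≤ 6 * r2)
    (Gd : Finset ℕ) (hGd : Gd ⊆ Finset.range N)
    (hGc : (N : ℝ) / 4 ≤ Gd.card) {Cp : ℝ} (hCp : 0 ≤ Cp)
    (hpo : ∀ n ∈ Gd, Y n ^ 2 ≤ Cp * P * r2 * E n) :
    ∀ m, N ≤ m → m ≤ T → Y m ≤ P * ((Real.sqrt (4 * Cp / c * (Q + 2 * K)) + 6 * K) * Real.sqrt (G + 1)) := by
  intro m hm hmT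
  obtain ⟨n, hn, hb⟩ := exists_good_le hh hc hD Y E hN hY hE hY0
    (fun n hn => hs n (by omega)) Gd hGd hGc
  have hnN : n < N := Finset.mem_range.1 (hGd hn)
  have h1 : r2 * c / 4 * E n ≤ (G * Q + 2 * K) * P := by
    have e1 : r2 * (c / 4 * E n) ≤ N * h * (c / 4 * E n) :=
      mul_le_mul_of_nonneg_right hN1 (mul_nonneg (by positivity) (hE n))
    have e2 : N * h * D ≤ 2 * r2 * D := mul_le_mul_of_nonneg_right hN2 hD
    linarith
  have h2 : Y n ^ 2 ≤ P ^ 2 * (4 * Cp / c * (Q + 2 * K) * (G + 1)) := by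
    have e1 : r2 * E n ≤ 4 / c * ((G * Q + 2 * K) * P) := by
      have := mul_le_mul_of_nonneg_left h1 (show 0 ≤ 4 / c by positivity)
      have e : 4 / c * (r2 * c / 4 * E n) = r2 * E n := by field_simp
      linarith
    have e2 : G * Q + 2 * K ≤ (Q + 2 * K) * (G + 1) := by
      have := mul_nonneg hK hG1
      linarith
    calc Y n ^ 2 ≤ Cp * P * (r2 * E n) := by linarith [hpo n hn]
      _ ≤ Cp * P * (4 / c * ((Q + 2 * K) * (G + 1) * P)) :=
          mul_le_mul_of_nonneg_left (e1.trans (mul_le_mul_of_nonneg_left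
            (mul_le_mul_of_nonneg_right e2 hP.le) (by positivity))) (by positivity)
      _ = _ := by ring
  have h3 : Y n ≤ P * (Real.sqrt (4 * Cp / c * (Q + 2 * K)) * Real.sqrt (G + 1)) := by
    rw [← Real.sqrt_mul (by positivity)]
    refine (Real.le_sqrt_of_sq_le h2).trans ?_
    rw [Real.sqrt_mul (sq_nonneg P), Real.sqrt_sq hP.le]
  have h4 := le_add_of_step hh hc Y E hE hs n (m - n) (by omega)
  rw [Nat.add_sub_cancel' (by omega)] at h4
  have h5 : ((m - n : ℕ) : ℝ) * h * D ≤ 6 * K * P := by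
    have e1 : ((m - n : ℕ) : ℝ) ≤ T := by exact_mod_cast (by omega : m - n ≤ T)
    have e2 : ((m - n : ℕ) : ℝ) * h * D ≤ T * h * D := by gcongr
    have e3 : T * h * D ≤ 6 * r2 * D := by gcongr
    linarith
  have h6 : 1 ≤ Real.sqrt (G + 1) := Real.one_le_sqrt.2 (by linarith)
  have h7 := mul_le_mul_of_nonneg_left h6 (show 0 ≤ 6 * K * P by positivity)
  linarith

/-- A nonnegative subcaloric function bounded by one that vanishes on half of a space-time
cylinder is close to one only on a small proportion of the later cylinder. -/
lemma density_small (d : ℕ) (hd : 1 ≤ d) (lam Lam : ℝ) (hl : 0 < lam) (hL : lam ≤ Lam) (ε : ℝ)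
    (hε : 0 < ε) :
    ∃ δ₁ h₁ : ℝ, 0 < δ₁ ∧ δ₁ ≤ 1 ∧ 0 < h₁ ∧ ∀ h : ℝ, 0 < h → h ≤ h₁ →
      ∀ a : ℕ → Zd d → Zd d → ℝ, (∀ n, Ell lam Lam (a n)) →
      ∀ (x0 : Zd d) (ρ N : ℕ), 1 ≤ ρ → (ρ : ℝ) ^ 2 ≤ N * h → N * h ≤ 2 * (ρ : ℝ) ^ 2 →
      ∀ z : ℕ → Zd d → ℝ, (∀ n x, 0 ≤ z n x) → (∀ n x, z n x ≤ 1) →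
      (∀ n < 3 * N, ∀ x ∈ box x0 (2 * ρ), z (n + 1) x ≤ z n x + h * Lap (a n) (z n) x) →
      N * ((box x0 ρ).card : ℝ) / 2 ≤
        ∑ n ∈ Finset.range N, (((box x0 ρ).filter fun x => z n x = 0).card : ℝ) →
      ∀ n, N ≤ n → n ≤ 3 * N →
        (((box x0 ρ).filter fun x => 1 - δ₁ < z n x).card : ℝ) ≤ ε * ρ ^ d := by
  have hLam : 0 < Lam := hl.trans_le hL
  have hd' : (0 : ℝ) < d := by exact_mod_cast hd
  set K : ℝ := Lam * d * 5 ^ d with hK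
  have hK0 : 0 < K := by positivity
  set Cp : ℝ := 36 * d ^ 2 * 70 ^ d with hCp
  set C2 : ℝ := Real.sqrt (4 * Cp / (lam / 8) * (5 ^ d + 2 * K)) + 6 * K with hC2
  have hC20 : 0 < C2 := by positivity
  set K3 : ℝ := 4 * 4 ^ d * C2 with hK3
  have hK30 : 0 < K3 := by positivity
  set M : ℝ := 1 + (K3 / ε) ^ 2 with hM
  have hM1 : 1 ≤ M := by rw [hM]; linarith [sq_nonneg (K3 / ε)]
  set s : ℝ := Real.exp (M / 2) with hs
  have hs1 : 1 < s := by rw [hs, Real.one_lt_exp_iff]; linarith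
  have hs2 : 0 < s ^ 2 - 1 := by nlinarith
  set δ : ℝ := 1 / (s ^ 2 - 1) with hδ
  have hδ0 : 0 < δ := by positivity
  have hsp : s ^ 2 * δ = 1 + δ := by rw [hδ]; field_simp; ring
  have hsq : s ^ 2 = Real.exp M := by rw [hs, ← Real.exp_nat_mul]; congr 1; push_cast; ring
  refine ⟨1 / (s + 1), δ / (32 * d * Lam * (1 + δ)), by positivity, ?_, by positivity, ?_⟩
  · rw [div_le_one (by linarith)]; linarith
  intro h hh hh1 a ha x0 ρ N hρ hN1 hN2 z hz0 hz1 hsub hzero m hm hm3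
  have h0 : (1 : ℝ) ≤ ρ := by exact_mod_cast hρ
  rw [le_div_iff₀ (by positivity)] at hh1
  set w : ℕ → Zd d → ℝ := fun n x => 1 + δ - z n x with hw
  have hwδ : ∀ n x, δ ≤ w n x := fun n x => by simp only [hw]; linarith [hz1 n x]
  have hw1 : ∀ n x, w n x ≤ 1 + δ := fun n x => by simp only [hw]; linarith [hz0 n x]
  have hwp : ∀ n x, 0 < w n x := fun n x => hδ0.trans_le (hwδ n x)
  set g : ℕ → Zd d → ℝ := fun n x => Real.log (1 + δ) - Real.log (w n x) with hg
  have hg0 : ∀ n x, 0 ≤ g n x := fun n x => sub_nonneg.2 (Real.log_le_log (hwp n x) (hw1 n x))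
  have hgM : ∀ n x, g n x ≤ M := by
    intro n x
    have e1 : Real.log δ ≤ Real.log (w n x) := Real.log_le_log hδ0 (hwδ n x)
    have e2 : Real.log (1 + δ) = M + Real.log δ := by
      rw [← hsp, Real.log_mul (by positivity) hδ0.ne', hsq, Real.log_exp]
    simp only [hg]; linarith
  set P : ℝ := (ρ : ℝ) ^ d with hP
  have hP0 : 0 < P := by positivity
  set Y : ℕ → ℝ := fun n => ∑ x ∈ box x0 (2 * ρ), cut x0 ρ x ^ 2 * g n x with hY
  have hY0 : ∀ n, 0 ≤ Y n := fun n => Finset.sum_nonneg fun x _ => mul_nonneg (sq_nonneg _) (hg0 n x)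
  set D : ℝ := Lam * ∑ x ∈ box x0 (2 * ρ), ∑ k, (cut x0 ρ (nbr x k) - cut x0 ρ x) ^ 2 with hD
  have hD0 : 0 ≤ D := mul_nonneg hLam.le
    (Finset.sum_nonneg fun _ _ => Finset.sum_nonneg fun _ _ => sq_nonneg _)
  have hDr : (ρ : ℝ) ^ 2 * D ≤ K * P := by
    have := mul_le_mul_of_nonneg_left (sum_cut_grad_le (x0 := x0) hρ) hLam.le
    rw [hD, hK]; linarith
  have hstep : ∀ n < 3 * N, Y (n + 1) ≤ Y n - h * (lam / 8) * cutEn x0 ρ (g n) + h * D := by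
    intro n hn
    have := log_step hl (ha n) hh hδ0 (by linarith) (box x0 (2 * ρ)) (w n) (w (n + 1)) (cut x0 ρ)
      (hwδ n) (hw1 n) (suppIn_cut hρ) (by
        intro x hx
        have e1 := hsub n hn x (suppIn_cut hρ x hx).1
        have e2 : Lap (a n) (w n) x = -Lap (a n) (z n) x := by
          unfold Lap
          rw [← Finset.sum_neg_distrib]
          exact Finset.sum_congr rfl fun k _ => by simp only [hw]; ring
        rw [e2]; simp only [hw]; linarith)
    have e3 : ∀ n, Y n = Real.log (1 + δ) * ∑ x ∈ box x0 (2 * ρ), cut x0 ρ x ^ 2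
        + ∑ x ∈ box x0 (2 * ρ), cut x0 ρ x ^ 2 * -Real.log (w n x) := by
      intro n
      rw [Finset.mul_sum, ← Finset.sum_add_distrib]
      exact Finset.sum_congr rfl fun x _ => by simp only [hg]; ring
    have e4 : cutEn x0 ρ (g n) = ∑ x ∈ box x0 (2 * ρ), ∑ k,
        min (cut x0 ρ x ^ 2) (cut x0 ρ (nbr x k) ^ 2) *
        (Real.log (w n (nbr x k)) - Real.log (w n x)) ^ 2 := by
      unfold cutEn
      exact Finset.sum_congr rfl fun x _ => Finset.sum_congr rfl fun k _ => by simp only [hg]; ring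
    rw [e3, e3, e4, hD]
    linarith
  have hN : 0 < N := by
    rcases Nat.eq_zero_or_pos N with h' | h'
    · subst h'
      have : (0 : ℝ) < (ρ : ℝ) ^ 2 := by positivity
      simp at hN1
      linarith
    · exact h'
  have hb0 : (0 : ℝ) < (box x0 ρ).card := by rw [card_box]; positivity
  have hGc := quarter_le_card_good N (box x0 ρ).card hb0
    (fun n => (((box x0 ρ).filter fun x => z n x = 0).card : ℝ))
    (fun n => by exact_mod_cast Finset.card_filter_le _ _) hzero
  have hpo : ∀ n ∈ (Finset.range N).filter (fun n => ((box x0 ρ).card : ℝ) / 4 ≤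
      (((box x0 ρ).filter fun x => z n x = 0).card : ℝ)),
      Y n ^ 2 ≤ Cp * P * ρ ^ 2 * cutEn x0 ρ (g n) := by
    intro n hn
    refine cut_poincare hρ (g n) _ (Finset.filter_subset _ _) (fun x hx => ?_) (Finset.mem_filter.1 hn).2
    simp only [hg, hw, (Finset.mem_filter.1 hx).2, sub_zero, sub_self]
  have hYm := phase_bound (T := 3 * N) (G := M) (Q := 5 ^ d) (K := K) (r2 := (ρ : ℝ) ^ 2) hh
    (show 0 < lam / 8 by positivity) hD0 Y
    (fun n => cutEn x0 ρ (g n)) hN hY0 (fun n => cutEn_nonneg _ _ _) hP0 (by positivity) (by linarith)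
    hK0.le (by positivity) (by
      have e1 : ∀ x ∈ box x0 (2 * ρ), cut x0 ρ x ^ 2 * g 0 x ≤ M := fun x _ => by
        have := mul_le_mul (pow_le_one₀ (n := 2) (cut_nonneg x0 ρ x) (cut_le_one x0 ρ x)) (hgM 0 x)
          (hg0 0 x) zero_le_one
        linarith
      have e2 := Finset.sum_le_card_nsmul _ _ _ e1
      rw [nsmul_eq_mul] at e2
      have e3 := mul_le_mul_of_nonneg_right (card_box_le (x0 := x0) hρ) (by linarith : 0 ≤ M)
      simp only [hY]
      linarith) hstep (by omega) hDr hN1 hN2 (by push_cast; linarith) _ (Finset.filter_subset _ _) hGc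
    (by positivity) hpo m hm hm3
  set Sm := (box x0 ρ).filter fun x => 1 - 1 / (s + 1) < z m x with hSm
  have hlow : (Sm.card : ℝ) * ((1 / 4) ^ d * (M / 2)) ≤ Y m := by
    have e0 : ∑ x ∈ Sm, cut x0 ρ x ^ 2 * g m x ≤ Y m :=
      Finset.sum_le_sum_of_subset_of_nonneg
        ((Finset.filter_subset _ _).trans (box_mono (by omega)))
        fun x _ _ => mul_nonneg (sq_nonneg _) (hg0 m x)
    refine le_trans ?_ e0
    rw [← nsmul_eq_mul]
    refine Finset.card_nsmul_le_sum _ _ _ fun x hx => ?_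
    have hx' := Finset.mem_filter.1 hx
    have e2 : (1 / 4 : ℝ) ^ d ≤ cut x0 ρ x ^ 2 := by
      have := cut_ge hρ hx'.1
      calc (1 / 4 : ℝ) ^ d = ((1 / 2 : ℝ) ^ d) ^ 2 := by rw [← pow_mul, mul_comm, pow_mul]; norm_num
        _ ≤ _ := pow_le_pow_left₀ (by positivity) this 2
    have e3 : M / 2 ≤ g m x := by
      have f1 : w m x ≤ (1 + δ) / s := by
        have f2 : (1 + δ) / s = s * δ := by rw [← hsp]; field_simp
        have f3 : s * δ = δ + 1 / (s + 1) := by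
          have : s ^ 2 - 1 = (s - 1) * (s + 1) := by ring
          have : s - 1 ≠ 0 := by linarith
          rw [hδ, ‹s ^ 2 - 1 = _›]; field_simp; ring
        rw [f2, f3]; simp only [hw]; linarith [hx'.2]
      have f4 := Real.log_le_log (hwp m x) f1
      rw [Real.log_div (by positivity) (by positivity), hs, Real.log_exp] at f4
      simp only [hg]; linarith
    exact mul_le_mul e2 e3 (by linarith) (sq_nonneg _)
  have hr : Real.sqrt (M + 1) ≤ 2 * Real.sqrt M := by
    rw [show (2 : ℝ) = Real.sqrt (2 ^ 2) by rw [Real.sqrt_sq (by norm_num)], ← Real.sqrt_mul (by positivity)]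
    exact Real.sqrt_le_sqrt (by linarith)
  have hr2 : K3 / ε ≤ Real.sqrt M := Real.le_sqrt_of_sq_le (by rw [hM]; linarith)
  rw [div_le_iff₀ hε] at hr2
  have hMs : M = Real.sqrt M * Real.sqrt M := (Real.mul_self_sqrt (by linarith)).symm
  have hsM : 0 < Real.sqrt M := Real.sqrt_pos.2 (by linarith)
  have h4 : (1 / 4 : ℝ) ^ d * 4 ^ d = 1 := by rw [← mul_pow]; norm_num
  have hfin : (Sm.card : ℝ) * ((1 / 4) ^ d * (M / 2)) ≤ (ε * P) * ((1 / 4) ^ d * (M / 2)) := by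
    refine hlow.trans (hYm.trans ?_)
    calc P * (C2 * Real.sqrt (M + 1)) ≤ P * (C2 * (2 * Real.sqrt M)) := by gcongr
      _ = (1 / 4 : ℝ) ^ d * 4 ^ d * (P * (C2 * (2 * Real.sqrt M))) := by rw [h4, one_mul]
      _ = (1 / 4 : ℝ) ^ d * P * Real.sqrt M / 2 * K3 := by rw [hK3]; ring
      _ ≤ (1 / 4 : ℝ) ^ d * P * Real.sqrt M / 2 * (Real.sqrt M * ε) := by gcongr
      _ = (ε * P) * ((1 / 4) ^ d * (Real.sqrt M * Real.sqrt M / 2)) := by ring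
      _ = _ := by rw [← hMs]
  exact le_of_mul_le_mul_right hfin (by positivity)

end

noncomputable section
variable {d : ℕ}

lemma sum_coeff_le {lam Lam : ℝ} {a : Zd d → Zd d → ℝ} (ha : Ell lam Lam a) (x : Zd d) :
    ∑ k, a x (nbr x k) ≤ 2 * d * Lam := by
  rw [← card_Dir, ← Finset.card_univ, ← nsmul_eq_mul]
  exact Finset.sum_le_card_nsmul _ _ _ fun k _ => ha.upper _ _

lemma step_eq (a : Zd d → Zd d → ℝ) (h : ℝ) (v : Zd d → ℝ) (x : Zd d) :
    v x + h * Lap a v x = (1 - h * ∑ k, a x (nbr x k)) * v x + h * ∑ k, a x (nbr x k) * v (nbr x k) := by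
  unfold Lap
  simp only [mul_sub, Finset.sum_sub_distrib, ← Finset.sum_mul]
  ring

/-- the explicit Euler step is monotone -/
lemma step_mono {lam Lam h : ℝ} {a : Zd d → Zd d → ℝ} (hl : 0 < lam) (ha : Ell lam Lam a) (hh : 0 ≤ h)
    (hh1 : 2 * d * Lam * h ≤ 1) {u v : Zd d → ℝ} {x : Zd d} (hx : u x ≤ v x)
    (hn : ∀ k, u (nbr x k) ≤ v (nbr x k)) : u x + h * Lap a u x ≤ v x + h * Lap a v x := by
  rw [step_eq, step_eq]
  have h1 := mul_le_mul_of_nonneg_left (sum_coeff_le ha x) hh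
  have h2 : ∑ k, a x (nbr x k) * u (nbr x k) ≤ ∑ k, a x (nbr x k) * v (nbr x k) :=
    Finset.sum_le_sum fun k _ => mul_le_mul_of_nonneg_left (hn k) (hl.le.trans (ha.lower _ _))
  have h3 := mul_le_mul_of_nonneg_left h2 hh
  have h4 : 0 ≤ 1 - h * ∑ k, a x (nbr x k) := by linarith
  have h5 := mul_le_mul_of_nonneg_left hx h4
  linarith

lemma Lap_affine (a : Zd d → Zd d → ℝ) (v : Zd d → ℝ) (c s : ℝ) (x : Zd d) :
    Lap a (fun y => (v y - c) * s) x = Lap a v x * s := by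
  unfold Lap
  rw [Finset.sum_mul]
  exact Finset.sum_congr rfl fun k _ => by ring

lemma posPart_step {lam Lam h : ℝ} {a : Zd d → Zd d → ℝ} (hl : 0 < lam) (ha : Ell lam Lam a) (hh : 0 ≤ h)
    (hh1 : 2 * d * Lam * h ≤ 1) {u : Zd d → ℝ} {u' : ℝ} {x : Zd d} {c s : ℝ} (hs : 0 ≤ s)
    (hu : u' ≤ u x + h * Lap a u x) :
    max ((u' - c) * s) 0 ≤ max ((u x - c) * s) 0 + h * Lap a (fun y => max ((u y - c) * s) 0) x := by
  refine max_le ?_ ?_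
  · have h1 := step_mono hl ha hh hh1 (u := fun y => (u y - c) * s)
      (v := fun y => max ((u y - c) * s) 0) (x := x) (le_max_left _ _) (fun k => le_max_left _ _)
    rw [Lap_affine] at h1
    have := mul_le_mul_of_nonneg_right hu hs
    linarith
  · have h1 := step_mono hl ha hh hh1 (u := fun _ => 0)
      (v := fun y => max ((u y - c) * s) 0) (x := x) (le_max_right _ _) (fun k => le_max_right _ _)
    have h2 : Lap a (fun _ => (0 : ℝ)) x = 0 := by simp [Lap]
    rw [h2] at h1
    simpa using h1

lemma Lap_congr {a : Zd d → Zd d → ℝ} {u v : Zd d → ℝ} {x : Zd d} (hx : u x = v x)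
    (hn : ∀ k, u (nbr x k) = v (nbr x k)) : Lap a u x = Lap a v x := by
  unfold Lap
  exact Finset.sum_congr rfl fun k _ => by rw [hx, hn]

/-- Growth lemma. -/
lemma growth (d : ℕ) (hd : 1 ≤ d) (lam Lam : ℝ) (hl : 0 < lam) (hL : lam ≤ Lam) :
    ∃ c h₁ : ℝ, 0 < c ∧ c ≤ 1 / 2 ∧ 0 < h₁ ∧ h₁ ≤ 1 ∧ 2 * d * Lam * h₁ ≤ 1 / 2 ∧ ∀ h : ℝ, 0 < h → h ≤ h₁ →
      ∀ a : ℕ → Zd d → Zd d → ℝ, (∀ n, Ell lam Lam (a n)) →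
      ∀ (x0 : Zd d) (ρ N : ℕ), 1 ≤ ρ → (ρ : ℝ) ^ 2 ≤ N * h → N * h ≤ 2 * (ρ : ℝ) ^ 2 →
      ∀ z : ℕ → Zd d → ℝ, (∀ n ≤ 3 * N, ∀ x ∈ box x0 (2 * ρ + 1), 0 ≤ z n x) →
      (∀ n ≤ 3 * N, ∀ x ∈ box x0 (2 * ρ + 1), z n x ≤ 1) →
      (∀ n < 3 * N, ∀ x ∈ box x0 (2 * ρ), z (n + 1) x ≤ z n x + h * Lap (a n) (z n) x) →
      N * ((box x0 ρ).card : ℝ) / 2 ≤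
        ∑ n ∈ Finset.range N, (((box x0 ρ).filter fun x => z n x = 0).card : ℝ) →
      ∀ n, 2 * N ≤ n → n ≤ 3 * N → ∀ x, 8 * ‖x - x0‖ ≤ ρ → z n x ≤ 1 - c := by
  classical
  have hLam : 0 < Lam := hl.trans_le hL
  have hd' : (0 : ℝ) < d := by exact_mod_cast hd
  obtain ⟨θ, hθ, hdg⟩ := degiorgi_sup d hd lam Lam hl hL
  obtain ⟨δ, h₂, hδ, hδ1, hh₂, hds⟩ := density_small d hd lam Lam hl hL (θ / 6) (by positivity)
  refine ⟨3 / 8 * δ, min h₂ (min 1 (1 / (48 * d * Lam))), by positivity, by linarith,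
    lt_min hh₂ (lt_min one_pos (by positivity)), (min_le_right _ _).trans (min_le_left _ _), ?_, ?_⟩
  · have := (min_le_right h₂ _).trans (min_le_right (1 : ℝ) (1 / (48 * d * Lam)))
    rw [le_div_iff₀ (by positivity)] at this
    linarith
  intro h hh hh1 a ha x0 ρ N hρ hN1 hN2 z hz0 hz1 hsub hzero n hn hn3 x hx
  have hhA : h ≤ h₂ := hh1.trans (min_le_left _ _)
  have hhB : h ≤ 1 := hh1.trans ((min_le_right _ _).trans (min_le_left _ _))
  have hhC : 48 * d * Lam * h ≤ 1 := by
    have := hh1.trans ((min_le_right _ _).trans (min_le_right _ _))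
    rw [le_div_iff₀ (by positivity)] at this
    linarith
  set y : ℕ → Zd d → ℝ := fun n x => if n ≤ 3 * N ∧ x ∈ box x0 (2 * ρ + 1) then z n x else 0 with hy
  have hyz : ∀ n ≤ 3 * N, ∀ x ∈ box x0 (2 * ρ + 1), y n x = z n x := fun n h1 x h2 => by
    simp only [hy]; rw [if_pos ⟨h1, h2⟩]
  have hy0 : ∀ n x, 0 ≤ y n x := by
    intro n x
    simp only [hy]
    split_ifs with h'
    · exact hz0 n h'.1 x h'.2
    · exact le_rfl
  have hy1 : ∀ n x, y n x ≤ 1 := by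
    intro n x
    simp only [hy]
    split_ifs with h'
    · exact hz1 n h'.1 x h'.2
    · exact zero_le_one
  have hys : ∀ n < 3 * N, ∀ x ∈ box x0 (2 * ρ), y (n + 1) x ≤ y n x + h * Lap (a n) (y n) x := by
    intro n hn x hx
    have hx' := box_mono (show 2 * ρ ≤ 2 * ρ + 1 by omega) hx
    rw [hyz (n + 1) (by omega) x hx', hyz n (by omega) x hx', Lap_congr (v := z n)
      (hyz n (by omega) x hx') (fun k => hyz n (by omega) _ (nbr_mem_box hx le_rfl k))]
    exact hsub n hn x hx
  have hyc : ∀ n ≤ 3 * N, (box x0 ρ).filter (fun x => y n x = 0) = (box x0 ρ).filter fun x => z n x = 0 := by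
    intro n hn
    refine Finset.filter_congr fun x hx => ?_
    rw [hyz n hn x (box_mono (by omega) hx)]
  have hdens := hds h hh hhA a ha x0 ρ N hρ hN1 hN2 y hy0 hy1 hys (hzero.trans (le_of_eq
    (Finset.sum_congr rfl fun n hn => by rw [hyc n (by have := Finset.mem_range.1 hn; omega)])))
  have h0 : (1 : ℝ) ≤ ρ := by exact_mod_cast hρ
  have hNpos : 1 ≤ N := by
    by_contra hc
    have : N = 0 := by omega
    subst this
    have : (0 : ℝ) < (ρ : ℝ) ^ 2 := by positivity
    simp at hN1
    linarith
  have hNpos' : (1 : ℝ) ≤ N := by exact_mod_cast hNpos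
  have key := hdg h hh hhB hhC (fun m => a (N + m)) (fun m => ha _) x0 ρ N (2 * N) hρ hN1
    (fun m x => max ((y (N + m) x - (1 - δ)) * (1 / δ)) 0) (by
      intro m x
      refine max_le ?_ zero_le_one
      have := hy1 (N + m) x
      rw [mul_one_div, div_le_one hδ]
      linarith) (by
      intro m hm x hx
      refine posPart_step hl (ha _) hh.le (by linarith) (by positivity) ?_
      exact hys (N + m) (by omega) x (box_mono (by omega) hx)) (by
      have e1 : ∀ m ∈ Finset.range (2 * N + 1), (((box x0 ρ).filter fun x =>
          1 / 4 < max ((y (N + m) x - (1 - δ)) * (1 / δ)) 0).card : ℝ) ≤ θ / 6 * ρ ^ d := by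
        intro m hm
        have := Finset.mem_range.1 hm
        refine le_trans ?_ (hdens (N + m) (by omega) (by omega))
        have : (box x0 ρ).filter (fun x => 1 / 4 < max ((y (N + m) x - (1 - δ)) * (1 / δ)) 0)
            ⊆ (box x0 ρ).filter fun x => 1 - δ < y (N + m) x := by
          intro x hx
          rw [Finset.mem_filter] at hx ⊢
          refine ⟨hx.1, ?_⟩
          by_contra hc
          have : (y (N + m) x - (1 - δ)) * (1 / δ) ≤ 0 :=
            mul_nonpos_of_nonpos_of_nonneg (by linarith) (by positivity)
          rw [max_eq_right this] at hx
          linarith [hx.2]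
        exact_mod_cast Finset.card_le_card this
      have e2 := Finset.sum_le_card_nsmul _ _ _ e1
      rw [nsmul_eq_mul, Finset.card_range] at e2
      push_cast at e2
      have e3 := mul_le_mul_of_nonneg_left e2 hh.le
      refine e3.trans ?_
      have e4 : h * (2 * N + 1) ≤ 6 * (ρ : ℝ) ^ 2 := by nlinarith
      have e5 := mul_le_mul_of_nonneg_right e4 (show 0 ≤ θ / 6 * (ρ : ℝ) ^ d by positivity)
      rw [pow_add]
      linarith) (n - N) (by omega) (by omega) x hx
  have hxb : x ∈ box x0 (2 * ρ + 1) := by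
    rw [mem_box_iff_norm]
    push_cast
    linarith [norm_nonneg (x - x0)]
  have h1 := (le_max_left _ _).trans key
  rw [Nat.add_sub_cancel' (by omega : N ≤ n), hyz n hn3 x hxb, mul_one_div, div_le_iff₀ hδ] at h1
  linarith

end

noncomputable section
variable {d : ℕ}

/-- one step of oscillation reduction, with the constants of the growth lemma -/
def GrowthProp (d : ℕ) (lam Lam c h₁ : ℝ) : Prop :=
  ∀ h : ℝ, 0 < h → h ≤ h₁ →
      ∀ a : ℕ → Zd d → Zd d → ℝ, (∀ n, Ell lam Lam (a n)) →
      ∀ (x0 : Zd d) (ρ N : ℕ), 1 ≤ ρ → (ρ : ℝ) ^ 2 ≤ N * h → N * h ≤ 2 * (ρ : ℝ) ^ 2 →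
      ∀ z : ℕ → Zd d → ℝ, (∀ n ≤ 3 * N, ∀ x ∈ box x0 (2 * ρ + 1), 0 ≤ z n x) →
      (∀ n ≤ 3 * N, ∀ x ∈ box x0 (2 * ρ + 1), z n x ≤ 1) →
      (∀ n < 3 * N, ∀ x ∈ box x0 (2 * ρ), z (n + 1) x ≤ z n x + h * Lap (a n) (z n) x) →
      N * ((box x0 ρ).card : ℝ) / 2 ≤
        ∑ n ∈ Finset.range N, (((box x0 ρ).filter fun x => z n x = 0).card : ℝ) →
      ∀ n, 2 * N ≤ n → n ≤ 3 * N → ∀ x, 8 * ‖x - x0‖ ≤ ρ → z n x ≤ 1 - c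

lemma osc_step {lam Lam c h₁ h : ℝ} (hl : 0 < lam) (hG : GrowthProp d lam Lam c h₁) (hh : 0 < h)
    (hh1 : h ≤ h₁) (hh2 : 2 * d * Lam * h ≤ 1) {a : ℕ → Zd d → Zd d → ℝ} (ha : ∀ n, Ell lam Lam (a n))
    {x0 : Zd d} {ρ N : ℕ} (hρ : 1 ≤ ρ) (hN1 : (ρ : ℝ) ^ 2 ≤ N * h) (hN2 : N * h ≤ 2 * (ρ : ℝ) ^ 2)
    {u : ℕ → Zd d → ℝ}
    (hu : ∀ n < 3 * N, ∀ x ∈ box x0 (2 * ρ), u (n + 1) x = u n x + h * Lap (a n) (u n) x)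
    {lo w : ℝ} (hw : 0 ≤ w) (h1 : ∀ n ≤ 3 * N, ∀ x ∈ box x0 (2 * ρ + 1), lo ≤ u n x)
    (h2 : ∀ n ≤ 3 * N, ∀ x ∈ box x0 (2 * ρ + 1), u n x ≤ lo + w) :
    ∃ lo', ∀ n, 2 * N ≤ n → n ≤ 3 * N → ∀ x, 8 * ‖x - x0‖ ≤ ρ →
      lo' ≤ u n x ∧ u n x ≤ lo' + (1 - c / 2) * w := by
  classical
  have hbox : ∀ x : Zd d, 8 * ‖x - x0‖ ≤ ρ → x ∈ box x0 (2 * ρ + 1) := fun x hx => by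
    rw [mem_box_iff_norm]; push_cast; linarith [norm_nonneg (x - x0)]
  rcases hw.eq_or_lt with hw0 | hw0
  · refine ⟨lo, fun n _ hn x hx => ⟨h1 n hn x (hbox x hx), ?_⟩⟩
    have := h2 n hn x (hbox x hx)
    rw [← hw0] at this ⊢
    linarith
  have hcards : ∀ p q : ℕ → Zd d → ℝ, (∀ n x, p n x = 0 ∨ q n x = 0) →
      (N * ((box x0 ρ).card : ℝ) / 2 ≤
        ∑ n ∈ Finset.range N, (((box x0 ρ).filter fun x => p n x = 0).card : ℝ)) ∨
      (N * ((box x0 ρ).card : ℝ) / 2 ≤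
        ∑ n ∈ Finset.range N, (((box x0 ρ).filter fun x => q n x = 0).card : ℝ)) := by
    intro p q hpq
    by_contra! hc
    have e1 : ∀ n ∈ Finset.range N, ((box x0 ρ).card : ℝ) ≤
        (((box x0 ρ).filter fun x => p n x = 0).card : ℝ) +
        (((box x0 ρ).filter fun x => q n x = 0).card : ℝ) := by
      intro n _
      have e2 : box x0 ρ ⊆ ((box x0 ρ).filter fun x => p n x = 0) ∪ ((box x0 ρ).filter fun x => q n x = 0) := by
        intro x hx
        rw [Finset.mem_union, Finset.mem_filter, Finset.mem_filter]
        rcases hpq n x with h | h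
        · exact Or.inl ⟨hx, h⟩
        · exact Or.inr ⟨hx, h⟩
      exact_mod_cast (Finset.card_le_card e2).trans (Finset.card_union_le _ _)
    have e3 := Finset.card_nsmul_le_sum _ _ _ e1
    rw [nsmul_eq_mul, Finset.card_range, Finset.sum_add_distrib] at e3
    linarith [hc.1, hc.2]
  set p : ℕ → Zd d → ℝ := fun n x => max ((u n x - (lo + w / 2)) * (2 / w)) 0 with hp
  set q : ℕ → Zd d → ℝ := fun n x => max ((-u n x - -(lo + w / 2)) * (2 / w)) 0 with hq
  have hs : 0 ≤ 2 / w := by positivity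
  rcases hcards p q (fun n x => by
    rcases le_total (u n x) (lo + w / 2) with h | h
    · left; exact max_eq_right (mul_nonpos_of_nonpos_of_nonneg (by linarith) hs)
    · right; exact max_eq_right (mul_nonpos_of_nonpos_of_nonneg (by linarith) hs)) with hz | hz
  · have := hG h hh hh1 a ha x0 ρ N hρ hN1 hN2 p (fun n _ x _ => le_max_right _ _) (fun n hn x hx => by
      refine max_le ?_ zero_le_one
      have := h2 n hn x hx
      rw [mul_div_assoc', div_le_one hw0]; linarith) (fun n hn x hx =>
      posPart_step hl (ha n) hh.le hh2 hs (hu n hn x hx).le) hz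
    refine ⟨lo, fun n hn hn3 x hx => ⟨h1 n hn3 x (hbox x hx), ?_⟩⟩
    have h3 := (le_max_left _ _).trans (this n hn hn3 x hx)
    rw [mul_div_assoc', div_le_iff₀ hw0] at h3
    linarith
  · have := hG h hh hh1 a ha x0 ρ N hρ hN1 hN2 q (fun n _ x _ => le_max_right _ _) (fun n hn x hx => by
      refine max_le ?_ zero_le_one
      have := h1 n hn x hx
      rw [mul_div_assoc', div_le_one hw0]; linarith) (fun n hn x hx => by
      refine posPart_step (u := fun x => -u n x) hl (ha n) hh.le hh2 hs ?_
      rw [hu n hn x hx]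
      have : Lap (a n) (fun x => -u n x) x = -Lap (a n) (u n) x := by
        unfold Lap; rw [← Finset.sum_neg_distrib]; exact Finset.sum_congr rfl fun k _ => by ring
      rw [this]; linarith) hz
    refine ⟨lo + c / 2 * w, fun n hn hn3 x hx => ⟨?_, ?_⟩⟩
    · have h3 := (le_max_left _ _).trans (this n hn hn3 x hx)
      rw [mul_div_assoc', div_le_iff₀ hw0] at h3
      linarith
    · have := h2 n hn3 x (hbox x hx)
      linarith

lemma half_box_card (x0 : Zd d) (ρ : ℕ) (i : Fin d) (σ : ℤ) :
    ((box x0 ρ).card : ℝ) ≤ 2 * ((box x0 ρ).filter fun x => 0 ≤ σ * (x i - x0 i)).card := by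
  classical
  set H := (box x0 ρ).filter fun x => 0 ≤ σ * (x i - x0 i) with hH
  have h1 : ((box x0 ρ).filter fun x => ¬ 0 ≤ σ * (x i - x0 i)).card ≤ H.card := by
    refine Finset.card_le_card_of_injOn (fun x => 2 • x0 - x) ?_ ?_
    · intro x hx
      have hx := Finset.mem_filter.1 hx
      refine Finset.mem_coe.2 (Finset.mem_filter.2 ⟨?_, ?_⟩)
      · rw [mem_box_iff_norm] at hx ⊢
        rw [show (2 • x0 - x) - x0 = -(x - x0) by rw [two_smul]; abel, norm_neg]
        exact hx.1
      · have h2 := hx.2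
        simp only [Pi.sub_apply, Pi.smul_apply]
        have : σ * (2 • x0 i - x i - x0 i) = -(σ * (x i - x0 i)) := by simp; ring
        have e : (2 • x0 i - x i - x0 i : ℤ) = 2 * x0 i - x i - x0 i := by simp
        simp at h2 ⊢
        linarith
    · intro x _ y _ h
      simpa using h
  have h2 : H.card + ((box x0 ρ).filter fun x => ¬ 0 ≤ σ * (x i - x0 i)).card = (box x0 ρ).card :=
    Finset.card_filter_add_card_filter_not _
  have h3 : (box x0 ρ).card ≤ 2 * H.card := by omega
  exact_mod_cast h3

/-- one step of decay near a flat piece of boundary -/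
lemma bdry_step {lam Lam c h₁ h : ℝ} (hl : 0 < lam) (hG : GrowthProp d lam Lam c h₁) (hh : 0 < h)
    (hh1 : h ≤ h₁) (hh2 : 2 * d * Lam * h ≤ 1) {a : ℕ → Zd d → Zd d → ℝ} (ha : ∀ n, Ell lam Lam (a n))
    {x0 : Zd d} {ρ N : ℕ} (hρ : 1 ≤ ρ) (hN1 : (ρ : ℝ) ^ 2 ≤ N * h) (hN2 : N * h ≤ 2 * (ρ : ℝ) ^ 2)
    {W : Set (Zd d)} {i : Fin d} {σ : ℤ} (hW : ∀ x ∈ box x0 ρ, 0 ≤ σ * (x i - x0 i) → x ∉ W)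
    {u : ℕ → Zd d → ℝ}
    (hu : ∀ n < 3 * N, ∀ x ∈ box x0 (2 * ρ), x ∈ W → u (n + 1) x = u n x + h * Lap (a n) (u n) x)
    {b S : ℝ} (hc : c ≤ 1) (hb : 0 ≤ b) (hS : 0 ≤ S)
    (h1 : ∀ n ≤ 3 * N, ∀ x ∈ box x0 (2 * ρ + 1), x ∉ W → u n x ≤ b)
    (h2 : ∀ n ≤ 3 * N, ∀ x ∈ box x0 (2 * ρ + 1), u n x ≤ S) :
    ∀ n, 2 * N ≤ n → n ≤ 3 * N → ∀ x, 8 * ‖x - x0‖ ≤ ρ → u n x ≤ (1 - c) * S + b := by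
  classical
  intro n hn hn3 x hx
  have hbox : ∀ x : Zd d, 8 * ‖x - x0‖ ≤ ρ → x ∈ box x0 (2 * ρ + 1) := fun x hx => by
    rw [mem_box_iff_norm]; push_cast; linarith [norm_nonneg (x - x0)]
  rcases le_or_gt S b with hSb | hSb
  · have := h2 n hn3 x (hbox x hx)
    have := mul_nonneg (by linarith : 0 ≤ 1 - c) hS
    linarith
  have hs0 : 0 < S - b := by linarith
  have hs : 0 ≤ 1 / (S - b) := by positivity
  set p : ℕ → Zd d → ℝ := fun n x => max ((u n x - b) * (1 / (S - b))) 0 with hp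
  have hp0 : ∀ n ≤ 3 * N, ∀ x ∈ box x0 (2 * ρ + 1), x ∉ W → p n x = 0 := by
    intro n hn x hx hxW
    exact max_eq_right (mul_nonpos_of_nonpos_of_nonneg (by linarith [h1 n hn x hx hxW]) hs)
  have := hG h hh hh1 a ha x0 ρ N hρ hN1 hN2 p (fun n _ x _ => le_max_right _ _) (fun n hn x hx => by
      refine max_le ?_ zero_le_one
      have := h2 n hn x hx
      rw [mul_one_div, div_le_one hs0]; linarith) (fun n hn x hx => by
      by_cases hxW : x ∈ W
      · exact posPart_step hl (ha n) hh.le hh2 hs (hu n hn x hx hxW).le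
      · rw [hp0 (n + 1) (by omega) x (box_mono (by omega) hx) hxW]
        have h1 := step_mono hl (ha n) hh.le hh2 (u := fun _ => 0)
          (v := p n) (x := x) (le_max_right _ _) (fun k => le_max_right _ _)
        have h2 : Lap (a n) (fun _ => (0 : ℝ)) x = 0 := by simp [Lap]
        rw [h2] at h1
        simpa using h1) (by
      have e1 : ∀ n ∈ Finset.range N, ((box x0 ρ).card : ℝ) / 2 ≤
          (((box x0 ρ).filter fun x => p n x = 0).card : ℝ) := by
        intro n hn
        have hn := Finset.mem_range.1 hn
        have e2 : (box x0 ρ).filter (fun x => 0 ≤ σ * (x i - x0 i)) ⊆ (box x0 ρ).filter fun x => p n x = 0 := by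
          intro x hx
          rw [Finset.mem_filter] at hx ⊢
          exact ⟨hx.1, hp0 n (by omega) x (box_mono (by omega) hx.1) (hW x hx.1 hx.2)⟩
        have e3 : (((box x0 ρ).filter fun x => 0 ≤ σ * (x i - x0 i)).card : ℝ) ≤
          (((box x0 ρ).filter fun x => p n x = 0).card : ℝ) := by exact_mod_cast Finset.card_le_card e2
        linarith [half_box_card x0 ρ i σ]
      have e3 := Finset.card_nsmul_le_sum _ _ _ e1
      rw [nsmul_eq_mul, Finset.card_range] at e3
      linarith) n hn hn3 x hx
  have h3 := (le_max_left _ _).trans this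
  rw [mul_one_div, div_le_iff₀ hs0] at h3
  have := mul_nonneg (by linarith : 0 ≤ 1 - c) hb
  linarith

end

noncomputable section
variable {d : ℕ}

lemma holder_scale {α q A X : ℝ} (hα : 0 < α) (hq : q = (32 : ℝ) ^ (-α)) (hA : 0 ≤ A) (r R : ℕ) (hr : 1 ≤ r)
    (hrR : r ≤ R) (hX : X ≤ A)
    (h : ∀ J j : ℕ, j ≤ J → 32 ^ (J + 2) ≤ R → r ≤ 32 ^ (j + 1) → X ≤ A * q ^ (J - j)) :
    X ≤ A * (q ^ 3)⁻¹ * ((r : ℝ) / R) ^ α := by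
  have hq0 : 0 < q := by rw [hq]; positivity
  have hq1 : q ≤ 1 := by
    rw [hq]; exact Real.rpow_le_one_of_one_le_of_nonpos (by norm_num) (by linarith)
  set j := Nat.log 32 r with hj
  set l := Nat.log 32 R with hl
  have h1 : 32 ^ j ≤ r := Nat.pow_log_le_self 32 (by omega)
  have h2 : r < 32 ^ (j + 1) := Nat.lt_pow_succ_log_self (by norm_num) r
  have h3 : 32 ^ l ≤ R := Nat.pow_log_le_self 32 (by omega)
  have h4 : R < 32 ^ (l + 1) := Nat.lt_pow_succ_log_self (by norm_num) R
  have hjl : j ≤ l := Nat.log_mono_right hrR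
  have hR0 : (0 : ℝ) < R := by exact_mod_cast (by omega : 0 < R)
  have h5 : q ^ (l + 1 - j) ≤ ((r : ℝ) / R) ^ α := by
    have e1 : ((32 : ℝ) ^ (l + 1 - j))⁻¹ ≤ (r : ℝ) / R := by
      rw [inv_le_iff_one_le_mul₀ (by positivity), div_mul_eq_mul_div, le_div_iff₀ hR0, one_mul]
      have : (R : ℝ) ≤ 32 ^ (l + 1) := by exact_mod_cast h4.le
      refine this.trans ?_
      have e2 : (32 : ℝ) ^ (l + 1) = 32 ^ (l + 1 - j) * 32 ^ j := by
        rw [← pow_add]; congr 1; omega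
      rw [e2, mul_comm]
      have : (32 : ℝ) ^ j ≤ r := by exact_mod_cast h1
      gcongr
    have e3 : q ^ (l + 1 - j) = (((32 : ℝ) ^ (l + 1 - j))⁻¹) ^ α := by
      rw [hq, ← Real.rpow_natCast, ← Real.rpow_natCast, ← Real.rpow_mul (by norm_num),
        ← Real.rpow_neg (by norm_num), ← Real.rpow_mul (by norm_num)]
      congr 1; ring
    rw [e3]
    exact Real.rpow_le_rpow (by positivity) e1 hα.le
  have hq3 : 0 < q ^ 3 := by positivity
  have h6 : A * (q ^ 3)⁻¹ * q ^ (l + 1 - j) ≤ A * (q ^ 3)⁻¹ * ((r : ℝ) / R) ^ α := by gcongr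
  refine le_trans ?_ h6
  by_cases hc : j + 2 ≤ l
  · have := h (l - 2) j (by omega) (by rwa [Nat.sub_add_cancel (by omega)]) h2.le
    refine this.trans (le_of_eq ?_)
    rw [show l + 1 - j = (l - 2 - j) + 3 by omega, pow_add]
    field_simp
  · refine hX.trans ?_
    rw [mul_assoc]
    refine le_mul_of_one_le_right hA ?_
    rw [inv_mul_eq_div, one_le_div hq3]
    exact pow_le_pow_of_le_one hq0.le hq1 (by omega)

/-- number of time steps attached to the scale `j` -/
def stepsAt (h : ℝ) (j : ℕ) : ℕ := ⌈((16 * 32 ^ j : ℕ) : ℝ) ^ 2 / h⌉₊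

lemma stepsAt_ge {h : ℝ} (hh : 0 < h) (j : ℕ) : ((16 * 32 ^ j : ℕ) : ℝ) ^ 2 ≤ stepsAt h j * h := by
  rw [← div_le_iff₀ hh]; exact Nat.le_ceil _

lemma stepsAt_le {h : ℝ} (hh : 0 < h) (hh1 : h ≤ 1) (j : ℕ) :
    stepsAt h j * h ≤ 2 * ((16 * 32 ^ j : ℕ) : ℝ) ^ 2 := by
  have h1 := (Nat.ceil_lt_add_one (show 0 ≤ ((16 * 32 ^ j : ℕ) : ℝ) ^ 2 / h by positivity)).le
  have h2 : (stepsAt h j : ℝ) * h ≤ (((16 * 32 ^ j : ℕ) : ℝ) ^ 2 / h + 1) * h :=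
    mul_le_mul_of_nonneg_right h1 hh.le
  rw [add_mul, div_mul_cancel₀ _ hh.ne'] at h2
  have h3 : (1 : ℝ) ≤ ((16 * 32 ^ j : ℕ) : ℝ) := by
    exact_mod_cast Nat.one_le_iff_ne_zero.2 (by positivity)
  nlinarith

lemma stepsAt_succ {h : ℝ} (hh : 0 < h) (hh1 : h ≤ 1) (j : ℕ) : 3 * stepsAt h j ≤ stepsAt h (j + 1) := by
  have h1 := stepsAt_le hh hh1 j
  have h2 := stepsAt_ge hh (j + 1)
  have h3 : ((16 * 32 ^ (j + 1) : ℕ) : ℝ) = 32 * ((16 * 32 ^ j : ℕ) : ℝ) := by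
    push_cast; rw [pow_succ]; ring
  rw [h3] at h2
  have h4 : 0 ≤ ((16 * 32 ^ j : ℕ) : ℝ) ^ 2 := by positivity
  have h5 : (3 * stepsAt h j : ℝ) * h ≤ stepsAt h (j + 1) * h := by nlinarith
  exact_mod_cast le_of_mul_le_mul_right h5 hh

lemma stepsAt_time {h : ℝ} (hh : 0 < h) (hh1 : h ≤ 1) {J R T : ℕ} (hR : 32 ^ (J + 2) ≤ R)
    (hT : (R : ℝ) ^ 2 ≤ T * h) : 3 * stepsAt h J ≤ T := by
  have h1 := stepsAt_le hh hh1 J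
  have h2 : (64 : ℝ) * ((16 * 32 ^ J : ℕ) : ℝ) ≤ R := by
    have : (64 * (16 * 32 ^ J) : ℕ) ≤ R := by rw [pow_add] at hR; omega
    exact_mod_cast this
  have h4 : 0 ≤ ((16 * 32 ^ J : ℕ) : ℝ) := by positivity
  have h3 : (64 * ((16 * 32 ^ J : ℕ) : ℝ)) ^ 2 ≤ (R : ℝ) ^ 2 := by gcongr
  have h5 : (3 * stepsAt h J : ℝ) * h ≤ T * h := by nlinarith
  exact_mod_cast le_of_mul_le_mul_right h5 hh

lemma window_shrink {x0 x : Zd d} {j : ℕ} (hx : x ∈ box x0 (2 * (16 * 32 ^ j) + 1)) :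
    8 * ‖x - x0‖ ≤ ((16 * 32 ^ (j + 1) : ℕ) : ℝ) := by
  rw [mem_box_iff_norm] at hx
  push_cast at hx ⊢
  have : (1 : ℝ) ≤ 32 ^ j := one_le_pow₀ (by norm_num)
  rw [pow_succ]
  linarith

lemma interior_iter {lam Lam c h₁ h : ℝ} (hl : 0 < lam) (hG : GrowthProp d lam Lam c h₁) (hh : 0 < h)
    (hh1 : h ≤ h₁) (hh3 : h ≤ 1) (hh2 : 2 * d * Lam * h ≤ 1) (hc : c ≤ 1) {a : ℕ → Zd d → Zd d → ℝ}
    (ha : ∀ n, Ell lam Lam (a n))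
    {x0 : Zd d} {R T J : ℕ} (hR : 32 ^ (J + 2) ≤ R) (hT : (R : ℝ) ^ 2 ≤ T * h)
    {u : ℕ → Zd d → ℝ}
    (hu : ∀ n < T, ∀ x ∈ box x0 (R - 1), u (n + 1) x = u n x + h * Lap (a n) (u n) x)
    {M : ℝ} (hM : 0 ≤ M) (hb : ∀ n ≤ T, ∀ x ∈ box x0 R, |u n x| ≤ M) :
    ∀ m ≤ J, ∃ lo, ∀ n, T - 3 * stepsAt h (J - m) ≤ n → n ≤ T →
      ∀ x ∈ box x0 (2 * (16 * 32 ^ (J - m)) + 1), lo ≤ u n x ∧ u n x ≤ lo + (1 - c / 2) ^ m * (2 * M) := by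
  have hwin : ∀ j ≤ J, 2 * (16 * 32 ^ j) + 1 ≤ R := by
    intro j hj
    have h1 : 32 ^ j ≤ 32 ^ J := Nat.pow_le_pow_right (by norm_num) hj
    have h2 : 0 < 32 ^ J := by positivity
    rw [pow_add] at hR
    omega
  have htime : ∀ j ≤ J, 3 * stepsAt h j ≤ T := by
    intro j hj
    refine stepsAt_time hh hh3 (J := j) ?_ hT
    exact (Nat.pow_le_pow_right (by norm_num) (by omega)).trans hR
  intro m
  induction m with
  | zero =>
    intro _
    refine ⟨-M, fun n _ hn x hx => ?_⟩
    have := abs_le.1 (hb n hn x (box_mono (hwin _ (by omega)) hx))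
    constructor <;> [exact this.1; linarith]
  | succ m ih =>
    intro hm
    obtain ⟨lo, hlo⟩ := ih (by omega)
    obtain ⟨j, hj⟩ : ∃ j, J - m = j + 1 := ⟨J - m - 1, by omega⟩
    have hj' : J - (m + 1) = j := by omega
    rw [hj] at hlo
    rw [hj']
    have hjt := htime (j + 1) (by omega)
    have hjw := hwin (j + 1) (by omega)
    set N := stepsAt h (j + 1) with hN
    have hss : 3 * stepsAt h j ≤ N := stepsAt_succ hh hh3 j
    obtain ⟨lo', h'⟩ := osc_step hl hG hh hh1 hh2 (a := fun n => a (T - 3 * N + n)) (fun n => ha _)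
      (x0 := x0) (ρ := 16 * 32 ^ (j + 1)) (N := N) (Nat.one_le_iff_ne_zero.2 (by positivity))
      (stepsAt_ge hh _) (stepsAt_le hh hh3 _)
      (u := fun n => u (T - 3 * N + n)) (fun n hn x hx =>
        hu (T - 3 * N + n) (by omega) x (box_mono (by omega) hx))
      (lo := lo) (w := (1 - c / 2) ^ m * (2 * M))
      (mul_nonneg (pow_nonneg (by linarith) _) (by linarith))
      (fun n hn x hx => (hlo _ (by omega) (by omega) x hx).1)
      (fun n hn x hx => (hlo _ (by omega) (by omega) x hx).2)
    refine ⟨lo', fun n hn hnT x hx => ?_⟩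
    have := h' (n - (T - 3 * N)) (by omega) (by omega) x (window_shrink hx)
    rw [Nat.add_sub_cancel' (by omega)] at this
    rw [pow_succ]
    refine ⟨this.1, this.2.trans (le_of_eq ?_)⟩
    ring

lemma bdry_iter {lam Lam c h₁ h : ℝ} (hl : 0 < lam) (hG : GrowthProp d lam Lam c h₁) (hh : 0 < h)
    (hh1 : h ≤ h₁) (hh3 : h ≤ 1) (hh2 : 2 * d * Lam * h ≤ 1) (hc0 : 0 < c) (hc : c ≤ 1)
    {a : ℕ → Zd d → Zd d → ℝ}
    (ha : ∀ n, Ell lam Lam (a n))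
    {x0 : Zd d} {R T J : ℕ} (hR : 32 ^ (J + 2) ≤ R) (hT : (R : ℝ) ^ 2 ≤ T * h)
    {W : Set (Zd d)} {i : Fin d} {σ : ℤ} (hW : ∀ x ∈ box x0 R, 0 ≤ σ * (x i - x0 i) → x ∉ W)
    {u : ℕ → Zd d → ℝ}
    (hu : ∀ n < T, ∀ x ∈ box x0 (R - 1), x ∈ W → u (n + 1) x = u n x + h * Lap (a n) (u n) x)
    {M : ℝ} (hM : 0 ≤ M) (hb : ∀ n ≤ T, ∀ x ∈ box x0 R, u n x ≤ M)
    (hbW : ∀ n ≤ T, ∀ x ∈ box x0 R, x ∉ W → u n x ≤ M * (‖x - x0‖ / R)) :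
    ∀ m ≤ J, ∀ n, T - 3 * stepsAt h (J - m) ≤ n → n ≤ T →
      ∀ x ∈ box x0 (2 * (16 * 32 ^ (J - m)) + 1), u n x ≤ (2 * M / c) * (1 - c / 2) ^ m := by
  have hwin : ∀ j ≤ J, 2 * (16 * 32 ^ j) + 1 ≤ R := by
    intro j hj
    have h1 : 32 ^ j ≤ 32 ^ J := Nat.pow_le_pow_right (by norm_num) hj
    have h2 : 0 < 32 ^ J := by positivity
    rw [pow_add] at hR
    omega
  have htime : ∀ j ≤ J, 3 * stepsAt h j ≤ T := by
    intro j hj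
    refine stepsAt_time hh hh3 (J := j) ?_ hT
    exact (Nat.pow_le_pow_right (by norm_num) (by omega)).trans hR
  have hRpos : (0 : ℝ) < R := by
    have : 0 < 32 ^ (J + 2) := by positivity
    exact_mod_cast this.trans_le hR
  intro m
  induction m with
  | zero =>
    intro _ n _ hn x hx
    have := hb n hn x (box_mono (hwin _ (by omega)) hx)
    rw [pow_zero, mul_one]
    refine this.trans ?_
    rw [le_div_iff₀ hc0]
    nlinarith
  | succ m ih =>
    intro hm n hn hnT x hx
    have hlo := ih (by omega)
    obtain ⟨j, hj⟩ : ∃ j, J - m = j + 1 := ⟨J - m - 1, by omega⟩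
    have hj' : J - (m + 1) = j := by omega
    rw [hj] at hlo
    rw [hj'] at hn hx
    have hjt := htime (j + 1) (by omega)
    have hjw := hwin (j + 1) (by omega)
    set N := stepsAt h (j + 1) with hN
    have hss : 3 * stepsAt h j ≤ N := stepsAt_succ hh hh3 j
    have hq0 : 0 ≤ 1 - c / 2 := by linarith
    have hbb : M * (((2 * (16 * 32 ^ (j + 1)) + 1 : ℕ) : ℝ) / R) ≤ M * (1 - c / 2) ^ m := by
      refine mul_le_mul_of_nonneg_left ?_ hM
      have e1 : (1 / 32 : ℝ) ^ m ≤ (1 - c / 2) ^ m := pow_le_pow_left₀ (by norm_num) (by linarith) m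
      refine le_trans ?_ e1
      rw [div_le_iff₀ hRpos]
      have e2 : ((32 : ℝ) ^ (J + 2)) ≤ R := by exact_mod_cast hR
      have e3 : (32 : ℝ) ^ (J + 2) = 32 ^ m * 32 ^ (j + 3) := by rw [← pow_add]; congr 1; omega
      have e4 : (1 / 32 : ℝ) ^ m * 32 ^ m = 1 := by rw [← mul_pow]; norm_num
      calc ((2 * (16 * 32 ^ (j + 1)) + 1 : ℕ) : ℝ) ≤ 32 ^ (j + 3) := by
            push_cast
            have : (1 : ℝ) ≤ 32 ^ (j + 1) := one_le_pow₀ (by norm_num)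
            rw [show j + 3 = (j + 1) + 2 by omega, pow_add _ (j + 1)]
            linarith
        _ = (1 / 32 : ℝ) ^ m * (32 ^ m * 32 ^ (j + 3)) := by rw [← mul_assoc, e4, one_mul]
        _ ≤ _ := by rw [← e3]; gcongr
    have := bdry_step hl hG hh hh1 hh2 (a := fun n => a (T - 3 * N + n)) (fun n => ha _)
      (x0 := x0) (ρ := 16 * 32 ^ (j + 1)) (N := N) (Nat.one_le_iff_ne_zero.2 (by positivity))
      (stepsAt_ge hh _) (stepsAt_le hh hh3 _) (W := W) (i := i) (σ := σ)
      (fun x hx => hW x (box_mono (by omega) hx))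
      (u := fun n => u (T - 3 * N + n)) (fun n hn x hx =>
        hu (T - 3 * N + n) (by omega) x (box_mono (by omega) hx))
      (b := M * (1 - c / 2) ^ m) (S := 2 * M / c * (1 - c / 2) ^ m) hc
      (mul_nonneg hM (pow_nonneg hq0 _)) (mul_nonneg (by positivity) (pow_nonneg hq0 _))
      (fun n hn x hx hxW => by
        refine (hbW _ (by omega) x (box_mono hjw hx) hxW).trans (le_trans ?_ hbb)
        have := mem_box_iff_norm.1 hx
        gcongr)
      (fun n hn x hx => hlo _ (by omega) (by omega) x hx)
      (n - (T - 3 * N)) (by omega) (by omega) x (window_shrink hx)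
    rw [Nat.add_sub_cancel' (by omega)] at this
    refine this.trans (le_of_eq ?_)
    rw [pow_succ]
    field_simp
    ring

/-- Interior and boundary Hölder estimates for the explicit parabolic scheme. -/
lemma parabolic_holder (d : ℕ) (hd : 1 ≤ d) (lam Lam : ℝ) (hl : 0 < lam) (hL : lam ≤ Lam) :
    ∃ α C h₁ : ℝ, 0 < α ∧ 0 < C ∧ 0 < h₁ ∧ h₁ ≤ 1 ∧ 2 * d * Lam * h₁ ≤ 1 / 2 ∧
      ∀ h : ℝ, 0 < h → h ≤ h₁ → ∀ a : ℕ → Zd d → Zd d → ℝ, (∀ n, Ell lam Lam (a n)) →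
      ∀ (x0 : Zd d) (R r T : ℕ), 1 ≤ r → r ≤ R → (R : ℝ) ^ 2 ≤ T * h → ∀ M : ℝ, 0 ≤ M →
      ∀ u : ℕ → Zd d → ℝ,
      ((∀ n ≤ T, ∀ x ∈ box x0 R, |u n x| ≤ M) →
        (∀ n < T, ∀ x ∈ box x0 (R - 1), u (n + 1) x = u n x + h * Lap (a n) (u n) x) →
        ∀ x ∈ box x0 r, |u T x - u T x0| ≤ C * M * ((r : ℝ) / R) ^ α) ∧
      (∀ (W : Set (Zd d)) (i : Fin d) (σ : ℤ), (∀ x ∈ box x0 R, 0 ≤ σ * (x i - x0 i) → x ∉ W) →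
        (∀ n < T, ∀ x ∈ box x0 (R - 1), x ∈ W → u (n + 1) x = u n x + h * Lap (a n) (u n) x) →
        (∀ n ≤ T, ∀ x ∈ box x0 R, u n x ≤ M) →
        (∀ n ≤ T, ∀ x ∈ box x0 R, x ∉ W → u n x ≤ M * (‖x - x0‖ / R)) →
        ∀ x ∈ box x0 r, u T x ≤ C * M * ((r : ℝ) / R) ^ α) := by
  obtain ⟨c, h₁, hc0, hc1, hh₁, hh₁1, hh₁2, hG⟩ := growth d hd lam Lam hl hL
  set q : ℝ := 1 - c / 2 with hq
  have hq0 : 0 < q := by rw [hq]; linarith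
  have hq1 : q < 1 := by rw [hq]; linarith
  have hl32 : 0 < Real.log 32 := Real.log_pos (by norm_num)
  set α : ℝ := -Real.log q / Real.log 32 with hα
  have hα0 : 0 < α := div_pos (neg_pos.2 (Real.log_neg hq0 hq1)) hl32
  have hqα : q = (32 : ℝ) ^ (-α) := by
    rw [Real.rpow_def_of_pos (by norm_num), hα]
    rw [show Real.log 32 * -(-Real.log q / Real.log 32) = Real.log q by field_simp, Real.exp_log hq0]
  refine ⟨α, 2 / c * (q ^ 3)⁻¹, h₁, hα0, by positivity, hh₁, hh₁1, hh₁2, ?_⟩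
  intro h hh hhle a ha x0 R r T hr hrR hT M hM u
  have hLam : 0 < Lam := hl.trans_le hL
  have hd2 : 2 * d * Lam * h ≤ 1 := by
    have : 2 * d * Lam * h ≤ 2 * d * Lam * h₁ := by gcongr
    linarith
  have h2c : 2 * M ≤ 2 * M / c := by
    rw [le_div_iff₀ hc0]
    nlinarith
  have hbx : ∀ j, r ≤ 32 ^ (j + 1) → r ≤ 2 * (16 * 32 ^ j) + 1 := by
    intro j hj
    rw [pow_succ] at hj
    omega
  constructor
  · intro hb hu x hx
    have := holder_scale (A := 2 * M / c) (X := |u T x - u T x0|) hα0 hqα (by positivity) r R hr hrR (by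
        have e1 := hb T le_rfl x (box_mono hrR hx)
        have e2 := hb T le_rfl x0 (self_mem_box _ _)
        have := abs_sub (u T x) (u T x0)
        linarith) (by
        intro J j hj hJR hrj
        obtain ⟨lo, hlo⟩ := interior_iter hl hG hh hhle (hhle.trans hh₁1) hd2 (by linarith) ha hJR hT hu
          hM hb (J - j) (by omega)
        rw [Nat.sub_sub_self hj] at hlo
        have e1 := hlo T (by omega) le_rfl x (box_mono (hbx j hrj) hx)
        have e2 := hlo T (by omega) le_rfl x0 (self_mem_box _ _)
        have e3 : (1 - c / 2) ^ (J - j) * (2 * M) ≤ 2 * M / c * q ^ (J - j) := by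
          rw [mul_comm]; gcongr
        rw [abs_le]
        constructor <;> linarith [e1.1, e1.2, e2.1, e2.2])
    refine this.trans (le_of_eq ?_)
    ring
  · intro W i σ hW hu hb hbW x hx
    have := holder_scale (A := 2 * M / c) (X := u T x) hα0 hqα (by positivity) r R hr hrR (by
        have e1 := hb T le_rfl x (box_mono hrR hx)
        linarith) (by
        intro J j hj hJR hrj
        have hlo := bdry_iter hl hG hh hhle (hhle.trans hh₁1) hd2 hc0 (by linarith) ha hJR hT hW hu
          hM hb hbW (J - j) (by omega)
        rw [Nat.sub_sub_self hj] at hlo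
        exact hlo T (by omega) le_rfl x (box_mono (hbx j hrj) hx))
    refine this.trans (le_of_eq ?_)
    ring

end

noncomputable section
variable {ι : Type*} [Fintype ι]

lemma integrable_exp_neg_sum_sq {c : ℝ} (hc : 0 < c) :
    Integrable fun φ : ι → ℝ => Real.exp (-c * ∑ i, φ i ^ 2) := by
  have h := MeasureTheory.Integrable.fintype_prod (ι := ι) (μ := fun _ => (volume : Measure ℝ))
    (f := fun _ t => Real.exp (-c * t ^ 2)) (fun _ => integrable_exp_neg_mul_sq hc)
  refine h.congr (Eventually.of_forall fun φ => ?_)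
  simp only
  rw [← Real.exp_sum, Finset.mul_sum]

lemma norm_sq_le_sum (φ : ι → ℝ) : ‖φ‖ ^ 2 ≤ ∑ i, φ i ^ 2 := by
  have h : ‖φ‖ ≤ Real.sqrt (∑ i, φ i ^ 2) := by
    rw [pi_norm_le_iff_of_nonneg (Real.sqrt_nonneg _)]
    intro i
    rw [Real.norm_eq_abs, ← Real.sqrt_sq_eq_abs]
    exact Real.sqrt_le_sqrt (Finset.single_le_sum (f := fun i => φ i ^ 2) (fun j _ => sq_nonneg _)
      (Finset.mem_univ i))
  calc ‖φ‖ ^ 2 ≤ Real.sqrt (∑ i, φ i ^ 2) ^ 2 := by gcongr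
    _ = _ := Real.sq_sqrt (Finset.sum_nonneg fun i _ => sq_nonneg _)

lemma one_add_pow_le_exp {c : ℝ} (hc : 0 < c) (p : ℕ) :
    ∃ C : ℝ, 0 ≤ C ∧ ∀ t : ℝ, 0 ≤ t → (1 + t) ^ p ≤ C * Real.exp (c / 2 * t ^ 2) := by
  refine ⟨p.factorial * Real.exp (1 + 1 / (2 * c)), by positivity, fun t ht => ?_⟩
  have h1 := Real.pow_div_factorial_le_exp (1 + t) (by linarith) p
  rw [div_le_iff₀ (by positivity)] at h1
  have h2 : 1 + t ≤ (1 + 1 / (2 * c)) + c / 2 * t ^ 2 := by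
    have : 0 ≤ (c * t - 1) ^ 2 / (2 * c) := by positivity
    have e : (c * t - 1) ^ 2 / (2 * c) = c / 2 * t ^ 2 - t + 1 / (2 * c) := by field_simp; ring
    linarith
  have h3 : Real.exp (1 + t) ≤ Real.exp (1 + 1 / (2 * c)) * Real.exp (c / 2 * t ^ 2) := by
    rw [← Real.exp_add]; exact Real.exp_le_exp.2 h2
  nlinarith [show (0 : ℝ) < p.factorial by positivity]

/-- polynomial weights are integrable against `exp (-H)` when `H` grows quadratically -/
lemma integrable_poly_exp {H : (ι → ℝ) → ℝ} (hH : Continuous H) {c K : ℝ} (hc : 0 < c)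
    (hlow : ∀ φ, c * ∑ i, φ i ^ 2 - K ≤ H φ) (p : ℕ) :
    Integrable fun φ : ι → ℝ => (1 + ‖φ‖) ^ p * Real.exp (-H φ) := by
  obtain ⟨C, hC, h⟩ := one_add_pow_le_exp hc p
  refine ((integrable_exp_neg_sum_sq (ι := ι) (half_pos hc)).const_mul (C * Real.exp K)).mono'
    (by fun_prop) (Eventually.of_forall fun φ => ?_)
  rw [Real.norm_of_nonneg (by positivity)]
  have h1 := h ‖φ‖ (norm_nonneg _)
  have h2 : Real.exp (c / 2 * ‖φ‖ ^ 2) ≤ Real.exp (c / 2 * ∑ i, φ i ^ 2) := by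
    have := norm_sq_le_sum φ
    gcongr
  have h3 : Real.exp (-H φ) ≤ Real.exp (-(c * ∑ i, φ i ^ 2) + K) :=
    Real.exp_le_exp.2 (by linarith [hlow φ])
  calc (1 + ‖φ‖) ^ p * Real.exp (-H φ)
      ≤ (C * Real.exp (c / 2 * ∑ i, φ i ^ 2)) * Real.exp (-(c * ∑ i, φ i ^ 2) + K) := by
        gcongr; exact h1.trans (by gcongr)
    _ = C * (Real.exp (c / 2 * ∑ i, φ i ^ 2) * Real.exp (-(c * ∑ i, φ i ^ 2) + K)) := by ring
    _ = C * Real.exp K * Real.exp (-(c / 2) * ∑ i, φ i ^ 2) := by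
        rw [← Real.exp_add, mul_assoc, ← Real.exp_add]; congr 2; ring

lemma integrable_growth_exp {H : (ι → ℝ) → ℝ} (hH : Continuous H) {c K : ℝ} (hc : 0 < c)
    (hlow : ∀ φ, c * ∑ i, φ i ^ 2 - K ≤ H φ) {F : (ι → ℝ) → ℝ} (hF : AEStronglyMeasurable F)
    {A : ℝ} {p : ℕ} (hA : ∀ φ, |F φ| ≤ A * (1 + ‖φ‖) ^ p) :
    Integrable fun φ : ι → ℝ => F φ * Real.exp (-H φ) := by
  refine ((integrable_poly_exp hH hc hlow p).const_mul A).mono' (hF.mul (by fun_prop))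
    (Eventually.of_forall fun φ => ?_)
  rw [norm_mul, Real.norm_of_nonneg (Real.exp_pos _).le, Real.norm_eq_abs, ← mul_assoc]
  exact mul_le_mul_of_nonneg_right (hA φ) (Real.exp_pos _).le

/-- An energy with Lipschitz gradient `b` and quadratic growth. -/
structure Good (H : (ι → ℝ) → ℝ) (b : (ι → ℝ) → ι → ℝ) (K c : ℝ) : Prop where
  hc : 0 < c
  hK : 0 ≤ K
  taylor : ∀ φ δ, |H (φ + δ) - H φ - ∑ i, b φ i * δ i| ≤ K * ‖δ‖ ^ 2
  lip : ∀ φ ψ, ‖b φ - b ψ‖ ≤ K * ‖φ - ψ‖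
  grow : ∀ φ, ‖b φ‖ ≤ K * (1 + ‖φ‖)
  lower : ∀ φ, c * ∑ i, φ i ^ 2 - K ≤ H φ

/-- the standard Gaussian energy of variance two -/
def gH (z : ι → ℝ) : ℝ := 1 / 4 * ∑ i, z i ^ 2

lemma abs_sum_mul_le (v w : ι → ℝ) : |∑ i, v i * w i| ≤ Fintype.card ι * (‖v‖ * ‖w‖) := by
  refine (Finset.abs_sum_le_sum_abs _ _).trans ?_
  rw [← nsmul_eq_mul]
  refine Finset.sum_le_card_nsmul _ _ _ fun i _ => ?_
  rw [abs_mul]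
  exact mul_le_mul (norm_le_pi_norm v i) (norm_le_pi_norm w i) (abs_nonneg _) (norm_nonneg _)

namespace Good
variable {H : (ι → ℝ) → ℝ} {b : (ι → ℝ) → ι → ℝ} {K c : ℝ}

lemma cont_b (g : Good H b K c) : Continuous b :=
  (LipschitzWith.of_dist_le_mul (K := ⟨K, g.hK⟩) fun x y => by
    rw [dist_eq_norm, dist_eq_norm]; exact g.lip x y).continuous

lemma cont_H (g : Good H b K c) : Continuous H := by
  rw [continuous_iff_continuousAt]
  intro φ
  rw [ContinuousAt, tendsto_iff_norm_sub_tendsto_zero]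
  have h1 : ∀ ψ, ‖H ψ - H φ‖ ≤ Fintype.card ι * (‖b φ‖ * ‖ψ - φ‖) + K * ‖ψ - φ‖ ^ 2 := by
    intro ψ
    have e1 := g.taylor φ (ψ - φ)
    have e2 := abs_sum_mul_le (b φ) (ψ - φ)
    rw [add_sub_cancel] at e1
    rw [Real.norm_eq_abs]
    rw [abs_le] at *
    constructor <;> linarith [e1.1, e1.2, e2.1, e2.2]
  refine squeeze_zero (fun _ => norm_nonneg _) h1 ?_
  have : Continuous fun ψ : ι → ℝ => (Fintype.card ι : ℝ) * (‖b φ‖ * ‖ψ - φ‖) + K * ‖ψ - φ‖ ^ 2 := by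
    fun_prop
  have h2 := this.tendsto φ
  simpa using h2

lemma integrable (g : Good H b K c) {F : (ι → ℝ) → ℝ} (hF : AEStronglyMeasurable F)
    {A : ℝ} {p : ℕ} (hA : ∀ φ, |F φ| ≤ A * (1 + ‖φ‖) ^ p) :
    Integrable fun φ : ι → ℝ => F φ * Real.exp (-H φ) :=
  integrable_growth_exp g.cont_H g.hc g.lower hF hA

end Good

lemma gH_cont : Continuous (gH : (ι → ℝ) → ℝ) := by unfold gH; fun_prop

lemma gH_lower (z : ι → ℝ) : 1 / 4 * ∑ i, z i ^ 2 - 0 ≤ gH z := by simp [gH]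

end

noncomputable section
set_option linter.unusedSectionVars false
variable {ι : Type*} [Fintype ι]

/-- the probability measure with density proportional to `exp (-H)` -/
def gm (H : (ι → ℝ) → ℝ) : Measure (ι → ℝ) :=
  volume.withDensity fun φ => ENNReal.ofReal (Real.exp (-H φ) / ∫ ψ, Real.exp (-H ψ))

/-- continuity and quadratic growth of an energy -/
structure Conf0 (H : (ι → ℝ) → ℝ) (K c : ℝ) : Prop where
  cont : Continuous H
  hc : 0 < c
  lower : ∀ φ, c * ∑ i, φ i ^ 2 - K ≤ H φ

lemma gH_conf : Conf0 (gH : (ι → ℝ) → ℝ) 0 (1 / 4) := ⟨by unfold gH; fun_prop, by norm_num, gH_lower⟩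

lemma Good.conf {H : (ι → ℝ) → ℝ} {b : (ι → ℝ) → ι → ℝ} {K c : ℝ} (g : Good H b K c) :
    Conf0 H K c := ⟨g.cont_H, g.hc, g.lower⟩

namespace Conf0
variable {H : (ι → ℝ) → ℝ} {K c : ℝ}

lemma integrable_exp (g : Conf0 H K c) : Integrable fun φ => Real.exp (-H φ) := by
  simpa using integrable_poly_exp g.cont g.hc g.lower 0

lemma Z_pos (g : Conf0 H K c) : 0 < ∫ φ, Real.exp (-H φ) := integral_exp_pos g.integrable_exp

lemma integral_gm (g : Conf0 H K c) (F : (ι → ℝ) → ℝ) :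
    ∫ φ, F φ ∂(gm H) = (∫ φ, F φ * Real.exp (-H φ)) / ∫ φ, Real.exp (-H φ) := by
  have hZ := g.Z_pos
  have hc := g.cont
  rw [gm, integral_withDensity_eq_integral_toReal_smul (by fun_prop)
    (Eventually.of_forall fun _ => ENNReal.ofReal_lt_top), ← integral_div]
  refine integral_congr_ae (Eventually.of_forall fun φ => ?_)
  simp only [smul_eq_mul]
  rw [ENNReal.toReal_ofReal (by positivity)]
  ring

lemma integrable_gm_iff (g : Conf0 H K c) (F : (ι → ℝ) → ℝ) :
    Integrable F (gm H) ↔ Integrable fun φ => F φ * Real.exp (-H φ) := by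
  have hZ := g.Z_pos
  have hc := g.cont
  rw [gm, integrable_withDensity_iff_integrable_smul' (by fun_prop)
    (Eventually.of_forall fun _ => ENNReal.ofReal_lt_top)]
  have : (fun φ => (ENNReal.ofReal (Real.exp (-H φ) / ∫ ψ, Real.exp (-H ψ))).toReal • F φ)
      = fun φ => (F φ * Real.exp (-H φ)) * (∫ ψ, Real.exp (-H ψ))⁻¹ := by
    funext φ
    rw [ENNReal.toReal_ofReal (by positivity), smul_eq_mul]
    ring
  rw [this]
  constructor
  · intro h
    have := h.mul_const (∫ ψ, Real.exp (-H ψ))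
    refine this.congr (Eventually.of_forall fun φ => ?_)
    simp only
    rw [mul_assoc, inv_mul_cancel₀ hZ.ne', mul_one]
  · exact fun h => h.mul_const _

lemma prob (g : Conf0 H K c) : IsProbabilityMeasure (gm H) := by
  have hZ := g.Z_pos
  refine ⟨?_⟩
  rw [gm, withDensity_apply _ MeasurableSet.univ, Measure.restrict_univ,
    ← ofReal_integral_eq_lintegral_ofReal (g.integrable_exp.div_const _)
      (Eventually.of_forall fun φ => by positivity), integral_div, div_self hZ.ne', ENNReal.ofReal_one]

lemma integrable_gm (g : Conf0 H K c) {F : (ι → ℝ) → ℝ} (hF : Continuous F)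
    {A : ℝ} {p : ℕ} (hA : ∀ φ, |F φ| ≤ A * (1 + ‖φ‖) ^ p) : Integrable F (gm H) :=
  (g.integrable_gm_iff F).2
    (integrable_growth_exp g.cont g.hc g.lower hF.aestronglyMeasurable hA)

end Conf0

lemma abs_exp_sub_exp_le (a b : ℝ) :
    |Real.exp a - Real.exp b| ≤ |a - b| * (Real.exp a + Real.exp b) := by
  have key : ∀ a b : ℝ, b ≤ a → |Real.exp a - Real.exp b| ≤ |a - b| * (Real.exp a + Real.exp b) := by
    intro a b h
    have h1 : Real.exp b = Real.exp a * Real.exp (b - a) := by rw [← Real.exp_add]; congr 1; ring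
    have h2 := Real.add_one_le_exp (b - a)
    have h3 := Real.exp_le_exp.2 h
    rw [abs_of_nonneg (by linarith), abs_of_nonneg (by linarith)]
    have h4 := mul_le_mul_of_nonneg_left h2 (Real.exp_pos a).le
    have h5 := mul_nonneg (sub_nonneg.2 h) (Real.exp_pos b).le
    nlinarith
  rcases le_total b a with h | h
  · exact key a b h
  · have := key b a h
    rw [abs_sub_comm, abs_sub_comm b a, add_comm (Real.exp b)] at this
    exact this

/-- the position part of the discrete Langevin step -/
def lstep (b : (ι → ℝ) → ι → ℝ) (s : ℝ) (φ z : ι → ℝ) : ι → ℝ := φ - s ^ 2 • b φ + s • z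

/-- the flip of the discrete Langevin step -/
def lflip (b : (ι → ℝ) → ι → ℝ) (s : ℝ) (q : (ι → ℝ) × (ι → ℝ)) : (ι → ℝ) × (ι → ℝ) :=
  (lstep b s q.1 q.2, -q.2 + s • (b q.1 + b (lstep b s q.1 q.2)))

lemma lflip_lflip (b : (ι → ℝ) → ι → ℝ) (s : ℝ) (q : (ι → ℝ) × (ι → ℝ)) :
    lflip b s (lflip b s q) = q := by
  obtain ⟨φ, z⟩ := q
  have h : lstep b s (lflip b s (φ, z)).1 (lflip b s (φ, z)).2 = φ := by
    funext i
    simp only [lflip, lstep, Pi.add_apply, Pi.sub_apply, Pi.smul_apply, Pi.neg_apply, smul_eq_mul]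
    ring
  refine Prod.ext h ?_
  rw [lflip]
  simp only [h]
  funext i
  simp only [lflip, Pi.add_apply, Pi.smul_apply, Pi.neg_apply, smul_eq_mul]
  ring

lemma measurePreserving_lflip {b : (ι → ℝ) → ι → ℝ} (hb : Continuous b) (s : ℝ) :
    MeasurePreserving (lflip b s) := by
  have m1 : MeasurePreserving (fun q : (ι → ℝ) × (ι → ℝ) => (q.1, q.2 - s • b q.1)) :=
    MeasurePreserving.skew_product (g := fun φ z => z - s • b φ) (MeasurePreserving.id volume)
      (by fun_prop) (Eventually.of_forall fun φ => (measurePreserving_sub_right volume (s • b φ)).map_eq)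
  have m2 : MeasurePreserving (fun q : (ι → ℝ) × (ι → ℝ) => (q.1, q.2 + s • q.1)) :=
    MeasurePreserving.skew_product (g := fun z φ => φ + s • z) (MeasurePreserving.id volume)
      (by fun_prop) (Eventually.of_forall fun φ => (measurePreserving_add_right volume (s • φ)).map_eq)
  have m3 : MeasurePreserving (fun q : (ι → ℝ) × (ι → ℝ) => (q.1, -q.2 + s • b q.1)) :=
    MeasurePreserving.skew_product (g := fun φ z => -z + s • b φ) (MeasurePreserving.id volume)
      (by fun_prop) (Eventually.of_forall fun φ =>
        ((measurePreserving_add_right volume (s • b φ)).comp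
          (Measure.measurePreserving_neg volume)).map_eq)
  have sw : MeasurePreserving (Prod.swap : (ι → ℝ) × (ι → ℝ) → (ι → ℝ) × (ι → ℝ)) :=
    Measure.measurePreserving_swap
  have := m3.comp (sw.comp (m2.comp (sw.comp m1)))
  convert this using 1
  funext q
  obtain ⟨φ, z⟩ := q
  have h : lstep b s φ z = φ + s • (z - s • b φ) := by
    funext i
    simp only [lstep, Pi.add_apply, Pi.sub_apply, Pi.smul_apply, smul_eq_mul]
    ring
  refine Prod.ext h ?_
  simp only [lflip, Function.comp, Prod.swap]
  rw [← h]
  funext i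
  simp only [Pi.add_apply, Pi.sub_apply, Pi.smul_apply, Pi.neg_apply, smul_eq_mul]
  ring

namespace Good
variable {H : (ι → ℝ) → ℝ} {b : (ι → ℝ) → ι → ℝ} {K c : ℝ}

lemma norm_lstep_sub_le (g : Good H b K c) {s : ℝ} (hs : 0 ≤ s) (hs1 : s ≤ 1) (φ z : ι → ℝ) :
    ‖lstep b s φ z - φ‖ ≤ s * ((1 + K) * (1 + ‖φ‖) * (1 + ‖z‖)) := by
  have e : lstep b s φ z - φ = s • (z - s • b φ) := by
    funext i
    simp only [lstep, Pi.add_apply, Pi.sub_apply, Pi.smul_apply, smul_eq_mul]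
    ring
  rw [e, norm_smul, Real.norm_of_nonneg hs]
  refine mul_le_mul_of_nonneg_left ?_ hs
  refine (norm_sub_le _ _).trans ?_
  rw [norm_smul, Real.norm_of_nonneg hs]
  have h1 := g.grow φ
  have h2 : s * ‖b φ‖ ≤ 1 * (K * (1 + ‖φ‖)) := mul_le_mul hs1 h1 (norm_nonneg _) zero_le_one
  have hK := g.hK
  have a1 := norm_nonneg φ
  have a2 := norm_nonneg z
  nlinarith [mul_nonneg hK a1, mul_nonneg hK a2, mul_nonneg a1 a2, mul_nonneg (mul_nonneg hK a1) a2]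

lemma log_ratio_le (g : Good H b K c) {s : ℝ} (hs : 0 ≤ s) (hs1 : s ≤ 1) (φ z : ι → ℝ) :
    |(-H (lstep b s φ z) - gH (lflip b s (φ, z)).2) - (-H φ - gH z)| ≤
      (K + Fintype.card ι * K / 2 + Fintype.card ι * K ^ 2) * s ^ 2 *
        ((1 + K) * (1 + ‖φ‖) * (1 + ‖z‖)) ^ 2 := by
  set y := lstep b s φ z with hy
  set D := (1 + K) * (1 + ‖φ‖) * (1 + ‖z‖) with hD
  have hδ : ‖y - φ‖ ≤ s * D := g.norm_lstep_sub_le hs hs1 φ z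
  have hK := g.hK
  have a1 := norm_nonneg φ
  have a2 := norm_nonneg z
  have hDφ : 1 + ‖φ‖ ≤ D := by
    rw [hD]; nlinarith [mul_nonneg hK a1, mul_nonneg hK a2, mul_nonneg a1 a2, mul_nonneg (mul_nonneg hK a1) a2]
  have hD0 : 0 ≤ D := by linarith
  have e0 : (-H y - gH (lflip b s (φ, z)).2) - (-H φ - gH z) =
      -(H (φ + (y - φ)) - H φ - ∑ i, b φ i * (y - φ) i) + 1 / 2 * ∑ i, (b y - b φ) i * (y - φ) i
        - s ^ 2 / 4 * ∑ i, (b φ + b y) i * (b y - b φ) i := by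
    rw [add_sub_cancel, gH, gH]
    simp only [lflip, ← hy]
    have : ∑ i, (-z + s • (b φ + b y)) i ^ 2 - ∑ i, z i ^ 2 = -2 * ∑ i, (b φ + b y) i * (y - φ) i
        + s ^ 2 * ∑ i, (b φ + b y) i * (b y - b φ) i := by
      rw [← Finset.sum_sub_distrib, Finset.mul_sum, Finset.mul_sum, ← Finset.sum_add_distrib]
      refine Finset.sum_congr rfl fun i _ => ?_
      have : y i = φ i - s ^ 2 * b φ i + s * z i := by
        rw [hy]; simp [lstep]
      simp only [Pi.add_apply, Pi.sub_apply, Pi.smul_apply, Pi.neg_apply, smul_eq_mul, this]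
      ring
    have e3 : ∑ i, (b φ + b y) i * (y - φ) i = 2 * ∑ i, b φ i * (y - φ) i + ∑ i, (b y - b φ) i * (y - φ) i := by
      rw [Finset.mul_sum, ← Finset.sum_add_distrib]
      refine Finset.sum_congr rfl fun i _ => ?_
      simp only [Pi.add_apply, Pi.sub_apply]
      ring
    rw [e3] at this
    linarith
  rw [e0]
  have n0 : (0 : ℝ) ≤ Fintype.card ι := Nat.cast_nonneg _
  set n : ℝ := (Fintype.card ι : ℝ)
  have t1 := g.taylor φ (y - φ)
  have t2 := abs_sum_mul_le (b y - b φ) (y - φ)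
  have t3 := abs_sum_mul_le (b φ + b y) (b y - b φ)
  have l1 := g.lip y φ
  have hn := norm_nonneg (y - φ)
  have g2 : ‖b φ + b y‖ ≤ 3 * K * D := by
    have : b φ + b y = (2 : ℝ) • b φ + (b y - b φ) := by
      funext i; simp only [Pi.add_apply, Pi.sub_apply, Pi.smul_apply, smul_eq_mul]; ring
    rw [this]
    refine (norm_add_le _ _).trans ?_
    rw [norm_smul, Real.norm_of_nonneg (by norm_num)]
    have g1 := g.grow φ
    have q1 : K * ‖y - φ‖ ≤ K * (1 * D) := mul_le_mul_of_nonneg_left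
      (hδ.trans (mul_le_mul_of_nonneg_right hs1 hD0)) hK
    have q2 := mul_le_mul_of_nonneg_left hDφ hK
    linarith
  have l2 : ‖b y - b φ‖ ≤ K * (s * D) := l1.trans (mul_le_mul_of_nonneg_left hδ hK)
  have hsD : 0 ≤ s * D := mul_nonneg hs hD0
  have k1 : K * ‖y - φ‖ ^ 2 ≤ K * (s * D) ^ 2 := mul_le_mul_of_nonneg_left (pow_le_pow_left₀ hn hδ 2) hK
  have k2 : n * (‖b y - b φ‖ * ‖y - φ‖) ≤ n * (K * (s * D) * (s * D)) :=
    mul_le_mul_of_nonneg_left (mul_le_mul l2 hδ hn (mul_nonneg hK hsD)) n0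
  have k3 : n * (‖b φ + b y‖ * ‖b y - b φ‖) ≤ n * (3 * K * D * (K * (1 * D))) :=
    mul_le_mul_of_nonneg_left (mul_le_mul g2 (l2.trans (mul_le_mul_of_nonneg_left
      (mul_le_mul_of_nonneg_right hs1 hD0) hK)) (norm_nonneg _) (by positivity)) n0
  have k4 : s ^ 2 / 4 * |∑ i, (b φ + b y) i * (b y - b φ) i| ≤ s ^ 2 / 4 * (n * (3 * K * D * (K * (1 * D)))) :=
    mul_le_mul_of_nonneg_left (t3.trans k3) (by positivity)
  have k5 : 0 ≤ s ^ 2 / 4 * (n * (K * D * (K * D))) := by positivity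
  calc _ ≤ K * ‖y - φ‖ ^ 2 + 1 / 2 * (n * (‖b y - b φ‖ * ‖y - φ‖)) +
        s ^ 2 / 4 * |∑ i, (b φ + b y) i * (b y - b φ) i| := by
        refine (abs_sub _ _).trans ?_
        rw [abs_mul (s ^ 2 / 4), abs_of_nonneg (by positivity : 0 ≤ s ^ 2 / 4)]
        refine add_le_add ((abs_add_le _ _).trans (add_le_add ?_ ?_)) le_rfl
        · rwa [abs_neg]
        · rw [abs_mul, abs_of_pos (by norm_num : (0 : ℝ) < 1 / 2)]; linarith
    _ ≤ _ := by
        have : (K + n * K / 2 + n * K ^ 2) * s ^ 2 * D ^ 2 = K * (s * D) ^ 2 +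
            1 / 2 * (n * (K * (s * D) * (s * D))) + s ^ 2 / 4 * (n * (3 * K * D * (K * (1 * D)))) +
            s ^ 2 / 4 * (n * (K * D * (K * D))) := by ring
        linarith

end Good
end

noncomputable section
set_option linter.unusedSectionVars false
variable {ι : Type*} [Fintype ι]

/-- Lipschitz functions of the configuration -/
def Lip (A : ℝ) (G : (ι → ℝ) → ℝ) : Prop := ∀ φ ψ, |G φ - G ψ| ≤ A * ‖φ - ψ‖

lemma Lip.continuous {A : ℝ} {G : (ι → ℝ) → ℝ} (hA : 0 ≤ A) (h : Lip A G) : Continuous G :=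
  (LipschitzWith.of_dist_le_mul (K := ⟨A, hA⟩) fun x y => by
    rw [Real.dist_eq, dist_eq_norm]; exact h x y).continuous

lemma Lip.growth {A : ℝ} {G : (ι → ℝ) → ℝ} (hA : 0 ≤ A) (h : Lip A G) (φ : ι → ℝ) :
    |G φ| ≤ (|G 0| + A) * (1 + ‖φ‖) ^ 1 := by
  have h1 := h φ 0
  rw [sub_zero] at h1
  have h2 := abs_sub_abs_le_abs_sub (G φ) (G 0)
  nlinarith [norm_nonneg φ, abs_nonneg (G 0), mul_nonneg (abs_nonneg (G 0)) (norm_nonneg φ)]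

lemma Conf0.integrable_lip {H : (ι → ℝ) → ℝ} {K c : ℝ} (g : Conf0 H K c) {A : ℝ}
    {G : (ι → ℝ) → ℝ} (hA : 0 ≤ A) (h : Lip A G) : Integrable G (gm H) :=
  g.integrable_gm (h.continuous hA) (h.growth hA)

/-- the transition operator of the discrete Langevin chain -/
def kop (b : (ι → ℝ) → ι → ℝ) (s : ℝ) (G : (ι → ℝ) → ℝ) (φ : ι → ℝ) : ℝ :=
  ∫ z, G (lstep b s φ z) ∂(gm gH)

instance : IsProbabilityMeasure (gm (gH : (ι → ℝ) → ℝ)) := gH_conf.prob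

/-- the unnormalised joint weight of a configuration and a noise -/
def jw (H : (ι → ℝ) → ℝ) (q : (ι → ℝ) × (ι → ℝ)) : ℝ := Real.exp (-H q.1 - gH q.2)

namespace Good
variable {H : (ι → ℝ) → ℝ} {b : (ι → ℝ) → ι → ℝ} {K c : ℝ}

lemma norm_lstep_lstep (g : Good H b K c) (s : ℝ) (φ ψ z : ι → ℝ) :
    ‖lstep b s φ z - lstep b s ψ z‖ ≤ (1 + K * s ^ 2) * ‖φ - ψ‖ := by
  have e : lstep b s φ z - lstep b s ψ z = (φ - ψ) - s ^ 2 • (b φ - b ψ) := by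
    funext i
    simp only [lstep, Pi.add_apply, Pi.sub_apply, Pi.smul_apply, smul_eq_mul]
    ring
  rw [e]
  refine (norm_sub_le _ _).trans ?_
  rw [norm_smul, Real.norm_of_nonneg (by positivity)]
  have := mul_le_mul_of_nonneg_left (g.lip φ ψ) (sq_nonneg s)
  linarith

lemma lip_lstep_noise (_g : Good H b K c) {A s : ℝ} {G : (ι → ℝ) → ℝ} (h : Lip A G)
    (φ : ι → ℝ) : Lip (A * |s|) fun z => G (lstep b s φ z) := by
  intro z w
  refine (h _ _).trans ?_
  have e : lstep b s φ z - lstep b s φ w = s • (z - w) := by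
    funext i
    simp only [lstep, Pi.add_apply, Pi.sub_apply, Pi.smul_apply, smul_eq_mul]
    ring
  rw [e, norm_smul, Real.norm_eq_abs, mul_assoc]

lemma integrable_lstep (g : Good H b K c) {A s : ℝ} (hA : 0 ≤ A) {G : (ι → ℝ) → ℝ} (h : Lip A G)
    (φ : ι → ℝ) : Integrable (fun z => G (lstep b s φ z)) (gm gH) :=
  gH_conf.integrable_lip (mul_nonneg hA (abs_nonneg s)) (g.lip_lstep_noise h φ)

lemma kop_lip (g : Good H b K c) {A s : ℝ} (hA : 0 ≤ A) {G : (ι → ℝ) → ℝ} (h : Lip A G) :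
    Lip (A * (1 + K * s ^ 2)) (kop b s G) := by
  intro φ ψ
  rw [kop, kop, ← integral_sub (g.integrable_lstep hA h φ) (g.integrable_lstep hA h ψ)]
  refine (abs_integral_le_integral_abs).trans ?_
  have hb : ∀ z, |G (lstep b s φ z) - G (lstep b s ψ z)| ≤ A * (1 + K * s ^ 2) * ‖φ - ψ‖ := by
    intro z
    refine (h _ _).trans ?_
    rw [mul_assoc]
    exact mul_le_mul_of_nonneg_left (g.norm_lstep_lstep s φ ψ z) hA
  refine (integral_mono ((g.integrable_lstep hA h φ).sub (g.integrable_lstep hA h ψ)).abs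
    (integrable_const (A * (1 + K * s ^ 2) * ‖φ - ψ‖)) hb).trans ?_
  simp

lemma iter_lip (g : Good H b K c) {A s : ℝ} (hA : 0 ≤ A) {G : (ι → ℝ) → ℝ} (h : Lip A G) (n : ℕ) :
    Lip (A * (1 + K * s ^ 2) ^ n) ((kop b s)^[n] G) := by
  have hK := g.hK
  induction n with
  | zero => simpa using h
  | succ n ih =>
    rw [Function.iterate_succ_apply', pow_succ, ← mul_assoc]
    exact g.kop_lip (by positivity) ih

lemma integrable_joint (g : Good H b K c) (p : ℕ) :
    Integrable fun q : (ι → ℝ) × (ι → ℝ) =>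
      ((1 + K) * (1 + ‖q.1‖) * (1 + ‖q.2‖)) ^ p * jw H q := by
  have h := ((integrable_poly_exp g.cont_H g.hc g.lower p).mul_prod
    (integrable_poly_exp (gH_cont (ι := ι)) (by norm_num) gH_lower p)).const_mul ((1 + K) ^ p)
  refine h.congr (Eventually.of_forall fun q => ?_)
  simp only [jw, sub_eq_add_neg, Real.exp_add, mul_pow]
  ring

lemma cont_lflip (g : Good H b K c) (s : ℝ) : Continuous (lflip b s) := by
  have := g.cont_b
  unfold lflip lstep
  fun_prop

/-- the flip as a measurable equivalence -/
def flipEquiv (g : Good H b K c) (s : ℝ) : ((ι → ℝ) × (ι → ℝ)) ≃ᵐ ((ι → ℝ) × (ι → ℝ)) where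
  toFun := lflip b s
  invFun := lflip b s
  left_inv := lflip_lflip b s
  right_inv := lflip_lflip b s
  measurable_toFun := (g.cont_lflip s).measurable
  measurable_invFun := (g.cont_lflip s).measurable

lemma integral_lflip (g : Good H b K c) (s : ℝ) (F : (ι → ℝ) × (ι → ℝ) → ℝ) :
    ∫ q, F (lflip b s q) = ∫ q, F q :=
  (measurePreserving_lflip g.cont_b s).integral_comp (g.flipEquiv s).measurableEmbedding F

lemma joint_le (g : Good H b K c) {A : ℝ} (hA : 0 ≤ A) {G : (ι → ℝ) → ℝ} (h : Lip A G)
    {s : ℝ} (hs : 0 ≤ s) (hs1 : s ≤ 1) :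
    Integrable (fun q => (G (lflip b s q).1 - G q.1) * jw H q) ∧
    |∫ q, (G (lflip b s q).1 - G q.1) * jw H q| ≤
      A * s ^ 3 * ((K + Fintype.card ι * K / 2 + Fintype.card ι * K ^ 2) *
        ∫ q, ((1 + K) * (1 + ‖q.1‖) * (1 + ‖q.2‖)) ^ 3 * jw H q) := by
  have H1 : ∀ q : (ι → ℝ) × (ι → ℝ), ‖(lflip b s q).1 - q.1‖ ≤ s * ((1 + K) * (1 + ‖q.1‖) * (1 + ‖q.2‖)) :=
    fun q => g.norm_lstep_sub_le hs hs1 q.1 q.2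
  have H2 : ∀ q, |(-H (lflip b s q).1 - gH (lflip b s q).2) - (-H q.1 - gH q.2)| ≤
      (K + Fintype.card ι * K / 2 + Fintype.card ι * K ^ 2) * s ^ 2 *
        ((1 + K) * (1 + ‖q.1‖) * (1 + ‖q.2‖)) ^ 2 := fun q => g.log_ratio_le hs hs1 q.1 q.2
  have hcT := g.cont_lflip s
  have hTT := lflip_lflip b s
  have hmp := measurePreserving_lflip g.cont_b s
  have hIT := g.integral_lflip s
  generalize lflip b s = T at *
  have hcG := h.continuous hA
  have hcH := g.cont_H
  have hcg := gH_cont (ι := ι)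
  have hK := g.hK
  have hcj : Continuous (jw H) := by unfold jw; fun_prop
  have hjpos : ∀ q, 0 < jw H q := fun q => Real.exp_pos _
  have hδ : ∀ q : (ι → ℝ) × (ι → ℝ), ‖(T q).1 - q.1‖ ≤ s * ((1 + K) * (1 + ‖q.1‖) * (1 + ‖q.2‖)) :=
    fun q => H1 q
  set C1 : ℝ := K + Fintype.card ι * K / 2 + Fintype.card ι * K ^ 2 with hC1
  have hC1' : 0 ≤ C1 := by positivity
  set D : (ι → ℝ) × (ι → ℝ) → ℝ := fun q => (1 + K) * (1 + ‖q.1‖) * (1 + ‖q.2‖) with hD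
  have hD0 : ∀ q, 0 ≤ D q := fun q => by simp only [hD]; positivity
  have hInt : Integrable (fun q => (G (T q).1 - G q.1) * jw H q) := by
    refine ((g.integrable_joint 1).const_mul (A * s)).mono' (by fun_prop)
      (Eventually.of_forall fun q => ?_)
    rw [norm_mul, Real.norm_of_nonneg (hjpos q).le, ← mul_assoc, pow_one, Real.norm_eq_abs]
    refine mul_le_mul_of_nonneg_right ((h _ _).trans ?_) (hjpos q).le
    rw [mul_assoc]
    exact mul_le_mul_of_nonneg_left (hδ q) hA
  refine ⟨hInt, ?_⟩
  set lr : (ι → ℝ) × (ι → ℝ) → ℝ := fun q =>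
    (-H (T q).1 - gH (T q).2) - (-H q.1 - gH q.2) with hlr
  set W : (ι → ℝ) × (ι → ℝ) → ℝ := fun q => ‖(T q).1 - q.1‖ * |lr q| with hW
  have hW0 : ∀ q, 0 ≤ W q := fun q => by simp only [hW]; positivity
  have hWT : ∀ q, W (T q) = W q := by
    intro q
    simp only [hW, hlr]
    rw [hTT, norm_sub_rev, abs_sub_comm]
  have hcW : Continuous W := by simp only [hW, hlr]; fun_prop
  have hWle : ∀ q, W q * jw H q ≤ C1 * s ^ 3 * (D q ^ 3 * jw H q) := by
    intro q
    have h1 : |lr q| ≤ C1 * s ^ 2 * D q ^ 2 := H2 q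
    have h2 : W q ≤ (s * D q) * (C1 * s ^ 2 * D q ^ 2) :=
      mul_le_mul (hδ q) h1 (abs_nonneg _) (mul_nonneg hs (hD0 q))
    calc W q * jw H q ≤ ((s * D q) * (C1 * s ^ 2 * D q ^ 2)) * jw H q :=
          mul_le_mul_of_nonneg_right h2 (hjpos q).le
      _ = _ := by ring
  have hWint : Integrable fun q => W q * jw H q := by
    refine ((g.integrable_joint 3).const_mul (C1 * s ^ 3)).mono' (by fun_prop)
      (Eventually.of_forall fun q => ?_)
    rw [Real.norm_of_nonneg (mul_nonneg (hW0 q) (hjpos q).le)]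
    exact hWle q
  have hWint' : Integrable fun q => W q * jw H (T q) := by
    have := hmp.integrable_comp_of_integrable hWint
    refine this.congr (Eventually.of_forall fun q => ?_)
    simp only [Function.comp, hWT]
  have hInt' : Integrable (fun q => (G (T q).1 - G q.1) * jw H (T q)) := by
    have := (hmp.integrable_comp_of_integrable hInt).neg
    refine this.congr (Eventually.of_forall fun q => ?_)
    simp only [Function.comp, Pi.neg_apply, hTT]
    ring
  have e1 : ∫ q, (G (T q).1 - G q.1) * jw H (T q) =
      -∫ q, (G (T q).1 - G q.1) * jw H q := by
    rw [← hIT, ← integral_neg]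
    refine integral_congr_ae (Eventually.of_forall fun q => ?_)
    simp only [hTT]
    ring
  have e2 : ∫ q, W q * jw H (T q) = ∫ q, W q * jw H q := by
    rw [← hIT (fun q => W q * jw H q)]
    refine integral_congr_ae (Eventually.of_forall fun q => ?_)
    simp only [hWT]
  have e3 : 2 * ∫ q, (G (T q).1 - G q.1) * jw H q =
      ∫ q, (G (T q).1 - G q.1) * (jw H q - jw H (T q)) := by
    simp only [mul_sub]
    rw [integral_sub hInt hInt', e1]
    ring
  have e4 : |∫ q, (G (T q).1 - G q.1) * (jw H q - jw H (T q))| ≤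
      ∫ q, A * (W q * jw H q + W q * jw H (T q)) := by
    refine abs_integral_le_integral_abs.trans ?_
    refine integral_mono_of_nonneg (Eventually.of_forall fun q => abs_nonneg _)
      ((hWint.add hWint').const_mul A) (Eventually.of_forall fun q => ?_)
    simp only
    rw [abs_mul]
    have h1 := abs_exp_sub_exp_le (-H q.1 - gH q.2) (-H (T q).1 - gH (T q).2)
    have h2 : |jw H q - jw H (T q)| ≤ |lr q| * (jw H q + jw H (T q)) := by
      rw [abs_sub_comm (-H q.1 - gH q.2)] at h1
      exact h1
    calc _ ≤ (A * ‖(T q).1 - q.1‖) * (|lr q| * (jw H q + jw H (T q))) :=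
          mul_le_mul (h _ _) h2 (abs_nonneg _) (mul_nonneg hA (norm_nonneg _))
      _ = _ := by simp only [hW]; ring
  rw [integral_const_mul, integral_add hWint hWint', e2] at e4
  have e5 : ∫ q, W q * jw H q ≤ C1 * s ^ 3 * ∫ q, D q ^ 3 * jw H q := by
    rw [← integral_const_mul]
    exact integral_mono hWint ((g.integrable_joint 3).const_mul _) hWle
  rw [← e3, abs_mul, abs_of_pos (by norm_num : (0 : ℝ) < 2)] at e4
  have e6 := mul_le_mul_of_nonneg_left e5 hA
  calc _ ≤ A * ∫ q, W q * jw H q := by linarith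
    _ ≤ _ := e6
    _ = _ := by ring

/-- the Gibbs measure is almost invariant under one step of the chain -/
lemma almost_stationary (g : Good H b K c) : ∃ C : ℝ, 0 ≤ C ∧ ∀ A : ℝ, 0 ≤ A →
    ∀ G : (ι → ℝ) → ℝ, Lip A G → ∀ s : ℝ, 0 ≤ s → s ≤ 1 →
    |∫ φ, kop b s G φ ∂(gm H) - ∫ φ, G φ ∂(gm H)| ≤ C * (A * s ^ 3) := by
  have hK := g.hK
  have hZ := g.conf.Z_pos
  have hZg := gH_conf.Z_pos (ι := ι)
  set Z := ∫ φ, Real.exp (-H φ)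
  set Zg := ∫ φ : ι → ℝ, Real.exp (-gH φ)
  have hI0 : 0 ≤ ∫ q, ((1 + K) * (1 + ‖q.1‖) * (1 + ‖q.2‖)) ^ 3 * jw H q :=
    integral_nonneg fun q => mul_nonneg (by positivity) (Real.exp_pos _).le
  refine ⟨((K + Fintype.card ι * K / 2 + Fintype.card ι * K ^ 2) *
        ∫ q, ((1 + K) * (1 + ‖q.1‖) * (1 + ‖q.2‖)) ^ 3 * jw H q) / (Zg * Z), by positivity,
    fun A hA G hG s hs hs1 => ?_⟩
  obtain ⟨hInt, hle⟩ := g.joint_le hA hG hs hs1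
  have hk := g.kop_lip (s := s) hA hG
  have h1 : ∫ φ, kop b s G φ ∂(gm H) - ∫ φ, G φ ∂(gm H) =
      (∫ q, (G (lflip b s q).1 - G q.1) * jw H q) / (Zg * Z) := by
    rw [← integral_sub (g.conf.integrable_lip (by positivity) hk) (g.conf.integrable_lip hA hG),
      g.conf.integral_gm, Measure.volume_eq_prod, integral_prod _ hInt, div_mul_eq_div_div]
    congr 1
    rw [← integral_div]
    refine integral_congr_ae (Eventually.of_forall fun φ => ?_)
    simp only
    have e1 : kop b s G φ - G φ = ∫ z, (G (lstep b s φ z) - G φ) ∂(gm gH) := by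
      rw [integral_sub (g.integrable_lstep hA hG φ) (integrable_const _), kop]
      simp
    rw [e1, gH_conf.integral_gm, div_mul_eq_mul_div]
    congr 1
    rw [← integral_mul_const]
    refine integral_congr_ae (Eventually.of_forall fun z => ?_)
    simp only [jw, lflip, sub_eq_add_neg, Real.exp_add]
    ring
  rw [h1, abs_div, abs_of_pos (by positivity : 0 < Zg * Z), div_mul_eq_mul_div]
  refine div_le_div_of_nonneg_right (hle.trans (le_of_eq ?_)) (by positivity)
  ring

end Good
end

noncomputable section
set_option linter.unusedSectionVars false
variable {ι : Type*} [Fintype ι]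

/-- two discrete Langevin trajectories driven by the same noise -/
def Coupled (b b' : (ι → ℝ) → ι → ℝ) (s : ℝ) (p p' : ℕ → ι → ℝ) : Prop :=
  ∀ n, p' (n + 1) - p' n + s ^ 2 • b' (p' n) = p (n + 1) - p n + s ^ 2 • b (p n)

lemma Coupled.cons {b b' : (ι → ℝ) → ι → ℝ} {s : ℝ} {p p' : ℕ → ι → ℝ} {φ φ' z : ι → ℝ}
    (h : Coupled b b' s p p') (h0 : p 0 = lstep b s φ z) (h0' : p' 0 = lstep b' s φ' z) :
    Coupled b b' s (fun n => Nat.casesOn n φ p) (fun n => Nat.casesOn n φ' p') := by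
  intro n
  cases n with
  | zero =>
    change p' 0 - φ' + s ^ 2 • b' φ' = p 0 - φ + s ^ 2 • b φ
    rw [h0, h0', lstep, lstep]
    abel
  | succ n => exact h n

lemma integral_sub_le_of_pointwise {E : Type*} [MeasurableSpace E] {μ μ' : Measure E}
    [IsProbabilityMeasure μ] [IsProbabilityMeasure μ'] {F F' G G' : E → ℝ} {B ε : ℝ}
    (hF' : Integrable F' μ') (hF : Integrable F μ) (hG' : Integrable G' μ') (hG : Integrable G μ)
    (h : ∀ φ φ', F' φ' - F φ ≤ B + ε * (G' φ' * G φ)) :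
    ∫ φ, F' φ ∂μ' - ∫ φ, F φ ∂μ ≤ B + ε * ((∫ φ, G' φ ∂μ') * ∫ φ, G φ ∂μ) := by
  have h1 : ∀ φ, ∫ φ', F' φ' ∂μ' ≤ (F φ + (ε * ∫ φ', G' φ' ∂μ') * G φ) + B := by
    intro φ
    have := integral_mono (μ := μ') (g := fun φ' => (ε * G φ) * G' φ' + (F φ + B)) hF'
      ((hG'.const_mul _).add (integrable_const _)) (fun φ' => by
        have := h φ φ'
        simp only
        linarith)
    rw [integral_add (hG'.const_mul _) (integrable_const _), integral_const_mul] at this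
    simp only [integral_const, probReal_univ, one_smul] at this
    linarith
  have hFn : Integrable (fun φ => F φ + (ε * ∫ φ', G' φ' ∂μ') * G φ) μ := hF.add (hG.const_mul _)
  have := integral_mono (μ := μ) (g := fun φ => (F φ + (ε * ∫ φ', G' φ' ∂μ') * G φ) + B)
    (integrable_const (∫ φ', F' φ' ∂μ')) (hFn.add (integrable_const B)) h1
  rw [integral_add hFn (integrable_const _), integral_add hF (hG.const_mul _), integral_const_mul] at this
  simp only [integral_const, probReal_univ, one_smul] at this
  linarith

namespace Good
variable {H H' : (ι → ℝ) → ℝ} {b b' : (ι → ℝ) → ι → ℝ} {K c K' c' : ℝ}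

lemma iter_stationary (g : Good H b K c) : ∃ C : ℝ, 0 ≤ C ∧ ∀ A : ℝ, 0 ≤ A →
    ∀ G : (ι → ℝ) → ℝ, Lip A G → ∀ s : ℝ, 0 ≤ s → s ≤ 1 → ∀ (τ : ℝ) (n : ℕ), n * s ^ 2 ≤ τ →
    |∫ φ, ((kop b s)^[n] G) φ ∂(gm H) - ∫ φ, G φ ∂(gm H)| ≤
      C * (A * Real.exp (K * τ)) * τ * s := by
  obtain ⟨C, hC, h⟩ := g.almost_stationary
  have hK := g.hK
  refine ⟨C, hC, fun A hA G hG s hs hs1 τ n hn => ?_⟩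
  have hτ : 0 ≤ τ := le_trans (by positivity) hn
  have key : ∀ m : ℕ, m ≤ n → |∫ φ, ((kop b s)^[m] G) φ ∂(gm H) - ∫ φ, G φ ∂(gm H)| ≤
      m * (C * (A * Real.exp (K * τ) * s ^ 3)) := by
    intro m
    induction m with
    | zero => intro _; simp
    | succ m ih =>
      intro hm
      have h1 := ih (by omega)
      have h2 := h _ (by positivity) _ (g.iter_lip (s := s) hA hG m) s hs hs1
      have h3 : (1 + K * s ^ 2) ^ m ≤ Real.exp (K * τ) := by
        have e1 : 1 + K * s ^ 2 ≤ Real.exp (K * s ^ 2) := by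
          have := Real.add_one_le_exp (K * s ^ 2); linarith
        refine (pow_le_pow_left₀ (by positivity) e1 m).trans ?_
        rw [← Real.exp_nat_mul]
        refine Real.exp_le_exp.2 ?_
        have e2 : (m : ℝ) * s ^ 2 ≤ n * s ^ 2 :=
          mul_le_mul_of_nonneg_right (by exact_mod_cast (by omega : m ≤ n)) (sq_nonneg s)
        calc (m : ℝ) * (K * s ^ 2) = K * (m * s ^ 2) := by ring
          _ ≤ K * τ := mul_le_mul_of_nonneg_left (e2.trans hn) hK
      have h4 : C * (A * (1 + K * s ^ 2) ^ m * s ^ 3) ≤ C * (A * Real.exp (K * τ) * s ^ 3) := by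
        gcongr
      rw [Function.iterate_succ_apply', Nat.cast_succ, add_mul, one_mul]
      have h5 := abs_sub_le (∫ φ, kop b s ((kop b s)^[m] G) φ ∂(gm H))
        (∫ φ, ((kop b s)^[m] G) φ ∂(gm H)) (∫ φ, G φ ∂(gm H))
      linarith
  have h0 : 0 ≤ C * (A * Real.exp (K * τ)) * s := by positivity
  have h1 := mul_le_mul_of_nonneg_left hn h0
  calc _ ≤ n * (C * (A * Real.exp (K * τ) * s ^ 3)) := key n le_rfl
    _ = C * (A * Real.exp (K * τ)) * s * (n * s ^ 2) := by ring
    _ ≤ _ := h1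
    _ = _ := by ring

lemma path_bound (g : Good H b K c) (g' : Good H' b' K' c') (ℓ : (ι → ℝ) →L[ℝ] ℝ) (s : ℝ) (N : ℕ) :
    ∀ (w : ℕ → ℝ) (φ φ' : ι → ℝ) (B : ℝ),
      (∀ p p', p 0 = φ → p' 0 = φ' → Coupled b b' s p p' →
        ∑ n ∈ Finset.range N, w n * ℓ (p' n - p n) ≤ B) →
      ∑ n ∈ Finset.range N, w n * (((kop b' s)^[n] ℓ) φ' - ((kop b s)^[n] ℓ) φ) ≤ B := by
  have hl : Lip ‖ℓ‖ ℓ := fun φ ψ => by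
    rw [← map_sub, ← Real.norm_eq_abs]; exact ℓ.le_opNorm _
  have hK := g.hK
  have hK' := g'.hK
  induction N with
  | zero =>
    intro w φ φ' B h
    simp only [Finset.range_zero, Finset.sum_empty] at h ⊢
    exact h (fun n => (fun ψ => lstep b s ψ 0)^[n] φ) (fun n => (fun ψ => lstep b' s ψ 0)^[n] φ') rfl rfl
      (fun n => by
        simp only [Function.iterate_succ_apply', lstep]; abel)
  | succ N ih =>
    intro w φ φ' B h
    rw [Finset.sum_range_succ']
    have hInt : ∀ n, Integrable (fun z => ((kop b s)^[n] ℓ) (lstep b s φ z)) (gm gH) := fun n =>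
      g.integrable_lstep (by positivity) (g.iter_lip (s := s) (norm_nonneg ℓ) hl n) φ
    have hInt' : ∀ n, Integrable (fun z => ((kop b' s)^[n] ℓ) (lstep b' s φ' z)) (gm gH) := fun n =>
      g'.integrable_lstep (by positivity) (g'.iter_lip (s := s) (norm_nonneg ℓ) hl n) φ'
    have hsub : ∀ n, Integrable (fun z => w (n + 1) * (((kop b' s)^[n] ℓ) (lstep b' s φ' z) -
        ((kop b s)^[n] ℓ) (lstep b s φ z))) (gm gH) := fun n => ((hInt' n).sub (hInt n)).const_mul _
    have e : ∑ n ∈ Finset.range N, w (n + 1) *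
        (((kop b' s)^[n + 1] ℓ) φ' - ((kop b s)^[n + 1] ℓ) φ) =
        ∫ z, ∑ n ∈ Finset.range N, w (n + 1) *
        (((kop b' s)^[n] ℓ) (lstep b' s φ' z) - ((kop b s)^[n] ℓ) (lstep b s φ z)) ∂(gm gH) := by
      rw [integral_finsetSum _ fun n _ => hsub n]
      refine Finset.sum_congr rfl fun n _ => ?_
      rw [integral_const_mul, integral_sub (hInt' n) (hInt n), Function.iterate_succ_apply',
        Function.iterate_succ_apply']
      rfl
    rw [e]
    have hz : ∀ z, ∑ n ∈ Finset.range N, w (n + 1) *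
        (((kop b' s)^[n] ℓ) (lstep b' s φ' z) - ((kop b s)^[n] ℓ) (lstep b s φ z)) ≤
        B - w 0 * ℓ (φ' - φ) := by
      intro z
      refine ih (fun n => w (n + 1)) _ _ _ fun p p' h0 h0' hp => ?_
      have := h _ _ rfl rfl (hp.cons h0 h0')
      rw [Finset.sum_range_succ'] at this
      exact le_sub_iff_add_le.2 this
    have := integral_mono (integrable_finsetSum _ fun n _ => hsub n)
      (integrable_const (μ := gm (gH : (ι → ℝ) → ℝ)) (B - w 0 * ℓ (φ' - φ))) hz
    simp only [integral_const, probReal_univ, one_smul] at this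
    simp only [Function.iterate_zero, id]
    rw [map_sub] at this
    linarith

/-- comparison of the means of two Gibbs measures through coupled trajectories -/
theorem mean_le_of_coupling (g : Good H b K c) (g' : Good H' b' K' c') (ℓ : (ι → ℝ) →L[ℝ] ℝ) (B : ℝ)
    (hyp : ∀ ε > 0, ∃ τ : ℝ, ∃ s₀ > 0, ∀ s, 0 < s → s < s₀ → ∃ N : ℕ, N * s ^ 2 ≤ τ ∧
      ∃ w : ℕ → ℝ, (∀ n, 0 ≤ w n) ∧ ∑ n ∈ Finset.range N, w n = 1 ∧ ∀ p p', Coupled b b' s p p' →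
        ∑ n ∈ Finset.range N, w n * ℓ (p' n - p n) ≤ B + ε * (1 + ‖p' 0 - p 0‖) ^ 2) :
    ∫ φ, ℓ φ ∂(gm H') - ∫ φ, ℓ φ ∂(gm H) ≤ B := by
  have hl : Lip ‖ℓ‖ ℓ := fun φ ψ => by
    rw [← map_sub, ← Real.norm_eq_abs]; exact ℓ.le_opNorm _
  have hK := g.hK
  have hK' := g'.hK
  have := g.conf.prob
  have := g'.conf.prob
  obtain ⟨C, hC, hst⟩ := g.iter_stationary
  obtain ⟨C', hC', hst'⟩ := g'.iter_stationary
  have hn : Integrable (fun φ : ι → ℝ => (1 + ‖φ‖) ^ 2) (gm H) := g.conf.integrable_gm (by fun_prop)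
    (A := 1) (p := 2) fun φ => by rw [one_mul, abs_of_nonneg (by positivity)]
  have hn' : Integrable (fun φ : ι → ℝ => (1 + ‖φ‖) ^ 2) (gm H') := g'.conf.integrable_gm (by fun_prop)
    (A := 1) (p := 2) fun φ => by rw [one_mul, abs_of_nonneg (by positivity)]
  have hM : 0 ≤ ∫ φ : ι → ℝ, (1 + ‖φ‖) ^ 2 ∂(gm H) := integral_nonneg fun _ => sq_nonneg _
  have hM' : 0 ≤ ∫ φ : ι → ℝ, (1 + ‖φ‖) ^ 2 ∂(gm H') := integral_nonneg fun _ => sq_nonneg _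
  set M := ∫ φ : ι → ℝ, (1 + ‖φ‖) ^ 2 ∂(gm H)
  set M' := ∫ φ : ι → ℝ, (1 + ‖φ‖) ^ 2 ∂(gm H')
  refine le_of_forall_pos_le_add fun η hη => ?_
  set ε := η / (2 * (1 + M * M')) with hε
  have hε0 : 0 < ε := by positivity
  obtain ⟨τ, s₀, hs₀, hs⟩ := hyp ε hε0
  obtain ⟨Q, hQ0, hQ⟩ : ∃ Q : ℝ, 0 < Q ∧ |C * (‖ℓ‖ * Real.exp (K * τ)) * τ| +
      |C' * (‖ℓ‖ * Real.exp (K' * τ)) * τ| ≤ Q := ⟨_, by positivity, (lt_add_one _).le⟩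
  obtain ⟨s, hs0, hss, hs1, hsQ⟩ : ∃ s : ℝ, 0 < s ∧ s < s₀ ∧ s ≤ 1 ∧ Q * s ≤ η / 2 := by
    refine ⟨min (s₀ / 2) (min 1 (η / 2 / Q)), by positivity, ?_, ?_, ?_⟩
    · exact (min_le_left _ _).trans_lt (by linarith)
    · exact (min_le_right _ _).trans (min_le_left _ _)
    · calc Q * min (s₀ / 2) (min 1 (η / 2 / Q)) ≤ Q * (η / 2 / Q) :=
          mul_le_mul_of_nonneg_left ((min_le_right _ _).trans (min_le_right _ _)) hQ0.le
        _ = η / 2 := by field_simp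
  obtain ⟨N, hN, w, hw0, hw1, hpath⟩ := hs s hs0 hss
  have hInt : ∀ n, Integrable ((kop b s)^[n] ℓ) (gm H) := fun n =>
    g.conf.integrable_lip (by positivity) (g.iter_lip (s := s) (norm_nonneg ℓ) hl n)
  have hInt' : ∀ n, Integrable ((kop b' s)^[n] ℓ) (gm H') := fun n =>
    g'.conf.integrable_lip (by positivity) (g'.iter_lip (s := s) (norm_nonneg ℓ) hl n)
  set F : (ι → ℝ) → ℝ := fun φ => ∑ n ∈ Finset.range N, w n * ((kop b s)^[n] ℓ) φ with hF
  set F' : (ι → ℝ) → ℝ := fun φ => ∑ n ∈ Finset.range N, w n * ((kop b' s)^[n] ℓ) φ with hF'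
  have hFi : Integrable F (gm H) := integrable_finsetSum _ fun n _ => (hInt n).const_mul _
  have hFi' : Integrable F' (gm H') := integrable_finsetSum _ fun n _ => (hInt' n).const_mul _
  have hpt : ∀ φ φ', F' φ' - F φ ≤ B + ε * ((1 + ‖φ'‖) ^ 2 * (1 + ‖φ‖) ^ 2) := by
    intro φ φ'
    have h1 := g.path_bound g' ℓ s N w φ φ' (B + ε * (1 + ‖φ' - φ‖) ^ 2) (fun p p' h0 h0' hp => by
      rw [← h0, ← h0']; exact hpath p p' hp)
    have h2 : F' φ' - F φ = ∑ n ∈ Finset.range N, w n * (((kop b' s)^[n] ℓ) φ' - ((kop b s)^[n] ℓ) φ) := by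
      rw [hF, hF', ← Finset.sum_sub_distrib]
      exact Finset.sum_congr rfl fun n _ => (mul_sub _ _ _).symm
    have h3 : 1 + ‖φ' - φ‖ ≤ (1 + ‖φ'‖) * (1 + ‖φ‖) := by
      have := norm_sub_le φ' φ
      nlinarith [mul_nonneg (norm_nonneg φ') (norm_nonneg φ)]
    have h4 : (1 + ‖φ' - φ‖) ^ 2 ≤ (1 + ‖φ'‖) ^ 2 * (1 + ‖φ‖) ^ 2 := by
      rw [← mul_pow]; exact pow_le_pow_left₀ (by positivity) h3 2
    have h5 := mul_le_mul_of_nonneg_left h4 hε0.le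
    rw [h2]
    linarith
  have hmean : ∫ φ', F' φ' ∂(gm H') - ∫ φ, F φ ∂(gm H) ≤ B + ε * (M' * M) := by
    exact integral_sub_le_of_pointwise hFi' hFi hn' hn hpt
  have hsum : ∫ φ, F φ ∂(gm H) ≤ ∫ φ, ℓ φ ∂(gm H) + C * (‖ℓ‖ * Real.exp (K * τ)) * τ * s := by
    rw [hF, integral_finsetSum _ fun n _ => (hInt n).const_mul _]
    calc _ ≤ ∑ n ∈ Finset.range N, w n * (∫ φ, ℓ φ ∂(gm H) + C * (‖ℓ‖ * Real.exp (K * τ)) * τ * s) := by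
          refine Finset.sum_le_sum fun n hnN => ?_
          rw [integral_const_mul]
          refine mul_le_mul_of_nonneg_left ?_ (hw0 n)
          have hnN' : (n : ℝ) ≤ N := by exact_mod_cast (Finset.mem_range.1 hnN).le
          have := hst _ (norm_nonneg ℓ) _ hl s hs0.le hs1 τ n
            ((mul_le_mul_of_nonneg_right hnN' (sq_nonneg s)).trans hN)
          linarith [le_abs_self (∫ φ, ((kop b s)^[n] ℓ) φ ∂(gm H) - ∫ φ, ℓ φ ∂(gm H))]
      _ = _ := by rw [← Finset.sum_mul, hw1, one_mul]
  have hsum' : ∫ φ, ℓ φ ∂(gm H') - C' * (‖ℓ‖ * Real.exp (K' * τ)) * τ * s ≤ ∫ φ, F' φ ∂(gm H') := by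
    rw [hF', integral_finsetSum _ fun n _ => (hInt' n).const_mul _]
    calc _ = ∑ n ∈ Finset.range N, w n * (∫ φ, ℓ φ ∂(gm H') - C' * (‖ℓ‖ * Real.exp (K' * τ)) * τ * s) := by
          rw [← Finset.sum_mul, hw1, one_mul]
      _ ≤ _ := by
          refine Finset.sum_le_sum fun n hnN => ?_
          rw [integral_const_mul]
          refine mul_le_mul_of_nonneg_left ?_ (hw0 n)
          have hnN' : (n : ℝ) ≤ N := by exact_mod_cast (Finset.mem_range.1 hnN).le
          have := hst' _ (norm_nonneg ℓ) _ hl s hs0.le hs1 τ n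
            ((mul_le_mul_of_nonneg_right hnN' (sq_nonneg s)).trans hN)
          linarith [neg_abs_le (∫ φ, ((kop b' s)^[n] ℓ) φ ∂(gm H') - ∫ φ, ℓ φ ∂(gm H'))]
  have f1 : C * (‖ℓ‖ * Real.exp (K * τ)) * τ * s + C' * (‖ℓ‖ * Real.exp (K' * τ)) * τ * s ≤ Q * s := by
    rw [← add_mul]
    refine mul_le_mul_of_nonneg_right (le_trans (add_le_add (le_abs_self _) (le_abs_self _)) hQ) hs0.le
  have f2 : ε * (M' * M) ≤ η / 2 := by
    have : ε * (1 + M * M') = η / 2 := by rw [hε]; field_simp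
    linarith
  linarith

end Good
end

noncomputable section
variable {d : ℕ}

lemma exists_poincare (hd : 1 ≤ d) (U B : Finset (Zd d)) : ∃ P : ℝ, 0 < P ∧
    ∀ v : Zd d → ℝ, SuppIn B v → (∀ x, v x ≠ 0 → x ∈ U) → ∑ x ∈ B, v x ^ 2 ≤ P * En B v := by
  have hr : 2 * U.card ≤ (2 * U.card + 1) ^ d :=
    (Nat.le_succ _).trans (Nat.le_self_pow (by omega) _)
  refine ⟨2 * (d * ((2 * U.card + 1 : ℕ) : ℝ)) ^ 2, ?_, fun v hv hU => ?_⟩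
  · have : (0 : ℝ) < d := by exact_mod_cast hd
    positivity
  · refine le_trans (le_of_eq ?_) (faber_krahn B U v hv hU _ hr)
    have e1 : ∑ x ∈ B, v x ^ 2 = ∑ x ∈ B ∩ U, v x ^ 2 := by
      refine (Finset.sum_subset Finset.inter_subset_left fun x hx hn => ?_).symm
      by_contra h0
      exact hn (Finset.mem_inter.2 ⟨hx, hU x fun h => h0 (by rw [h]; simp)⟩)
    have e2 : ∑ x ∈ U, v x ^ 2 = ∑ x ∈ B ∩ U, v x ^ 2 := by
      refine (Finset.sum_subset Finset.inter_subset_right fun x hx hn => ?_).symm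
      by_contra h0
      have : v x ≠ 0 := fun h => h0 (by rw [h]; simp)
      exact hn (Finset.mem_inter.2 ⟨(hv x this).1, hx⟩)
    rw [e1, e2]

/-- long-time maximum principle for discrete caloric functions -/
lemma caloric_eventually_le (hd : 1 ≤ d) {lam Lam : ℝ} (hl : 0 < lam) (U : Finset (Zd d)) (M : ℝ)
    {ε : ℝ} (hε : 0 < ε) : ∃ τ : ℝ, 0 ≤ τ ∧ ∀ h : ℝ, 0 < h → 2 * d * Lam * h ≤ 1 / 2 →
      ∀ a : ℕ → Zd d → Zd d → ℝ, (∀ n, Ell lam Lam (a n)) → ∀ u : ℕ → Zd d → ℝ,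
      (∀ n, ∀ x ∈ U, u (n + 1) x = u n x + h * Lap (a n) (u n) x) →
      (∀ n, ∀ x ∈ U, ∀ k, nbr x k ∉ U → u n (nbr x k) ≤ M) →
      ∀ A : ℝ, (∀ x ∈ U, |u 0 x| ≤ A) → ∀ n : ℕ, τ ≤ n * h → ∀ x ∈ U, u n x ≤ M + ε * (1 + A) := by
  classical
  obtain ⟨B, hB⟩ := exists_suppIn U
  obtain ⟨P, hP, hpoin⟩ := exists_poincare hd U B
  set θ := lam / (2 * P) with hθ
  have hθ0 : 0 < θ := by positivity
  set Q : ℝ := (U.card + 1) * (1 + |M|) ^ 2 with hQ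
  have hQ0 : 0 < Q := by positivity
  obtain ⟨τ, hτ0, hτ⟩ : ∃ τ : ℝ, 0 ≤ τ ∧ ∀ t, τ ≤ t → Q * Real.exp (-(θ * t)) ≤ ε ^ 2 := by
    have h1 : Tendsto (fun t : ℝ => Q * Real.exp (-(θ * t))) atTop (nhds (Q * 0)) :=
      (Real.tendsto_exp_neg_atTop_nhds_zero.comp (tendsto_id.const_mul_atTop hθ0)).const_mul Q
    rw [mul_zero] at h1
    obtain ⟨τ, hτ⟩ := Filter.eventually_atTop.1 (h1.eventually (eventually_le_nhds (show (0 : ℝ) < ε ^ 2 by positivity)))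
    exact ⟨max τ 0, le_max_right _ _, fun t ht => hτ t ((le_max_left _ _).trans ht)⟩
  refine ⟨τ, hτ0, fun h hh hh' a ha u hcal hbd A hA n hn x hx => ?_⟩
  have hA0 : 0 ≤ A := (abs_nonneg _).trans (hA x hx)
  set v : ℕ → Zd d → ℝ := fun n x => if x ∈ U then max ((u n x - M) * 1) 0 else 0 with hv
  have hvU : ∀ n x, v n x ≠ 0 → x ∈ U := by
    intro n x h0
    by_contra h1
    exact h0 (by simp only [hv]; rw [if_neg h1])
  have hvS : ∀ n, SuppIn B (v n) := fun n x h0 => hB x (hvU n x h0)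
  have hv0 : ∀ n x, 0 ≤ v n x := by
    intro n x
    simp only [hv]
    split_ifs
    · exact le_max_right _ _
    · exact le_rfl
  have hLam : 0 ≤ Lam := hl.le.trans (((ha 0).lower 0 0).trans ((ha 0).upper 0 0))
  have hstep : ∀ n, ∑ x ∈ B, v (n + 1) x ^ 2 ≤ (1 - h * θ) * ∑ x ∈ B, v n x ^ 2 := by
    intro n
    have h1 := sum_sq_step_le hl (ha n) hh.le hh' (hvS n) (v' := v (n + 1)) (fun x _ => hv0 _ _)
      (fun x _ h0 => by
        have hxU := hvU _ _ h0
        have e := posPart_step hl (ha n) hh.le (by linarith) (c := M) (s := 1) zero_le_one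
          (hcal n x hxU).le
        have e1 : v (n + 1) x = max ((u (n + 1) x - M) * 1) 0 := if_pos hxU
        have e2 : v n x = max ((u n x - M) * 1) 0 := if_pos hxU
        have e3 : Lap (a n) (v n) x = Lap (a n) (fun y => max ((u n y - M) * 1) 0) x := by
          unfold Lap
          refine Finset.sum_congr rfl fun k _ => ?_
          rw [e2]
          by_cases hk : nbr x k ∈ U
          · rw [show v n (nbr x k) = max ((u n (nbr x k) - M) * 1) 0 from if_pos hk]
          · have e4 : max ((u n (nbr x k) - M) * 1) 0 = 0 := max_eq_right (by linarith [hbd n x hxU k hk])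
            rw [show v n (nbr x k) = 0 from if_neg hk]
            simp only [e4]
        rw [e1, e3, e2]
        exact e)
    have h2 := hpoin (v n) (hvS n) (hvU n)
    have h3 : θ * ∑ x ∈ B, v n x ^ 2 ≤ lam / 2 * En B (v n) := by
      calc θ * ∑ x ∈ B, v n x ^ 2 ≤ θ * (P * En B (v n)) := mul_le_mul_of_nonneg_left h2 hθ0.le
        _ = _ := by rw [hθ]; field_simp
    have h4 := mul_le_mul_of_nonneg_left h3 hh.le
    linarith
  have hdec : ∀ n : ℕ, ∑ x ∈ B, v n x ^ 2 ≤ Real.exp (-(θ * (n * h))) * ∑ x ∈ B, v 0 x ^ 2 := by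
    intro n
    induction n with
    | zero => simp
    | succ n ih =>
      have hS0 : 0 ≤ ∑ x ∈ B, v n x ^ 2 := Finset.sum_nonneg fun _ _ => sq_nonneg _
      have h1 : 1 - h * θ ≤ Real.exp (-(h * θ)) := by
        have := Real.add_one_le_exp (-(h * θ)); linarith
      calc _ ≤ (1 - h * θ) * ∑ x ∈ B, v n x ^ 2 := hstep n
        _ ≤ Real.exp (-(h * θ)) * ∑ x ∈ B, v n x ^ 2 := mul_le_mul_of_nonneg_right h1 hS0
        _ ≤ Real.exp (-(h * θ)) * (Real.exp (-(θ * (n * h))) * ∑ x ∈ B, v 0 x ^ 2) :=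
          mul_le_mul_of_nonneg_left ih (Real.exp_pos _).le
        _ = _ := by
          rw [← mul_assoc, ← Real.exp_add]
          congr 2
          push_cast
          ring
  have hstart : ∑ x ∈ B, v 0 x ^ 2 ≤ Q * (1 + A) ^ 2 := by
    have e : ∑ x ∈ B, v 0 x ^ 2 = ∑ x ∈ U, v 0 x ^ 2 := by
      refine (Finset.sum_subset (fun x hx => (hB x hx).1) fun x _ hn => ?_).symm
      rw [show v 0 x = 0 from if_neg hn]; norm_num
    rw [e]
    have hb : ∀ x ∈ U, v 0 x ^ 2 ≤ (1 + |M|) ^ 2 * (1 + A) ^ 2 := by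
      intro x hx
      rw [← mul_pow]
      refine pow_le_pow_left₀ (hv0 _ _) ?_ 2
      rw [show v 0 x = max ((u 0 x - M) * 1) 0 from if_pos hx]
      refine max_le ?_ (by positivity)
      have h1 := (le_abs_self _).trans (hA x hx)
      have h2 := neg_abs_le M
      nlinarith [mul_nonneg (abs_nonneg M) hA0]
    refine (Finset.sum_le_card_nsmul _ _ _ hb).trans ?_
    rw [nsmul_eq_mul, hQ]
    have : 0 ≤ (1 + |M|) ^ 2 * (1 + A) ^ 2 := by positivity
    nlinarith
  have hfin : v n x ^ 2 ≤ (ε * (1 + A)) ^ 2 := by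
    have h1 : v n x ^ 2 ≤ ∑ x ∈ B, v n x ^ 2 :=
      Finset.single_le_sum (f := fun x => v n x ^ 2) (fun _ _ => sq_nonneg _) (hB x hx).1
    calc v n x ^ 2 ≤ Real.exp (-(θ * (n * h))) * ∑ x ∈ B, v 0 x ^ 2 := h1.trans (hdec n)
      _ ≤ Real.exp (-(θ * (n * h))) * (Q * (1 + A) ^ 2) :=
        mul_le_mul_of_nonneg_left hstart (Real.exp_pos _).le
      _ = (Q * Real.exp (-(θ * (n * h)))) * (1 + A) ^ 2 := by ring
      _ ≤ ε ^ 2 * (1 + A) ^ 2 := mul_le_mul_of_nonneg_right (hτ _ hn) (by positivity)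
      _ = _ := by ring
  have h2 := abs_le_of_sq_le_sq hfin (mul_nonneg hε.le (by linarith))
  have h3 : u n x - M ≤ v n x := by
    rw [show v n x = max ((u n x - M) * 1) 0 from if_pos hx, mul_one]
    exact le_max_left _ _
  linarith [le_abs_self (v n x)]

/-- pointwise bound along the ray leaving the support in a coordinate direction -/
lemma sq_le_of_ray {U : Finset (Zd d)} {v : Zd d → ℝ} (hv : ∀ x, x ∉ U → v x = 0) (i : Fin d) (L : ℕ)
    (hU : ∀ x ∈ U, |x i| ≤ L) (x : Zd d) : v x ^ 2 ≤ (2 * L + 1) * En U v := by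
  classical
  by_cases hx : x ∈ U
  swap
  · rw [hv x hx, zero_pow two_ne_zero]
    exact mul_nonneg (by positivity) (En_nonneg U v)
  set y : ℕ → Zd d := fun j => x + (j : ℤ) • Pi.single i 1 with hy
  have hyi : ∀ j, y j i = x i + j := fun j => by simp [hy]
  have hstep : ∀ j, y (j + 1) = nbr (y j) (i, true) := by
    intro j
    rw [nbr_eq_add]
    simp only [hy, if_true]
    push_cast
    rw [add_smul, one_smul, add_assoc]
  have hex : ∃ j, y j ∉ U := ⟨2 * L + 1, fun h => by
    have h1 := abs_le.1 (hU _ h)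
    have h2 := abs_le.1 (hU _ hx)
    rw [hyi] at h1
    push_cast at h1
    omega⟩
  set m := Nat.find hex with hm
  have hm1 : y m ∉ U := Nat.find_spec hex
  have hm2 : ∀ j < m, y j ∈ U := fun j hj => by
    by_contra h
    exact Nat.find_min hex hj h
  have hmle : m ≤ 2 * L + 1 := by
    by_contra h
    have h1 := abs_le.1 (hU _ (hm2 (2 * L + 1) (by omega)))
    have h2 := abs_le.1 (hU _ hx)
    rw [hyi] at h1
    push_cast at h1
    omega
  have htel : ∑ j ∈ Finset.range m, (v (y (j + 1)) - v (y j)) = -v x := by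
    rw [Finset.sum_range_sub (fun j => v (y j)), hv _ hm1]
    simp [hy]
  have hcs := sq_sum_le_card_mul_sum_sq (s := Finset.range m) (f := fun j => v (y (j + 1)) - v (y j))
  rw [htel, neg_sq, Finset.card_range] at hcs
  have hinj : Set.InjOn y (Finset.range m) := fun j _ j' _ h => by
    have := congrFun h i
    rw [hyi, hyi] at this
    omega
  have hsum : ∑ j ∈ Finset.range m, (v (y (j + 1)) - v (y j)) ^ 2 ≤ En U v := by
    calc ∑ j ∈ Finset.range m, (v (y (j + 1)) - v (y j)) ^ 2
        = ∑ z ∈ (Finset.range m).image y, (v (nbr z (i, true)) - v z) ^ 2 := by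
          rw [Finset.sum_image hinj]
          exact Finset.sum_congr rfl fun j _ => by rw [hstep]
      _ ≤ ∑ z ∈ U, (v (nbr z (i, true)) - v z) ^ 2 := by
          refine Finset.sum_le_sum_of_subset_of_nonneg ?_ fun _ _ _ => sq_nonneg _
          intro z hz
          obtain ⟨j, hj, rfl⟩ := Finset.mem_image.1 hz
          exact hm2 j (Finset.mem_range.1 hj)
      _ ≤ En U v := Finset.sum_le_sum fun z _ =>
          Finset.single_le_sum (f := fun k => (v (nbr z k) - v z) ^ 2) (fun _ _ => sq_nonneg _)
            (Finset.mem_univ _)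
  have hmr : (m : ℝ) ≤ 2 * L + 1 := by exact_mod_cast hmle
  refine hcs.trans (mul_le_mul hmr hsum (Finset.sum_nonneg fun _ _ => sq_nonneg _) (by positivity))

/-- time averages of a linear observable along a tilted discrete caloric function -/
lemma tilted_average {lam Lam : ℝ} (hl : 0 < lam) {h t : ℝ} (hh : 0 < h)
    (ht : 0 < t) (hh' : 2 * d * Lam * h ≤ 1 / 4) {U B : Finset (Zd d)}
    (hB : ∀ x ∈ U, x ∈ B ∧ ∀ k, nbr x k ∈ B) {Γ : ℝ}
    (w : Zd d → ℝ) (hw : ∀ v : Zd d → ℝ, (∀ x, x ∉ U → v x = 0) → (∑ x ∈ U, w x * v x) ^ 2 ≤ Γ * En U v)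
    {a : ℕ → Zd d → Zd d → ℝ} (ha : ∀ n, Ell lam Lam (a n)) {u : ℕ → Zd d → ℝ}
    (hcal : ∀ n, ∀ x ∈ U, u (n + 1) x = u n x + h * (Lap (a n) (u n) x + t * w x))
    (hu0 : ∀ n, ∀ x, x ∉ U → u n x = 0) (hΓ : 0 ≤ Γ) (N : ℕ) :
    2 * h * t * ∑ n ∈ Finset.range N, ∑ x ∈ U, w x * u n x ≤
      ∑ x ∈ U, u 0 x ^ 2 + N * (8 * h * t ^ 2 * Γ / lam + 2 * h ^ 2 * t ^ 2 * ∑ x ∈ U, w x ^ 2) := by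
  have hUB : U ⊆ B := fun x hx => (hB x hx).1
  have key : ∀ n, 2 * h * t * ∑ x ∈ U, w x * u n x ≤ ∑ x ∈ U, u n x ^ 2 - ∑ x ∈ U, u (n + 1) x ^ 2 +
      (8 * h * t ^ 2 * Γ / lam + 2 * h ^ 2 * t ^ 2 * ∑ x ∈ U, w x ^ 2) := by
    intro n
    have hS : SuppIn B (u n) := fun x hx => hB x (by by_contra h; exact hx (hu0 n x h))
    have e1 : ∑ x ∈ U, u (n + 1) x ^ 2 = ∑ x ∈ U, u n x ^ 2 + 2 * h * ∑ x ∈ U, u n x * Lap (a n) (u n) x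
        + 2 * h * t * ∑ x ∈ U, w x * u n x + h ^ 2 * ∑ x ∈ U, (Lap (a n) (u n) x + t * w x) ^ 2 := by
      rw [Finset.mul_sum, Finset.mul_sum, Finset.mul_sum, ← Finset.sum_add_distrib,
        ← Finset.sum_add_distrib, ← Finset.sum_add_distrib]
      refine Finset.sum_congr rfl fun x hx => ?_
      rw [hcal n x hx]
      ring
    have e2 : ∑ x ∈ U, u n x * Lap (a n) (u n) x = -(1 / 2) * Ena (a n) B (u n) := by
      have := sum_mul_Lap (ha n).symm hS (u n)
      rw [← Finset.sum_subset hUB (f := fun x => u n x * Lap (a n) (u n) x)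
        (fun x _ hx => by rw [hu0 n x hx, zero_mul])] at this
      rw [this, Ena]
      congr 1
      refine Finset.sum_congr rfl fun x _ => Finset.sum_congr rfl fun k _ => ?_
      ring
    have e3 : ∑ x ∈ U, (Lap (a n) (u n) x + t * w x) ^ 2 ≤
        2 * (2 * d * Lam * Ena (a n) B (u n)) + 2 * t ^ 2 * ∑ x ∈ U, w x ^ 2 := by
      have f1 : ∑ x ∈ U, Lap (a n) (u n) x ^ 2 ≤ 2 * d * Lam * Ena (a n) B (u n) := by
        calc _ ≤ ∑ x ∈ B, Lap (a n) (u n) x ^ 2 :=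
              Finset.sum_le_sum_of_subset_of_nonneg hUB fun _ _ _ => sq_nonneg _
          _ ≤ _ := by
              rw [Ena, Finset.mul_sum]
              exact Finset.sum_le_sum fun x _ => Lap_sq_le hl (ha n) _ _
      have f2 : ∑ x ∈ U, (Lap (a n) (u n) x + t * w x) ^ 2 ≤
          ∑ x ∈ U, (2 * Lap (a n) (u n) x ^ 2 + 2 * t ^ 2 * w x ^ 2) := by
        refine Finset.sum_le_sum fun x _ => ?_
        nlinarith [sq_nonneg (Lap (a n) (u n) x - t * w x)]
      rw [Finset.sum_add_distrib, ← Finset.mul_sum, ← Finset.mul_sum] at f2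
      linarith
    have hE : 0 ≤ Ena (a n) B (u n) :=
      le_trans (mul_nonneg hl.le (En_nonneg _ _)) ((ha n).lam_En_le B (u n))
    have e4 : lam * En U (u n) ≤ Ena (a n) B (u n) := by
      refine le_trans (mul_le_mul_of_nonneg_left ?_ hl.le) ((ha n).lam_En_le B (u n))
      exact Finset.sum_le_sum_of_subset_of_nonneg hUB fun _ _ _ =>
        Finset.sum_nonneg fun _ _ => sq_nonneg _
    have e5 : 2 * t * ∑ x ∈ U, w x * u n x ≤ lam / 4 * En U (u n) + 4 * t ^ 2 * Γ / lam := by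
      have g1 := hw (u n) (hu0 n)
      have hEU := En_nonneg U (u n)
      refine le_trans (le_abs_self _) (abs_le_of_sq_le_sq ?_ (by positivity))
      have g2 : (2 * t * ∑ x ∈ U, w x * u n x) ^ 2 ≤ 4 * t ^ 2 * (Γ * En U (u n)) := by
        rw [mul_pow, mul_pow]
        have := mul_le_mul_of_nonneg_left g1 (show 0 ≤ 2 ^ 2 * t ^ 2 by positivity)
        linarith
      refine g2.trans ?_
      have g3 : 4 * t ^ 2 * (Γ * En U (u n)) = 4 * (lam / 4 * En U (u n)) * (4 * t ^ 2 * Γ / lam) := by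
        field_simp
      rw [g3]
      nlinarith [sq_nonneg (lam / 4 * En U (u n) - 4 * t ^ 2 * Γ / lam)]
    have e6 : h ^ 2 * (2 * (2 * d * Lam * Ena (a n) B (u n))) ≤ h / 2 * Ena (a n) B (u n) := by
      have := mul_le_mul_of_nonneg_right hh' (show 0 ≤ 2 * h * Ena (a n) B (u n) by positivity)
      linarith
    have e7 := mul_le_mul_of_nonneg_left e3 (sq_nonneg h)
    have e8 := mul_le_mul_of_nonneg_left e5 hh.le
    have e9 := mul_le_mul_of_nonneg_left e4 hh.le
    have e10 : 8 * h * t ^ 2 * Γ / lam = 2 * (h * (4 * t ^ 2 * Γ / lam)) := by ring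
    rw [e10]
    rw [e2] at e1
    linarith
  have hsum := Finset.sum_le_sum fun n (_ : n ∈ Finset.range N) => key n
  rw [← Finset.mul_sum, Finset.sum_add_distrib, Finset.sum_range_sub' (fun n => ∑ x ∈ U, u n x ^ 2),
    Finset.sum_const, Finset.card_range, nsmul_eq_mul] at hsum
  have : 0 ≤ ∑ x ∈ U, u N x ^ 2 := Finset.sum_nonneg fun _ _ => sq_nonneg _
  linarith
end

noncomputable section
variable {d : ℕ}

/-- even, uniformly convex potentials -/
structure VOk (V : ℝ → ℝ) (lam Lam : ℝ) : Prop where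
  even : ∀ t, V (-t) = V t
  odd : ∀ t, deriv V (-t) = -deriv V t
  lower : ∀ p q, p ≤ q → lam * (q - p) ≤ deriv V q - deriv V p
  upper : ∀ p q, p ≤ q → deriv V q - deriv V p ≤ Lam * (q - p)
  taylor : ∀ p q, |V (p + q) - V p - deriv V p * q| ≤ Lam * q ^ 2
  low : ∀ t, V 0 + lam / 2 * t ^ 2 ≤ V t

lemma VOk.lip {V : ℝ → ℝ} {lam Lam : ℝ} (hl : 0 < lam) (h : VOk V lam Lam) (p q : ℝ) :
    |deriv V q - deriv V p| ≤ Lam * |q - p| := by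
  rcases le_total p q with hpq | hpq
  · rw [abs_of_nonneg (sub_nonneg.2 hpq), abs_of_nonneg]
    · exact h.upper p q hpq
    · exact (mul_nonneg hl.le (sub_nonneg.2 hpq)).trans (h.lower p q hpq)
  · rw [abs_sub_comm, abs_sub_comm q, abs_of_nonneg (sub_nonneg.2 hpq), abs_of_nonneg]
    · exact h.upper q p hpq
    · exact (mul_nonneg hl.le (sub_nonneg.2 hpq)).trans (h.lower q p hpq)

lemma VOk.of_contDiff {V : ℝ → ℝ} {lam Lam : ℝ} (hl : 0 < lam) (hV : ContDiff ℝ 2 V)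
    (heven : ∀ t, V (-t) = V t)
    (h : ∀ t, lam ≤ iteratedDeriv 2 V t ∧ iteratedDeriv 2 V t ≤ Lam) : VOk V lam Lam := by
  have hd1 : Differentiable ℝ V := hV.differentiable (by norm_num)
  have hd2 : Differentiable ℝ (deriv V) := by
    have := hV.differentiable_iteratedDeriv 1 (by norm_num)
    rwa [iteratedDeriv_one] at this
  have hdd : ∀ t, deriv (deriv V) t = iteratedDeriv 2 V t := fun t => by
    rw [iteratedDeriv_succ, iteratedDeriv_one]
  have hodd : ∀ t, deriv V (-t) = -deriv V t := by
    intro t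
    have h1 : deriv (fun x => V (-x)) t = -deriv V (-t) := deriv_comp_neg V t
    rw [show (fun x => V (-x)) = V from funext heven] at h1
    linarith
  have hlow : ∀ p q, p ≤ q → lam * (q - p) ≤ deriv V q - deriv V p := fun p q hpq =>
    mul_sub_le_image_sub_of_le_deriv hd2 (fun t => by rw [hdd]; exact (h t).1) hpq
  have hup : ∀ p q, p ≤ q → deriv V q - deriv V p ≤ Lam * (q - p) := fun p q hpq =>
    image_sub_le_mul_sub_of_deriv_le hd2 (fun t => by rw [hdd]; exact (h t).2) hpq
  have hLam : 0 ≤ Lam := hl.le.trans ((h 0).1.trans (h 0).2)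
  have habs : ∀ p q, |deriv V q - deriv V p| ≤ Lam * |q - p| := by
    intro p q
    rcases le_total p q with hpq | hpq
    · rw [abs_of_nonneg (sub_nonneg.2 hpq), abs_of_nonneg]
      · exact hup p q hpq
      · exact (mul_nonneg hl.le (sub_nonneg.2 hpq)).trans (hlow p q hpq)
    · rw [abs_sub_comm, abs_sub_comm q, abs_of_nonneg (sub_nonneg.2 hpq), abs_of_nonneg]
      · exact hup q p hpq
      · exact (mul_nonneg hl.le (sub_nonneg.2 hpq)).trans (hlow q p hpq)
  refine ⟨heven, hodd, hlow, hup, fun p q => ?_, fun t => ?_⟩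
  · have hF : ∀ x, HasDerivAt (fun x => V x - deriv V p * x) (deriv V x - deriv V p) x := fun x => by
      have := (hd1 x).hasDerivAt.sub ((hasDerivAt_id x).const_mul (deriv V p))
      rw [mul_one] at this
      exact this
    have := (convex_segment p (p + q)).norm_image_sub_le_of_norm_hasDerivWithin_le (C := Lam * |q|)
      (fun x _ => (hF x).hasDerivWithinAt) (fun x hx => by
        rw [Real.norm_eq_abs]
        refine (habs p x).trans (mul_le_mul_of_nonneg_left ?_ hLam)
        rw [segment_eq_uIcc] at hx
        have := Set.abs_sub_left_of_mem_uIcc hx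
        simpa using this) (left_mem_segment ℝ p (p + q)) (right_mem_segment ℝ p (p + q))
    rw [Real.norm_eq_abs, Real.norm_eq_abs] at this
    have e : V (p + q) - deriv V p * (p + q) - (V p - deriv V p * p) = V (p + q) - V p - deriv V p * q := by ring
    rw [e, add_sub_cancel_left, mul_assoc, ← sq, sq_abs] at this
    exact this
  · have h0 : deriv V 0 = 0 := by
      have := hodd 0
      rw [neg_zero] at this
      linarith
    have hF : ∀ x, HasDerivAt (fun x => V x - lam / 2 * x ^ 2) (deriv V x - lam * x) x := fun x => by
      refine ((hd1 x).hasDerivAt.sub ((hasDerivAt_pow 2 x).const_mul (lam / 2))).congr_deriv ?_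
      push_cast
      ring
    have hmono : MonotoneOn (fun x => V x - lam / 2 * x ^ 2) (Set.Ici 0) := by
      refine monotoneOn_of_deriv_nonneg (convex_Ici 0) (fun x _ => (hF x).continuousAt.continuousWithinAt)
        (fun x _ => (hF x).differentiableAt.differentiableWithinAt) fun x hx => ?_
      rw [interior_Ici, Set.mem_Ioi] at hx
      rw [(hF x).deriv]
      have := hlow 0 x hx.le
      rw [h0] at this
      linarith
    have key : ∀ t, 0 ≤ t → V 0 + lam / 2 * t ^ 2 ≤ V t := fun t ht => by
      have := hmono (Set.mem_Ici.2 le_rfl) (Set.mem_Ici.2 ht) ht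
      simp only at this
      linarith
    rcases le_total 0 t with ht | ht
    · exact key t ht
    · have := key (-t) (by linarith)
      rwa [heven, neg_sq] at this

/-- extension of a finite configuration by zero -/
def zx (U : Finset (Zd d)) (φ : U → ℝ) (x : Zd d) : ℝ := if h : x ∈ U then φ ⟨x, h⟩ else 0

lemma zx_mem {U : Finset (Zd d)} (φ : U → ℝ) {x : Zd d} (h : x ∈ U) : zx U φ x = φ ⟨x, h⟩ := dif_pos h

lemma zx_coe {U : Finset (Zd d)} (φ : U → ℝ) (x : U) : zx U φ x = φ x := dif_pos x.2

lemma zx_not_mem {U : Finset (Zd d)} (φ : U → ℝ) {x : Zd d} (h : x ∉ U) : zx U φ x = 0 := dif_neg h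

lemma zx_add (U : Finset (Zd d)) (φ ψ : U → ℝ) (x : Zd d) : zx U (φ + ψ) x = zx U φ x + zx U ψ x := by
  by_cases h : x ∈ U
  · simp [zx_mem _ h]
  · simp [zx_not_mem _ h]

lemma zx_sub (U : Finset (Zd d)) (φ ψ : U → ℝ) (x : Zd d) : zx U (φ - ψ) x = zx U φ x - zx U ψ x := by
  by_cases h : x ∈ U
  · simp [zx_mem _ h]
  · simp [zx_not_mem _ h]

lemma zx_smul (U : Finset (Zd d)) (c : ℝ) (φ : U → ℝ) (x : Zd d) : zx U (c • φ) x = c * zx U φ x := by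
  by_cases h : x ∈ U
  · simp [zx_mem _ h]
  · simp [zx_not_mem _ h]

lemma abs_zx_le (U : Finset (Zd d)) (φ : U → ℝ) (x : Zd d) : |zx U φ x| ≤ ‖φ‖ := by
  by_cases h : x ∈ U
  · rw [zx_mem _ h, ← Real.norm_eq_abs]; exact norm_le_pi_norm φ _
  · rw [zx_not_mem _ h, abs_zero]; exact norm_nonneg _

/-- the value at a site, as a continuous linear functional -/
def ev (U : Finset (Zd d)) (x : Zd d) : (U → ℝ) →L[ℝ] ℝ :=
  LinearMap.mkContinuous
    { toFun := fun φ => zx U φ x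
      map_add' := fun φ ψ => zx_add U φ ψ x
      map_smul' := fun c φ => zx_smul U c φ x } 1 (fun φ => by
        rw [one_mul]; exact abs_zx_le U φ x)

@[simp] lemma ev_apply (U : Finset (Zd d)) (x : Zd d) (φ : U → ℝ) : ev U x φ = zx U φ x := rfl

open Classical in
/-- weight of a term of the energy -/
def cw (U : Finset (Zd d)) (β : ℝ) (y : Zd d) : ℝ := if y ∈ U then 1 else β

open Classical in
/-- total weight of an edge in the energy -/
def kw (U : Finset (Zd d)) (β : ℝ) (x y : Zd d) : ℝ := if x ∈ U ∧ y ∈ U then 2 else β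

/-- gradient energy on `U` around the background `g` -/
def Ham (V : ℝ → ℝ) (U : Finset (Zd d)) (β : ℝ) (g : Zd d → ℝ) (φ : U → ℝ) : ℝ :=
  ∑ x ∈ U, ∑ k, cw U β (nbr x k) *
    V (zx U φ (nbr x k) - zx U φ x + (g (nbr x k) - g x))

/-- gradient of the energy -/
def drift (V : ℝ → ℝ) (U : Finset (Zd d)) (β : ℝ) (g : Zd d → ℝ) (φ : U → ℝ) (x : U) : ℝ :=
  -∑ k, kw U β x (nbr x k) * deriv V (zx U φ (nbr x k) - zx U φ x + (g (nbr x k) - g x))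

lemma kw_symm (U : Finset (Zd d)) (β : ℝ) (x y : Zd d) : kw U β x y = kw U β y x := by
  simp only [kw, and_comm]

lemma kw_bounds (U : Finset (Zd d)) {β : ℝ} (h1 : 1 ≤ β) (h2 : β ≤ 2) (x y : Zd d) :
    1 ≤ kw U β x y ∧ kw U β x y ≤ 2 := by
  unfold kw
  split_ifs
  · norm_num
  · exact ⟨h1, h2⟩

lemma cw_bounds (U : Finset (Zd d)) {β : ℝ} (h1 : 1 ≤ β) (h2 : β ≤ 2) (x : Zd d) :
    1 ≤ cw U β x ∧ cw U β x ≤ 2 := by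
  unfold cw
  split_ifs
  · norm_num
  · exact ⟨h1, h2⟩

lemma sum_drift_mul {V : ℝ → ℝ} {lam Lam : ℝ} (hV : VOk V lam Lam) (U : Finset (Zd d)) (β : ℝ)
    (g : Zd d → ℝ) (φ δ : U → ℝ) :
    ∑ x, drift V U β g φ x * δ x = ∑ x ∈ U, ∑ k, cw U β (nbr x k) *
      (deriv V (zx U φ (nbr x k) - zx U φ x + (g (nbr x k) - g x)) *
        (zx U δ (nbr x k) - zx U δ x)) := by
  classical
  set G : Zd d → Zd d → ℝ := fun x y => deriv V (zx U φ y - zx U φ x + (g y - g x)) with hG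
  have hGs : ∀ x y, G x y = -G y x := fun x y => by
    simp only [hG]
    rw [← hV.odd]
    congr 1
    ring
  have h1 : ∑ x, drift V U β g φ x * δ x =
      ∑ x ∈ U, ∑ k, -(kw U β x (nbr x k) * G x (nbr x k) * zx U δ x) := by
    rw [← Finset.sum_coe_sort U]
    refine Finset.sum_congr rfl fun x _ => ?_
    rw [zx_coe, drift, neg_mul, Finset.sum_mul, Finset.sum_neg_distrib]
  have h2 := sum_nbr_swap U (fun x y => if x ∈ U ∧ y ∈ U then G x y * zx U δ y else 0)
    (fun x k h => by by_contra h'; exact h (if_neg h'))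
  have h3 : ∑ x ∈ U, ∑ k, cw U β (nbr x k) * (G x (nbr x k) * (zx U δ (nbr x k) - zx U δ x)) =
      ∑ x ∈ U, ∑ k, (if x ∈ U ∧ nbr x k ∈ U then G x (nbr x k) * zx U δ (nbr x k) else 0) -
      ∑ x ∈ U, ∑ k, cw U β (nbr x k) * (G x (nbr x k) * zx U δ x) := by
    rw [← Finset.sum_sub_distrib]
    refine Finset.sum_congr rfl fun x hx => ?_
    rw [← Finset.sum_sub_distrib]
    refine Finset.sum_congr rfl fun k _ => ?_
    by_cases h : nbr x k ∈ U
    · rw [if_pos ⟨hx, h⟩, cw, if_pos h]; ring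
    · rw [if_neg (fun h' => h h'.2), cw, if_neg h, zx_not_mem _ h]; ring
  rw [h1, h3, h2, ← Finset.sum_sub_distrib]
  refine Finset.sum_congr rfl fun x hx => ?_
  rw [← Finset.sum_sub_distrib]
  refine Finset.sum_congr rfl fun k _ => ?_
  by_cases h : nbr x k ∈ U
  · simp only [kw, cw]
    rw [if_pos ⟨hx, h⟩, if_pos ⟨h, hx⟩, if_pos h, hGs (nbr x k) x]
    ring
  · simp only [kw, cw]
    rw [if_neg (fun h' => h h'.2), if_neg (fun h' => h h'.1), if_neg h]
    ring

lemma exists_radius (U : Finset (Zd d)) : ∃ L : ℕ, ∀ x ∈ U, ∀ i, |x i| ≤ L := by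
  classical
  refine ⟨U.sup fun x => Finset.univ.sup fun i => (x i).natAbs, fun x hx i => ?_⟩
  have h1 : (x i).natAbs ≤ Finset.univ.sup fun i => (x i).natAbs :=
    Finset.le_sup (f := fun i => (x i).natAbs) (Finset.mem_univ i)
  have h2 : (Finset.univ.sup fun i => (x i).natAbs) ≤ U.sup fun x => Finset.univ.sup fun i => (x i).natAbs :=
    Finset.le_sup (f := fun x : Zd d => Finset.univ.sup fun i => (x i).natAbs) hx
  have := h1.trans h2
  rw [Int.abs_eq_natAbs]
  exact_mod_cast this

lemma zx_lower (hd : 1 ≤ d) (U : Finset (Zd d)) : ∃ P : ℝ, 0 < P ∧ ∀ φ : U → ℝ,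
    ∑ x, φ x ^ 2 ≤ P * En U (zx U φ) := by
  obtain ⟨L, hL⟩ := exists_radius U
  refine ⟨(U.card + 1) * (2 * L + 1), by positivity, fun φ => ?_⟩
  have h : ∀ x ∈ (Finset.univ : Finset U), φ x ^ 2 ≤ (2 * L + 1) * En U (zx U φ) := fun x _ => by
    have := sq_le_of_ray (U := U) (v := zx U φ) (fun x hx => zx_not_mem φ hx) ⟨0, hd⟩ L
      (fun x hx => hL x hx _) x
    rwa [zx_coe] at this
  refine (Finset.sum_le_card_nsmul _ _ _ h).trans ?_
  rw [nsmul_eq_mul, Finset.card_univ, Fintype.card_coe]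
  have := En_nonneg U (zx U φ)
  have : 0 ≤ (2 * (L : ℝ) + 1) * En U (zx U φ) := by positivity
  nlinarith

lemma Ham_good {V : ℝ → ℝ} {lam Lam : ℝ} (hd : 1 ≤ d) (hl : 0 < lam) (hV : VOk V lam Lam)
    (U : Finset (Zd d)) {β : ℝ} (h1 : 1 ≤ β) (h2 : β ≤ 2) (g : Zd d → ℝ) :
    ∃ K c, Good (Ham V U β g) (drift V U β g) K c := by
  obtain ⟨P, hP, hpoin⟩ := zx_lower hd U
  have hLam : 0 ≤ Lam := by
    have a1 := hV.lower 0 1 zero_le_one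
    have a2 := hV.upper 0 1 zero_le_one
    linarith
  set D : ℝ := (Fintype.card (Dir d) : ℝ) with hD
  set K1 : ℝ := U.card * (D * (8 * Lam)) with hK1
  set K2 : ℝ := D * (4 * Lam) with hK2
  set K3 : ℝ := ‖drift V U β g 0‖ with hK3
  set K4 : ℝ := |∑ x ∈ U, ∑ k, (cw U β (nbr x k) * V 0 - lam / 2 * (g (nbr x k) - g x) ^ 2)| with hK4
  have p1 : 0 ≤ K1 := by positivity
  have p2 : 0 ≤ K2 := by positivity
  have p3 : 0 ≤ K3 := norm_nonneg _
  have p4 : 0 ≤ K4 := abs_nonneg _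
  have hlip : ∀ φ ψ, ‖drift V U β g φ - drift V U β g ψ‖ ≤ K2 * ‖φ - ψ‖ := by
    intro φ ψ
    refine (pi_norm_le_iff_of_nonneg (by positivity)).2 fun x => ?_
    rw [Pi.sub_apply, Real.norm_eq_abs, drift, drift, neg_sub_neg, ← Finset.sum_sub_distrib]
    refine (Finset.abs_sum_le_sum_abs _ _).trans ?_
    have hb : ∀ k ∈ (Finset.univ : Finset (Dir d)),
        |kw U β x (nbr x k) * deriv V (zx U ψ (nbr x k) - zx U ψ x + (g (nbr x k) - g x)) -
        kw U β x (nbr x k) * deriv V (zx U φ (nbr x k) - zx U φ x + (g (nbr x k) - g x))|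
        ≤ 4 * Lam * ‖φ - ψ‖ := by
      intro k _
      rw [← mul_sub, abs_mul]
      have a1 := hV.lip hl (zx U φ (nbr x k) - zx U φ x + (g (nbr x k) - g x))
        (zx U ψ (nbr x k) - zx U ψ x + (g (nbr x k) - g x))
      have e : zx U ψ (nbr x k) - zx U ψ x + (g (nbr x k) - g x) -
        (zx U φ (nbr x k) - zx U φ x + (g (nbr x k) - g x)) =
        zx U (φ - ψ) x - zx U (φ - ψ) (nbr x k) := by
        rw [zx_sub, zx_sub]; ring
      rw [e] at a1
      have a2 := abs_zx_le U (φ - ψ) x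
      have a3 := abs_zx_le U (φ - ψ) (nbr x k)
      have a4 : |zx U (φ - ψ) x - zx U (φ - ψ) (nbr x k)| ≤ 2 * ‖φ - ψ‖ :=
        (abs_sub _ _).trans (by linarith)
      have b := kw_bounds U h1 h2 x (nbr x k)
      rw [abs_of_nonneg (by linarith [b.1])]
      calc _ ≤ 2 * (Lam * (2 * ‖φ - ψ‖)) := by
            refine mul_le_mul b.2 (a1.trans (mul_le_mul_of_nonneg_left a4 hLam)) (abs_nonneg _) (by norm_num)
        _ = _ := by ring
    refine (Finset.sum_le_card_nsmul _ _ _ hb).trans (le_of_eq ?_)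
    rw [nsmul_eq_mul, Finset.card_univ, hK2]
    ring
  refine ⟨K1 + K2 + K3 + K4, lam / (4 * P), by positivity, by positivity, fun φ δ => ?_, fun φ ψ => ?_,
    fun φ => ?_, fun φ => ?_⟩
  · rw [sum_drift_mul hV, Ham, Ham, ← Finset.sum_sub_distrib, ← Finset.sum_sub_distrib]
    have hb : ∀ x ∈ U, ∀ k ∈ (Finset.univ : Finset (Dir d)),
        |cw U β (nbr x k) * V (zx U (φ + δ) (nbr x k) - zx U (φ + δ) x + (g (nbr x k) - g x)) -
          cw U β (nbr x k) * V (zx U φ (nbr x k) - zx U φ x + (g (nbr x k) - g x)) -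
          cw U β (nbr x k) * (deriv V (zx U φ (nbr x k) - zx U φ x + (g (nbr x k) - g x)) *
            (zx U δ (nbr x k) - zx U δ x))| ≤ 8 * Lam * ‖δ‖ ^ 2 := by
      intro x _ k _
      rw [← mul_sub, ← mul_sub, abs_mul, zx_add, zx_add]
      have a1 := hV.taylor (zx U φ (nbr x k) - zx U φ x + (g (nbr x k) - g x))
        (zx U δ (nbr x k) - zx U δ x)
      rw [show zx U φ (nbr x k) - zx U φ x + (g (nbr x k) - g x) + (zx U δ (nbr x k) - zx U δ x) =
        zx U φ (nbr x k) + zx U δ (nbr x k) - (zx U φ x + zx U δ x) + (g (nbr x k) - g x) by ring] at a1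
      have a2 := abs_zx_le U δ x
      have a3 := abs_zx_le U δ (nbr x k)
      have a4 : |zx U δ (nbr x k) - zx U δ x| ≤ 2 * ‖δ‖ := (abs_sub _ _).trans (by linarith)
      have a5 : (zx U δ (nbr x k) - zx U δ x) ^ 2 ≤ (2 * ‖δ‖) ^ 2 := by
        rw [← sq_abs]; exact pow_le_pow_left₀ (abs_nonneg _) a4 2
      have b := cw_bounds U h1 h2 (nbr x k)
      rw [abs_of_nonneg (by linarith [b.1])]
      calc _ ≤ 2 * (Lam * (2 * ‖δ‖) ^ 2) := by
            refine mul_le_mul b.2 (a1.trans (mul_le_mul_of_nonneg_left a5 hLam)) (abs_nonneg _) (by norm_num)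
        _ = _ := by ring
    have : |∑ x ∈ U, (∑ k, cw U β (nbr x k) * V (zx U (φ + δ) (nbr x k) - zx U (φ + δ) x + (g (nbr x k) - g x)) -
          ∑ k, cw U β (nbr x k) * V (zx U φ (nbr x k) - zx U φ x + (g (nbr x k) - g x)) -
          ∑ k, cw U β (nbr x k) * (deriv V (zx U φ (nbr x k) - zx U φ x + (g (nbr x k) - g x)) *
            (zx U δ (nbr x k) - zx U δ x)))| ≤ U.card • (Fintype.card (Dir d) • (8 * Lam * ‖δ‖ ^ 2)) := by
      refine (Finset.abs_sum_le_sum_abs _ _).trans (Finset.sum_le_card_nsmul _ _ _ fun x hx => ?_)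
      rw [← Finset.sum_sub_distrib, ← Finset.sum_sub_distrib]
      exact (Finset.abs_sum_le_sum_abs _ _).trans (Finset.sum_le_card_nsmul _ _ _ (hb x hx))
    refine this.trans ?_
    rw [nsmul_eq_mul, nsmul_eq_mul]
    have : 0 ≤ (K2 + K3 + K4) * ‖δ‖ ^ 2 := by positivity
    have e : (U.card : ℝ) * (D * (8 * Lam * ‖δ‖ ^ 2)) = K1 * ‖δ‖ ^ 2 := by rw [hK1]; ring
    rw [← hD, e]
    linarith
  · refine (hlip φ ψ).trans (mul_le_mul_of_nonneg_right (by linarith) (norm_nonneg _))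
  · have a := hlip φ 0
    rw [sub_zero] at a
    have b : ‖drift V U β g φ‖ ≤ ‖drift V U β g φ - drift V U β g 0‖ + K3 := by
      have := norm_add_le (drift V U β g φ - drift V U β g 0) (drift V U β g 0)
      rwa [sub_add_cancel] at this
    have : 0 ≤ (K1 + K3 + K4) * ‖φ‖ := by positivity
    linarith
  · have a1 : lam / 4 * En U (zx U φ) +
        ∑ x ∈ U, ∑ k, (cw U β (nbr x k) * V 0 - lam / 2 * (g (nbr x k) - g x) ^ 2) ≤ Ham V U β g φ := by
      rw [En, Ham, Finset.mul_sum, ← Finset.sum_add_distrib]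
      refine Finset.sum_le_sum fun x _ => ?_
      rw [Finset.mul_sum, ← Finset.sum_add_distrib]
      refine Finset.sum_le_sum fun k _ => ?_
      have b := (cw_bounds U h1 h2 (nbr x k)).1
      set A := zx U φ (nbr x k) - zx U φ x
      set G := g (nbr x k) - g x
      have c1 := hV.low (A + G)
      have c2 : A ^ 2 / 2 - G ^ 2 ≤ (A + G) ^ 2 := by nlinarith [sq_nonneg (A + 2 * G)]
      have c3 := mul_le_mul_of_nonneg_left c2 (half_pos hl).le
      have c4 := mul_le_mul_of_nonneg_left c1 (by linarith : 0 ≤ cw U β (nbr x k))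
      have c5 : lam / 2 * (A + G) ^ 2 ≤ cw U β (nbr x k) * (lam / 2 * (A + G) ^ 2) :=
        le_mul_of_one_le_left (by positivity) b
      linarith
    have a2 := neg_abs_le (∑ x ∈ U, ∑ k, (cw U β (nbr x k) * V 0 - lam / 2 * (g (nbr x k) - g x) ^ 2))
    have a3 : lam / (4 * P) * ∑ i, φ i ^ 2 ≤ lam / 4 * En U (zx U φ) := by
      calc _ ≤ lam / (4 * P) * (P * En U (zx U φ)) := mul_le_mul_of_nonneg_left (hpoin φ) (by positivity)
        _ = _ := by field_simp
    linarith
end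

noncomputable section
variable {d : ℕ}

open Classical in
/-- difference quotients of `V'` -/
def dq (V : ℝ → ℝ) (lam p q : ℝ) : ℝ := if p = q then lam else (deriv V q - deriv V p) / (q - p)

lemma dq_mul (V : ℝ → ℝ) (lam p q : ℝ) : dq V lam p q * (q - p) = deriv V q - deriv V p := by
  unfold dq
  split_ifs with h
  · simp [h]
  · exact div_mul_cancel₀ _ (sub_ne_zero.2 (Ne.symm h))

lemma VOk.dq_bounds {V : ℝ → ℝ} {lam Lam : ℝ} (hV : VOk V lam Lam) (p q : ℝ) :
    lam ≤ dq V lam p q ∧ dq V lam p q ≤ Lam := by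
  unfold dq
  split_ifs with h
  · have a1 := hV.lower 0 1 zero_le_one
    have a2 := hV.upper 0 1 zero_le_one
    exact ⟨le_rfl, by linarith⟩
  · rcases lt_or_gt_of_ne h with h | h
    · have h' := sub_pos.2 h
      exact ⟨(le_div_iff₀ h').2 (hV.lower p q h.le), (div_le_iff₀ h').2 (hV.upper p q h.le)⟩
    · have h' := sub_pos.2 h
      rw [← neg_div_neg_eq, neg_sub, neg_sub]
      exact ⟨(le_div_iff₀ h').2 (hV.lower q p h.le), (div_le_iff₀ h').2 (hV.upper q p h.le)⟩

lemma VOk.dq_neg {V : ℝ → ℝ} {lam Lam : ℝ} (hV : VOk V lam Lam) (p q : ℝ) :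
    dq V lam (-p) (-q) = dq V lam p q := by
  unfold dq
  simp only [neg_inj]
  split_ifs with h
  · rfl
  · rw [hV.odd, hV.odd, ← neg_div_neg_eq]
    congr 1 <;> ring

lemma exists_conductance {V : ℝ → ℝ} {lam Lam : ℝ} (hl : 0 < lam) (hV : VOk V lam Lam)
    (U : Finset (Zd d)) {β : ℝ} (h1 : 1 ≤ β) (h2 : β ≤ 2) (g g' : Zd d → ℝ) (φ φ' : U → ℝ) :
    ∃ a : Zd d → Zd d → ℝ, Ell lam (2 * Lam) a ∧ ∀ x : U,
      drift V U β g' φ' x - drift V U β g φ x =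
        -Lap a (fun y => zx U φ' y + g' y - (zx U φ y + g y)) x := by
  refine ⟨fun x y => kw U β x y * dq V lam (zx U φ y - zx U φ x + (g y - g x))
    (zx U φ' y - zx U φ' x + (g' y - g' x)), ⟨fun x y => ?_, fun x y => ?_, fun x y => ?_⟩, fun x => ?_⟩
  · rw [kw_symm, ← hV.dq_neg]
    congr 2 <;> ring
  · have b := kw_bounds U h1 h2 x y
    have c := hV.dq_bounds (zx U φ y - zx U φ x + (g y - g x)) (zx U φ' y - zx U φ' x + (g' y - g' x))
    nlinarith [c.1, b.1]
  · have b := kw_bounds U h1 h2 x y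
    have c := hV.dq_bounds (zx U φ y - zx U φ x + (g y - g x)) (zx U φ' y - zx U φ' x + (g' y - g' x))
    exact mul_le_mul b.2 c.2 (hl.le.trans c.1) (by norm_num)
  · rw [drift, drift, neg_sub_neg, Lap, ← Finset.sum_sub_distrib, ← Finset.sum_neg_distrib]
    refine Finset.sum_congr rfl fun k _ => ?_
    have := dq_mul V lam (zx U φ (nbr x k) - zx U φ x + (g (nbr x k) - g x))
      (zx U φ' (nbr x k) - zx U φ' x + (g' (nbr x k) - g' x))
    rw [← mul_sub, mul_assoc, ← mul_neg]
    congr 1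
    rw [← neg_sub (deriv V _), ← this]
    ring

lemma Coupled.caloric {V : ℝ → ℝ} {lam Lam : ℝ} (hl : 0 < lam) (hV : VOk V lam Lam)
    {U : Finset (Zd d)} {β : ℝ} (h1 : 1 ≤ β) (h2 : β ≤ 2) {g g' : Zd d → ℝ} {w : U → ℝ} {s : ℝ}
    {p p' : ℕ → U → ℝ} (hc : Coupled (drift V U β g) (fun φ => drift V U β g' φ - w) s p p') :
    ∃ a : ℕ → Zd d → Zd d → ℝ, (∀ n, Ell lam (2 * Lam) (a n)) ∧ ∀ n, ∀ x ∈ U,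
      zx U (p' (n + 1)) x + g' x - (zx U (p (n + 1)) x + g x) =
      zx U (p' n) x + g' x - (zx U (p n) x + g x) + s ^ 2 *
        (Lap (a n) (fun y => zx U (p' n) y + g' y - (zx U (p n) y + g y)) x + zx U w x) := by
  choose a ha ha' using fun n => exists_conductance hl hV U h1 h2 g g' (p n) (p' n)
  refine ⟨a, ha, fun n x hx => ?_⟩
  have e := congrFun (hc n) ⟨x, hx⟩
  have e' := ha' n ⟨x, hx⟩
  simp only [Pi.add_apply, Pi.sub_apply, Pi.smul_apply, smul_eq_mul] at e
  simp only [zx_mem _ hx] at e' ⊢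
  rw [← neg_eq_iff_eq_neg] at e'
  rw [← e']
  linarith

/-- mean height at `x` -/
def mn (V : ℝ → ℝ) (U : Finset (Zd d)) (β : ℝ) (g : Zd d → ℝ) (x : Zd d) : ℝ :=
  g x + ∫ φ, zx U φ x ∂(gm (Ham V U β g))

lemma mn_not_mem (V : ℝ → ℝ) {U : Finset (Zd d)} (β : ℝ) (g : Zd d → ℝ) {x : Zd d} (hx : x ∉ U) :
    mn V U β g x = g x := by
  simp [mn, zx_not_mem _ hx]

/-- comparison of means through the deterministic dynamics of differences -/
lemma mn_combination_le {V : ℝ → ℝ} {lam Lam : ℝ} (hd : 1 ≤ d) (hl : 0 < lam) (hV : VOk V lam Lam)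
    (U : Finset (Zd d)) {β : ℝ} (h1 : 1 ≤ β) (h2 : β ≤ 2) (g g' : Zd d → ℝ) (x y : Zd d) (c₁ c₂ B : ℝ)
    (hyp : ∀ ε > 0, ∃ τ : ℝ, ∃ h₀ > 0, ∀ h, 0 < h → h < h₀ → ∃ n : ℕ, n * h ≤ τ ∧
      ∀ a : ℕ → Zd d → Zd d → ℝ, (∀ n, Ell lam (2 * Lam) (a n)) → ∀ u : ℕ → Zd d → ℝ,
      (∀ n, ∀ x ∈ U, u (n + 1) x = u n x + h * Lap (a n) (u n) x) →
      (∀ n, ∀ x, x ∉ U → u n x = g' x - g x) →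
      ∀ A, 0 ≤ A → (∀ x ∈ U, |u 0 x| ≤ A + |g' x - g x|) →
      c₁ * u n x + c₂ * u n y ≤ B + ε * (1 + A) ^ 2) :
    c₁ * (mn V U β g' x - mn V U β g x) + c₂ * (mn V U β g' y - mn V U β g y) ≤ B := by
  classical
  obtain ⟨K, c, hg⟩ := Ham_good hd hl hV U h1 h2 g
  obtain ⟨K', c', hg'⟩ := Ham_good hd hl hV U h1 h2 g'
  have hInt : ∀ x, Integrable (fun φ => zx U φ x) (gm (Ham V U β g)) := fun x =>
    hg.conf.integrable_gm (p := 1) (A := 1) (ev U x).continuous (fun φ => by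
      have := abs_zx_le U φ x
      linarith [norm_nonneg φ])
  have hInt' : ∀ x, Integrable (fun φ => zx U φ x) (gm (Ham V U β g')) := fun x =>
    hg'.conf.integrable_gm (p := 1) (A := 1) (ev U x).continuous (fun φ => by
      have := abs_zx_le U φ x
      linarith [norm_nonneg φ])
  have key := hg.mean_le_of_coupling hg' (c₁ • ev U x + c₂ • ev U y)
    (B - c₁ * (g' x - g x) - c₂ * (g' y - g y)) (fun ε hε => by
      obtain ⟨τ, h₀, hh₀, H⟩ := hyp ε hε
      refine ⟨τ + h₀, √h₀, Real.sqrt_pos.2 hh₀, fun s hs hs' => ?_⟩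
      have hs2 : s ^ 2 < h₀ := (Real.lt_sqrt hs.le).1 hs'
      obtain ⟨n, hn, H⟩ := H (s ^ 2) (by positivity) hs2
      refine ⟨n + 1, ?_, fun j => if j = n then 1 else 0, fun j => ?_, ?_, fun p p' hc => ?_⟩
      · push_cast; linarith
      · change (0 : ℝ) ≤ if j = n then 1 else 0
        split_ifs <;> norm_num
      · rw [Finset.sum_ite_eq' (Finset.range (n + 1)) n, if_pos (Finset.self_mem_range_succ n)]
      · have hc' : Coupled (drift V U β g) (fun φ => drift V U β g' φ - 0) s p p' := by
          simpa using hc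
        obtain ⟨a, ha, hcal⟩ := hc'.caloric hl hV h1 h2
        have h0 : ∀ x, zx U (0 : U → ℝ) x = 0 := fun x => by
          unfold zx; split_ifs <;> rfl
        have := H a ha (fun n x => zx U (p' n) x + g' x - (zx U (p n) x + g x))
          (fun n x hx => by have := hcal n x hx; rwa [h0, add_zero] at this)
          (fun n x hx => by simp only [zx_not_mem _ hx]; ring) ‖p' 0 - p 0‖ (norm_nonneg _)
          (fun x hx => by
            have e : zx U (p' 0) x + g' x - (zx U (p 0) x + g x) = zx U (p' 0 - p 0) x + (g' x - g x) := by
              rw [zx_sub]; ring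
            rw [e]
            exact (abs_add_le _ _).trans (by linarith [abs_zx_le U (p' 0 - p 0) x]))
        simp only [ite_mul, one_mul, zero_mul]
        rw [Finset.sum_ite_eq' (Finset.range (n + 1)) n, if_pos (Finset.self_mem_range_succ n)]
        have e : (c₁ • ev U x + c₂ • ev U y) (p' n - p n) =
            c₁ * zx U (p' n - p n) x + c₂ * zx U (p' n - p n) y := rfl
        rw [e, zx_sub, zx_sub]
        linarith)
  have e : ∀ μ : Measure (U → ℝ), (∀ x, Integrable (fun φ => zx U φ x) μ) →
      ∫ φ, (c₁ • ev U x + c₂ • ev U y) φ ∂μ = c₁ * ∫ φ, zx U φ x ∂μ + c₂ * ∫ φ, zx U φ y ∂μ := by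
    intro μ hμ
    change ∫ φ, c₁ * zx U φ x + c₂ * zx U φ y ∂μ = _
    rw [integral_add ((hμ x).const_mul c₁) ((hμ y).const_mul c₂), integral_const_mul, integral_const_mul]
  rw [e _ hInt, e _ hInt'] at key
  unfold mn
  linarith

lemma exists_bound (U : Finset (Zd d)) (g : Zd d → ℝ) : ∃ G : ℝ, 0 ≤ G ∧ ∀ x ∈ U, |g x| ≤ G :=
  ⟨∑ x ∈ U, |g x|, Finset.sum_nonneg fun _ _ => abs_nonneg _, fun _ hx =>
    Finset.single_le_sum (f := fun x => |g x|) (fun _ _ => abs_nonneg _) hx⟩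

/-- maximum principle for mean heights -/
lemma mn_sub_le {V : ℝ → ℝ} {lam Lam : ℝ} (hd : 1 ≤ d) (hl : 0 < lam) (hV : VOk V lam Lam)
    (U : Finset (Zd d)) {β : ℝ} (h1 : 1 ≤ β) (h2 : β ≤ 2) (g g' : Zd d → ℝ) (M : ℝ)
    (hM : ∀ x ∈ U, ∀ k, nbr x k ∉ U → g' (nbr x k) - g (nbr x k) ≤ M) {x : Zd d} (hx : x ∈ U) :
    mn V U β g' x - mn V U β g x ≤ M := by
  have key := mn_combination_le hd hl hV U h1 h2 g g' x x 1 0 M (fun ε hε => by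
    obtain ⟨G, hG0, hG⟩ := exists_bound U (fun x => g' x - g x)
    obtain ⟨τ, hτ0, hτ⟩ := caloric_eventually_le (Lam := 2 * Lam) hd hl U M
      (ε := ε / (1 + G)) (by positivity)
    obtain ⟨h₀, hh₀, hh₀'⟩ : ∃ h₀ : ℝ, 0 < h₀ ∧ 2 * d * (2 * Lam) * h₀ ≤ 1 / 2 := by
      refine ⟨1 / (2 * (2 * d * (2 * |Lam|) + 1)), by positivity, ?_⟩
      have : 2 * d * (2 * Lam) ≤ 2 * d * (2 * |Lam|) + 1 := by
        have := mul_le_mul_of_nonneg_left (le_abs_self Lam) (show (0 : ℝ) ≤ 4 * d by positivity)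
        linarith
      rw [mul_one_div, div_le_div_iff₀ (by positivity) (by norm_num)]
      linarith
    refine ⟨τ + h₀, h₀, hh₀, fun h hh hh' => ⟨⌈τ / h⌉₊, ?_, fun a ha u hcal hbd A hA hA0 => ?_⟩⟩
    · have := Nat.ceil_lt_add_one (show 0 ≤ τ / h by positivity)
      have := mul_lt_mul_of_pos_right this hh
      rw [add_mul, div_mul_cancel₀ _ hh.ne'] at this
      linarith
    · have hLam : 0 ≤ Lam := by
        have a1 := hV.lower 0 1 zero_le_one
        have a2 := hV.upper 0 1 zero_le_one
        linarith
      have := hτ h hh ((mul_le_mul_of_nonneg_left hh'.le (by positivity)).trans hh₀') a ha u hcal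
        (fun n x hx k hk => by rw [hbd n _ hk]; exact hM x hx k hk) (A + G)
        (fun x hx => (hA0 x hx).trans (by linarith [hG x hx])) ⌈τ / h⌉₊ (by
          have := Nat.le_ceil (τ / h)
          rwa [div_le_iff₀ hh] at this) x hx
      rw [one_mul, zero_mul, add_zero]
      refine this.trans ?_
      have : ε / (1 + G) * (1 + (A + G)) ≤ ε * (1 + A) ^ 2 := by
        rw [div_mul_eq_mul_div, div_le_iff₀ (by positivity), mul_assoc]
        refine mul_le_mul_of_nonneg_left ?_ hε.le
        nlinarith [mul_nonneg hA hG0, mul_nonneg (mul_nonneg hA hA) hG0]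
      linarith)
  linarith

end

noncomputable section
variable {d : ℕ}

lemma Lap_neg (a : Zd d → Zd d → ℝ) (u : Zd d → ℝ) (x : Zd d) : Lap a (fun y => -u y) x = -Lap a u x := by
  unfold Lap
  rw [← Finset.sum_neg_distrib]
  exact Finset.sum_congr rfl fun k _ => by ring

lemma VOk.Lam_nonneg {V : ℝ → ℝ} {lam Lam : ℝ} (hl : 0 < lam) (hV : VOk V lam Lam) : 0 ≤ Lam := by
  have a1 := hV.lower 0 1 zero_le_one
  have a2 := hV.upper 0 1 zero_le_one
  linarith

lemma exists_step_size (c : ℝ) {δ h₁ : ℝ} (hδ : 0 < δ) (hh₁ : 0 < h₁) : ∃ h₀ : ℝ, 0 < h₀ ∧ h₀ ≤ h₁ ∧ |c| * h₀ ≤ δ := by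
  refine ⟨min h₁ (δ / (|c| + 1)), lt_min hh₁ (by positivity), min_le_left _ _, ?_⟩
  calc |c| * min h₁ (δ / (|c| + 1)) ≤ (|c| + 1) * (δ / (|c| + 1)) :=
        mul_le_mul (by linarith) (min_le_right _ _) (le_min hh₁.le (by positivity)) (by positivity)
    _ = δ := mul_div_cancel₀ _ (by positivity)

/-- Hölder estimates for differences of mean heights, in the interior and at a flat boundary -/
theorem mn_holder (d : ℕ) (hd : 1 ≤ d) (lam Lam : ℝ) (hl : 0 < lam) (hL : lam ≤ Lam) :
    ∃ α C : ℝ, 0 < α ∧ 0 < C ∧ ∀ V, VOk V lam Lam → ∀ (U : Finset (Zd d)) (β : ℝ), 1 ≤ β → β ≤ 2 →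
      ∀ (g g' : Zd d → ℝ) (x0 : Zd d) (R r : ℕ), 1 ≤ r → r ≤ R → ∀ M : ℝ, 0 ≤ M →
      (box x0 R ⊆ U → (∀ x ∈ U, ∀ k, nbr x k ∉ U → |g' (nbr x k) - g (nbr x k)| ≤ M) →
        ∀ x ∈ box x0 r, |mn V U β g' x - mn V U β g x - (mn V U β g' x0 - mn V U β g x0)| ≤
          C * M * ((r : ℝ) / R) ^ α) ∧
      (∀ (i : Fin d) (σ : ℤ), (∀ x ∈ box x0 R, 0 ≤ σ * (x i - x0 i) → x ∉ U) →
        (∀ x ∈ U, ∀ k, nbr x k ∉ U → g' (nbr x k) - g (nbr x k) ≤ M) →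
        (∀ x ∈ box x0 R, x ∉ U → g' x - g x ≤ M * (‖x - x0‖ / R)) →
        ∀ x ∈ box x0 r, mn V U β g' x - mn V U β g x ≤ C * M * ((r : ℝ) / R) ^ α) := by
  obtain ⟨α, C, h₁, hα, hC, hh₁, -, -, hol⟩ := parabolic_holder d hd lam (2 * Lam) hl (by linarith)
  refine ⟨α, C, hα, hC, fun V hV U β hβ1 hβ2 g g' x0 R r hr hrR M hM => ?_⟩
  have hR : (0 : ℝ) < R := by exact_mod_cast hr.trans hrR
  have hρ0 : (0 : ℝ) ≤ (r : ℝ) / R := by positivity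
  have hρ1 : (r : ℝ) / R ≤ 1 := (div_le_one hR).2 (by exact_mod_cast hrR)
  have hρα : ((r : ℝ) / R) ^ α ≤ 1 := Real.rpow_le_one hρ0 hρ1 hα.le
  have hρα0 : 0 ≤ ((r : ℝ) / R) ^ α := Real.rpow_nonneg hρ0 _
  have hLam := hV.Lam_nonneg hl
  obtain ⟨G, hG0, hG⟩ := exists_bound U (fun x => g' x - g x)
  have time : ∀ τ h : ℝ, 0 ≤ τ → 0 < h → τ ≤ ⌈τ / h⌉₊ * h ∧ ⌈τ / h⌉₊ * h ≤ τ + h := by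
    intro τ h hτ hh
    have a1 := Nat.le_ceil (τ / h)
    have a2 := mul_lt_mul_of_pos_right (Nat.ceil_lt_add_one (show 0 ≤ τ / h by positivity)) hh
    rw [add_mul, div_mul_cancel₀ _ hh.ne'] at a2
    rw [div_le_iff₀ hh] at a1
    exact ⟨a1, by linarith⟩
  have err : ∀ ε > 0, ∀ A, 0 ≤ A →
      C * (M + ε / (C * (1 + G)) * (1 + (A + G))) * ((r : ℝ) / R) ^ α ≤
        C * M * ((r : ℝ) / R) ^ α + ε * (1 + A) ^ 2 := by
    intro ε hε A hA
    have e1 : C * (M + ε / (C * (1 + G)) * (1 + (A + G))) * ((r : ℝ) / R) ^ α =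
      C * M * ((r : ℝ) / R) ^ α + ε * ((1 + (A + G)) / (1 + G) * ((r : ℝ) / R) ^ α) := by
      field_simp
    rw [e1]
    have e2 : (1 + (A + G)) / (1 + G) ≤ (1 + A) ^ 2 := by
      rw [div_le_iff₀ (by positivity)]
      nlinarith [mul_nonneg hA hG0, mul_nonneg (mul_nonneg hA hA) hG0]
    have e3 : (1 + (A + G)) / (1 + G) * ((r : ℝ) / R) ^ α ≤ (1 + A) ^ 2 * 1 :=
      mul_le_mul e2 hρα hρα0 (by positivity)
    have := mul_le_mul_of_nonneg_left e3 hε.le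
    linarith
  constructor
  · intro hbox hbd
    have main : ∀ x ∈ box x0 r, ∀ ε > 0, ∃ τ : ℝ, ∃ h₀ > 0, ∀ h, 0 < h → h < h₀ → ∃ n : ℕ, n * h ≤ τ ∧
        ∀ a : ℕ → Zd d → Zd d → ℝ, (∀ n, Ell lam (2 * Lam) (a n)) → ∀ u : ℕ → Zd d → ℝ,
        (∀ n, ∀ x ∈ U, u (n + 1) x = u n x + h * Lap (a n) (u n) x) →
        (∀ n, ∀ x, x ∉ U → u n x = g' x - g x) →
        ∀ A, 0 ≤ A → (∀ x ∈ U, |u 0 x| ≤ A + |g' x - g x|) →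
        |u n x - u n x0| ≤ C * M * ((r : ℝ) / R) ^ α + ε * (1 + A) ^ 2 := by
      intro x hx ε hε
      obtain ⟨τ, hτ0, hτ⟩ := caloric_eventually_le (Lam := 2 * Lam) hd hl U M
        (ε := ε / (C * (1 + G))) (by positivity)
      obtain ⟨h₀, hh₀, hh₀1, hh₀'⟩ := exists_step_size (2 * d * (2 * Lam)) (δ := 1 / 2) (by norm_num) hh₁
      rw [abs_of_nonneg (by positivity)] at hh₀'
      refine ⟨τ + R ^ 2 + 2 * h₀, h₀, hh₀, fun h hh hh' => ⟨⌈τ / h⌉₊ + ⌈(R : ℝ) ^ 2 / h⌉₊, ?_,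
        fun a ha u hcal hout A hA hA0 => ?_⟩⟩
      · have a1 := (time τ h hτ0 hh).2
        have a2 := (time (R ^ 2) h (by positivity) hh).2
        push_cast
        linarith
      · have hh2 : 2 * d * (2 * Lam) * h ≤ 1 / 2 :=
          (mul_le_mul_of_nonneg_left hh'.le (by positivity)).trans hh₀'
        have b1 := hτ h hh hh2 a ha u hcal
          (fun n x hx k hk => by rw [hout n _ hk]; exact (le_abs_self _).trans (hbd x hx k hk)) (A + G)
          (fun x hx => (hA0 x hx).trans (by linarith [hG x hx]))
        have b2 := hτ h hh hh2 a ha (fun n x => -u n x)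
          (fun n x hx => by rw [hcal n x hx, Lap_neg]; ring)
          (fun n x hx k hk => by rw [hout n _ hk]; exact (neg_le_abs _).trans (hbd x hx k hk)) (A + G)
          (fun x hx => by rw [abs_neg]; exact (hA0 x hx).trans (by linarith [hG x hx]))
        set n0 := ⌈τ / h⌉₊ with hn0
        have hn : ∀ k : ℕ, τ ≤ ((n0 + k : ℕ) : ℝ) * h := fun k => by
          have := (time τ h hτ0 hh).1
          have h3 : (0 : ℝ) ≤ k * h := by positivity
          push_cast
          linarith
        have hM' : 0 ≤ M + ε / (C * (1 + G)) * (1 + (A + G)) := by positivity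
        have := (hol h hh (hh'.le.trans hh₀1) (fun n => a (n0 + n)) (fun n => ha _) x0 R r ⌈(R : ℝ) ^ 2 / h⌉₊ hr hrR
          (time (R ^ 2) h (by positivity) hh).1 _ hM' (fun n => u (n0 + n))).1
          (fun n _ x hx => abs_le.2 ⟨by linarith [b2 (n0 + n) (hn n) x (hbox hx)],
            b1 (n0 + n) (hn n) x (hbox hx)⟩)
          (fun n _ x hx => hcal (n0 + n) x (hbox (box_mono (Nat.sub_le _ _) hx))) x hx
        exact this.trans (err ε hε A hA)
    intro x hx
    have k1 := mn_combination_le hd hl hV U hβ1 hβ2 g g' x x0 1 (-1) (C * M * ((r : ℝ) / R) ^ α)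
      (fun ε hε => by
        obtain ⟨τ, h₀, hh₀, H⟩ := main x hx ε hε
        refine ⟨τ, h₀, hh₀, fun h hh hh' => ?_⟩
        obtain ⟨n, hn, H⟩ := H h hh hh'
        refine ⟨n, hn, fun a ha u h1 h2 A hA h3 => ?_⟩
        linarith [le_abs_self (u n x - u n x0), H a ha u h1 h2 A hA h3])
    have k2 := mn_combination_le hd hl hV U hβ1 hβ2 g g' x x0 (-1) 1 (C * M * ((r : ℝ) / R) ^ α)
      (fun ε hε => by
        obtain ⟨τ, h₀, hh₀, H⟩ := main x hx ε hε
        refine ⟨τ, h₀, hh₀, fun h hh hh' => ?_⟩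
        obtain ⟨n, hn, H⟩ := H h hh hh'
        refine ⟨n, hn, fun a ha u h1 h2 A hA h3 => ?_⟩
        linarith [neg_abs_le (u n x - u n x0), H a ha u h1 h2 A hA h3])
    exact abs_le.2 ⟨by linarith, by linarith⟩
  · intro i σ hface hbd hnear x hx
    have hx0 : ∀ x ∈ box x0 R, M * (‖x - x0‖ / R) ≤ M := fun x hx =>
      mul_le_of_le_one_right hM ((div_le_one hR).2 (mem_box_iff_norm.1 hx))
    have k := mn_combination_le hd hl hV U hβ1 hβ2 g g' x x 1 0 (C * M * ((r : ℝ) / R) ^ α)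
      (fun ε hε => by
        obtain ⟨τ, hτ0, hτ⟩ := caloric_eventually_le (Lam := 2 * Lam) hd hl U M
          (ε := ε / (C * (1 + G))) (by positivity)
        obtain ⟨h₀, hh₀, hh₀1, hh₀'⟩ := exists_step_size (2 * d * (2 * Lam)) (δ := 1 / 2) (by norm_num) hh₁
        rw [abs_of_nonneg (by positivity)] at hh₀'
        refine ⟨τ + R ^ 2 + 2 * h₀, h₀, hh₀, fun h hh hh' => ⟨⌈τ / h⌉₊ + ⌈(R : ℝ) ^ 2 / h⌉₊, ?_,
          fun a ha u hcal hout A hA hA0 => ?_⟩⟩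
        · have a1 := (time τ h hτ0 hh).2
          have a2 := (time (R ^ 2) h (by positivity) hh).2
          push_cast
          linarith
        · have hh2 : 2 * d * (2 * Lam) * h ≤ 1 / 2 :=
            (mul_le_mul_of_nonneg_left hh'.le (by positivity)).trans hh₀'
          have b1 := hτ h hh hh2 a ha u hcal
            (fun n x hx k hk => by rw [hout n _ hk]; exact hbd x hx k hk) (A + G)
            (fun x hx => (hA0 x hx).trans (by linarith [hG x hx]))
          set n0 := ⌈τ / h⌉₊ with hn0
          have hn : ∀ k : ℕ, τ ≤ ((n0 + k : ℕ) : ℝ) * h := fun k => by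
            have := (time τ h hτ0 hh).1
            have h3 : (0 : ℝ) ≤ k * h := by positivity
            push_cast
            linarith
          have hε' : 0 ≤ ε / (C * (1 + G)) * (1 + (A + G)) := by positivity
          have hM' : 0 ≤ M + ε / (C * (1 + G)) * (1 + (A + G)) := by positivity
          have := (hol h hh (hh'.le.trans hh₀1) (fun n => a (n0 + n)) (fun n => ha _) x0 R r ⌈(R : ℝ) ^ 2 / h⌉₊ hr hrR
            (time (R ^ 2) h (by positivity) hh).1 _ hM' (fun n => u (n0 + n))).2 (U : Set (Zd d)) i σ
            (fun x hx h => fun h' => hface x hx h (Finset.mem_coe.1 h'))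
            (fun n _ x _ hxU => hcal (n0 + n) x (Finset.mem_coe.1 hxU))
            (fun n _ x hx => by
              by_cases hxU : x ∈ U
              · exact b1 (n0 + n) (hn n) x hxU
              · rw [hout _ _ hxU]
                exact ((hnear x hx hxU).trans (hx0 x hx)).trans (by linarith))
            (fun n _ x hx hxU => by
              have hxU' : x ∉ U := fun h => hxU (Finset.mem_coe.2 h)
              rw [hout _ _ hxU']
              exact (hnear x hx hxU').trans (mul_le_mul_of_nonneg_right (by linarith) (by positivity))) x hx
          have e := err ε hε A hA
          linarith)
    linarith
end

noncomputable section
section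
variable {ι : Type*} [Fintype ι]

/-- the linear functional with coefficients `w` -/
def linF (w : ι → ℝ) : (ι → ℝ) →L[ℝ] ℝ := ∑ i, w i • ContinuousLinearMap.proj i

lemma linF_apply (w φ : ι → ℝ) : linF w φ = ∑ i, w i * φ i := by
  simp [linF]

lemma linF_smul (t : ℝ) (w φ : ι → ℝ) : linF (t • w) φ = t * linF w φ := by
  simp only [linF_apply, Finset.mul_sum, Pi.smul_apply, smul_eq_mul, mul_assoc]

lemma linF_neg (w φ : ι → ℝ) : linF (-w) φ = -linF w φ := by
  simp [linF_apply]

lemma Good.tilt {H : (ι → ℝ) → ℝ} {b : (ι → ℝ) → ι → ℝ} {K c : ℝ} (g : Good H b K c) (w : ι → ℝ) :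
    ∃ K' c', Good (fun φ => H φ - linF w φ) (fun φ => b φ - w) K' c' := by
  have hc := g.hc
  have hK := g.hK
  have hS : 0 ≤ ∑ i, w i ^ 2 / (2 * c) := Finset.sum_nonneg fun _ _ => by positivity
  have hn := norm_nonneg w
  refine ⟨K + ‖w‖ + ∑ i, w i ^ 2 / (2 * c), c / 2, by positivity, by positivity, fun φ δ => ?_,
    fun φ ψ => ?_, fun φ => ?_, fun φ => ?_⟩
  · have e : H (φ + δ) - linF w (φ + δ) - (H φ - linF w φ) - ∑ i, (b φ - w) i * δ i =
        H (φ + δ) - H φ - ∑ i, b φ i * δ i := by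
      have : ∑ i, (b φ - w) i * δ i = ∑ i, b φ i * δ i - linF w δ := by
        rw [linF_apply, ← Finset.sum_sub_distrib]
        exact Finset.sum_congr rfl fun i _ => by rw [Pi.sub_apply, sub_mul]
      rw [this, map_add]
      ring
    rw [e]
    exact (g.taylor φ δ).trans (mul_le_mul_of_nonneg_right (by linarith) (by positivity))
  · rw [sub_sub_sub_cancel_right]
    exact (g.lip φ ψ).trans (mul_le_mul_of_nonneg_right (by linarith) (norm_nonneg _))
  · have a1 := g.grow φ
    have a2 := norm_sub_le (b φ) w
    have a3 : 0 ≤ (‖w‖ + ∑ i, w i ^ 2 / (2 * c)) * ‖φ‖ := by positivity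
    linarith
  · have a1 := g.lower φ
    have a2 : linF w φ ≤ c / 2 * ∑ i, φ i ^ 2 + ∑ i, w i ^ 2 / (2 * c) := by
      rw [linF_apply, Finset.mul_sum, ← Finset.sum_add_distrib]
      refine Finset.sum_le_sum fun i _ => ?_
      have : c / 2 * φ i ^ 2 + w i ^ 2 / (2 * c) - w i * φ i = (c * φ i - w i) ^ 2 / (2 * c) := by
        field_simp
        ring
      have h2 : 0 ≤ (c * φ i - w i) ^ 2 / (2 * c) := by positivity
      linarith
    linarith

/-- exponential moments from control of tilted means -/
lemma Conf0.exp_moment_le {H : (ι → ℝ) → ℝ} {K c K' c' : ℝ} (g : Conf0 H K c) {w : ι → ℝ}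
    (g' : Conf0 (fun φ => H φ - linF w φ) K' c') (m : ℝ)
    (hm : ∫ φ, linF w φ ∂(gm fun φ => H φ - linF w φ) ≤ m) :
    Integrable (fun φ => Real.exp (linF w φ)) (gm H) ∧ ∫ φ, Real.exp (linF w φ) ∂(gm H) ≤ Real.exp m := by
  have hprob := g'.prob
  have hZ := g.Z_pos
  have hZ' := g'.Z_pos
  have e1 : ∀ φ, Real.exp (linF w φ) * Real.exp (-H φ) = Real.exp (-(H φ - linF w φ)) := fun φ => by
    rw [← Real.exp_add]; congr 1; ring
  have hi : Integrable (fun φ => Real.exp (linF w φ)) (gm H) := by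
    rw [g.integrable_gm_iff]
    simp only [e1]
    exact g'.integrable_exp
  refine ⟨hi, ?_⟩
  set m' := ∫ φ, linF w φ ∂(gm fun φ => H φ - linF w φ) with hm'
  have e2 : ∀ φ, Real.exp (-linF w φ) * Real.exp (-(H φ - linF w φ)) = Real.exp (-H φ) := fun φ => by
    rw [← Real.exp_add]; congr 1; ring
  have hi2 : Integrable (fun φ => Real.exp (-linF w φ)) (gm fun φ => H φ - linF w φ) := by
    rw [g'.integrable_gm_iff]
    simp only [e2]
    exact g.integrable_exp
  have hi3 : Integrable (fun φ => linF w φ) (gm fun φ => H φ - linF w φ) :=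
    g'.integrable_gm (p := 1) (A := ‖linF w‖) (linF w).continuous (fun φ => by
      have := (linF w).le_opNorm φ
      rw [Real.norm_eq_abs] at this
      rw [pow_one]
      linarith [norm_nonneg (linF w)])
  have j1 : ∫ φ, (Real.exp (-m') * (1 + m' - linF w φ)) ∂(gm fun φ => H φ - linF w φ) ≤
      ∫ φ, Real.exp (-linF w φ) ∂(gm fun φ => H φ - linF w φ) := by
    refine integral_mono ((((integrable_const _).sub hi3)).const_mul _) hi2 fun φ => ?_
    have := Real.add_one_le_exp (m' - linF w φ)
    calc Real.exp (-m') * (1 + m' - linF w φ) ≤ Real.exp (-m') * Real.exp (m' - linF w φ) :=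
          mul_le_mul_of_nonneg_left (by linarith) (Real.exp_pos _).le
      _ = Real.exp (-linF w φ) := by rw [← Real.exp_add]; congr 1; ring
  rw [integral_const_mul, integral_sub (integrable_const _) hi3, integral_const, probReal_univ,
    one_smul, ← hm', add_sub_cancel_right, mul_one] at j1
  rw [g'.integral_gm] at j1
  simp only [e2] at j1
  rw [g.integral_gm]
  simp only [e1]
  set Z := ∫ φ, Real.exp (-H φ)
  set Z' := ∫ φ, Real.exp (-(H φ - linF w φ))
  rw [le_div_iff₀ hZ'] at j1
  rw [div_le_iff₀ hZ]
  calc Z' = Real.exp m' * (Real.exp (-m') * Z') := by rw [← mul_assoc, ← Real.exp_add]; simp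
    _ ≤ Real.exp m' * Z := mul_le_mul_of_nonneg_left j1 (Real.exp_pos _).le
    _ ≤ Real.exp m * Z := mul_le_mul_of_nonneg_right (Real.exp_le_exp.2 hm) hZ.le
end

variable {d : ℕ}

lemma linF_zx (U : Finset (Zd d)) (w φ : U → ℝ) : linF w φ = ∑ x ∈ U, zx U w x * zx U φ x := by
  rw [linF_apply, ← Finset.sum_coe_sort U]
  exact Finset.sum_congr rfl fun x _ => by rw [zx_coe, zx_coe]

lemma tilted_mean_le {V : ℝ → ℝ} {lam Lam : ℝ} (hd : 1 ≤ d) (hl : 0 < lam) (hV : VOk V lam Lam)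
    (U : Finset (Zd d)) {β : ℝ} (h1 : 1 ≤ β) (h2 : β ≤ 2) (g : Zd d → ℝ) (w : U → ℝ) {Γ : ℝ} (hΓ : 0 ≤ Γ)
    (hw : ∀ v : Zd d → ℝ, (∀ x, x ∉ U → v x = 0) → (∑ x ∈ U, zx U w x * v x) ^ 2 ≤ Γ * En U v)
    {t : ℝ} (ht : 0 < t) :
    ∫ φ, linF w φ ∂(gm fun φ => Ham V U β g φ - linF (t • w) φ) - ∫ φ, linF w φ ∂(gm (Ham V U β g)) ≤
      4 * t * Γ / lam := by
  obtain ⟨K, c, hg⟩ := Ham_good hd hl hV U h1 h2 g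
  obtain ⟨K', c', hg'⟩ := hg.tilt (t • w)
  obtain ⟨B, hB⟩ := exists_suppIn U
  have hLam := hV.Lam_nonneg hl
  refine hg.mean_le_of_coupling hg' (linF w) _ fun ε hε => ?_
  set W : ℝ := ∑ x ∈ U, zx U w x ^ 2 with hW
  have hW0 : 0 ≤ W := Finset.sum_nonneg fun _ _ => sq_nonneg _
  obtain ⟨h₀, hh₀, hh₀1, hh₀2⟩ := exists_step_size (2 * d * (2 * Lam)) (δ := 1 / 4) (by norm_num) one_pos
  rw [abs_of_nonneg (by positivity)] at hh₀2
  obtain ⟨h₁, hh₁, hh₁1, hh₁2⟩ := exists_step_size (t * W) (δ := ε / 2) (by positivity) hh₀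
  rw [abs_of_nonneg (by positivity)] at hh₁2
  set τ : ℝ := (U.card + 1) / (t * ε) with hτ
  have hτ0 : 0 < τ := by positivity
  refine ⟨τ + h₁, √h₁, Real.sqrt_pos.2 hh₁, fun s hs hs' => ?_⟩
  have hs2 : s ^ 2 < h₁ := (Real.lt_sqrt hs.le).1 hs'
  have hsp : 0 < s ^ 2 := by positivity
  set h := s ^ 2 with hh
  have b1 : τ ≤ ⌈τ / h⌉₊ * h := (div_le_iff₀ hsp).1 (Nat.le_ceil (τ / h))
  have b2 : ⌈τ / h⌉₊ * h ≤ τ + h := by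
    have a2 := mul_lt_mul_of_pos_right (Nat.ceil_lt_add_one (show 0 ≤ τ / h by positivity)) hsp
    rw [add_mul, div_mul_cancel₀ _ hsp.ne'] at a2
    linarith
  set N := ⌈τ / h⌉₊ with hN
  have hN0 : (0 : ℝ) < N := by
    by_contra hc
    have := mul_nonpos_of_nonpos_of_nonneg (not_lt.1 hc) hsp.le
    linarith
  refine ⟨N, by linarith, fun _ => 1 / N, fun _ => by positivity, ?_, fun p p' hc => ?_⟩
  · rw [Finset.sum_const, Finset.card_range, nsmul_eq_mul, mul_one_div, div_self hN0.ne']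
  · obtain ⟨a, ha, hcal⟩ := hc.caloric hl hV h1 h2
    set u : ℕ → Zd d → ℝ := fun n x => zx U (p' n) x + g x - (zx U (p n) x + g x) with hu
    have hu' : ∀ n x, u n x = zx U (p' n - p n) x := fun n x => by rw [zx_sub]; simp only [hu]; ring
    have key := tilted_average (lam := lam) (Lam := 2 * Lam) hl hsp ht
      ((mul_le_mul_of_nonneg_left (hs2.le.trans hh₁1) (by positivity)).trans hh₀2) hB (zx U w) hw ha
      (u := u) (fun n x hx => by
        have := hcal n x hx
        rw [zx_smul] at this
        exact this)
      (fun n x hx => by rw [hu', zx_not_mem _ hx]) hΓ N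
    have e1 : ∀ n, ∑ x ∈ U, zx U w x * u n x = linF w (p' n - p n) := fun n => by
      rw [linF_zx]
      exact Finset.sum_congr rfl fun x _ => by rw [hu']
    simp only [e1] at key
    rw [← Finset.mul_sum]
    set S := ∑ n ∈ Finset.range N, linF w (p' n - p n) with hS
    set A := ‖p' 0 - p 0‖ with hA
    have hA0 : 0 ≤ A := norm_nonneg _
    have e2 : ∑ x ∈ U, u 0 x ^ 2 ≤ (U.card + 1) * (1 + A) ^ 2 := by
      have : ∀ x ∈ U, u 0 x ^ 2 ≤ (1 + A) ^ 2 := fun x _ => by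
        rw [hu', ← sq_abs]
        exact pow_le_pow_left₀ (abs_nonneg _) ((abs_zx_le U _ x).trans (by linarith)) 2
      refine (Finset.sum_le_card_nsmul _ _ _ this).trans ?_
      rw [nsmul_eq_mul]
      exact mul_le_mul_of_nonneg_right (by linarith) (by positivity)
    have e3 : (U.card + 1) * (1 + A) ^ 2 ≤ h * N * (t * ε * (1 + A) ^ 2) := by
      have : (U.card + 1 : ℝ) = τ * (t * ε) := by rw [hτ]; field_simp
      rw [this]
      have := mul_le_mul_of_nonneg_right b1 (show 0 ≤ t * ε * (1 + A) ^ 2 by positivity)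
      linarith
    have e4 : 2 * h ^ 2 * t ^ 2 * W ≤ h * t * ε := by
      have := mul_le_mul_of_nonneg_left ((mul_le_mul_of_nonneg_left hs2.le
        (show 0 ≤ t * W by positivity)).trans hh₁2) (show 0 ≤ 2 * h * t by positivity)
      linarith
    have e5 : ε ≤ ε * (1 + A) ^ 2 := le_mul_of_one_le_right hε.le (by nlinarith)
    have e6 : N * (2 * h ^ 2 * t ^ 2 * W) ≤ N * (h * t * (ε * (1 + A) ^ 2)) := by
      refine mul_le_mul_of_nonneg_left (e4.trans ?_) hN0.le
      exact mul_le_mul_of_nonneg_left e5 (by positivity)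
    have e7 : 2 * h * t * S ≤ 2 * h * t * (N * (4 * t * Γ / lam + ε * (1 + A) ^ 2)) := by
      have : N * (8 * h * t ^ 2 * Γ / lam) = 2 * h * t * (N * (4 * t * Γ / lam)) := by ring
      linarith
    have e8 := le_of_mul_le_mul_left e7 (by positivity)
    rw [one_div, inv_mul_le_iff₀ hN0]
    exact e8

/-- sub-Gaussian concentration of linear observables -/
theorem exp_moment {V : ℝ → ℝ} {lam Lam : ℝ} (hd : 1 ≤ d) (hl : 0 < lam) (hV : VOk V lam Lam)
    (U : Finset (Zd d)) {β : ℝ} (h1 : 1 ≤ β) (h2 : β ≤ 2) (g : Zd d → ℝ) (w : U → ℝ) {Γ : ℝ} (hΓ : 0 ≤ Γ)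
    (hw : ∀ v : Zd d → ℝ, (∀ x, x ∉ U → v x = 0) → (∑ x ∈ U, zx U w x * v x) ^ 2 ≤ Γ * En U v)
    {t : ℝ} (ht : 0 < t) {m : ℝ} (hm : m = ∫ φ, linF w φ ∂(gm (Ham V U β g))) :
    Integrable (fun φ => Real.exp (t * |linF w φ - m|)) (gm (Ham V U β g)) ∧
    ∫ φ, Real.exp (t * |linF w φ - m|) ∂(gm (Ham V U β g)) ≤ 2 * Real.exp (4 * t ^ 2 * Γ / lam) := by
  obtain ⟨K, c, hg⟩ := Ham_good hd hl hV U h1 h2 g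
  have side : ∀ w : U → ℝ, (∀ v : Zd d → ℝ, (∀ x, x ∉ U → v x = 0) →
      (∑ x ∈ U, zx U w x * v x) ^ 2 ≤ Γ * En U v) → ∀ m, m = ∫ φ, linF w φ ∂(gm (Ham V U β g)) →
      Integrable (fun φ => Real.exp (t * (linF w φ - m))) (gm (Ham V U β g)) ∧
      ∫ φ, Real.exp (t * (linF w φ - m)) ∂(gm (Ham V U β g)) ≤ Real.exp (4 * t ^ 2 * Γ / lam) := by
    intro w hw m hm
    obtain ⟨K', c', hg'⟩ := hg.tilt (t • w)
    have a := tilted_mean_le hd hl hV U h1 h2 g w hΓ hw ht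
    rw [← hm] at a
    have b := hg.conf.exp_moment_le hg'.conf (t * m + 4 * t ^ 2 * Γ / lam) (by
      simp only [linF_smul] at a ⊢
      rw [integral_const_mul]
      have := mul_le_mul_of_nonneg_left a ht.le
      have e : t * (4 * t * Γ / lam) = 4 * t ^ 2 * Γ / lam := by ring
      rw [e] at this
      linarith)
    have e : ∀ φ, Real.exp (t * (linF w φ - m)) = Real.exp (-(t * m)) * Real.exp (linF (t • w) φ) := fun φ => by
      rw [linF_smul, ← Real.exp_add]; congr 1; ring
    simp only [e]
    refine ⟨b.1.const_mul _, ?_⟩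
    rw [integral_const_mul]
    calc _ ≤ Real.exp (-(t * m)) * Real.exp (t * m + 4 * t ^ 2 * Γ / lam) :=
          mul_le_mul_of_nonneg_left b.2 (Real.exp_pos _).le
      _ = _ := by rw [← Real.exp_add]; congr 1; ring
  obtain ⟨p1, p2⟩ := side w hw m hm
  obtain ⟨q1, q2⟩ := side (-w) (fun v hv => by
    have e : ∀ x, zx U (-w) x = -zx U w x := fun x => by
      have := zx_smul U (-1) w x
      rwa [neg_one_smul, neg_one_mul] at this
    simp only [e, neg_mul, Finset.sum_neg_distrib, neg_sq]
    exact hw v hv) (-m) (by simp only [linF_neg]; rw [integral_neg, hm])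
  have hle : ∀ φ, Real.exp (t * |linF w φ - m|) ≤
      Real.exp (t * (linF w φ - m)) + Real.exp (t * (linF (-w) φ - -m)) := fun φ => by
    rw [linF_neg]
    rcases abs_cases (linF w φ - m) with ⟨h, -⟩ | ⟨h, -⟩
    · rw [h]; linarith [Real.exp_pos (t * (-linF w φ - -m))]
    · rw [h, show -(linF w φ - m) = -linF w φ - -m by ring]; linarith [Real.exp_pos (t * (linF w φ - m))]
  have hsum := p1.add q1
  have hcont : Continuous fun φ => Real.exp (t * |linF w φ - m|) := by
    have := (linF w).continuous
    fun_prop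
  have hi : Integrable (fun φ => Real.exp (t * |linF w φ - m|)) (gm (Ham V U β g)) :=
    hsum.mono' hcont.aestronglyMeasurable (Eventually.of_forall fun φ => by
      rw [Real.norm_eq_abs, abs_of_pos (Real.exp_pos _)]
      exact hle φ)
  refine ⟨hi, (integral_mono hi hsum hle).trans ?_⟩
  have e : ∫ φ, (Real.exp (t * (linF w φ - m)) + Real.exp (t * (linF (-w) φ - -m))) ∂(gm (Ham V U β g)) =
    _ := integral_add p1 q1
  change ∫ φ, (Real.exp (t * (linF w φ - m)) + Real.exp (t * (linF (-w) φ - -m))) ∂(gm (Ham V U β g)) ≤ _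
  rw [e]
  linarith
end

noncomputable section
variable {d : ℕ}

lemma mn_eq {V : ℝ → ℝ} {lam Lam : ℝ} (hd : 1 ≤ d) (hl : 0 < lam) (hV : VOk V lam Lam)
    (U : Finset (Zd d)) {β : ℝ} (h1 : 1 ≤ β) (h2 : β ≤ 2) (g : Zd d → ℝ) (x : Zd d) :
    mn V U β g x = g x + (∫ φ, zx U φ x * Real.exp (-Ham V U β g φ)) /
      ∫ φ, Real.exp (-Ham V U β g φ) := by
  obtain ⟨K, c, hG⟩ := Ham_good hd hl hV U h1 h2 g
  rw [mn, hG.conf.integral_gm]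

lemma integrable_zx {V : ℝ → ℝ} {lam Lam : ℝ} (hd : 1 ≤ d) (hl : 0 < lam) (hV : VOk V lam Lam)
    (U : Finset (Zd d)) {β : ℝ} (h1 : 1 ≤ β) (h2 : β ≤ 2) (g : Zd d → ℝ) (x : Zd d) :
    Integrable (fun φ => zx U φ x) (gm (Ham V U β g)) := by
  obtain ⟨K, c, hG⟩ := Ham_good hd hl hV U h1 h2 g
  refine hG.conf.integrable_gm (ev U x).continuous (A := 1) (p := 1) fun φ => ?_
  have := abs_zx_le U φ x
  rw [one_mul, pow_one]
  linarith

lemma Ham_prob {V : ℝ → ℝ} {lam Lam : ℝ} (hd : 1 ≤ d) (hl : 0 < lam) (hV : VOk V lam Lam)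
    (U : Finset (Zd d)) {β : ℝ} (h1 : 1 ≤ β) (h2 : β ≤ 2) (g : Zd d → ℝ) :
    IsProbabilityMeasure (gm (Ham V U β g)) := by
  obtain ⟨K, c, hG⟩ := Ham_good hd hl hV U h1 h2 g
  exact hG.conf.prob

lemma Ham_congr (V : ℝ → ℝ) (U : Finset (Zd d)) (β : ℝ) {g g' : Zd d → ℝ}
    (h : ∀ x k, g' (nbr x k) - g' x = g (nbr x k) - g x) : Ham V U β g' = Ham V U β g := by
  funext φ
  simp only [Ham, h]

lemma mn_add_const (V : ℝ → ℝ) (U : Finset (Zd d)) (β : ℝ) (g : Zd d → ℝ) (c : ℝ) (x : Zd d) :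
    mn V U β (fun y => g y + c) x = mn V U β g x + c := by
  rw [mn, mn, Ham_congr V U β (g := g) (fun x k => by ring)]
  ring

lemma mn_neg {V : ℝ → ℝ} {lam Lam : ℝ} (hd : 1 ≤ d) (hl : 0 < lam) (hV : VOk V lam Lam)
    (U : Finset (Zd d)) {β : ℝ} (h1 : 1 ≤ β) (h2 : β ≤ 2) (g : Zd d → ℝ) (x : Zd d) :
    mn V U β (fun y => -g y) x = -mn V U β g x := by
  have hH : ∀ φ, Ham V U β (fun y => -g y) φ = Ham V U β g (-φ) := fun φ => by
    have hz : ∀ y, zx U (-φ) y = -zx U φ y := fun y => by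
      rw [show -φ = (-1 : ℝ) • φ by simp, zx_smul]; ring
    unfold Ham
    refine Finset.sum_congr rfl fun y _ => Finset.sum_congr rfl fun k _ => ?_
    rw [hz, hz, ← hV.even]
    congr 2
    ring
  have hz : ∀ φ, zx U φ x = -zx U (-φ) x := fun φ => by
    rw [show -φ = (-1 : ℝ) • φ by simp, zx_smul]; ring
  rw [mn_eq hd hl hV U h1 h2, mn_eq hd hl hV U h1 h2]
  have e1 : ∫ φ, zx U φ x * Real.exp (-Ham V U β (fun y => -g y) φ) =
      -∫ φ, zx U φ x * Real.exp (-Ham V U β g φ) := by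
    rw [← integral_neg, ← integral_neg_eq_self]
    refine integral_congr_ae (Eventually.of_forall fun φ => ?_)
    simp only
    rw [hH, neg_neg, hz (-φ), neg_neg]
    ring
  have e2 : ∫ φ, Real.exp (-Ham V U β (fun y => -g y) φ) = ∫ φ, Real.exp (-Ham V U β g φ) := by
    rw [← integral_neg_eq_self]
    refine integral_congr_ae (Eventually.of_forall fun φ => ?_)
    simp only
    rw [hH, neg_neg]
  rw [e1, e2]
  ring

lemma mn_equiv {V : ℝ → ℝ} {lam Lam : ℝ} (hd : 1 ≤ d) (hl : 0 < lam) (hV : VOk V lam Lam)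
    {U U' : Finset (Zd d)} {β : ℝ} (h1 : 1 ≤ β) (h2 : β ≤ 2) (σ : Zd d ≃ Zd d) (κ : Dir d ≃ Dir d)
    (hσ : ∀ x k, σ (nbr x k) = nbr (σ x) (κ k)) (hU : ∀ x, σ x ∈ U' ↔ x ∈ U) (g : Zd d → ℝ) (x : Zd d) :
    mn V U β (fun y => g (σ y)) x = mn V U' β g (σ x) := by
  let E : U ≃ U' := σ.subtypeEquiv fun a => (hU a).symm
  let T := MeasurableEquiv.piCongrLeft (fun _ : U' => ℝ) E
  have hT : MeasurePreserving T volume volume := volume_measurePreserving_piCongrLeft (fun _ : U' => ℝ) E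
  have hz : ∀ φ y, zx U' (T φ) (σ y) = zx U φ y := fun φ y => by
    by_cases h : y ∈ U
    · rw [zx_mem _ h, zx_mem _ ((hU y).2 h)]
      exact Equiv.piCongrLeft_apply_apply (fun _ : U' => ℝ) E φ ⟨y, h⟩
    · rw [zx_not_mem _ h, zx_not_mem _ (fun h' => h ((hU y).1 h'))]
  have hH : ∀ φ, Ham V U' β g (T φ) = Ham V U β (fun y => g (σ y)) φ := fun φ => by
    unfold Ham
    symm
    refine Finset.sum_bij (fun y _ => σ y) (fun y hy => (hU y).2 hy) (fun y _ z _ h => σ.injective h)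
      (fun z hz' => ⟨σ.symm z, (hU _).1 (by simpa using hz'), by simp⟩) fun y _ => ?_
    rw [← κ.sum_comp (fun k => cw U' β (nbr (σ y) k) * _)]
    refine Finset.sum_congr rfl fun k _ => ?_
    rw [← hσ, hz, hz]
    congr 1
    unfold cw
    simp only [hU]
  rw [mn_eq hd hl hV U h1 h2, mn_eq hd hl hV U' h1 h2, ← hT.integral_comp', ← hT.integral_comp']
  simp only [hz, hH]

lemma mn_translate {V : ℝ → ℝ} {lam Lam : ℝ} (hd : 1 ≤ d) (hl : 0 < lam) (hV : VOk V lam Lam)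
    {β : ℝ} (h1 : 1 ≤ β) (h2 : β ≤ 2) (c z : Zd d) (r : ℕ) (g : Zd d → ℝ) (x : Zd d) :
    mn V (box c r) β (fun y => g (y + z)) x = mn V (box (c + z) r) β g (x + z) :=
  mn_equiv hd hl hV h1 h2 (Equiv.addRight z) (Equiv.refl _) (fun x k => by
    simp only [Equiv.coe_addRight, Equiv.refl_apply]
    rw [add_comm x z, nbr_add, add_comm])
    (fun x => by simp [mem_box]) g x

lemma nbr_neg (x : Zd d) (k : Dir d) : nbr (-x) (rev k) = -nbr x k := by
  obtain ⟨i, b⟩ := k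
  cases b <;> simp [nbr_eq_add, rev, Pi.single_neg, add_comm]

/-- affine data produce affine means at the centre of a box -/
lemma mn_affine_center {V : ℝ → ℝ} {lam Lam : ℝ} (hd : 1 ≤ d) (hl : 0 < lam) (hV : VOk V lam Lam)
    {β : ℝ} (h1 : 1 ≤ β) (h2 : β ≤ 2) (c : Zd d) (r : ℕ) (g : Zd d → ℝ) (a : ℝ)
    (hg : ∀ y, g (c + (c - y)) = 2 * a - g y) :
    mn V (box c r) β g c = a := by
  have e := mn_equiv hd hl hV (U := box c r) (U' := box c r) h1 h2 (Equiv.subLeft (c + c))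
    ⟨rev, rev, rev_rev, rev_rev⟩
    (fun x k => by
      simp only [Equiv.subLeft_apply, Equiv.coe_fn_mk]
      rw [sub_eq_add_neg, ← nbr_neg, ← nbr_add, ← sub_eq_add_neg])
    (fun x => by
      simp only [mem_box, Equiv.subLeft_apply, Pi.sub_apply, Pi.add_apply]
      refine forall_congr' fun i => ?_
      rw [← abs_neg, show -(c i + c i - x i - c i) = x i - c i by ring]) g c
  simp only [Equiv.subLeft_apply, add_sub_cancel_right] at e
  have h3 : (fun y => g (c + c - y)) = fun y => -g y + 2 * a := by
    funext y
    rw [add_sub_assoc, hg]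
    ring
  rw [h3, mn_add_const, mn_neg hd hl hV _ h1 h2] at e
  linarith
end

noncomputable section
section
variable {α β : Type*} [Fintype α] [Fintype β]

/-- reversibility of a heat-bath resampling along the range of `ι` -/
lemma resample {H f : (α → ℝ) → ℝ} (hH : Continuous H) (hf : Continuous f)
    (ι : (β → ℝ) →L[ℝ] (α → ℝ))
    (h1 : ∀ φ, Integrable fun η => Real.exp (-H (φ + ι η)))
    (h2 : Integrable fun φ => f φ * Real.exp (-H φ)) :
    Integrable (fun φ => (∫ η, f (φ + ι η) * Real.exp (-H (φ + ι η))) /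
      (∫ η, Real.exp (-H (φ + ι η))) * Real.exp (-H φ)) ∧
    ∫ φ, (∫ η, f (φ + ι η) * Real.exp (-H (φ + ι η))) /
      (∫ η, Real.exp (-H (φ + ι η))) * Real.exp (-H φ) = ∫ φ, f φ * Real.exp (-H φ) := by
  set Z : (α → ℝ) → ℝ := fun φ => ∫ η, Real.exp (-H (φ + ι η)) with hZ
  have hZpos : ∀ φ, 0 < Z φ := fun φ => integral_exp_pos (h1 φ)
  have hZm : StronglyMeasurable Z := by
    refine StronglyMeasurable.integral_prod_right
      (f := fun (φ : α → ℝ) (η : β → ℝ) => Real.exp (-H (φ + ι η))) ?_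
    exact Continuous.stronglyMeasurable (by unfold Function.uncurry; fun_prop)
  have hZs : ∀ φ η, Z (φ + ι η) = Z φ := fun φ η => by
    simp only [hZ]
    rw [← integral_add_left_eq_self (μ := (volume : Measure (β → ℝ)))
      (fun η' => Real.exp (-H (φ + ι η'))) η]
    simp only [map_add, add_assoc]
  have hneg : ∀ φ, Integrable fun η => Real.exp (-H (φ - ι η)) := fun φ => by
    have := (h1 φ).comp_neg
    simpa only [map_neg, ← sub_eq_add_neg] using this
  have hnegZ : ∀ φ, ∫ η, Real.exp (-H (φ - ι η)) = Z φ := fun φ => by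
    have := integral_neg_eq_self (μ := (volume : Measure (β → ℝ))) (fun η => Real.exp (-H (φ + ι η)))
    simpa only [map_neg, ← sub_eq_add_neg] using this
  set G : (β → ℝ) × (α → ℝ) → ℝ := fun p =>
    f p.2 * Real.exp (-H p.2) / Z p.2 * Real.exp (-H (p.2 - ι p.1)) with hG
  have hGm : AEStronglyMeasurable G ((volume : Measure (β → ℝ)).prod (volume : Measure (α → ℝ))) := by
    have m1 : StronglyMeasurable fun p : (β → ℝ) × (α → ℝ) => f p.2 * Real.exp (-H p.2) :=
      Continuous.stronglyMeasurable (by fun_prop)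
    have m2 : StronglyMeasurable fun p : (β → ℝ) × (α → ℝ) => Real.exp (-H (p.2 - ι p.1)) :=
      Continuous.stronglyMeasurable (by fun_prop)
    have m3 : StronglyMeasurable fun p : (β → ℝ) × (α → ℝ) => Z p.2 :=
      hZm.comp_measurable measurable_snd
    exact ((m1.div m3).mul m2).aestronglyMeasurable
  have hGi : Integrable G ((volume : Measure (β → ℝ)).prod (volume : Measure (α → ℝ))) := by
    rw [integrable_prod_iff' hGm]
    refine ⟨Eventually.of_forall fun φ => (hneg φ).const_mul (f φ * Real.exp (-H φ) / Z φ), ?_⟩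
    refine h2.norm.congr (Eventually.of_forall fun φ => ?_)
    simp only [hG, norm_mul, norm_div]
    rw [integral_const_mul]
    simp only [Real.norm_eq_abs, Real.abs_exp]
    rw [hnegZ, abs_of_pos (hZpos φ)]
    field_simp [(hZpos φ).ne']
  let S : (β → ℝ) × (α → ℝ) → (β → ℝ) × (α → ℝ) := fun p => (p.1, p.2 + ι p.1)
  have hS : MeasurePreserving S ((volume : Measure (β → ℝ)).prod (volume : Measure (α → ℝ)))
      ((volume : Measure (β → ℝ)).prod (volume : Measure (α → ℝ))) := by
    refine (MeasurePreserving.id volume).skew_product (g := fun η φ => φ + ι η) ?_ ?_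
    · exact Continuous.measurable (by unfold Function.uncurry; fun_prop)
    · exact Eventually.of_forall fun η => (measurePreserving_add_right volume (ι η)).map_eq
  have hSi := hS.integrable_comp_of_integrable hGi
  have hpt : ∀ φ, ∫ η, (G ∘ S) (η, φ) = (∫ η, f (φ + ι η) * Real.exp (-H (φ + ι η))) /
      Z φ * Real.exp (-H φ) := fun φ => by
    rw [← integral_div, ← integral_mul_const]
    refine integral_congr_ae (Eventually.of_forall fun η => ?_)
    simp only [hG, S, Function.comp, hZs, add_sub_cancel_right]
  refine ⟨?_, ?_⟩
  · refine hSi.integral_prod_right.congr (Eventually.of_forall fun φ => ?_)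
    exact hpt φ
  · have e1 : ∫ φ, ∫ η, (G ∘ S) (η, φ) = ∫ φ, ∫ η, G (η, φ) := by
      rw [← integral_prod_symm _ hSi, ← integral_prod_symm _ hGi]
      have := integral_map hS.measurable.aemeasurable (f := G) (by rw [hS.map_eq]; exact hGm)
      rw [hS.map_eq] at this
      exact this.symm
    simp only [hpt] at e1
    rw [e1]
    refine integral_congr_ae (Eventually.of_forall fun φ => ?_)
    simp only [hG]
    rw [integral_const_mul, hnegZ, div_mul_cancel₀ _ (hZpos φ).ne']

end

variable {d : ℕ}

/-- the inclusion of configurations on a smaller set -/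
def inc (U W : Finset (Zd d)) : (U → ℝ) →L[ℝ] (W → ℝ) := ContinuousLinearMap.pi fun y => ev U y

lemma zx_inc {U W : Finset (Zd d)} (h : U ⊆ W) (η : U → ℝ) (x : Zd d) : zx W (inc U W η) x = zx U η x := by
  by_cases hx : x ∈ W
  · rw [zx_mem _ hx]; rfl
  · rw [zx_not_mem _ hx, zx_not_mem _ (fun h' => hx (h h'))]

lemma Ham_inc {V : ℝ → ℝ} {lam Lam : ℝ} (hV : VOk V lam Lam) {U W : Finset (Zd d)} (hUW : U ⊆ W)
    (hn : ∀ x ∈ U, ∀ k, nbr x k ∈ W) (β : ℝ) (g : Zd d → ℝ) (φ : W → ℝ) (η : U → ℝ) :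
    Ham V W β g (φ + inc U W η) - Ham V W β g φ =
      Ham V U 2 (fun y => zx W φ y + g y) η - Ham V U 2 (fun y => zx W φ y + g y) 0 := by
  classical
  set D : Zd d → Zd d → ℝ := fun x y =>
    V (zx U η y - zx U η x + (zx W φ y + g y - (zx W φ x + g x))) -
      V (zx W φ y + g y - (zx W φ x + g x)) with hD
  have hDs : ∀ x y, D x y = D y x := fun x y => by
    simp only [hD]
    rw [← hV.even, ← hV.even (zx W φ y + g y - (zx W φ x + g x))]
    congr 2 <;> ring
  have hD0 : ∀ x y, x ∉ U → y ∉ U → D x y = 0 := fun x y hx hy => by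
    simp only [hD]
    rw [zx_not_mem _ hx, zx_not_mem _ hy]
    simp
  have hn' : ∀ x k, nbr x k ∈ U → x ∈ W := fun x k h => by
    have := hn _ h (rev k)
    rwa [nbr_nbr_rev] at this
  have e1 : Ham V W β g (φ + inc U W η) - Ham V W β g φ = ∑ x ∈ W, ∑ k, D x (nbr x k) := by
    unfold Ham
    rw [← Finset.sum_sub_distrib]
    refine Finset.sum_congr rfl fun x hx => ?_
    rw [← Finset.sum_sub_distrib]
    refine Finset.sum_congr rfl fun k _ => ?_
    rw [← mul_sub, zx_add, zx_add, zx_inc hUW, zx_inc hUW]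
    have e : V (zx W φ (nbr x k) + zx U η (nbr x k) - (zx W φ x + zx U η x) + (g (nbr x k) - g x)) -
        V (zx W φ (nbr x k) - zx W φ x + (g (nbr x k) - g x)) = D x (nbr x k) := by
      simp only [hD]
      congr 2 <;> ring
    rw [e]
    by_cases h : nbr x k ∈ W
    · rw [cw, if_pos h, one_mul]
    · rw [hD0 x (nbr x k) (fun hx => h (hn x hx k)) (fun h' => h (hUW h')), mul_zero]
  have e2 : Ham V U 2 (fun y => zx W φ y + g y) η - Ham V U 2 (fun y => zx W φ y + g y) 0 =
      ∑ x ∈ U, ∑ k, cw U 2 (nbr x k) * D x (nbr x k) := by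
    unfold Ham
    rw [← Finset.sum_sub_distrib]
    refine Finset.sum_congr rfl fun x hx => ?_
    rw [← Finset.sum_sub_distrib]
    refine Finset.sum_congr rfl fun k _ => ?_
    have h0 : ∀ y, zx U (0 : U → ℝ) y = 0 := fun y => by simp [zx]
    rw [← mul_sub, h0, h0]
    simp only [hD, sub_zero, zero_add]
  have e3 := sum_nbr_swap W (fun x y => if x ∈ U then 0 else D x y) (fun x k h => by
    have hx : x ∉ U := fun h' => h (if_pos h')
    have hy : nbr x k ∈ U := by
      by_contra h'
      refine h ?_
      rw [if_neg hx, hD0 _ _ hx h']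
    exact ⟨hn' x k hy, hUW hy⟩)
  have e4 : ∑ x ∈ W, ∑ k, D x (nbr x k) = ∑ x ∈ W, ∑ k, (if x ∈ U then D x (nbr x k) else 0) +
      ∑ x ∈ W, ∑ k, (if x ∈ U then 0 else D x (nbr x k)) := by
    rw [← Finset.sum_add_distrib]
    refine Finset.sum_congr rfl fun x hx => ?_
    rw [← Finset.sum_add_distrib]
    refine Finset.sum_congr rfl fun k _ => ?_
    split_ifs <;> ring
  rw [e1, e2, e4, e3, ← Finset.sum_add_distrib, ← Finset.sum_subset hUW]
  · refine Finset.sum_congr rfl fun x hx => ?_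
    rw [← Finset.sum_add_distrib]
    refine Finset.sum_congr rfl fun k _ => ?_
    rw [if_pos hx, hDs (nbr x k) x]
    unfold cw
    split_ifs <;> ring
  · intro x _ hx
    rw [← Finset.sum_add_distrib]
    refine Finset.sum_eq_zero fun k _ => ?_
    rw [if_neg hx, hDs (nbr x k) x]
    split_ifs with h
    · simp
    · rw [hD0 _ _ hx h, zero_add]

/-- the domain Markov property for mean heights -/
lemma mn_tower {V : ℝ → ℝ} {lam Lam : ℝ} (hd : 1 ≤ d) (hl : 0 < lam) (hV : VOk V lam Lam)
    {U W : Finset (Zd d)} (hUW : U ⊆ W) (hn : ∀ x ∈ U, ∀ k, nbr x k ∈ W) {β : ℝ} (h1 : 1 ≤ β)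
    (h2 : β ≤ 2) (g : Zd d → ℝ) (x : Zd d) :
    Integrable (fun φ => mn V U 2 (fun y => zx W φ y + g y) x) (gm (Ham V W β g)) ∧
    ∫ φ, mn V U 2 (fun y => zx W φ y + g y) x ∂(gm (Ham V W β g)) = mn V W β g x := by
  obtain ⟨K, c, hG⟩ := Ham_good hd hl hV W h1 h2 g
  have hp := hG.conf.prob
  have hE : ∀ φ η, Real.exp (-Ham V W β g (φ + inc U W η)) =
      Real.exp (Ham V U 2 (fun y => zx W φ y + g y) 0 - Ham V W β g φ) *
      Real.exp (-Ham V U 2 (fun y => zx W φ y + g y) η) := fun φ η => by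
    rw [← Real.exp_add]
    congr 1
    have := Ham_inc hV hUW hn β g φ η
    linarith
  have hI : ∀ φ, Integrable fun η : U → ℝ => Real.exp (-Ham V U 2 (fun y => zx W φ y + g y) η) := fun φ => by
    obtain ⟨K', c', hG'⟩ := Ham_good hd hl hV U one_le_two le_rfl (fun y => zx W φ y + g y)
    exact hG'.conf.integrable_exp
  have hIz : ∀ φ, Integrable fun η : U → ℝ =>
      zx U η x * Real.exp (-Ham V U 2 (fun y => zx W φ y + g y) η) := fun φ => by
    obtain ⟨K', c', hG'⟩ := Ham_good hd hl hV U one_le_two le_rfl (fun y => zx W φ y + g y)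
    exact (hG'.conf.integrable_gm_iff _).1 (integrable_zx hd hl hV U one_le_two le_rfl _ x)
  have hf : Continuous fun φ : W → ℝ => zx W φ x + g x := (ev W x).continuous.add continuous_const
  have hfi : Integrable (fun φ : W → ℝ => zx W φ x + g x) (gm (Ham V W β g)) :=
    (integrable_zx hd hl hV W h1 h2 g x).add (integrable_const _)
  obtain ⟨r1, r2⟩ := resample hG.conf.cont hf (inc U W)
    (fun φ => by simp only [hE]; exact (hI φ).const_mul _) ((hG.conf.integrable_gm_iff _).1 hfi)
  have hm : ∀ φ, (∫ η, (zx W (φ + inc U W η) x + g x) * Real.exp (-Ham V W β g (φ + inc U W η))) /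
      (∫ η, Real.exp (-Ham V W β g (φ + inc U W η))) = mn V U 2 (fun y => zx W φ y + g y) x := fun φ => by
    rw [mn_eq hd hl hV U one_le_two le_rfl]
    simp only [hE]
    have e : ∀ η : U → ℝ, (zx W (φ + inc U W η) x + g x) *
        (Real.exp (Ham V U 2 (fun y => zx W φ y + g y) 0 - Ham V W β g φ) *
        Real.exp (-Ham V U 2 (fun y => zx W φ y + g y) η)) =
        Real.exp (Ham V U 2 (fun y => zx W φ y + g y) 0 - Ham V W β g φ) *
        (zx U η x * Real.exp (-Ham V U 2 (fun y => zx W φ y + g y) η) +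
        (zx W φ x + g x) * Real.exp (-Ham V U 2 (fun y => zx W φ y + g y) η)) := fun η => by
      rw [zx_add, zx_inc hUW]
      ring
    simp only [e]
    rw [integral_const_mul, integral_const_mul, mul_div_mul_left _ _ (Real.exp_pos _).ne',
      integral_add (hIz φ) ((hI φ).const_mul _), integral_const_mul, add_div,
      mul_div_cancel_right₀ _ (integral_exp_pos (hI φ)).ne', add_comm]
  simp only [hm] at r1 r2
  refine ⟨(hG.conf.integrable_gm_iff _).2 r1, ?_⟩
  rw [hG.conf.integral_gm, r2, ← hG.conf.integral_gm, integral_add (integrable_zx hd hl hV W h1 h2 g x)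
    (integrable_const _), integral_const, mn]
  simp [add_comm]
end

noncomputable section
variable {d : ℕ}

/-- a family of linear functionals is uniformly controlled by an explicit random variable -/
lemma exists_sup_bound {V : ℝ → ℝ} {lam Lam : ℝ} (hd : 1 ≤ d) (hl : 0 < lam) (hV : VOk V lam Lam)
    (U : Finset (Zd d)) {β : ℝ} (h1 : 1 ≤ β) (h2 : β ≤ 2) (g : Zd d → ℝ) {κ : Type*} (S : Finset κ)
    (w : κ → U → ℝ) {Γ : ℝ} (hΓ : 0 ≤ Γ)
    (hw : ∀ s ∈ S, ∀ v : Zd d → ℝ, (∀ x, x ∉ U → v x = 0) →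
      (∑ x ∈ U, zx U (w s) x * v x) ^ 2 ≤ Γ * En U v)
    {n t : ℝ} (hn : 1 ≤ n) (hS : (S.card : ℝ) ≤ n) (ht : 0 < t) :
    ∃ F : (U → ℝ) → ℝ, Integrable F (gm (Ham V U β g)) ∧ (∀ φ, 0 ≤ F φ) ∧
      (∀ s ∈ S, ∀ φ, |linF (w s) φ - ∫ η, linF (w s) η ∂(gm (Ham V U β g))| ≤ F φ) ∧
      ∫ φ, F φ ∂(gm (Ham V U β g)) ≤ (Real.log n + 2 * Real.exp (4 * t ^ 2 * Γ / lam)) / t := by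
  have hp := Ham_prob hd hl hV U h1 h2 g
  set μ := gm (Ham V U β g)
  set X : κ → (U → ℝ) → ℝ := fun s φ => |linF (w s) φ - ∫ η, linF (w s) η ∂μ| with hX
  set E : ℝ := 2 * Real.exp (4 * t ^ 2 * Γ / lam) with hE
  have hE0 : 0 < E := by positivity
  have hlog := Real.log_nonneg hn
  have hn0 : 0 < n := by linarith
  have hi : ∀ s ∈ S, Integrable (fun φ => Real.exp (t * X s φ)) μ ∧ ∫ φ, Real.exp (t * X s φ) ∂μ ≤ E :=
    fun s hs => exp_moment hd hl hV U h1 h2 g (w s) hΓ (hw s hs) ht rfl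
  have hsum : Integrable (fun φ => ∑ s ∈ S, Real.exp (t * X s φ)) μ :=
    integrable_finsetSum _ fun s hs => (hi s hs).1
  refine ⟨fun φ => (Real.log n + 1 / n * ∑ s ∈ S, Real.exp (t * X s φ)) / t, ?_, fun φ => ?_,
    fun s hs φ => ?_, ?_⟩
  · exact ((integrable_const _).add (hsum.const_mul _)).div_const _
  · have : 0 ≤ ∑ s ∈ S, Real.exp (t * X s φ) := Finset.sum_nonneg fun _ _ => (Real.exp_pos _).le
    positivity
  · have a1 : Real.exp (t * X s φ) ≤ ∑ s ∈ S, Real.exp (t * X s φ) :=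
      Finset.single_le_sum (f := fun s => Real.exp (t * X s φ)) (fun _ _ => (Real.exp_pos _).le) hs
    have a2 : t * X s φ - Real.log n ≤ 1 / n * Real.exp (t * X s φ) := by
      have := Real.add_one_le_exp (t * X s φ - Real.log n)
      rw [Real.exp_sub, Real.exp_log hn0] at this
      rw [one_div_mul_eq_div]
      linarith
    change X s φ ≤ _
    rw [le_div_iff₀ ht]
    have := mul_le_mul_of_nonneg_left a1 (show 0 ≤ 1 / n by positivity)
    linarith
  · rw [integral_div]
    refine div_le_div_of_nonneg_right ?_ ht.le
    rw [integral_add (integrable_const _) (hsum.const_mul _), integral_const, integral_const_mul,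
      integral_finsetSum _ fun s hs => (hi s hs).1]
    have a1 : ∑ s ∈ S, ∫ φ, Real.exp (t * X s φ) ∂μ ≤ n * E := by
      refine (Finset.sum_le_card_nsmul _ _ E fun s hs => (hi s hs).2).trans ?_
      rw [nsmul_eq_mul]
      exact mul_le_mul_of_nonneg_right hS hE0.le
    have a2 : 1 / n * ∑ s ∈ S, ∫ φ, Real.exp (t * X s φ) ∂μ ≤ E := by
      rw [one_div_mul_eq_div, div_le_iff₀ hn0]
      linarith
    simpa using a2

open Classical in
/-- coefficients of the evaluation at a site -/
def siteW (U : Finset (Zd d)) (x : Zd d) (y : U) : ℝ := if (y : Zd d) = x then 1 else 0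

lemma sum_siteW {U : Finset (Zd d)} (x : Zd d) {v : Zd d → ℝ} (hv : ∀ x, x ∉ U → v x = 0) :
    ∑ y ∈ U, zx U (siteW U x) y * v y = v x := by
  classical
  have e : ∀ y ∈ U, zx U (siteW U x) y * v y = if y = x then v y else 0 := fun y hy => by
    rw [zx_mem _ hy, siteW]
    split_ifs <;> simp
  rw [Finset.sum_congr rfl e, Finset.sum_ite_eq']
  split_ifs with h
  · rfl
  · rw [hv x h]

lemma linF_siteW (U : Finset (Zd d)) (x : Zd d) (φ : U → ℝ) : linF (siteW U x) φ = zx U φ x := by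
  rw [linF_zx]
  exact sum_siteW x fun y hy => zx_not_mem _ hy

/-- uniform control of the height fluctuations in a box -/
lemma exists_height_bound {V : ℝ → ℝ} {lam Lam : ℝ} (hd : 1 ≤ d) (hl : 0 < lam) (hV : VOk V lam Lam)
    {N : ℕ} {β : ℝ} (h1 : 1 ≤ β) (h2 : β ≤ 2) (g : Zd d → ℝ) {n t : ℝ} (hn : 1 ≤ n)
    (hS : ((2 * N + 1 : ℕ) : ℝ) ^ d ≤ n) (ht : 0 < t) :
    ∃ F : (box (0 : Zd d) N → ℝ) → ℝ, Integrable F (gm (Ham V (box 0 N) β g)) ∧ (∀ φ, 0 ≤ F φ) ∧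
      (∀ x φ, |zx (box 0 N) φ x + g x - mn V (box 0 N) β g x| ≤ F φ) ∧
      ∫ φ, F φ ∂(gm (Ham V (box 0 N) β g)) ≤
        (Real.log n + 2 * Real.exp (4 * t ^ 2 * (2 * N + 1) / lam)) / t := by
  obtain ⟨F, a1, a2, a3, a4⟩ := exists_sup_bound hd hl hV (box 0 N) h1 h2 g (box (0 : Zd d) N)
    (fun x => siteW (box 0 N) x) (Γ := 2 * N + 1) (by positivity)
    (fun x _ v hv => by
      rw [sum_siteW x hv]
      exact sq_le_of_ray hv ⟨0, hd⟩ N (fun y hy => by simpa using (mem_box.1 hy ⟨0, hd⟩)) x)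
    hn (by rw [card_box]; exact_mod_cast hS) ht
  refine ⟨F, a1, a2, fun x φ => ?_, a4⟩
  by_cases hx : x ∈ box (0 : Zd d) N
  · have := a3 x hx φ
    simp only [linF_siteW] at this
    rw [mn]
    convert this using 2
    ring
  · rw [mn_not_mem V _ _ hx, zx_not_mem _ hx]
    simpa using a2 φ

/-- uniform control of the gradient fluctuations in a box -/
lemma exists_gradient_bound {V : ℝ → ℝ} {lam Lam : ℝ} (hd : 1 ≤ d) (hl : 0 < lam) (hV : VOk V lam Lam)
    {N : ℕ} {β : ℝ} (h1 : 1 ≤ β) (h2 : β ≤ 2) (g : Zd d → ℝ) {n : ℝ} (hn : 1 ≤ n)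
    (hS : ((2 * N + 1 : ℕ) : ℝ) ^ d * (2 * d) ≤ n) :
    ∃ F : (box (0 : Zd d) N → ℝ) → ℝ, Integrable F (gm (Ham V (box 0 N) β g)) ∧ (∀ φ, 0 ≤ F φ) ∧
      (∀ x ∈ box (0 : Zd d) N, ∀ k φ, |zx (box 0 N) φ (nbr x k) + g (nbr x k) - (zx (box 0 N) φ x + g x)
        - (mn V (box 0 N) β g (nbr x k) - mn V (box 0 N) β g x)| ≤ F φ) ∧
      ∫ φ, F φ ∂(gm (Ham V (box 0 N) β g)) ≤ Real.log n + 2 * Real.exp (4 / lam) := by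
  have hlin : ∀ (x y : Zd d) (φ : box (0 : Zd d) N → ℝ),
      linF (siteW (box 0 N) y - siteW (box 0 N) x) φ =
      zx (box 0 N) φ y - zx (box 0 N) φ x := fun x y φ => by
    rw [sub_eq_add_neg, ← linF_siteW, ← linF_siteW, sub_eq_add_neg, ← linF_neg]
    simp only [linF_apply, Pi.add_apply, add_mul, Finset.sum_add_distrib]
  obtain ⟨F, a1, a2, a3, a4⟩ := exists_sup_bound hd hl hV (box 0 N) h1 h2 g
    (box (0 : Zd d) N ×ˢ (Finset.univ : Finset (Dir d)))
    (fun p => siteW (box 0 N) (nbr p.1 p.2) - siteW (box 0 N) p.1) (Γ := 1) zero_le_one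
    (fun p hp v hv => by
      have e : ∑ y ∈ box (0 : Zd d) N, zx (box 0 N)
          (siteW (box 0 N) (nbr p.1 p.2) - siteW (box 0 N) p.1) y * v y = v (nbr p.1 p.2) - v p.1 := by
        simp only [zx_sub, sub_mul, Finset.sum_sub_distrib]
        rw [sum_siteW _ hv, sum_siteW _ hv]
      rw [e, one_mul]
      refine le_trans ?_ (Finset.single_le_sum (f := fun x => ∑ k, (v (nbr x k) - v x) ^ 2)
        (fun _ _ => Finset.sum_nonneg fun _ _ => sq_nonneg _) (Finset.mem_product.1 hp).1)
      exact Finset.single_le_sum (f := fun k => (v (nbr p.1 k) - v p.1) ^ 2)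
        (fun _ _ => sq_nonneg _) (Finset.mem_univ p.2))
    hn (by
      rw [Finset.card_product, card_box, Finset.card_univ]
      push_cast [card_Dir]
      push_cast at hS
      exact hS) one_pos
  refine ⟨F, a1, a2, fun x hx k φ => ?_, by simpa using a4⟩
  have := a3 (x, k) (Finset.mk_mem_product hx (Finset.mem_univ k)) φ
  simp only [hlin] at this
  rw [integral_sub (integrable_zx hd hl hV _ h1 h2 g _) (integrable_zx hd hl hV _ h1 h2 g _)] at this
  rw [mn, mn]
  convert this using 2
  ring
end

noncomputable section
variable {d : ℕ}

/-- linear function of a site -/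
def aff (p : Fin d → ℝ) (x : Zd d) : ℝ := ∑ i, p i * (x i : ℝ)

lemma aff_sub (p : Fin d → ℝ) (x y : Zd d) : aff p x - aff p y = ∑ i, p i * ((x i - y i : ℤ) : ℝ) := by
  simp only [aff, ← Finset.sum_sub_distrib]
  refine Finset.sum_congr rfl fun i _ => ?_
  push_cast
  ring

lemma abs_aff_sub_le {p : Fin d → ℝ} {R : ℝ} (hp : ∀ i, |p i| ≤ R) (x y : Zd d) :
    |aff p x - aff p y| ≤ d * R * ‖x - y‖ := by
  rw [aff_sub]
  refine (Finset.abs_sum_le_sum_abs _ _).trans ((Finset.sum_le_card_nsmul _ _ (R * ‖x - y‖)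
    fun i _ => ?_).trans_eq (by simp [mul_assoc]))
  rw [abs_mul]
  refine mul_le_mul (hp i) ?_ (abs_nonneg _) ((abs_nonneg _).trans (hp i))
  have := norm_le_pi_norm (x - y) i
  rwa [Int.norm_eq_abs] at this

/-- mean height under a linear tilt -/
def hm (V : ℝ → ℝ) (N : ℕ) (p : Fin d → ℝ) (x : Zd d) : ℝ :=
  ∫ φ, zx (box 0 N) φ x ∂(gm (Ham V (box 0 N) 1 (aff p)))

lemma mn_aff (V : ℝ → ℝ) (N : ℕ) (p : Fin d → ℝ) (x : Zd d) :
    mn V (box 0 N) 1 (aff p) x = aff p x + hm V N p x := rfl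

lemma hm_not_mem (V : ℝ → ℝ) {N : ℕ} (p : Fin d → ℝ) {x : Zd d} (hx : x ∉ box 0 N) : hm V N p x = 0 := by
  simp [hm, zx_not_mem _ hx]

lemma hm_neg {V : ℝ → ℝ} {lam Lam : ℝ} (hd : 1 ≤ d) (hl : 0 < lam) (hV : VOk V lam Lam)
    (N : ℕ) (p : Fin d → ℝ) (x : Zd d) : hm V N (-p) x = -hm V N p x := by
  have h := mn_neg hd hl hV (box 0 N) le_rfl one_le_two (aff p) x
  have e : (fun y => -aff p y) = aff (-p) := by
    funext y
    simp [aff]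
  rw [e, mn_aff, mn_aff, ← e] at h
  linarith

lemma hm_boundary_le (d : ℕ) (hd : 1 ≤ d) (lam Lam : ℝ) (hl : 0 < lam) (hL : lam ≤ Lam) :
    ∃ α C : ℝ, 0 < α ∧ α ≤ 1 ∧ 0 < C ∧ ∀ V, VOk V lam Lam → ∀ (p : Fin d → ℝ) (R : ℝ), (∀ i, |p i| ≤ R) →
      ∀ N r : ℕ, 1 ≤ r → r ≤ N + 1 → ∀ x ∈ box (0 : Zd d) N, ∀ i, (N : ℤ) + 1 ≤ |x i| + r →
      hm V N p x ≤ C * R * (N + 1) * ((r : ℝ) / (N + 1)) ^ α := by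
  obtain ⟨α, C, hα, hC, key⟩ := mn_holder d hd lam Lam hl hL
  refine ⟨min α 1, 2 * d * C + d, lt_min hα one_pos, min_le_right _ _, by positivity,
    fun V hV p R hp N r hr hrN x hx i hxi => ?_⟩
  have hR : 0 ≤ R := (abs_nonneg _).trans (hp i)
  have hN : (0 : ℝ) < N + 1 := by positivity
  have hr0 : (0 : ℝ) < r := by exact_mod_cast hr
  set ρ : ℝ := (r : ℝ) / (N + 1) with hρ
  have hρ0 : 0 < ρ := by positivity
  have hρ1 : ρ ≤ 1 := (div_le_one hN).2 (by exact_mod_cast hrN)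
  obtain ⟨σ, hσ, hσx⟩ : ∃ σ : ℤ, (σ = 1 ∨ σ = -1) ∧ |x i| = σ * x i := by
    rcases le_total 0 (x i) with h | h
    · exact ⟨1, Or.inl rfl, by rw [abs_of_nonneg h, one_mul]⟩
    · exact ⟨-1, Or.inr rfl, by rw [abs_of_nonpos h]; ring⟩
  have hx' : ∀ j, |x j| ≤ N := fun j => by simpa using mem_box.1 hx j
  set x0 : Zd d := Function.update x i (σ * (N + 1)) with hx0
  have hx0i : x0 i = σ * (N + 1) := by simp [hx0]
  have hx0j : ∀ j, j ≠ i → x0 j = x j := fun j hj => by simp [hx0, hj]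
  have hx0b : x0 ∈ box (0 : Zd d) (N + 1) := by
    rw [mem_box]
    intro j
    have := hx' j
    by_cases hj : j = i
    · subst hj
      rw [hx0i, Pi.zero_apply, sub_zero, abs_mul]
      rcases hσ with h | h <;> simp [h] <;> rw [abs_of_nonneg (by positivity)]
    · rw [hx0j j hj, Pi.zero_apply, sub_zero]
      push_cast
      linarith
  have hxx0 : x ∈ box x0 r := by
    rw [mem_box]
    intro j
    by_cases hj : j = i
    · subst hj
      rw [hx0i]
      have := hx' j
      rcases hσ with h | h <;> rw [h] at hσx ⊢ <;> rw [abs_le] <;> constructor <;> omega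
    · rw [hx0j j hj]
      simp
  have h := (key V hV (box 0 N) 1 le_rfl one_le_two (fun _ => 0) (fun y => aff p y + -aff p x0) x0 (N + 1) r hr hrN
    (2 * d * R * (N + 1)) (by positivity)).2 i σ (fun y hy h hy' => by
      have := mem_box.1 hy' i
      rw [hx0i] at h
      simp only [Pi.zero_apply, sub_zero] at this
      rw [abs_le] at this
      rcases hσ with h' | h' <;> rw [h'] at h <;> omega) (fun y hy k hk => by
      have a1 : nbr y k ∈ box (0 : Zd d) (N + 1) := nbr_mem_box hy le_rfl k
      have a2 := (abs_le.1 (abs_aff_sub_le hp (nbr y k) x0)).2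
      have a3 : ‖nbr y k - x0‖ ≤ 2 * (N + 1) := by
        rw [mem_box_iff_norm] at a1 hx0b
        have := norm_sub_le (nbr y k - 0) (x0 - 0)
        rw [sub_sub_sub_cancel_right] at this
        push_cast at a1 hx0b
        linarith
      have := mul_le_mul_of_nonneg_left a3 (show 0 ≤ d * R by positivity)
      linarith) (fun y hy _ => by
      have a2 := (abs_le.1 (abs_aff_sub_le hp y x0)).2
      have a3 : 0 ≤ d * R * ‖y - x0‖ := by positivity
      push_cast
      rw [mul_assoc, mul_div_cancel₀ _ hN.ne']
      linarith) x hxx0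
  have h0 : mn V (box 0 N) 1 (fun _ => 0) x = 0 := by
    have := mn_neg hd hl hV (box 0 N) le_rfl one_le_two (fun _ => 0) x
    rw [neg_zero] at this
    linarith
  rw [mn_add_const, mn_aff, h0, sub_zero] at h
  push_cast at h
  have a1 : ρ ^ α ≤ ρ ^ min α 1 := Real.rpow_le_rpow_of_exponent_ge hρ0 hρ1 (min_le_left _ _)
  have a2 : ρ ≤ ρ ^ min α 1 := by
    have := Real.rpow_le_rpow_of_exponent_ge hρ0 hρ1 (min_le_right α 1)
    rwa [Real.rpow_one] at this
  have a3 := (abs_le.1 (abs_aff_sub_le hp x x0)).1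
  have a4 : d * R * ‖x - x0‖ ≤ d * R * (N + 1) * ρ ^ min α 1 := by
    rw [mul_assoc (d * R)]
    refine mul_le_mul_of_nonneg_left (((mem_box_iff_norm).1 hxx0).trans ?_) (by positivity)
    have := mul_le_mul_of_nonneg_left a2 hN.le
    rwa [hρ, mul_div_cancel₀ _ hN.ne', ← hρ] at this
  have a5 := mul_le_mul_of_nonneg_left a1 (show 0 ≤ C * (2 * d * R * (N + 1)) by positivity)
  rw [← hρ] at h
  linarith
end

noncomputable section
variable {d : ℕ}

/-- a penalised maximum of the mean height is attained near the boundary -/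
lemma exists_near_boundary {V : ℝ → ℝ} {lam Lam : ℝ} (hd : 1 ≤ d) (hl : 0 < lam) (hV : VOk V lam Lam)
    {N r : ℕ} (p : Fin d → ℝ) (hr : 1 ≤ r) {κ B : ℝ} (hκ : 0 ≤ κ)
    {F : (box (0 : Zd d) N → ℝ) → ℝ} (hFi : Integrable F (gm (Ham V (box 0 N) 1 (aff p))))
    (hF : ∀ x φ, |zx (box 0 N) φ x + aff p x - mn V (box 0 N) 1 (aff p) x| ≤ F φ)
    (hFB : ∫ φ, F φ ∂(gm (Ham V (box 0 N) 1 (aff p))) ≤ B) (hB : B < κ * r ^ 2) :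
    ∃ x0 ∈ box (0 : Zd d) N, ∃ i, (N : ℤ) + 1 ≤ |x0 i| + r ∧
      ∀ x ∈ box (0 : Zd d) N, hm V N p x ≤ hm V N p x0 + κ * (d * (N + 1) ^ 2) := by
  have hp := Ham_prob hd hl hV (box 0 N) le_rfl one_le_two (aff p)
  set μ := gm (Ham V (box 0 N) 1 (aff p)) with hμ
  obtain ⟨x0, hx0, hmax⟩ := Finset.exists_max_image (box (0 : Zd d) N)
    (fun x => hm V N p x + κ * ∑ i, (x i : ℝ) ^ 2) ⟨0, self_mem_box _ _⟩
  refine ⟨x0, hx0, ?_⟩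
  suffices h : ∃ i, (N : ℤ) + 1 ≤ |x0 i| + r by
    obtain ⟨i, hi⟩ := h
    refine ⟨i, hi, fun x hx => ?_⟩
    have a1 := hmax x hx
    have a2 : ∑ i, (x0 i : ℝ) ^ 2 ≤ d * (N + 1) ^ 2 := by
      refine (Finset.sum_le_card_nsmul _ _ (((N : ℝ) + 1) ^ 2) fun j _ => ?_).trans_eq (by simp)
      rw [← sq_abs]
      have : |x0 j| ≤ N := by simpa using mem_box.1 hx0 j
      have : |(x0 j : ℝ)| ≤ N := by exact_mod_cast this
      gcongr
      linarith
    have a3 : 0 ≤ κ * ∑ i, (x i : ℝ) ^ 2 := mul_nonneg hκ (Finset.sum_nonneg fun _ _ => sq_nonneg _)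
    have a4 := mul_le_mul_of_nonneg_left a2 hκ
    linarith
  by_contra! hno
  have hW : box x0 r ⊆ box (0 : Zd d) N := fun y hy => by
    rw [mem_box] at hy ⊢
    intro i
    have := hno i
    have := hy i
    have e : (y i - (0 : Zd d) i) = (y i - x0 i) + x0 i := by simp
    rw [e]
    refine (abs_add_le _ _).trans ?_
    omega
  have hn : ∀ x ∈ box x0 (r - 1), ∀ k, nbr x k ∈ box (0 : Zd d) N := fun x hx k =>
    hW (nbr_mem_box hx (by omega) k)
  set ℓ : Zd d → ℝ := fun y => aff p x0 + hm V N p x0 +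
    ∑ i, (p i - 2 * κ * x0 i) * ((y i : ℝ) - x0 i) with hℓ
  have hc : mn V (box x0 (r - 1)) 2 ℓ x0 = aff p x0 + hm V N p x0 := by
    refine mn_affine_center hd hl hV one_le_two le_rfl x0 (r - 1) ℓ _ fun y => ?_
    have : ∑ i, (p i - 2 * κ * x0 i) * (((x0 + (x0 - y)) i : ℤ) - x0 i : ℝ) =
        -∑ i, (p i - 2 * κ * x0 i) * ((y i : ℝ) - x0 i) := by
      rw [← Finset.sum_neg_distrib]
      refine Finset.sum_congr rfl fun i _ => ?_
      simp only [Pi.add_apply, Pi.sub_apply]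
      push_cast
      ring
    simp only [hℓ]
    rw [this]
    ring
  have hpt : ∀ φ, mn V (box x0 (r - 1)) 2 (fun y => zx (box 0 N) φ y + aff p y) x0 ≤
      aff p x0 + hm V N p x0 + (F φ - κ * r ^ 2) := fun φ => by
    have h := mn_sub_le hd hl hV (box x0 (r - 1)) one_le_two le_rfl ℓ
      (fun y => zx (box 0 N) φ y + aff p y) (F φ - κ * r ^ 2) (fun x hx k hk => by
        set y := nbr x k
        have b1 := (abs_le.1 (hF y φ)).2
        rw [mn_aff] at b1
        have b2 := hmax y (hn x hx k)
        have b3 : aff p y - aff p x0 = ∑ i, p i * ((y i : ℝ) - x0 i) := by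
          rw [aff_sub]
          push_cast
          rfl
        have b4 : ∑ i, (p i - 2 * κ * x0 i) * ((y i : ℝ) - x0 i) =
            ∑ i, p i * ((y i : ℝ) - x0 i) - κ * (∑ i, (y i : ℝ) ^ 2 - ∑ i, (x0 i : ℝ) ^ 2 -
              ∑ i, ((y i : ℝ) - x0 i) ^ 2) := by
          rw [← Finset.sum_sub_distrib, ← Finset.sum_sub_distrib, Finset.mul_sum,
            ← Finset.sum_sub_distrib]
          exact Finset.sum_congr rfl fun i _ => by ring
        have b5 : (r : ℝ) ^ 2 ≤ ∑ i, ((y i : ℝ) - x0 i) ^ 2 := by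
          rw [mem_box] at hk
          push Not at hk
          obtain ⟨i, hi⟩ := hk
          have hi' : (r : ℤ) ≤ |y i - x0 i| := by omega
          have hi'' : (r : ℝ) ≤ |(y i : ℝ) - x0 i| := by exact_mod_cast hi'
          refine le_trans ?_ (Finset.single_le_sum (f := fun i => ((y i : ℝ) - x0 i) ^ 2)
            (fun _ _ => sq_nonneg _) (Finset.mem_univ i))
          rw [← sq_abs ((y i : ℝ) - x0 i)]
          gcongr
        have b6 := mul_le_mul_of_nonneg_left b5 hκ
        simp only [hℓ]
        rw [b4]
        linarith) (x := x0) (self_mem_box _ _)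
    rw [hc] at h
    linarith
  obtain ⟨t1, t2⟩ := mn_tower hd hl hV (fun x hx => hW (box_mono (by omega) hx)) hn le_rfl one_le_two (aff p) x0
  obtain ⟨c, hc'⟩ : ∃ c, c = aff p x0 + hm V N p x0 - κ * r ^ 2 := ⟨_, rfl⟩
  have hpt' : ∀ φ, mn V (box x0 (r - 1)) 2 (fun y => zx (box 0 N) φ y + aff p y) x0 ≤ F φ + c :=
    fun φ => by
      have := hpt φ
      linarith
  have hi : Integrable (fun φ => F φ + c) μ := hFi.add (integrable_const _)
  have h := integral_mono t1 hi hpt'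
  have e : ∫ φ, (F φ + c) ∂μ = ∫ φ, F φ ∂μ + c := by
    rw [integral_add hFi (integrable_const _)]
    simp
  rw [t2, e, mn_aff] at h
  linarith
end

noncomputable section
variable {d : ℕ}

lemma log_mul_pow_le {c L δ : ℝ} (hc : 1 ≤ c) (hL : 1 ≤ L) (hδ : 0 < δ) (n : ℕ) :
    Real.log ((c * L) ^ n) ≤ n * (c ^ δ / δ) * L ^ δ := by
  have h := Real.log_le_rpow_div (show 0 ≤ c * L by positivity) hδ
  rw [Real.mul_rpow (by positivity) (by positivity)] at h
  rw [Real.log_pow]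
  have := mul_le_mul_of_nonneg_left h (Nat.cast_nonneg (α := ℝ) n)
  refine this.trans_eq ?_
  ring

lemma exists_height_bound' {V : ℝ → ℝ} {lam Lam : ℝ} (hd : 1 ≤ d) (hl : 0 < lam) (hV : VOk V lam Lam)
    (N : ℕ) (g : Zd d → ℝ) :
    ∃ F : (box (0 : Zd d) N → ℝ) → ℝ, Integrable F (gm (Ham V (box 0 N) 1 g)) ∧
      (∀ x φ, |zx (box 0 N) φ x + g x - mn V (box 0 N) 1 g x| ≤ F φ) ∧
      ∫ φ, F φ ∂(gm (Ham V (box 0 N) 1 g)) ≤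
        (d * (2 ^ (1 / 4 : ℝ) / (1 / 4)) + 2 * Real.exp (8 / lam)) * ((N : ℝ) + 1) ^ (3 / 4 : ℝ) := by
  set L : ℝ := (N : ℝ) + 1 with hL
  have hL1 : 1 ≤ L := by rw [hL]; linarith [Nat.cast_nonneg (α := ℝ) N]
  have hL0 : 0 < L := by linarith
  have hs : 0 < L ^ (1 / 2 : ℝ) := by positivity
  have hsq : L ^ (1 / 2 : ℝ) * L ^ (1 / 2 : ℝ) = L := by
    rw [← Real.rpow_add hL0]; norm_num
  obtain ⟨F, a1, -, a3, a4⟩ := exists_height_bound hd hl hV (N := N) le_rfl one_le_two g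
    (n := (2 * L) ^ d) (t := 1 / L ^ (1 / 2 : ℝ)) (one_le_pow₀ (by linarith))
    (by push_cast; gcongr; rw [hL]; linarith) (by positivity)
  refine ⟨F, a1, a3, a4.trans ?_⟩
  have b1 := log_mul_pow_le one_le_two hL1 (show (0 : ℝ) < 1 / 4 by norm_num) d
  have b2 : 4 * (1 / L ^ (1 / 2 : ℝ)) ^ 2 * (2 * N + 1) / lam ≤ 8 / lam := by
    gcongr
    rw [div_pow, one_pow, sq, hsq, mul_one_div, div_mul_eq_mul_div, div_le_iff₀ hL0, hL]
    linarith
  have b3 : 1 ≤ L ^ (1 / 4 : ℝ) := Real.one_le_rpow hL1 (by norm_num)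
  have b4 : 2 * Real.exp (4 * (1 / L ^ (1 / 2 : ℝ)) ^ 2 * (2 * N + 1) / lam) ≤
      2 * Real.exp (8 / lam) * L ^ (1 / 4 : ℝ) := by
    have := Real.exp_le_exp.2 b2
    have := mul_le_mul_of_nonneg_left b3 (show 0 ≤ 2 * Real.exp (8 / lam) by positivity)
    linarith
  have e : L ^ (3 / 4 : ℝ) = L ^ (1 / 4 : ℝ) * L ^ (1 / 2 : ℝ) := by
    rw [← Real.rpow_add hL0]; norm_num
  rw [div_div_eq_mul_div, div_one, e, ← mul_assoc]
  refine mul_le_mul_of_nonneg_right ?_ hs.le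
  linarith

/-- mean heights grow sublinearly -/
lemma abs_hm_le (d : ℕ) (hd : 1 ≤ d) (lam Lam : ℝ) (hl : 0 < lam) (hL : lam ≤ Lam) :
    ∃ β C : ℝ, 0 < β ∧ β ≤ 1 ∧ 0 < C ∧ ∀ V, VOk V lam Lam → ∀ (p : Fin d → ℝ) (R : ℝ), 1 ≤ R →
      (∀ i, |p i| ≤ R) → ∀ (N : ℕ) (x : Zd d), |hm V N p x| ≤ C * R * ((N : ℝ) + 1) ^ (1 - β) := by
  obtain ⟨α, C₁, hα, hα1, hC₁, hbd⟩ := hm_boundary_le d hd lam Lam hl hL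
  set C₂ : ℝ := d * (2 ^ (1 / 4 : ℝ) / (1 / 4)) + 2 * Real.exp (8 / lam) with hC₂
  have hC₂0 : 0 < C₂ := by positivity
  refine ⟨α / 16, 2 * C₁ + 2 * C₂ * d, by positivity, by linarith, by positivity, ?_⟩
  have key : ∀ V, VOk V lam Lam → ∀ (p : Fin d → ℝ) (R : ℝ), 1 ≤ R → (∀ i, |p i| ≤ R) →
      ∀ (N : ℕ) (x : Zd d), x ∈ box (0 : Zd d) N →
      hm V N p x ≤ (2 * C₁ + 2 * C₂ * d) * R * ((N : ℝ) + 1) ^ (1 - α / 16) := by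
    intro V hV p R hR hp N x hx
    obtain ⟨F, f1, f2, f3⟩ := exists_height_bound' hd hl hV N (aff p)
    rw [← hC₂] at f3
    set L : ℝ := (N : ℝ) + 1 with hL
    have hL1 : 1 ≤ L := by rw [hL]; linarith [Nat.cast_nonneg (α := ℝ) N]
    have hL0 : 0 < L := by linarith
    set s : ℝ := L ^ (15 / 16 : ℝ) with hs
    have hs1 : 1 ≤ s := Real.one_le_rpow hL1 (by norm_num)
    have hsL : s ≤ L := by
      have := Real.rpow_le_rpow_of_exponent_le hL1 (show (15 / 16 : ℝ) ≤ 1 by norm_num)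
      rwa [Real.rpow_one] at this
    set r : ℕ := ⌈s⌉₊ with hr
    have hr1 : 1 ≤ r := Nat.one_le_ceil_iff.2 (by linarith)
    have hrs : s ≤ r := Nat.le_ceil s
    have hrs' : (r : ℝ) ≤ 2 * s := by
      have := Nat.ceil_lt_add_one (show 0 ≤ s by linarith)
      linarith
    have hrN : r ≤ N + 1 := Nat.ceil_le.2 (by push_cast; exact hsL)
    have hr0 : (0 : ℝ) < r := by linarith
    have hL34 : 0 < L ^ (3 / 4 : ℝ) := by positivity
    obtain ⟨x0, hx0, i, hi, hmax⟩ := exists_near_boundary hd hl hV p hr1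
      (κ := 2 * C₂ * L ^ (3 / 4 : ℝ) / (r : ℝ) ^ 2) (by positivity) f1 f2 f3 (by
        rw [div_mul_cancel₀ _ (by positivity)]
        have := mul_pos hC₂0 hL34
        linarith)
    have b1 := hbd V hV p R hp N r hr1 hrN x0 hx0 i hi
    rw [← hL] at b1
    have b2 := hmax x hx
    rw [← hL] at b2
    have e1 : L * L ^ (-(1 / 16) : ℝ) = s := by
      nth_rewrite 1 [← Real.rpow_one L]
      rw [← Real.rpow_add hL0, hs]
      norm_num
    have b3 : (r : ℝ) / L ≤ 2 * L ^ (-(1 / 16) : ℝ) := by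
      rw [div_le_iff₀ hL0]
      linarith
    have b4 : ((r : ℝ) / L) ^ α ≤ 2 * L ^ (-(α / 16)) := by
      refine (Real.rpow_le_rpow (by positivity) b3 hα.le).trans ?_
      rw [Real.mul_rpow (by norm_num) (by positivity), ← Real.rpow_mul hL0.le,
        show -(1 / 16) * α = -(α / 16) by ring]
      refine mul_le_mul_of_nonneg_right ?_ (by positivity)
      have := Real.rpow_le_rpow_of_exponent_le one_le_two hα1
      rwa [Real.rpow_one] at this
    have e2 : L * L ^ (-(α / 16)) = L ^ (1 - α / 16) := by
      nth_rewrite 1 [← Real.rpow_one L]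
      rw [← Real.rpow_add hL0, ← sub_eq_add_neg]
    have b5 : C₁ * R * L * ((r : ℝ) / L) ^ α ≤ 2 * C₁ * R * L ^ (1 - α / 16) := by
      have := mul_le_mul_of_nonneg_left b4 (show 0 ≤ C₁ * R * L by positivity)
      rw [← e2]
      linarith
    have b6 : 2 * C₂ * L ^ (3 / 4 : ℝ) / (r : ℝ) ^ 2 * (d * L ^ 2) ≤ 2 * C₂ * d * L ^ (7 / 8 : ℝ) := by
      have e3 : L ^ (3 / 4 : ℝ) * L ^ 2 = L ^ (7 / 8 : ℝ) * s ^ 2 := by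
        rw [hs, ← Real.rpow_natCast, ← Real.rpow_natCast, ← Real.rpow_mul hL0.le, ← Real.rpow_add hL0,
          ← Real.rpow_add hL0]
        norm_num
      have : s ^ 2 ≤ (r : ℝ) ^ 2 := by gcongr
      rw [div_mul_eq_mul_div, div_le_iff₀ (by positivity)]
      have := mul_le_mul_of_nonneg_left this (show 0 ≤ 2 * C₂ * d * L ^ (7 / 8 : ℝ) by positivity)
      refine le_trans (le_of_eq ?_) this
      linear_combination (2 * C₂ * d) * e3
    have b7 : L ^ (7 / 8 : ℝ) ≤ R * L ^ (1 - α / 16) := by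
      have := Real.rpow_le_rpow_of_exponent_le hL1 (show (7 / 8 : ℝ) ≤ 1 - α / 16 by linarith)
      have := mul_le_mul_of_nonneg_right hR (show 0 ≤ L ^ (1 - α / 16) by positivity)
      linarith
    have b8 := mul_le_mul_of_nonneg_left b7 (show 0 ≤ 2 * C₂ * d by positivity)
    linarith
  intro V hV p R hR hp N x
  by_cases hx : x ∈ box (0 : Zd d) N
  · rw [abs_le]
    have h1 := key V hV p R hR hp N x hx
    have h2 := key V hV (-p) R hR (fun i => by simpa using hp i) N x hx
    rw [hm_neg hd hl hV] at h2
    constructor <;> linarith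
  · rw [hm_not_mem V p hx, abs_zero]
    positivity
end

noncomputable section
variable {d : ℕ}

lemma norm_nbr_sub_self_le (x : Zd d) (k : Dir d) : ‖nbr x k - x‖ ≤ 1 := by
  have h := norm_nbr_sub_le x x k
  rw [sub_self, norm_zero, sub_zero] at h
  exact (le_abs_self _).trans h

lemma abs_integral_le_of_abs_le {α : Type*} [MeasurableSpace α] {μ : Measure α} [IsProbabilityMeasure μ]
    {f F : α → ℝ} {a b : ℝ} (hF : Integrable F μ) (h : ∀ x, |f x| ≤ a * (b + F x)) :
    |∫ x, f x ∂μ| ≤ a * (b + ∫ x, F x ∂μ) := by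
  have h1 : Integrable (fun x => a * (b + F x)) μ := ((integrable_const b).add hF).const_mul a
  have h2 := norm_integral_le_of_norm_le h1 (f := f) (Eventually.of_forall fun x => by
    rw [Real.norm_eq_abs]; exact h x)
  rw [integral_const_mul, integral_add (integrable_const b) hF] at h2
  simpa using h2

lemma integral_sub_sub_sub {α : Type*} [MeasurableSpace α] {μ : Measure α} {f₁ f₂ f₃ f₄ : α → ℝ}
    (h₁ : Integrable f₁ μ) (h₂ : Integrable f₂ μ) (h₃ : Integrable f₃ μ) (h₄ : Integrable f₄ μ) :
    ∫ x, (f₁ x - f₂ x - (f₃ x - f₄ x)) ∂μ =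
      ∫ x, f₁ x ∂μ - ∫ x, f₂ x ∂μ - (∫ x, f₃ x ∂μ - ∫ x, f₄ x ∂μ) := by
  have h₁₂ : Integrable (fun x => f₁ x - f₂ x) μ := h₁.sub h₂
  have h₃₄ : Integrable (fun x => f₃ x - f₄ x) μ := h₃.sub h₄
  rw [integral_sub h₁₂ h₃₄, integral_sub h₁ h₂, integral_sub h₃ h₄]

/-- Hölder control of the mean gradient in terms of its maximum on a larger box -/
lemma hm_gradient_osc (d : ℕ) (hd : 1 ≤ d) (lam Lam : ℝ) (hl : 0 < lam) (hL : lam ≤ Lam) :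
    ∃ α C : ℝ, 0 < α ∧ 0 < C ∧ ∀ V, VOk V lam Lam → ∀ (p : Fin d → ℝ) (R : ℝ), (∀ i, |p i| ≤ R) →
      ∀ (N : ℕ) (n : ℝ), 1 ≤ n → ((2 * N + 1 : ℕ) : ℝ) ^ d * (2 * d) ≤ n →
      ∀ (k : Dir d) (D : ℝ) (x : Zd d) (r s : ℕ), 1 ≤ r → r ≤ s → box x (s + 2) ⊆ box 0 N → 0 ≤ D →
      (∀ y ∈ box x (s + 1), |hm V N p (nbr y k) - hm V N p y| ≤ D) → ∀ x' ∈ box x r,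
      |hm V N p (nbr x' k) - hm V N p x' - (hm V N p (nbr x k) - hm V N p x)| ≤
        C * ((r : ℝ) / s) ^ α * (D + d * R + (Real.log n + 2 * Real.exp (4 / lam))) := by
  obtain ⟨α, C, hα, hC, key⟩ := mn_holder d hd lam Lam hl hL
  refine ⟨α, C, hα, hC, fun V hV p R hp N n hn hS k D x r s hr hrs hbox hD hgrad x' hx' => ?_⟩
  have hR : 0 ≤ R := (abs_nonneg _).trans (hp k.1)
  have hprob := Ham_prob hd hl hV (box (0 : Zd d) N) (β := 1) le_rfl one_le_two (aff p)
  obtain ⟨F, f1, f2, f3, f4⟩ := exists_gradient_bound hd hl hV (N := N) le_rfl one_le_two (aff p) hn hS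
  set e : Zd d := Pi.single k.1 (if k.2 then 1 else -1) with he
  have hadd : ∀ y : Zd d, nbr y k = y + e := fun y => nbr_eq_add y k
  have hxe : x + e ∈ box x 1 := by
    rw [← hadd]
    exact nbr_mem_box (self_mem_box x 0) le_rfl k
  have t1 := fun y => mn_tower hd hl hV (U := box x s) (W := box 0 N)
    ((box_mono (by omega)).trans hbox)
    (fun y hy k => hbox (nbr_mem_box hy (by omega) k)) (β := 1) le_rfl one_le_two (aff p) y
  have t2 := fun y => mn_tower hd hl hV (U := box (x + e) s) (W := box 0 N)
    ((box_subset_box hxe (by omega)).trans hbox)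
    (fun y hy k => hbox (box_subset_box hxe (by omega) (nbr_mem_box hy le_rfl k))) (β := 1)
    le_rfl one_le_two (aff p) y
  have hpt : ∀ φ : box (0 : Zd d) N → ℝ,
      |mn V (box (x + e) s) 2 (fun y => zx (box 0 N) φ y + aff p y) (x' + e) -
        mn V (box x s) 2 (fun y => zx (box 0 N) φ y + aff p y) x' -
        (mn V (box (x + e) s) 2 (fun y => zx (box 0 N) φ y + aff p y) (x + e) -
        mn V (box x s) 2 (fun y => zx (box 0 N) φ y + aff p y) x)| ≤
        C * ((r : ℝ) / s) ^ α * (D + d * R + F φ) := fun φ => by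
    have h := (key V hV (box x s) 2 one_le_two le_rfl (fun y => zx (box 0 N) φ y + aff p y)
      (fun y => zx (box 0 N) φ (y + e) + aff p (y + e)) x s r hr hrs (D + d * R + F φ)
      (by have := f2 φ; positivity)).1 subset_rfl (fun y hy j _ => by
        have hz : nbr y j ∈ box x (s + 1) := nbr_mem_box hy le_rfl j
        set z := nbr y j
        have b1 := f3 z (hbox (box_mono (by omega) hz)) k φ
        have b2 := hgrad z hz
        have b3 := abs_aff_sub_le hp (nbr z k) z
        have b4 := mul_le_mul_of_nonneg_left (norm_nbr_sub_self_le z k) (show 0 ≤ d * R by positivity)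
        rw [mn_aff, mn_aff] at b1
        rw [hadd] at b1 b2 b3 b4
        rw [abs_le] at *
        constructor <;> linarith) x' hx'
    have e1 := fun y => mn_translate hd hl hV (β := 2) one_le_two le_rfl x e s
      (fun y => zx (box 0 N) φ y + aff p y) y
    beta_reduce at e1
    rw [e1, e1] at h
    linarith
  have hi := abs_integral_le_of_abs_le f1 hpt
  rw [integral_sub_sub_sub (t2 (x' + e)).1 (t1 x').1 (t2 (x + e)).1 (t1 x).1, (t2 (x' + e)).2, (t1 x').2,
    (t2 (x + e)).2, (t1 x).2, mn_aff, mn_aff, mn_aff, mn_aff] at hi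
  rw [hadd, hadd]
  have e1 : aff p (x' + e) - aff p x' = aff p (x + e) - aff p x := by
    rw [aff_sub, aff_sub]
    simp only [Pi.add_apply, add_sub_cancel_left]
  have e2 : hm V N p (x' + e) - hm V N p x' - (hm V N p (x + e) - hm V N p x) =
      aff p (x' + e) + hm V N p (x' + e) - (aff p x' + hm V N p x') -
      (aff p (x + e) + hm V N p (x + e) - (aff p x + hm V N p x)) := by linarith
  rw [e2]
  refine hi.trans (mul_le_mul_of_nonneg_left ?_ (by positivity))
  linarith
end

noncomputable section
variable {d : ℕ}

lemma abs_gradient_le_of_osc {f : Zd d → ℝ} {A δ : ℝ} {x : Zd d} {k : Dir d} {r : ℕ} (hr : 1 ≤ r)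
    (hA : ∀ y, |f y| ≤ A)
    (h : ∀ y ∈ box x r, |f (nbr y k) - f y - (f (nbr x k) - f x)| ≤ δ) :
    |f (nbr x k) - f x| ≤ 2 * A / r + δ := by
  have hr0 : (0 : ℝ) < r := by exact_mod_cast hr
  set G := f (nbr x k) - f x with hG
  have key : ∀ j : ℕ, j ≤ r → ∃ y ∈ box x j, |f y - f x - j * G| ≤ j * δ := by
    intro j
    induction j with
    | zero => exact fun _ => ⟨x, self_mem_box x 0, by simp⟩
    | succ j ih =>
      intro hj
      obtain ⟨y, hy, hy'⟩ := ih (by omega)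
      refine ⟨nbr y k, nbr_mem_box hy le_rfl k, ?_⟩
      have := h y (box_mono (by omega) hy)
      push_cast
      rw [abs_le] at *
      constructor <;> linarith
  obtain ⟨y, -, hy⟩ := key r le_rfl
  have h1 := hA y
  have h2 := hA x
  have h3 : r * |G| ≤ 2 * A + r * δ := by
    rw [← abs_of_pos hr0, ← abs_mul, abs_of_pos hr0]
    rw [abs_le] at *
    constructor <;> linarith
  rw [div_add' _ _ _ hr0.ne', le_div_iff₀ hr0]
  linarith

lemma abs_gradient_iterate {f : Zd d → ℝ} {A Q b : ℝ} {N r s : ℕ} (hr : 1 ≤ r) (hA : ∀ y, |f y| ≤ A)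
    (hQ : 0 ≤ Q) (hb : 0 ≤ b) (hb2 : b ≤ 1 / 2)
    (h : ∀ (k : Dir d) (D : ℝ) (x : Zd d), box x (s + 2) ⊆ box 0 N → 0 ≤ D →
      (∀ y ∈ box x (s + 1), |f (nbr y k) - f y| ≤ D) → ∀ y ∈ box x r,
      |f (nbr y k) - f y - (f (nbr x k) - f x)| ≤ b * (D + Q)) (k : Dir d) (K : ℕ) :
    ∀ x : Zd d, box x (K * (s + 2)) ⊆ box 0 N →
      |f (nbr x k) - f x| ≤ 2 * (2 * A / r + b * Q) + b ^ K * (2 * A) := by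
  have hA0 : 0 ≤ A := (abs_nonneg _).trans (hA 0)
  induction K with
  | zero =>
    intro x _
    have h1 := hA x
    have h2 := hA (nbr x k)
    have h3 : 0 ≤ 2 * A / r + b * Q := by positivity
    rw [pow_zero, one_mul]
    rw [abs_le] at *
    constructor <;> linarith
  | succ K ih =>
    intro x hx
    set a := 2 * A / r + b * Q with ha
    have ha0 : 0 ≤ a := by positivity
    have h1 := abs_gradient_le_of_osc hr hA (h k (2 * a + b ^ K * (2 * A)) x
      ((box_mono (by nlinarith)).trans hx) (by positivity)
      fun y hy => ih y ((box_subset_box (box_mono (Nat.le_succ _) hy) (by ring_nf; omega)).trans hx))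
    have h2 := mul_le_mul_of_nonneg_right hb2 ha0
    rw [pow_succ]
    linarith

/-- mean gradients in the bulk decay polynomially -/
lemma hm_gradient_decay (d : ℕ) (hd : 1 ≤ d) (lam Lam : ℝ) (hl : 0 < lam) (hL : lam ≤ Lam) :
    ∃ γ : ℝ, 0 < γ ∧ ∀ R : ℝ, 1 ≤ R → ∃ C : ℝ, ∀ V, VOk V lam Lam → ∀ p : Fin d → ℝ, (∀ i, |p i| ≤ R) →
      ∀ (N : ℕ), ∀ x ∈ box (0 : Zd d) ((N + 2) / 2), ∀ k,
      |hm V N p (nbr x k) - hm V N p x| ≤ C * ((N : ℝ) + 1) ^ (-γ) := by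
  obtain ⟨β, CA, hβ, hβ1, hCA, hA⟩ := abs_hm_le d hd lam Lam hl hL
  obtain ⟨α, C, hα, hC, hosc⟩ := hm_gradient_osc d hd lam Lam hl hL
  set γ : ℝ := min α 1 * β / 4 with hγ
  have hm0 : 0 < min α 1 := lt_min hα one_pos
  have hγ0 : 0 < γ := by positivity
  have hγα : 2 * γ ≤ β / 2 * α := by
    have := mul_le_mul_of_nonneg_right (min_le_left α 1) hβ.le
    linarith
  have hγβ : γ ≤ β / 2 := by
    have := mul_le_mul_of_nonneg_right (min_le_right α 1) hβ.le
    linarith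
  set K : ℕ := ⌈(1 + γ) / (2 * γ)⌉₊ with hK
  have hK1 : 1 ≤ K := Nat.one_le_ceil_iff.2 (by positivity)
  have hK1' : (1 : ℝ) ≤ K := by exact_mod_cast hK1
  have hKγ : 1 + γ ≤ 2 * γ * K := by
    have := Nat.le_ceil ((1 + γ) / (2 * γ))
    rw [div_le_iff₀ (by positivity)] at this
    linarith
  set B : ℝ := C * (32 * K) ^ α with hB
  have hB0 : 0 < B := by positivity
  obtain ⟨L0, hL01, hL0⟩ : ∃ L0 : ℝ, 1 ≤ L0 ∧ ∀ L, L0 ≤ L → 32 * (K : ℝ) ≤ L ^ (β / 2) ∧ 2 * B ≤ L ^ (2 * γ) := by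
    have h1 := (tendsto_rpow_atTop (show 0 < β / 2 by positivity)).eventually_ge_atTop (32 * (K : ℝ))
    have h2 := (tendsto_rpow_atTop (show 0 < 2 * γ by positivity)).eventually_ge_atTop (2 * B)
    obtain ⟨a, ha⟩ := eventually_atTop.1 (h1.and h2)
    exact ⟨max a 1, le_max_right _ _, fun L hL => ha L ((le_max_left _ _).trans hL)⟩
  set CE : ℝ := d * ((4 * d) ^ γ / γ) + 2 * Real.exp (4 / lam) with hCE
  have hCE0 : 0 < CE := by positivity
  refine ⟨γ, hγ0, fun R hR => ⟨2 * (2 * (CA * R) + B * (d * R + CE)) + B ^ K * (2 * (CA * R)) +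
    2 * (CA * R) * L0 ^ (1 + γ), fun V hV p hp N x hx k => ?_⟩⟩
  have hAN := hA V hV p R hR hp N
  set L : ℝ := (N : ℝ) + 1 with hLdef
  have hL1 : 1 ≤ L := by rw [hLdef]; linarith [Nat.cast_nonneg (α := ℝ) N]
  have hLpos : 0 < L := by linarith
  have hLβ : L ^ (1 - β) ≤ L := by
    have := Real.rpow_le_rpow_of_exponent_le hL1 (show 1 - β ≤ 1 by linarith)
    rwa [Real.rpow_one] at this
  set g : ℝ := L ^ (-γ) with hg
  have hg0 : 0 < g := by positivity
  have hd1 : (1 : ℝ) ≤ d := by exact_mod_cast hd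
  have hL1γ : L = L ^ (1 + γ) * g := by
    rw [hg, ← Real.rpow_add hLpos]; simp
  rcases le_or_gt L0 L with hc | hc
  swap
  · have h1 := hAN x
    have h2 := hAN (nbr x k)
    have h3 : CA * R * L ^ (1 - β) ≤ CA * R * (L0 ^ (1 + γ) * g) := by
      refine mul_le_mul_of_nonneg_left (hLβ.trans ?_) (by positivity)
      nth_rewrite 1 [hL1γ]
      gcongr
    have h4 : 0 ≤ (2 * (2 * (CA * R) + B * (d * R + CE)) + B ^ K * (2 * (CA * R))) * g := by positivity
    rw [abs_le] at *
    constructor <;> linarith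
  obtain ⟨hc1, hc2⟩ := hL0 L hc
  set q : ℝ := L ^ (1 - β / 2) with hq
  have hq1 : 1 ≤ q := Real.one_le_rpow hL1 (by linarith)
  have hqL : q * L ^ (β / 2) = L := by
    rw [hq, ← Real.rpow_add hLpos]; simp
  have hLK : 32 * (K : ℝ) ≤ L := by
    refine hc1.trans ?_
    have := Real.rpow_le_rpow_of_exponent_le hL1 (show β / 2 ≤ 1 by linarith)
    rwa [Real.rpow_one] at this
  set r : ℕ := ⌈q⌉₊ with hr
  have hr1 : 1 ≤ r := Nat.one_le_ceil_iff.2 (by linarith)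
  have hqr : q ≤ r := Nat.le_ceil q
  have hrq : (r : ℝ) ≤ 2 * q := by
    have := Nat.ceil_lt_add_one (show 0 ≤ q by linarith)
    linarith
  set s : ℕ := ⌊L / (8 * K)⌋₊ with hs
  have hs1 : (s : ℝ) * (8 * K) ≤ L := by
    have := Nat.floor_le (show 0 ≤ L / (8 * K) by positivity)
    rwa [le_div_iff₀ (by positivity)] at this
  have hs2 : L ≤ s * (16 * K) := by
    have := Nat.lt_floor_add_one (L / (8 * K))
    rw [div_lt_iff₀ (by positivity)] at this
    linarith
  have hqK : q * (32 * K) ≤ L := by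
    have := mul_le_mul_of_nonneg_left hc1 (show 0 ≤ q by linarith)
    linarith
  have hK0 : (0 : ℝ) < K := by linarith
  have hrs' : (r : ℝ) ≤ s := by
    have : 2 * q * (16 * K) ≤ s * (16 * K) := by linarith
    exact hrq.trans (le_of_mul_le_mul_right this (by positivity))
  have hrs : r ≤ s := by exact_mod_cast hrs'
  have hs0 : (0 : ℝ) < s := lt_of_lt_of_le (by exact_mod_cast hr1) hrs'
  have hρ : (r : ℝ) / s ≤ 32 * K * L ^ (-(β / 2)) := by
    rw [div_le_iff₀ hs0]
    have h1 : L * L ^ (-(β / 2)) = q := by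
      nth_rewrite 1 [← Real.rpow_one L]
      rw [← Real.rpow_add hLpos, ← sub_eq_add_neg]
    have h2 := mul_le_mul_of_nonneg_right hs2 (show 0 ≤ L ^ (-(β / 2)) by positivity)
    linarith
  set b : ℝ := C * ((r : ℝ) / s) ^ α with hb
  have hb0 : 0 ≤ b := by positivity
  have hbB : b ≤ B * L ^ (-(2 * γ)) := by
    rw [hb, hB, mul_assoc]
    refine mul_le_mul_of_nonneg_left ?_ hC.le
    refine (Real.rpow_le_rpow (by positivity) hρ hα.le).trans ?_
    rw [Real.mul_rpow (by positivity) (by positivity), ← Real.rpow_mul hLpos.le]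
    refine mul_le_mul_of_nonneg_left ?_ (by positivity)
    exact Real.rpow_le_rpow_of_exponent_le hL1 (by linarith)
  have hb2 : b ≤ 1 / 2 := by
    refine hbB.trans ?_
    rw [Real.rpow_neg hLpos.le, ← div_eq_mul_inv, div_le_iff₀ (by positivity)]
    linarith
  have hn1 : (1 : ℝ) ≤ 4 * d * L := by
    have : (1 : ℝ) ≤ 4 * d := by linarith
    exact one_le_mul_of_one_le_of_one_le this hL1
  have hS : ((2 * N + 1 : ℕ) : ℝ) ^ d * (2 * d) ≤ (4 * d * L) ^ d := by
    have h1 : (2 * d : ℝ) ≤ (2 * d) ^ d := le_self_pow₀ (by linarith) (by omega)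
    have h2 : ((2 * N + 1 : ℕ) : ℝ) ^ d ≤ (2 * L) ^ d := by
      push_cast
      gcongr
      linarith
    calc _ ≤ (2 * L) ^ d * (2 * d) ^ d := by gcongr
      _ = _ := by rw [← mul_pow]; ring
  have hLγ : 1 ≤ L ^ γ := Real.one_le_rpow hL1 hγ0.le
  have hE : Real.log ((4 * d * L) ^ d) + 2 * Real.exp (4 / lam) ≤ CE * L ^ γ := by
    have h1 := log_mul_pow_le (c := 4 * d) (by linarith) hL1 hγ0 d
    have h2 := mul_le_mul_of_nonneg_left hLγ (show 0 ≤ 2 * Real.exp (4 / lam) by positivity)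
    rw [hCE]
    linarith
  set E : ℝ := Real.log ((4 * d * L) ^ d) + 2 * Real.exp (4 / lam) with hEdef
  have hE0 : 0 ≤ E := by
    have := Real.log_nonneg (one_le_pow₀ hn1 (n := d))
    positivity
  have hKs : (N + 2) / 2 + K * (s + 2) ≤ N := by
    have h1 : (K : ℝ) * s ≤ L / 8 := by linarith
    have h2 : ((((N + 2) / 2 : ℕ) : ℝ)) ≤ (L + 1) / 2 := by
      refine Nat.cast_div_le.trans ?_
      push_cast
      linarith
    have h3 : ((((N + 2) / 2 + K * (s + 2) : ℕ)) : ℝ) ≤ (N : ℕ) := by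
      rw [Nat.cast_add, Nat.cast_mul, Nat.cast_add]
      push_cast at h2 ⊢
      linarith
    exact_mod_cast h3
  have main := abs_gradient_iterate (A := CA * R * L ^ (1 - β)) (Q := d * R + E) (N := N) (s := s) hr1 hAN
    (by positivity) hb0 hb2 (fun k D x hbox hD hgrad y hy => by
      have := hosc V hV p R hp N _ (one_le_pow₀ hn1 (n := d)) hS k D x r s hr1 hrs hbox hD hgrad y hy
      rwa [add_assoc] at this) k K x (box_subset_box hx hKs)
  refine main.trans ?_
  have m1 : 2 * (CA * R * L ^ (1 - β)) / r ≤ 2 * (CA * R) * g := by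
    rw [div_le_iff₀ (by linarith)]
    have h1 : L ^ (1 - β) = L ^ (-(β / 2)) * q := by
      rw [hq, ← Real.rpow_add hLpos]; congr 1; ring
    have h2 : L ^ (-(β / 2)) ≤ g := Real.rpow_le_rpow_of_exponent_le hL1 (by linarith)
    have h3 : L ^ (1 - β) ≤ g * r := by
      rw [h1]
      gcongr
    have := mul_le_mul_of_nonneg_left h3 (show 0 ≤ 2 * (CA * R) by positivity)
    linarith
  have m2 : b * (d * R + E) ≤ B * (d * R + CE) * g := by
    have h1 : d * R + E ≤ (d * R + CE) * L ^ γ := by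
      have := mul_le_mul_of_nonneg_left hLγ (show 0 ≤ d * R by positivity)
      linarith
    have h2 : L ^ (-(2 * γ)) * L ^ γ = g := by
      rw [hg, ← Real.rpow_add hLpos]; congr 1; ring
    calc b * (d * R + E) ≤ (B * L ^ (-(2 * γ))) * ((d * R + CE) * L ^ γ) := by gcongr
      _ = B * (d * R + CE) * g := by rw [← h2]; ring
  have m3 : b ^ K * (2 * (CA * R * L ^ (1 - β))) ≤ B ^ K * (2 * (CA * R)) * g := by
    have h1 : (L ^ (-(2 * γ))) ^ K * L ≤ g := by
      rw [← Real.rpow_natCast, ← Real.rpow_mul hLpos.le]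
      nth_rewrite 2 [← Real.rpow_one L]
      rw [← Real.rpow_add hLpos]
      exact Real.rpow_le_rpow_of_exponent_le hL1 (by linarith)
    calc b ^ K * (2 * (CA * R * L ^ (1 - β))) ≤ (B * L ^ (-(2 * γ))) ^ K * (2 * (CA * R * L)) := by gcongr
      _ = B ^ K * (2 * (CA * R)) * ((L ^ (-(2 * γ))) ^ K * L) := by rw [mul_pow]; ring
      _ ≤ _ := by gcongr
  have m4 : 0 ≤ 2 * (CA * R) * L0 ^ (1 + γ) * g := by positivity
  linarith
end

noncomputable section
variable {d : ℕ}

lemma mem_cube {L : ℕ} {x : Zd d} : x ∈ cube d L ↔ x ∈ box (0 : Zd d) L := by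
  simp [cube, box]

lemma adj_nbr (x : Zd d) (k : Dir d) : adj x (nbr x k) := by
  unfold adj
  rw [Finset.sum_eq_single k.1]
  · rw [nbr_eq_add]
    rcases k with ⟨i, _ | _⟩ <;> simp
  · intro j _ hj
    rw [nbr_eq_add]
    simp [hj]
  · simp

lemma intr_cube (N : ℕ) : intr (cube d ((N + 1 : ℕ) : ℤ)) = box (0 : Zd d) N := by
  ext x
  simp only [intr, Finset.mem_filter, mem_cube]
  constructor
  · rintro ⟨-, h⟩
    rw [mem_box]
    intro i
    have h1 := mem_box.1 (h _ (adj_nbr x (i, true))) i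
    have h2 := mem_box.1 (h _ (adj_nbr x (i, false))) i
    simp only [nbr_eq_add, Pi.add_apply, Pi.single_eq_same, Pi.zero_apply, sub_zero] at h1 h2 ⊢
    rw [abs_le] at *
    push_cast at h1 h2
    simp at h1 h2
    constructor <;> linarith [h1.1, h1.2, h2.1, h2.2]
  · intro h
    refine ⟨box_mono (Nat.le_succ N) h, fun y hy => ?_⟩
    rw [mem_box]
    intro i
    have h1 := mem_box.1 h i
    have h2 : |x i - y i| ≤ 1 := hy ▸ Finset.single_le_sum (f := fun i => |x i - y i|)
      (fun _ _ => abs_nonneg _) (Finset.mem_univ i)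
    simp only [Pi.zero_apply, sub_zero] at h1 ⊢
    rw [abs_le] at *
    push_cast
    constructor <;> linarith [h1.1, h1.2, h2.1, h2.2]

lemma exists_nbr_of_edge {U : Finset (Zd d)} {e : Zd d × Zd d} (he : e ∈ edges U) :
    e.1 ∈ U ∧ ∃ k, e.2 = nbr e.1 k := by
  simp only [edges, Finset.mem_filter] at he
  obtain ⟨h1, h2, h3, -⟩ := he
  refine ⟨(Finset.mem_product.1 h1).1, ?_⟩
  have hs : ∑ i, (e.2 i - e.1 i) = 1 := by
    rw [← h2]
    refine Finset.sum_congr rfl fun i _ => ?_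
    rw [abs_sub_comm, abs_of_nonneg (sub_nonneg.2 (h3 i))]
  obtain ⟨i, -, hi⟩ := Finset.exists_ne_zero_of_sum_ne_zero (hs.trans_ne one_ne_zero)
  rw [← Finset.add_sum_erase _ _ (Finset.mem_univ i)] at hs
  have h0 : ∀ j ∈ Finset.univ.erase i, 0 ≤ e.2 j - e.1 j := fun j _ => sub_nonneg.2 (h3 j)
  have h4 := Finset.sum_nonneg h0
  have h5 := h3 i
  have h6 : ∑ j ∈ Finset.univ.erase i, (e.2 j - e.1 j) = 0 := by omega
  refine ⟨(i, true), funext fun j => ?_⟩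
  rw [nbr_eq_add]
  by_cases hj : j = i
  · subst hj
    simp only [Pi.add_apply, Pi.single_eq_same, if_true]
    omega
  · have := (Finset.sum_eq_zero_iff_of_nonneg h0).1 h6 j (by simp [hj])
    simp only [Pi.add_apply, Pi.single_eq_of_ne hj]
    omega

lemma sum_tilted_eq_Ham (V : ℝ → ℝ) (U : Finset (Zd d)) (ξ : EuclideanSpace ℝ (Fin d)) (φ : U → ℝ) :
    ∑ x ∈ U, ∑ i : Fin d, ∑ s : Bool, V (zx U φ (step x i s) - zx U φ x - xiDot ξ x (step x i s)) =
      Ham V U 1 (aff fun i => -ξ i) φ := by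
  refine Finset.sum_congr rfl fun x _ => ?_
  rw [Fintype.sum_prod_type]
  refine Finset.sum_congr rfl fun i _ => Finset.sum_congr rfl fun s _ => ?_
  rw [aff_sub]
  have hcw : cw U 1 (nbr x (i, s)) = 1 := by
    unfold cw
    split_ifs <;> rfl
  simp only [hcw, one_mul]
  simp only [nbr, xiDot, neg_mul, Finset.sum_neg_distrib, ← sub_eq_add_neg]

lemma integral_gibbs_gradient {V : ℝ → ℝ} {lam Lam : ℝ} (hd : 1 ≤ d) (hl : 0 < lam) (hV : VOk V lam Lam)
    (N : ℕ) (ξ : EuclideanSpace ℝ (Fin d)) (x y : Zd d) :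
    ∫ φ, (extD φ y - extD φ x) ∂(gibbs d V ((N + 1 : ℕ) : ℤ) ξ) =
      hm V N (fun i => -ξ i) y - hm V N (fun i => -ξ i) x := by
  have h1 : ∫ φ, (extD φ y - extD φ x) ∂(gibbs d V ((N + 1 : ℕ) : ℤ) ξ) =
      ∫ φ, (zx (intr (cube d ((N + 1 : ℕ) : ℤ))) φ y - zx (intr (cube d ((N + 1 : ℕ) : ℤ))) φ x)
        ∂(gm fun φ => ∑ x ∈ intr (cube d ((N + 1 : ℕ) : ℤ)), ∑ i : Fin d, ∑ s : Bool,
          V (zx (intr (cube d ((N + 1 : ℕ) : ℤ))) φ (step x i s) -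
            zx (intr (cube d ((N + 1 : ℕ) : ℤ))) φ x - xiDot ξ x (step x i s))) := rfl
  rw [h1]
  simp only [sum_tilted_eq_Ham]
  rw [intr_cube]
  exact integral_sub (integrable_zx hd hl hV _ le_rfl one_le_two _ _)
    (integrable_zx hd hl hV _ le_rfl one_le_two _ _)

end

theorem expectation_gradient_decay
    (d : ℕ) (hd : 2 ≤ d) (lam Lam : ℝ) (hlam : 0 < lam) (hlamLam : lam ≤ Lam) :
    ∃ α : ℝ, 0 < α ∧
      ∀ R : ℝ, 1 ≤ R → ∃ C : ℝ,
        ∀ V : ℝ → ℝ, ContDiff ℝ 2 V → (∀ t, V (-t) = V t) →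
          (∀ t, lam ≤ iteratedDeriv 2 V t ∧ iteratedDeriv 2 V t ≤ Lam) →
        ∀ ξ : EuclideanSpace ℝ (Fin d), ‖ξ‖ ≤ R →
        ∀ L : ℕ, 2 ≤ L →
          ∀ e ∈ edges (cube d (((L + 1) / 2 : ℕ) : ℤ)),
            |∫ φ, (extD φ e.2 - extD φ e.1) ∂(gibbs d V (L : ℤ) ξ)|
              ≤ C * (L : ℝ) ^ (-α) := by
  obtain ⟨γ, hγ, h⟩ := hm_gradient_decay d (by omega) lam Lam hlam hlamLam
  refine ⟨γ, hγ, fun R hR => ?_⟩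
  obtain ⟨C, hC⟩ := h R hR
  refine ⟨C, fun V hV heven hV2 ξ hξ L hL e he => ?_⟩
  have hVok := VOk.of_contDiff hlam hV heven hV2
  obtain ⟨N, rfl⟩ : ∃ N, L = N + 1 := ⟨L - 1, by omega⟩
  obtain ⟨h1, k, hk⟩ := exists_nbr_of_edge he
  rw [integral_gibbs_gradient (by omega) hlam hVok, hk]
  have := hC V hVok (fun i => -ξ i) (fun i => by
    rw [abs_neg]
    exact (PiLp.norm_apply_le ξ i).trans hξ) N e.1 (mem_cube.1 h1) k
  exact_mod_cast this

end
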